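/- Under the blow-up decomposition hypotheses, for every α ∈ (0,1/2) there exists a constant C > 0, independent of n, such that ‖ψ_n‖_{C^{0,α}(closed 𝔻)} ≤ C (1−|a_n|)^{−2α} ( (1−|a_n|) + |ε_n| ) for all n, where ‖ψ‖_{C^{0,α}} = sup_{closed 𝔻}|ψ| + sup_{x≠y} |ψ(x)−ψ(y)|/|x−y|^α. -/

import Mathlib

open MeasureTheory Real Filter

noncomputable section

/-- The open unit disk in ℝ² ≅ ℂ. -/
def unitDisk : Set ℂ := Metric.ball 0 1

/-- The unit circle ∂𝔻. -/
def unitCircle : Set ℂ := Metric.sphere 0 1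

/-- The closed unit disk. -/
def closedUnitDisk : Set ℂ := Metric.closedBall 0 1

/-- Directional derivative of `u` at `x` in direction `v`. -/
def pd (u : ℂ → ℝ) (v x : ℂ) : ℝ := fderiv ℝ u x v

/-- Laplacian of `u` at `x`. -/
def lap (u : ℂ → ℝ) (x : ℂ) : ℝ :=
  fderiv ℝ (fun y => pd u 1 y) x 1 + fderiv ℝ (fun y => pd u Complex.I y) x Complex.I

/-- Squared norm of the gradient, |∇u|². -/
def gradSq (u : ℂ → ℝ) (x : ℂ) : ℝ := pd u 1 x ^ 2 + pd u Complex.I x ^ 2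

/-- Outward normal derivative ∂_ν u(x) = ∇u(x)·x at a boundary point. -/
def nderiv (u : ℂ → ℝ) (x : ℂ) : ℝ := x.re * pd u 1 x + x.im * pd u Complex.I x

/-- Tangential derivative ∂_τ u(x) = ∇u(x)·(−x₂,x₁) at a boundary point. -/
def tderiv (u : ℂ → ℝ) (x : ℂ) : ℝ := -x.im * pd u 1 x + x.re * pd u Complex.I x

/-- Unit-speed parametrization of the unit circle. -/
def bpt (θ : ℝ) : ℂ := Complex.exp ((θ : ℂ) * Complex.I)

/-- Integral over ∂𝔻 with respect to arclength. -/
def bint (f : ℂ → ℝ) : ℝ := ∫ θ in (0:ℝ)..(2 * π), f (bpt θ)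

/-- A solution of the prescribed curvature problem for `(K, h)`. -/
def IsSolution (K h u : ℂ → ℝ) : Prop :=
  ContDiff ℝ 2 u ∧
  (∀ x ∈ unitDisk, -lap u x = 2 * K x * Real.exp (u x)) ∧
  (∀ x ∈ unitCircle, nderiv u x + 2 = 2 * h x * Real.exp (u x / 2))

/-- The auxiliary function Φ = H + √(H² + K). -/
def Phi (K H : ℂ → ℝ) (x : ℂ) : ℝ := H x + Real.sqrt (H x ^ 2 + K x)

/-- `H` is the harmonic extension of `h`, C¹ up to the boundary. -/
def IsHarmExt (h H : ℂ → ℝ) : Prop :=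
  ContDiff ℝ 1 H ∧ ContDiffOn ℝ 2 H unitDisk ∧
  (∀ x ∈ unitDisk, lap H x = 0) ∧ ∀ x ∈ unitCircle, H x = h x

/-- K_ε. -/
def Keps (K : ℂ → ℝ) (ε : ℝ) (x : ℂ) : ℝ := (K x - ε / 2) / (1 + ε)

/-- h_ε. -/
def heps (h : ℂ → ℝ) (ε : ℝ) (x : ℂ) : ℝ := h x / (1 + ε)

/-- K̃_ε. -/
def Ktil (ε : ℝ) : ℝ := -ε / (2 * (1 + ε))

/-- h̃_ε. -/
def htil (ε : ℝ) : ℝ := 1 / (1 + ε)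

/-- A solution of the perturbed problem (P_ε). -/
def IsPerturbedSolution (K h : ℂ → ℝ) (ε : ℝ) (u : ℂ → ℝ) : Prop :=
  ContDiff ℝ 2 u ∧
  (∀ x ∈ unitDisk, -lap u x + 2 * Ktil ε = 2 * Keps K ε x * Real.exp (u x)) ∧
  (∀ x ∈ unitCircle, nderiv u x + 2 * htil ε = 2 * heps h ε x * Real.exp (u x / 2))

/-- The energy functional I. -/
def Ifun (K h u : ℂ → ℝ) : ℝ :=
  (∫ x in unitDisk, ((1/2) * gradSq u x - 2 * K x * Real.exp (u x))) +
  bint (fun x => 2 * u x - 4 * h x * Real.exp (u x / 2))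

/-- The perturbation term T. -/
def Tfun (u : ℂ → ℝ) : ℝ :=
  ∫ x in unitDisk, ((1/2) * gradSq u x + Real.exp (u x) - u x)

/-- The perturbed functional I_ε. -/
def Ieps (K h : ℂ → ℝ) (ε : ℝ) (u : ℂ → ℝ) : ℝ := (Ifun K h u + ε * Tfun u) / (1 + ε)

/-- The Möbius map f_a(x) = (a+x)/(1+āx) of the disk. -/
def moeb (a x : ℂ) : ℂ := (a + x) / (1 + (starRingEnd ℂ) a * x)

/-- φ̂ = h_ε(a/|a|) + √(h_ε(a/|a|)² + K_ε(a/|a|)). -/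
def phiHat (K h : ℂ → ℝ) (ε : ℝ) (a : ℂ) : ℝ :=
  heps h ε (a / (‖a‖ : ℂ)) +
    Real.sqrt (heps h ε (a / (‖a‖ : ℂ)) ^ 2 + Keps K ε (a / (‖a‖ : ℂ)))

/-- k̂ = K_ε(a/|a|). -/
def kHat (K : ℂ → ℝ) (ε : ℝ) (a : ℂ) : ℝ := Keps K ε (a / (‖a‖ : ℂ))

/-- Denominator of the bubble: φ̂²|1 − āx|² + k̂|x − a|². -/
def bubDen (K h : ℂ → ℝ) (ε : ℝ) (a x : ℂ) : ℝ :=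
  phiHat K h ε a ^ 2 * ‖1 - (starRingEnd ℂ) a * x‖ ^ 2 + kHat K ε a * ‖x - a‖ ^ 2

/-- The bubble u_a(x) = 2 log( 2φ̂(1−|a|²) / (φ̂²|1−āx|² + k̂|x−a|²) ). -/
def bub (K h : ℂ → ℝ) (ε : ℝ) (a x : ℂ) : ℝ :=
  2 * Real.log (2 * phiHat K h ε a * (1 - ‖a‖ ^ 2) / bubDen K h ε a x)

/-- The recentred function v(x) = u(f_a(x)) + 2 log|f'_a(x)|,
where |f'_a(x)| = (1−|a|²)/|1+āx|². -/
def recen (a : ℂ) (u : ℂ → ℝ) (x : ℂ) : ℝ :=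
  u (moeb a x) + 2 * Real.log ((1 - ‖a‖ ^ 2) / ‖1 + (starRingEnd ℂ) a * x‖ ^ 2)

local notation "BB" => Metric.ball (0:ℂ) 1
local notation "CB" => Metric.closedBall (0:ℂ) 1
local notation "iI" => Complex.I
local notation "cj" => starRingEnd ℂ

lemma polar_disk {F : Type*} [NormedAddCommGroup F] [NormedSpace ℝ F] (g : ℂ → F) :
    ∫ x in BB, g x =
      ∫ q in Set.Icc ((0:ℝ), -π) ((1:ℝ), π), q.1 • g (q.1 * bpt q.2) := by
  have e1 : ∀ q : ℝ × ℝ, Complex.polarCoord.symm q = q.1 * bpt q.2 := by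
    intro q
    rw [Complex.polarCoord_symm_apply, bpt, Complex.exp_mul_I]; push_cast; rfl
  rw [← integral_indicator measurableSet_ball, ← Complex.integral_comp_polarCoord_symm]
  have hm : MeasurableSet (Set.Ioo (0:ℝ) 1 ×ˢ Set.Ioo (-π) π) :=
    measurableSet_Ioo.prod measurableSet_Ioo
  have hae : (Set.Icc ((0:ℝ), -π) ((1:ℝ), π)) =ᵐ[volume] (Set.Ioo (0:ℝ) 1 ×ˢ Set.Ioo (-π) π) := by
    rw [← Set.Icc_prod_Icc, Measure.volume_eq_prod]
    exact (Measure.set_prod_ae_eq Ioo_ae_eq_Icc Ioo_ae_eq_Icc).symm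
  rw [setIntegral_congr_set hae, ← integral_indicator hm,
    ← integral_indicator (by rw [polarCoord_target]; exact measurableSet_Ioi.prod measurableSet_Ioo)]
  congr 1
  ext q
  have hn : ‖(q.1 : ℂ) * bpt q.2‖ = |q.1| := by
    rw [bpt, norm_mul, Complex.norm_exp_ofReal_mul_I, mul_one, Complex.norm_real, norm_eq_abs]
  by_cases h1 : q ∈ polarCoord.target
  · rw [Set.indicator_of_mem h1, e1]
    rw [polarCoord_target] at h1
    have h0 : 0 < q.1 := h1.1
    by_cases h2 : q.1 < 1
    · rw [Set.indicator_of_mem (show q ∈ Set.Ioo (0:ℝ) 1 ×ˢ Set.Ioo (-π) π from ⟨⟨h0, h2⟩, h1.2⟩),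
        Set.indicator_of_mem (by rw [mem_ball_zero_iff, hn, abs_of_pos h0]; exact h2)]
    · rw [Set.indicator_of_notMem (by rw [mem_ball_zero_iff, hn, abs_of_pos h0]; exact h2),
        Set.indicator_of_notMem (fun h => h2 h.1.2), smul_zero]
  · rw [Set.indicator_of_notMem h1, Set.indicator_of_notMem]
    intro h
    apply h1
    rw [polarCoord_target]
    exact ⟨h.1.1, h.2⟩

lemma hasDerivAt_bpt (θ : ℝ) : HasDerivAt bpt (iI * bpt θ) θ := by
  have := hasDerivAt_circleMap 0 1 θ
  have e : bpt = circleMap 0 1 := by ext t; simp [bpt, circleMap]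
  rw [e]; convert this using 1; ring

lemma contDiff_bpt {n : WithTop ℕ∞} : ContDiff ℝ n bpt := by
  unfold bpt
  exact ((Complex.ofRealCLM.contDiff).mul contDiff_const).cexp

lemma continuous_bpt : Continuous bpt := (contDiff_bpt (n := 0)).continuous

lemma bpt_eq (θ : ℝ) : bpt θ = (cos θ : ℂ) + (sin θ : ℂ) * iI := by
  rw [bpt, Complex.exp_mul_I]; push_cast; rfl

@[simp] lemma bpt_re (θ : ℝ) : (bpt θ).re = cos θ := by
  rw [bpt_eq]; simp [-Complex.ofReal_cos, -Complex.ofReal_sin]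
@[simp] lemma bpt_im (θ : ℝ) : (bpt θ).im = sin θ := by
  rw [bpt_eq]; simp [-Complex.ofReal_cos, -Complex.ofReal_sin]
@[simp] lemma norm_bpt (θ : ℝ) : ‖bpt θ‖ = 1 := by rw [bpt, Complex.norm_exp_ofReal_mul_I]

lemma bpt_mem (θ : ℝ) : bpt θ ∈ CB := by simp

lemma bpt_periodic : Function.Periodic bpt (2 * π) := by
  intro θ
  rw [bpt, bpt]; push_cast
  rw [add_mul, Complex.exp_add, Complex.exp_two_pi_mul_I, mul_one]

lemma clm_apply {F : Type*} [NormedAddCommGroup F] [NormedSpace ℝ F] (L : ℂ →L[ℝ] F) (z : ℂ) :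
    L z = z.re • L 1 + z.im • L iI := by
  conv_lhs => rw [← Complex.re_add_im z]
  rw [map_add]
  congr 1
  · rw [show ((z.re : ℝ) : ℂ) = z.re • (1:ℂ) by simp, map_smul]
  · rw [show ((z.im : ℝ) : ℂ) * iI = z.im • iI by simp, map_smul]

theorem div_thm {F : Type*} [NormedAddCommGroup F] [NormedSpace ℝ F]
    (P R : ℂ → F) (hP : ∀ x ∈ CB, ContDiffAt ℝ 1 P x)
    (hR : ∀ x ∈ CB, ContDiffAt ℝ 1 R x) :
    ∫ x in BB, (fderiv ℝ P x 1 + fderiv ℝ R x iI) =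
      ∫ θ in 0..2 * π, (cos θ • P (bpt θ) + sin θ • R (bpt θ)) := by
  by_cases hF : CompleteSpace F
  swap
  · rw [intervalIntegral, integral, integral, integral]; simp [hF]
  rw [polar_disk]
  set m : ℝ × ℝ → ℂ := fun q => q.1 * bpt q.2 with hm
  set f : ℝ × ℝ → F := fun q => q.1 • (cos q.2 • P (m q) + sin q.2 • R (m q)) with hf
  set g : ℝ × ℝ → F := fun q => cos q.2 • R (m q) - sin q.2 • P (m q) with hg
  have hmem : ∀ q ∈ Set.Icc ((0:ℝ), -π) ((1:ℝ), π), m q ∈ CB := by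
    intro q hq
    have h1 : 0 ≤ q.1 := hq.1.1
    have h2 : q.1 ≤ 1 := hq.2.1
    simp only [hm, mem_closedBall_zero_iff, norm_mul, norm_bpt, mul_one, Complex.norm_real,
      norm_eq_abs, abs_of_nonneg h1]
    exact h2
  have hmC : ContDiff ℝ 1 m :=
    ((Complex.ofRealCLM.contDiff).comp contDiff_fst).mul (contDiff_bpt.comp contDiff_snd)
  have hcos : ContDiff ℝ 1 (fun q : ℝ × ℝ => cos q.2) := contDiff_cos.comp contDiff_snd
  have hsin : ContDiff ℝ 1 (fun q : ℝ × ℝ => sin q.2) := contDiff_sin.comp contDiff_snd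
  have hPm : ∀ q ∈ Set.Icc ((0:ℝ), -π) ((1:ℝ), π), ContDiffAt ℝ 1 (fun q => P (m q)) q :=
    fun q hq => (hP _ (hmem q hq)).comp q hmC.contDiffAt
  have hRm : ∀ q ∈ Set.Icc ((0:ℝ), -π) ((1:ℝ), π), ContDiffAt ℝ 1 (fun q => R (m q)) q :=
    fun q hq => (hR _ (hmem q hq)).comp q hmC.contDiffAt
  have hfC : ∀ q ∈ Set.Icc ((0:ℝ), -π) ((1:ℝ), π), ContDiffAt ℝ 1 f q := fun q hq =>
    contDiff_fst.contDiffAt.smul ((hcos.contDiffAt.smul (hPm q hq)).add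
      (hsin.contDiffAt.smul (hRm q hq)))
  have hgC : ∀ q ∈ Set.Icc ((0:ℝ), -π) ((1:ℝ), π), ContDiffAt ℝ 1 g q := fun q hq =>
    (hcos.contDiffAt.smul (hRm q hq)).sub (hsin.contDiffAt.smul (hPm q hq))
  have hkey : ∀ q ∈ Set.Icc ((0:ℝ), -π) ((1:ℝ), π),
      q.1 • (fderiv ℝ P (m q) 1 + fderiv ℝ R (m q) iI)
        = fderiv ℝ f q (1, 0) + fderiv ℝ g q (0, 1) := by
    intro q hq
    have dP := ((hP _ (hmem q hq)).differentiableAt (by norm_num)).hasFDerivAt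
    have dR := ((hR _ (hmem q hq)).differentiableAt (by norm_num)).hasFDerivAt
    have l1 : HasDerivAt (fun s : ℝ => q + s • ((1:ℝ), (0:ℝ))) ((1:ℝ), (0:ℝ)) 0 := by
      simpa using ((hasDerivAt_id (0:ℝ)).smul_const ((1:ℝ), (0:ℝ))).const_add q
    have l2 : HasDerivAt (fun s : ℝ => q + s • ((0:ℝ), (1:ℝ))) ((0:ℝ), (1:ℝ)) 0 := by
      simpa using ((hasDerivAt_id (0:ℝ)).smul_const ((0:ℝ), (1:ℝ))).const_add q
    have m1 : HasDerivAt (fun s : ℝ => m (q + s • ((1:ℝ), (0:ℝ)))) (bpt q.2) 0 := by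
      have : HasDerivAt (fun s : ℝ => ((q.1 + s : ℝ) : ℂ) * bpt q.2) (bpt q.2) 0 := by
        simpa using (((hasDerivAt_id (0:ℝ)).const_add q.1).ofReal_comp).mul_const (bpt q.2)
      simpa [hm] using this
    have m2 : HasDerivAt (fun s : ℝ => m (q + s • ((0:ℝ), (1:ℝ))))
        (q.1 * (iI * bpt q.2)) 0 := by
      have h3 : HasDerivAt (fun s : ℝ => bpt (q.2 + s)) (iI * bpt q.2) 0 := by
        have := HasDerivAt.comp_const_add q.2 0 (by simpa using hasDerivAt_bpt q.2)
        simpa using this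
      simpa [hm] using h3.const_mul (q.1 : ℂ)
    have q0 : ∀ y : ℝ × ℝ, q + (0:ℝ) • y = q := by intro y; simp
    have P1 : HasDerivAt (fun s : ℝ => P (m (q + s • ((1:ℝ), (0:ℝ))))) (fderiv ℝ P (m q) (bpt q.2)) 0 :=
      HasFDerivAt.comp_hasDerivAt (0:ℝ) (by rw [q0]; exact dP) m1
    have R1 : HasDerivAt (fun s : ℝ => R (m (q + s • ((1:ℝ), (0:ℝ))))) (fderiv ℝ R (m q) (bpt q.2)) 0 :=
      HasFDerivAt.comp_hasDerivAt (0:ℝ) (by rw [q0]; exact dR) m1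
    have P2 : HasDerivAt (fun s : ℝ => P (m (q + s • ((0:ℝ), (1:ℝ)))))
        (fderiv ℝ P (m q) (q.1 * (iI * bpt q.2))) 0 :=
      HasFDerivAt.comp_hasDerivAt (0:ℝ) (by rw [q0]; exact dP) m2
    have R2 : HasDerivAt (fun s : ℝ => R (m (q + s • ((0:ℝ), (1:ℝ)))))
        (fderiv ℝ R (m q) (q.1 * (iI * bpt q.2))) 0 :=
      HasFDerivAt.comp_hasDerivAt (0:ℝ) (by rw [q0]; exact dR) m2
    have F1 : HasDerivAt (fun s : ℝ => f (q + s • ((1:ℝ), (0:ℝ)))) (fderiv ℝ f q (1, 0)) 0 :=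
      HasFDerivAt.comp_hasDerivAt (l := f) (l' := fderiv ℝ f q) (0:ℝ)
        (by rw [q0]; exact ((hfC q hq).differentiableAt (by norm_num)).hasFDerivAt) l1
    have G1 : HasDerivAt (fun s : ℝ => g (q + s • ((0:ℝ), (1:ℝ)))) (fderiv ℝ g q (0, 1)) 0 :=
      HasFDerivAt.comp_hasDerivAt (l := g) (l' := fderiv ℝ g q) (0:ℝ)
        (by rw [q0]; exact ((hgC q hq).differentiableAt (by norm_num)).hasFDerivAt) l2
    have F2 := ((hasDerivAt_id (0:ℝ)).const_add q.1).smul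
      ((P1.const_smul (cos q.2)).add (R1.const_smul (sin q.2)))
    have hc : HasDerivAt (fun s : ℝ => cos (q.2 + s)) (-sin q.2) 0 := by
      simpa using ((hasDerivAt_id (0:ℝ)).const_add q.2).cos
    have hs : HasDerivAt (fun s : ℝ => sin (q.2 + s)) (cos q.2) 0 := by
      simpa using ((hasDerivAt_id (0:ℝ)).const_add q.2).sin
    have G2 := (hc.smul R2).sub (hs.smul P2)
    have eF := F1.unique (f₁' := _) (by
      convert F2 using 1
      ext s; simp [hf])
    have eG := G1.unique (f₁' := _) (by
      convert G2 using 1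
      ext s; simp [hg])
    rw [eF, eG]
    simp only [q0, id, add_zero]
    rw [clm_apply (fderiv ℝ P (m q)) (bpt q.2), clm_apply (fderiv ℝ R (m q)) (bpt q.2),
      clm_apply (fderiv ℝ P (m q)) (q.1 * _), clm_apply (fderiv ℝ R (m q)) (q.1 * _)]
    simp only [Pi.add_apply, Pi.smul_apply, q0, Complex.ofReal_re, Complex.ofReal_im, Complex.mul_re, Complex.mul_im,
      Complex.I_re, Complex.I_im, bpt_re, bpt_im]
    have sc := sin_sq_add_cos_sq q.2
    have sc2 : sin q.2 ^ 2 = 1 - cos q.2 ^ 2 := by linarith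
    match_scalars <;> first | ring1 | linear_combination (-q.1) * sc | linear_combination (q.1) * sc
  have hle : ((0:ℝ), -π) ≤ ((1:ℝ), π) := ⟨zero_le_one, by linarith [pi_pos]⟩
  have hcd : ∀ (f : ℝ × ℝ → F) (hfC : ∀ q ∈ Set.Icc ((0:ℝ), -π) ((1:ℝ), π), ContDiffAt ℝ 1 f q)
      (y : ℝ × ℝ), ContinuousOn (fun q => fderiv ℝ f q y) (Set.Icc ((0:ℝ), -π) ((1:ℝ), π)) := by
    intro f hfC y q hq
    have := ((hfC q hq).fderiv_right (m := 0) (by norm_num)).continuousAt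
    exact (this.clm_apply continuousAt_const).continuousWithinAt
  have hsub : Set.Ioo (0:ℝ) 1 ×ˢ Set.Ioo (-π) π ⊆ Set.Icc ((0:ℝ), -π) ((1:ℝ), π) := by
    intro q hq
    exact ⟨⟨hq.1.1.le, hq.2.1.le⟩, ⟨hq.1.2.le, hq.2.2.le⟩⟩
  have := integral_divergence_prod_Icc_of_hasFDerivAt_of_le f g (fderiv ℝ f) (fderiv ℝ g)
    ((0:ℝ), -π) ((1:ℝ), π) hle
    (fun q hq => (hfC q hq).continuousAt.continuousWithinAt)
    (fun q hq => (hgC q hq).continuousAt.continuousWithinAt)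
    (fun q hq => ((hfC q (hsub hq)).differentiableAt (by norm_num)).hasFDerivAt)
    (fun q hq => ((hgC q (hsub hq)).differentiableAt (by norm_num)).hasFDerivAt)
    (((hcd f hfC _).add (hcd g hgC _)).integrableOn_compact isCompact_Icc)
  rw [setIntegral_congr_fun measurableSet_Icc hkey, this]
  have hbp : bpt (-π) = bpt π := by
    have := bpt_periodic (-π)
    rw [← this]; congr 1; ring
  have hmb : ∀ x : ℝ, m (x, -π) = m (x, π) := by intro x; simp [hm, hbp]
  have hgp : ∀ x : ℝ, g (x, -π) = g (x, π) := by intro x; simp [hg, hmb]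
  simp only [hgp, sub_self, zero_add]
  have f0 : ∀ y, f (0, y) = 0 := by intro y; simp [hf]
  simp only [f0, intervalIntegral.integral_zero, sub_zero]
  have hper : Function.Periodic (fun θ => f (1, θ)) (2 * π) := by
    intro θ; simp [hf, hm, bpt_periodic θ]
  have := hper.intervalIntegral_add_eq (-π) 0
  rw [show -π + 2 * π = π by ring, zero_add] at this
  rw [this]
  simp [hf, hm]

def rker (δ : ℝ) (m : ℕ) (α : ℝ) (t : ℝ) : ℝ := ((δ + t) ^ m)⁻¹ * t ^ (-α)

lemma ker_nonneg {δ α t : ℝ} {m : ℕ} (hδ : 0 < δ) (ht : 0 ≤ t) : 0 ≤ rker δ m α t := by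
  unfold rker; positivity

lemma ker_anti {δ α s t : ℝ} {m : ℕ} (hδ : 0 < δ) (hα : 0 ≤ α) (hs : 0 < s) (hst : s ≤ t) :
    rker δ m α t ≤ rker δ m α s := by
  unfold rker
  have h1 : t ^ (-α) ≤ s ^ (-α) := rpow_le_rpow_of_nonpos hs hst (by linarith)
  have h2 : ((δ + t) ^ m)⁻¹ ≤ ((δ + s) ^ m)⁻¹ := by gcongr
  have : 0 < t := hs.trans_le hst
  gcongr

lemma two_center {δ α s t : ℝ} {m : ℕ} (hδ : 0 < δ) (hα : 0 ≤ α) (hs : 0 < s) (ht : 0 < t) :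
    ((δ + t) ^ m)⁻¹ * s ^ (-α) ≤ rker δ m α t + rker δ m α s := by
  rcases le_total t s with h | h
  · have h1 : s ^ (-α) ≤ t ^ (-α) := rpow_le_rpow_of_nonpos ht h (by linarith)
    have : ((δ + t) ^ m)⁻¹ * s ^ (-α) ≤ rker δ m α t := by unfold rker; gcongr
    linarith [ker_nonneg (α := α) (m := m) hδ hs.le]
  · have : ((δ + t) ^ m)⁻¹ * s ^ (-α) ≤ rker δ m α s := by unfold rker; gcongr
    linarith [ker_nonneg (α := α) (m := m) hδ ht.le]

section
variable {E : Type*} [NormedAddCommGroup E] [NormedSpace ℝ E] [FiniteDimensional ℝ E]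
  [MeasureSpace E] [BorelSpace E] [(volume : Measure E).IsAddHaarMeasure]

lemma ker_meas (δ α : ℝ) (m : ℕ) : Measurable (fun y : E => rker δ m α ‖y‖) := by
  unfold rker; fun_prop

lemma ker_int1 (hd : 1 ≤ Module.finrank ℝ E) {m : ℕ} {α : ℝ} (hα : 0 ≤ α)
    (hα2 : α < Module.finrank ℝ E) (hm : (Module.finrank ℝ E : ℝ) < m + α) :
    Integrable (fun y : E => rker 1 m α ‖y‖) := by
  have h1 : IntegrableOn (fun y : E => rker 1 m α ‖y‖) (Metric.ball 0 1) := by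
    refine integrableOn_ball_of_norm_le_rpow hd (C := 1) hα2 (Eventually.of_forall fun y => ?_)
      (ker_meas 1 α m).aestronglyMeasurable
    rw [norm_eq_abs, abs_of_nonneg (ker_nonneg one_pos (norm_nonneg _))]
    unfold rker
    gcongr
    exact inv_le_one_of_one_le₀ (one_le_pow₀ (by linarith [norm_nonneg y]))
  have h2 : IntegrableOn (fun y : E => rker 1 m α ‖y‖) (Metric.ball 0 1)ᶜ := by
    refine Integrable.mono' (g := fun y : E => 2 ^ α * (1 + ‖y‖) ^ (-(m + α)))
      ((integrable_one_add_norm hm).const_mul _).integrableOn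
      (ker_meas 1 α m).aestronglyMeasurable ?_
    filter_upwards [ae_restrict_mem measurableSet_ball.compl] with y hy
    rw [norm_eq_abs, abs_of_nonneg (ker_nonneg one_pos (norm_nonneg _))]
    have hy1 : 1 ≤ ‖y‖ := by simpa using hy
    unfold rker
    rw [neg_add, rpow_add (by positivity), rpow_neg (by positivity) (m:ℝ), rpow_natCast]
    have : ‖y‖ ^ (-α) ≤ 2 ^ α * (1 + ‖y‖) ^ (-α) := by
      have h3 : ((1 + ‖y‖) / 2) ^ α ≤ ‖y‖ ^ α := by gcongr; linarith
      rw [rpow_neg (by positivity), rpow_neg (by positivity)]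
      rw [div_rpow (by positivity) (by positivity)] at h3
      rw [← div_eq_mul_inv, inv_eq_one_div, div_le_div_iff₀ (by positivity) (by positivity)]
      rw [div_le_iff₀ (by positivity)] at h3
      linarith
    calc _ ≤ ((1 + ‖y‖) ^ m)⁻¹ * (2 ^ α * (1 + ‖y‖) ^ (-α)) := by gcongr
      _ = _ := by ring
  rw [← integrableOn_univ, ← Set.union_compl_self (Metric.ball (0:E) 1)]
  exact h1.union h2

lemma ker_scale {m : ℕ} {α δ : ℝ} (hδ : 0 < δ) (y : E) :
    rker δ m α ‖y‖ = δ ^ (-(m:ℝ) - α) * rker 1 m α ‖δ⁻¹ • y‖ := by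
  unfold rker
  rw [norm_smul, norm_inv, norm_eq_abs, abs_of_pos hδ, sub_eq_add_neg, rpow_add hδ,
    rpow_neg hδ.le (m:ℝ), rpow_natCast, mul_rpow (by positivity) (norm_nonneg _),
    inv_rpow hδ.le, rpow_neg hδ.le α, inv_inv,
    show δ + ‖y‖ = δ * (1 + δ⁻¹ * ‖y‖) by field_simp, mul_pow, mul_inv]
  have : δ ^ α ≠ 0 := (rpow_pos_of_pos hδ α).ne'
  field_simp

lemma ker_int (hd : 1 ≤ Module.finrank ℝ E) {m : ℕ} {α : ℝ} (hα : 0 ≤ α)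
    (hα2 : α < Module.finrank ℝ E) (hm : (Module.finrank ℝ E : ℝ) < m + α) :
    ∃ C > (0:ℝ), ∀ δ > (0:ℝ), Integrable (fun y : E => rker δ m α ‖y‖) ∧
      ∫ y : E, rker δ m α ‖y‖ ≤ C * δ ^ ((Module.finrank ℝ E : ℝ) - m - α) := by
  have h1 := ker_int1 hd hα hα2 hm
  refine ⟨(∫ y : E, rker 1 m α ‖y‖) + 1, ?_, fun δ hδ => ⟨?_, ?_⟩⟩
  · have : 0 ≤ ∫ y : E, rker 1 m α ‖y‖ := integral_nonneg fun y => ker_nonneg one_pos (norm_nonneg _)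
    linarith
  · simp_rw [ker_scale hδ]
    exact ((integrable_comp_smul_iff volume (fun y : E => rker 1 m α ‖y‖) (inv_ne_zero hδ.ne')).2 h1).const_mul _
  · simp_rw [ker_scale hδ]
    rw [integral_const_mul, Measure.integral_comp_smul volume (fun y : E => rker 1 m α ‖y‖)]
    rw [smul_eq_mul, inv_pow, inv_inv, abs_of_pos (by positivity), ← mul_assoc,
      ← rpow_natCast δ, ← rpow_add hδ, mul_comm]
    rw [show -(m:ℝ) - α + (Module.finrank ℝ E : ℝ) = (Module.finrank ℝ E : ℝ) - m - α by ring]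
    gcongr
    linarith
end

lemma ker_disk {m : ℕ} {α : ℝ} (hα : 0 ≤ α) (hα2 : α < 2) (hm : 2 < m + α) :
    ∃ C > (0:ℝ), ∀ δ > (0:ℝ), ∀ q x : ℂ,
      IntegrableOn (fun y => ((δ + ‖y - q‖) ^ m)⁻¹ * ‖y - x‖ ^ (-α)) (Metric.ball 0 1) ∧
      ∫ y in BB, ((δ + ‖y - q‖) ^ m)⁻¹ * ‖y - x‖ ^ (-α) ≤
        C * δ ^ ((2:ℝ) - m - α) := by
  obtain ⟨C, hC, h⟩ := ker_int (E := ℂ) (by simp) hα (by simpa using hα2) (by simpa using hm)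
  simp only [Complex.finrank_real_complex, Nat.cast_ofNat] at h
  refine ⟨2 * C, by positivity, fun δ hδ q x => ?_⟩
  have hI : ∀ c : ℂ, Integrable (fun y : ℂ => rker δ m α ‖y - c‖) := fun c =>
    ((h δ hδ).1.comp_sub_right c)
  have hle : ∀ᵐ y : ℂ, ((δ + ‖y - q‖) ^ m)⁻¹ * ‖y - x‖ ^ (-α) ≤
      rker δ m α ‖y - q‖ + rker δ m α ‖y - x‖ := by
    have h1 : ∀ᵐ y : ℂ, y ≠ q := by simp [ae_iff]
    have h2 : ∀ᵐ y : ℂ, y ≠ x := by simp [ae_iff]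
    filter_upwards [h1, h2] with y hy1 hy2
    exact two_center hδ hα (norm_pos_iff.2 (sub_ne_zero.2 hy2)) (norm_pos_iff.2 (sub_ne_zero.2 hy1))
  have hInt : Integrable (fun y : ℂ => ((δ + ‖y - q‖) ^ m)⁻¹ * ‖y - x‖ ^ (-α)) := by
    refine Integrable.mono' ((hI q).add (hI x)) (Measurable.aestronglyMeasurable (by fun_prop)) ?_
    filter_upwards [hle] with y hy
    rw [norm_eq_abs, abs_of_nonneg (by positivity)]
    exact hy
  refine ⟨hInt.integrableOn, ?_⟩
  calc _ ≤ ∫ y : ℂ, ((δ + ‖y - q‖) ^ m)⁻¹ * ‖y - x‖ ^ (-α) :=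
        setIntegral_le_integral hInt (Eventually.of_forall fun y => by
          simp only [Pi.zero_apply]; positivity)
    _ ≤ ∫ y : ℂ, (rker δ m α ‖y - q‖ + rker δ m α ‖y - x‖) :=
        integral_mono_ae hInt ((hI q).add (hI x)) hle
    _ = (∫ y : ℂ, rker δ m α ‖y‖) + ∫ y : ℂ, rker δ m α ‖y‖ := by
        rw [integral_add (hI q) (hI x), integral_sub_right_eq_self (fun y : ℂ => rker δ m α ‖y‖) q,
          integral_sub_right_eq_self (fun y : ℂ => rker δ m α ‖y‖) x]
    _ ≤ _ := by linarith [(h δ hδ).2]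

lemma rpow_disk {α : ℝ} (hα : 0 ≤ α) (hα2 : α < 2) :
    ∃ C > (0:ℝ), ∀ x : ℂ, IntegrableOn (fun y => ‖y - x‖ ^ (-α)) (Metric.ball 0 1) ∧
      ∫ y in BB, ‖y - x‖ ^ (-α) ≤ C := by
  obtain ⟨C, hC, h⟩ := ker_disk (m := 3) hα hα2 (by norm_num; linarith)
  refine ⟨8 * C, by positivity, fun x => ?_⟩
  obtain ⟨h1, h2⟩ := h 1 one_pos 0 x
  simp only [sub_zero, one_rpow, mul_one] at h1 h2
  have hle : ∀ y ∈ BB, ‖y - x‖ ^ (-α) ≤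
      8 * (((1 + ‖y‖) ^ 3)⁻¹ * ‖y - x‖ ^ (-α)) := by
    intro y hy
    have hy1 : ‖y‖ < 1 := by simpa using hy
    have h3 : (1 + ‖y‖) ^ 3 ≤ 2 ^ 3 := by gcongr; linarith
    have h4 : (8:ℝ)⁻¹ ≤ ((1 + ‖y‖) ^ 3)⁻¹ := by gcongr; norm_num at h3; exact h3
    have : 0 ≤ ‖y - x‖ ^ (-α) := by positivity
    nlinarith
  have hInt : IntegrableOn (fun y => ‖y - x‖ ^ (-α)) (Metric.ball 0 1) := by
    refine Integrable.mono' (h1.const_mul 8) (Measurable.aestronglyMeasurable (by fun_prop)) ?_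
    filter_upwards [ae_restrict_mem measurableSet_ball] with y hy
    rw [norm_eq_abs, abs_of_nonneg (by positivity)]
    exact hle y hy
  refine ⟨hInt, ?_⟩
  calc _ ≤ ∫ y in BB, 8 * (((1 + ‖y‖) ^ 3)⁻¹ * ‖y - x‖ ^ (-α)) :=
        setIntegral_mono_on hInt (h1.const_mul 8) measurableSet_ball hle
    _ = 8 * ∫ y in BB, (((1 + ‖y‖) ^ 3)⁻¹ * ‖y - x‖ ^ (-α)) := integral_const_mul _ _
    _ ≤ _ := by linarith

lemma bpt_arg {z : ℂ} (hz : ‖z‖ = 1) : ∃ φ, bpt φ = z := by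
  refine ⟨z.arg, ?_⟩
  have := Complex.norm_mul_exp_arg_mul_I z
  rw [hz] at this
  simpa [bpt] using this

lemma bpt_sub_lower {θ φ : ℝ} (h : |θ - φ| ≤ π) : (2 / π) * |θ - φ| ≤ ‖bpt θ - bpt φ‖ := by
  have e : ‖bpt θ - bpt φ‖ = 2 * |sin ((θ - φ) / 2)| := by
    have h1 : ‖bpt θ - bpt φ‖ ^ 2 = (2 * |sin ((θ - φ) / 2)|) ^ 2 := by
      rw [mul_pow, sq_abs, sin_sq_eq_half_sub, ← Complex.normSq_eq_norm_sq, Complex.normSq_apply]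
      simp only [Complex.sub_re, Complex.sub_im, bpt_re, bpt_im]
      rw [show 2 * ((θ - φ) / 2) = θ - φ by ring, cos_sub]
      linear_combination sin_sq_add_cos_sq θ + sin_sq_add_cos_sq φ
    exact (pow_left_inj₀ (norm_nonneg _) (by positivity) two_ne_zero).1 h1
  rw [e]
  have := mul_abs_le_abs_sin (x := (θ - φ) / 2) (by rw [abs_div, abs_two]; linarith)
  rw [abs_div, abs_two] at this
  linarith

lemma near_bpt {x : ℂ} (hx : ‖x‖ ≤ 1) : ∃ φ, ∀ θ, ‖bpt θ - bpt φ‖ ≤ 2 * ‖bpt θ - x‖ := by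
  by_cases h0 : x = 0
  · refine ⟨0, fun θ => ?_⟩
    rw [h0, sub_zero, norm_bpt]
    calc _ ≤ ‖bpt θ‖ + ‖bpt 0‖ := norm_sub_le _ _
      _ = _ := by simp; norm_num
  have hn : 0 < ‖x‖ := norm_pos_iff.2 h0
  obtain ⟨φ, hφ⟩ := bpt_arg (z := x / ‖x‖) (by
    rw [norm_div, Complex.norm_real, norm_norm, div_self hn.ne'])
  refine ⟨φ, fun θ => ?_⟩
  have h1 : ‖x - bpt φ‖ = 1 - ‖x‖ := by
    rw [hφ, show x - x / ‖x‖ = (x / ‖x‖) * ((‖x‖ - 1 : ℝ) : ℂ) by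
      have : (‖x‖ : ℂ) ≠ 0 := by exact_mod_cast hn.ne'
      push_cast; field_simp, norm_mul, norm_div, Complex.norm_real, Complex.norm_real, norm_norm,
      div_self hn.ne', one_mul, norm_eq_abs, abs_of_nonpos (by linarith)]
    ring
  have h2 : 1 - ‖x‖ ≤ ‖bpt θ - x‖ := by
    have := norm_sub_norm_le (bpt θ) x
    rwa [norm_bpt] at this
  have h3 : ‖bpt θ - bpt φ‖ ≤ ‖bpt θ - x‖ + ‖x - bpt φ‖ := norm_sub_le_norm_sub_add_norm_sub _ _ _
  linarith

lemma ker_circ {m : ℕ} {α : ℝ} (hα : 0 ≤ α) (hα2 : α < 1) (hm : 1 < m + α) :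
    ∃ C > (0:ℝ), ∀ δ > (0:ℝ), ∀ q x : ℂ, ‖q‖ = 1 → ‖x‖ < 1 →
      ∫ θ in 0..2 * π, ((δ + ‖bpt θ - q‖) ^ m)⁻¹ * ‖bpt θ - x‖ ^ (-α) ≤
        C * δ ^ ((1:ℝ) - m - α) := by
  obtain ⟨C, hC, h⟩ := ker_int (E := ℝ) (m := m) (by simp) hα (by simpa using hα2) (by simpa using hm)
  simp only [Module.finrank_self, Nat.cast_one] at h
  have pp := pi_pos
  refine ⟨2 * (π * C), by positivity, fun δ hδ q x hq hx => ?_⟩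
  have key : ∀ (z : ℂ) (φ : ℝ), (∀ θ, ‖bpt θ - bpt φ‖ ≤ 2 * ‖bpt θ - z‖) →
      IntervalIntegrable (fun θ => rker δ m α ‖bpt θ - z‖) volume 0 (2 * π) ∧
      ∫ θ in 0..2 * π, rker δ m α ‖bpt θ - z‖ ≤ π * C * δ ^ ((1:ℝ) - m - α) := by
    intro z φ hz
    have hper : Function.Periodic (fun θ => rker δ m α ‖bpt θ - z‖) (2 * π) := by
      intro θ; simp [bpt_periodic θ]
    have hIR : Integrable (fun θ : ℝ => rker δ m α ‖π⁻¹ • (θ - φ)‖) :=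
      ((integrable_comp_smul_iff volume (fun y : ℝ => rker δ m α ‖y‖)
        (inv_ne_zero pp.ne')).2 (h δ hδ).1).comp_sub_right φ
    have hle : ∀ᵐ θ : ℝ, θ ∈ Set.Ioc (φ - π) (φ - π + 2 * π) →
        rker δ m α ‖bpt θ - z‖ ≤ rker δ m α ‖π⁻¹ • (θ - φ)‖ := by
      have h1 : ∀ᵐ y : ℝ, y ≠ φ := by simp [ae_iff]
      filter_upwards [h1] with θ hθ hmem
      have h2 : |θ - φ| ≤ π := by rw [abs_le]; constructor <;> linarith [hmem.1, hmem.2]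
      have h3 := bpt_sub_lower h2
      have h4 := hz θ
      have h5 : 0 < |θ - φ| := abs_pos.2 (sub_ne_zero.2 hθ)
      apply ker_anti hδ hα
      · rw [norm_smul, norm_eq_abs, norm_eq_abs]; positivity
      · rw [norm_smul, norm_eq_abs, norm_eq_abs, abs_of_pos (by positivity)]
        have : 2 / π * |θ - φ| = 2 * (π⁻¹ * |θ - φ|) := by ring
        linarith
    have hmeas : Measurable (fun θ => rker δ m α ‖bpt θ - z‖) := by
      have := continuous_bpt.measurable
      unfold rker; fun_prop
    have hII : IntervalIntegrable (fun θ => rker δ m α ‖bpt θ - z‖) volume (φ - π) (φ - π + 2 * π) := by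
      rw [intervalIntegrable_iff_integrableOn_Ioc_of_le (by linarith)]
      refine Integrable.mono' hIR.integrableOn hmeas.aestronglyMeasurable ?_
      rw [ae_restrict_iff' measurableSet_Ioc]
      filter_upwards [hle] with θ hθ hmem
      rw [norm_eq_abs, abs_of_nonneg (ker_nonneg hδ (norm_nonneg _))]
      exact hθ hmem
    have hsh := hper.intervalIntegral_add_eq (φ - π) 0
    rw [zero_add] at hsh
    refine ⟨hper.intervalIntegrable (by positivity) hII _ _, ?_⟩
    rw [← hsh, intervalIntegral.integral_of_le (by linarith)]
    calc _ ≤ ∫ θ in Set.Ioc (φ - π) (φ - π + 2 * π), rker δ m α ‖π⁻¹ • (θ - φ)‖ := by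
            refine setIntegral_mono_ae_restrict ?_ hIR.integrableOn ?_
            · rwa [intervalIntegrable_iff_integrableOn_Ioc_of_le (by linarith)] at hII
            · rw [EventuallyLE, ae_restrict_iff' measurableSet_Ioc]; exact hle
      _ ≤ ∫ θ : ℝ, rker δ m α ‖π⁻¹ • (θ - φ)‖ := setIntegral_le_integral hIR
            (Eventually.of_forall fun y => ker_nonneg hδ (norm_nonneg _))
      _ = π * ∫ y : ℝ, rker δ m α ‖y‖ := by
            rw [integral_sub_right_eq_self (fun θ : ℝ => rker δ m α ‖π⁻¹ • θ‖) φ,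
              Measure.integral_comp_smul volume (fun y : ℝ => rker δ m α ‖y‖)]
            simp [abs_of_pos pp]
      _ ≤ _ := by nlinarith [(h δ hδ).2]
  obtain ⟨φq, hφq⟩ := near_bpt hq.le
  obtain ⟨φx, hφx⟩ := near_bpt hx.le
  obtain ⟨i1, k1⟩ := key q φq hφq
  obtain ⟨i2, k2⟩ := key x φx hφx
  have hxne : ∀ θ, 0 < ‖bpt θ - x‖ := by
    intro θ
    rw [norm_pos_iff, sub_ne_zero]
    intro hh; rw [← hh, norm_bpt] at hx; exact lt_irrefl _ hx
  have hcont : Continuous (fun θ => ((δ + ‖bpt θ - q‖) ^ m)⁻¹ * ‖bpt θ - x‖ ^ (-α)) := by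
    have := continuous_bpt
    refine Continuous.mul (Continuous.inv₀ (by fun_prop) fun θ => by positivity) ?_
    exact Continuous.rpow_const (by fun_prop) fun θ => Or.inl (hxne θ).ne'
  calc _ ≤ ∫ θ in 0..2 * π, (rker δ m α ‖bpt θ - q‖ + rker δ m α ‖bpt θ - x‖) := by
        refine intervalIntegral.integral_mono_ae (by linarith) (hcont.intervalIntegrable _ _) (i1.add i2) ?_
        obtain ⟨φ, hφ⟩ := bpt_arg hq
        have hcount : ({θ : ℝ | bpt θ = q}).Countable := by
          have : {θ : ℝ | bpt θ = q} ⊆ Set.range (fun n : ℤ => φ + n * (2 * π)) := by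
            intro θ hθ
            have hθ' : bpt θ = bpt φ := by rw [hφ]; exact hθ
            rw [bpt, bpt, Complex.exp_eq_exp_iff_exists_int] at hθ'
            obtain ⟨n, hn⟩ := hθ'
            refine ⟨n, ?_⟩
            have h2 : ((θ : ℂ)) = (φ + n * (2 * π) : ℝ) := by
              have hI := Complex.I_ne_zero
              apply mul_right_cancel₀ hI
              rw [hn]; push_cast; ring
            exact (by exact_mod_cast h2.symm)
          exact (Set.countable_range _).mono this
        have : ∀ᵐ θ : ℝ, bpt θ ≠ q := by
          rw [ae_iff]; simpa using hcount.measure_zero volume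
        filter_upwards [this] with θ hθ
        exact two_center hδ hα (hxne θ) (norm_pos_iff.2 (sub_ne_zero.2 hθ))
    _ = _ := intervalIntegral.integral_add i1 i2
    _ ≤ _ := by linarith

def C1 {F : Type*} [NormedAddCommGroup F] [NormedSpace ℝ F] (v : ℂ → F) : Prop :=
  ∀ x ∈ CB, ContDiffAt ℝ 1 v x
def C2 {F : Type*} [NormedAddCommGroup F] [NormedSpace ℝ F] (v : ℂ → F) : Prop :=
  ∀ x ∈ CB, ContDiffAt ℝ 2 v x

section
variable {F : Type*} [NormedAddCommGroup F] [NormedSpace ℝ F]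
lemma C2.C1 {v : ℂ → F} (h : C2 v) : C1 v := fun x hx => (h x hx).of_le (by norm_num)
lemma C2.fd {v : ℂ → F} (h : C2 v) (e : ℂ) : _root_.C1 (fun y => fderiv ℝ v y e) := fun x hx =>
  ((h x hx).fderiv_right (m := 1) (by norm_num)).clm_apply contDiffAt_const
lemma C1.cont {v : ℂ → F} (h : C1 v) : ContinuousOn v CB :=
  fun x hx => (h x hx).continuousAt.continuousWithinAt
lemma C1.fdcont {v : ℂ → F} (h : C1 v) (e : ℂ) :
    ContinuousOn (fun y => fderiv ℝ v y e) CB := fun x hx =>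
  (((h x hx).fderiv_right (m := 0) (by norm_num)).clm_apply
    contDiffAt_const).continuousAt.continuousWithinAt
lemma C1.diff {v : ℂ → F} (h : C1 v) {x : ℂ} (hx : x ∈ CB) :
    DifferentiableAt ℝ v x := (h x hx).differentiableAt (by norm_num)
lemma intD {f : ℂ → F} (h : ContinuousOn f CB) :
    IntegrableOn f BB :=
  (h.integrableOn_compact (isCompact_closedBall _ _)).mono_set Metric.ball_subset_closedBall
lemma cont_bpt {f : ℂ → F} (h : ContinuousOn f CB) :
    Continuous (fun θ => f (bpt θ)) := h.comp_continuous continuous_bpt bpt_mem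
end

lemma C2.pd {v : ℂ → ℝ} (h : C2 v) (e : ℂ) : _root_.C1 (pd v e) := h.fd e
lemma C2.lap_cont {v : ℂ → ℝ} (h : C2 v) : ContinuousOn (lap v) CB :=
  ((h.pd 1).fdcont 1).add ((h.pd iI).fdcont iI)
lemma C1.pd_cont {v : ℂ → ℝ} (h : C1 v) (e : ℂ) : ContinuousOn (pd v e) CB :=
  h.fdcont e
lemma C1.nderiv_cont {v : ℂ → ℝ} (h : C1 v) : ContinuousOn (nderiv v) CB :=
  (Complex.continuous_re.continuousOn.mul (h.pd_cont 1)).add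
    (Complex.continuous_im.continuousOn.mul (h.pd_cont iI))
lemma C1.tderiv_cont {v : ℂ → ℝ} (h : C1 v) : ContinuousOn (tderiv v) CB :=
  (Complex.continuous_im.neg.continuousOn.mul (h.pd_cont 1)).add
    (Complex.continuous_re.continuousOn.mul (h.pd_cont iI))

theorem green1 {φ w : ℂ → ℝ} (hφ : C1 φ) (hw : C2 w) :
    ∫ x in BB, (φ x * lap w x + (pd φ 1 x * pd w 1 x + pd φ iI x * pd w iI x))
     = ∫ θ in 0..2 * π, φ (bpt θ) * nderiv w (bpt θ) := by
  have := div_thm (fun y => φ y * pd w 1 y) (fun y => φ y * pd w iI y)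
    (fun x hx => (hφ x hx).mul (hw.pd 1 x hx)) (fun x hx => (hφ x hx).mul (hw.pd iI x hx))
  convert this using 1
  · refine setIntegral_congr_fun measurableSet_ball fun x hx => ?_
    have hx' := Metric.ball_subset_closedBall hx
    beta_reduce
    rw [fderiv_fun_mul (hφ.diff hx') ((hw.pd 1).diff hx'),
      fderiv_fun_mul (hφ.diff hx') ((hw.pd iI).diff hx')]
    simp only [ContinuousLinearMap.add_apply, ContinuousLinearMap.smul_apply, smul_eq_mul, lap,
      show ∀ e, pd φ e x = fderiv ℝ φ x e from fun _ => rfl]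
    ring
  · refine intervalIntegral.integral_congr fun θ _ => ?_
    simp only [nderiv, bpt_re, bpt_im, smul_eq_mul]; ring

theorem green2 {φ w : ℂ → ℝ} (hφ : C2 φ) (hw : C2 w) :
    (∫ x in BB, φ x * lap w x) - (∫ x in BB, w x * lap φ x) =
      (∫ θ in 0..2 * π, φ (bpt θ) * nderiv w (bpt θ)) -
      ∫ θ in 0..2 * π, w (bpt θ) * nderiv φ (bpt θ) := by
  rw [← green1 hφ.C1 hw, ← green1 hw.C1 hφ, ← integral_sub, ← integral_sub]
  · congr 1; ext x; ring
  all_goals apply intD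
  all_goals
    have a1 := hφ.C1.cont
    have a2 := hw.C1.cont
    have a3 := hφ.lap_cont
    have a4 := hw.lap_cont
    have b1 := hφ.C1.pd_cont 1
    have b2 := hφ.C1.pd_cont iI
    have b3 := hw.C1.pd_cont 1
    have b4 := hw.C1.pd_cont iI
    fun_prop

def quad (A : ℝ) (b : ℂ) (c : ℝ) (y : ℂ) : ℝ :=
  A + (b.re * y.re + b.im * y.im) + c * (y.re * y.re + y.im * y.im)

lemma contDiff_re {n : WithTop ℕ∞} : ContDiff ℝ n Complex.re := Complex.reCLM.contDiff
lemma contDiff_im {n : WithTop ℕ∞} : ContDiff ℝ n Complex.im := Complex.imCLM.contDiff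

lemma quad_contDiff {n : WithTop ℕ∞} (A : ℝ) (b : ℂ) (c : ℝ) : ContDiff ℝ n (quad A b c) := by
  unfold quad
  have := contDiff_re (n := n)
  have := contDiff_im (n := n)
  fun_prop

lemma quad_hasFDerivAt (A : ℝ) (b : ℂ) (c : ℝ) (y : ℂ) :
    HasFDerivAt (quad A b c) ((b.re + 2 * c * y.re) • Complex.reCLM +
      (b.im + 2 * c * y.im) • Complex.imCLM) y := by
  have h1 := Complex.reCLM.hasFDerivAt (x := y)
  have h2 := Complex.imCLM.hasFDerivAt (x := y)
  have := (((h1.const_mul b.re).add (h2.const_mul b.im)).const_add A).add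
    (((h1.mul h1).add (h2.mul h2)).const_mul c)
  refine this.congr_fderiv ?_
  ext <;> simp <;> ring

lemma pd_quad (A : ℝ) (b : ℂ) (c : ℝ) (e y : ℂ) :
    pd (quad A b c) e y = (b.re + 2 * c * y.re) * e.re + (b.im + 2 * c * y.im) * e.im := by
  rw [pd, (quad_hasFDerivAt A b c y).fderiv]; simp

lemma pd_log_quad {A : ℝ} {b : ℂ} {c : ℝ} {y : ℂ} (h : 0 < quad A b c y) (e : ℂ) :
    pd (fun y => log (quad A b c y)) e y =
      ((b.re + 2 * c * y.re) * e.re + (b.im + 2 * c * y.im) * e.im) / quad A b c y := by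
  rw [pd, ((quad_hasFDerivAt A b c y).log h.ne').fderiv]
  simp; field_simp

lemma log_quad_contDiffAt {n : WithTop ℕ∞} {A : ℝ} {b : ℂ} {c : ℝ} {y : ℂ} (h : 0 < quad A b c y) :
    ContDiffAt ℝ n (fun y => log (quad A b c y)) y :=
  (quad_contDiff A b c).contDiffAt.log h.ne'

lemma lap_log_quad {A : ℝ} {b : ℂ} {c : ℝ} {y : ℂ} (h : 0 < quad A b c y) :
    lap (fun y => log (quad A b c y)) y =
      (4 * c * A - (b.re * b.re + b.im * b.im)) / quad A b c y ^ 2 := by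
  have hev : ∀ᶠ z in nhds y, 0 < quad A b c z :=
    (quad_contDiff (n := 0) A b c).continuous.continuousAt.eventually_const_lt h
  have e1 : (fun z => pd (fun y => log (quad A b c y)) 1 z) =ᶠ[nhds y]
      fun z => (b.re + 2 * c * z.re) * (quad A b c z)⁻¹ := by
    filter_upwards [hev] with z hz
    rw [pd_log_quad hz, div_eq_mul_inv]; simp
  have e2 : (fun z => pd (fun y => log (quad A b c y)) iI z) =ᶠ[nhds y]
      fun z => (b.im + 2 * c * z.im) * (quad A b c z)⁻¹ := by
    filter_upwards [hev] with z hz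
    rw [pd_log_quad hz, div_eq_mul_inv]; simp
  have h1 := Complex.reCLM.hasFDerivAt (x := y)
  have h2 := Complex.imCLM.hasFDerivAt (x := y)
  have qi : HasFDerivAt (fun z => (quad A b c z)⁻¹) _ y :=
    (hasDerivAt_inv h.ne').comp_hasFDerivAt y (quad_hasFDerivAt A b c y)
  have q1 := ((h1.const_mul (2 * c)).const_add b.re).fun_mul qi
  have q2 := ((h2.const_mul (2 * c)).const_add b.im).fun_mul qi
  simp only [Complex.reCLM_apply, Complex.imCLM_apply] at q1 q2
  rw [lap, e1.fderiv_eq, e2.fderiv_eq, q1.fderiv, q2.fderiv]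
  simp
  field_simp
  unfold quad; ring

lemma nderiv_log_quad {A : ℝ} {b : ℂ} {c : ℝ} {y : ℂ} (h : 0 < quad A b c y) :
    nderiv (fun y => log (quad A b c y)) y =
      (b.re * y.re + b.im * y.im + 2 * c * (y.re * y.re + y.im * y.im)) / quad A b c y := by
  rw [nderiv, pd_log_quad h, pd_log_quad h]; simp; ring

lemma log_holder {a b α : ℝ} (ha : 0 < a) (hb : 0 < b) (hα : 0 < α) (hα1 : α ≤ 1) :
    |log a - log b| ≤ α⁻¹ * (|a - b| ^ α * (a ^ (-α) + b ^ (-α))) := by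
  have key : ∀ a b : ℝ, 0 < b → b ≤ a → |log a - log b| ≤ α⁻¹ * (|a - b| ^ α * (b ^ (-α))) := by
    intro a b hb hab
    have ha : 0 < a := hb.trans_le hab
    rw [abs_of_nonneg (sub_nonneg.2 (log_le_log hb hab)), abs_of_nonneg (by linarith)]
    have h1 : α * (log a - log b) ≤ (a / b) ^ α - 1 := by
      rw [← log_div ha.ne' hb.ne', ← log_rpow (by positivity)]
      exact log_le_sub_one_of_pos (by positivity)
    have h2 : a ^ α ≤ b ^ α + (a - b) ^ α := by
      have := rpow_add_le_add_rpow hb.le (sub_nonneg.2 hab) hα.le hα1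
      rwa [add_sub_cancel] at this
    have h3 : (a / b) ^ α - 1 ≤ (a - b) ^ α * b ^ (-α) := by
      rw [div_rpow ha.le hb.le, rpow_neg hb.le]
      have : 0 < b ^ α := by positivity
      rw [← div_eq_mul_inv, le_div_iff₀ this, sub_mul, div_mul_cancel₀ _ this.ne']
      linarith
    rw [inv_mul_eq_div, le_div_iff₀ hα]
    linarith
  have pa : 0 ≤ a ^ (-α) := by positivity
  have pb : 0 ≤ b ^ (-α) := by positivity
  have pc : 0 ≤ α⁻¹ * |a - b| ^ α := by positivity
  rcases le_total b a with h | h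
  · refine (key a b hb h).trans ?_
    gcongr; linarith
  · rw [abs_sub_comm]
    refine (key b a ha h).trans ?_
    rw [abs_sub_comm b a]
    gcongr; linarith

lemma log_sq_add {a b s : ℝ} (ha : 0 < a) (hb : 0 < b) :
    |log (a ^ 2 + s ^ 2) - log (b ^ 2 + s ^ 2)| ≤ 2 * |log a - log b| := by
  have key : ∀ a b : ℝ, 0 < b → b ≤ a →
      |log (a ^ 2 + s ^ 2) - log (b ^ 2 + s ^ 2)| ≤ 2 * |log a - log b| := by
    intro a b hb hab
    have ha : 0 < a := hb.trans_le hab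
    have h2 : b ^ 2 ≤ a ^ 2 := by gcongr
    rw [abs_of_nonneg (sub_nonneg.2 (log_le_log hb hab)),
      abs_of_nonneg (sub_nonneg.2 (log_le_log (by positivity) (by linarith))),
      ← log_div (by positivity) (by positivity), ← log_div ha.ne' hb.ne']
    rw [show (2:ℝ) * log (a / b) = log ((a / b) ^ 2) by rw [log_pow]; norm_num]
    apply log_le_log (by positivity)
    rw [div_pow, div_le_div_iff₀ (by positivity) (by positivity)]
    nlinarith [sq_nonneg s]
  rcases le_total b a with h | h
  · exact key a b hb h
  · rw [abs_sub_comm, abs_sub_comm (log a)]; exact key b a ha h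

lemma norm_sq_re_im (z : ℂ) : ‖z‖ ^ 2 = z.re * z.re + z.im * z.im := by
  rw [← Complex.normSq_eq_norm_sq, Complex.normSq_apply]

lemma quad_s (x y : ℂ) (s : ℝ) : quad (‖x‖ ^ 2 + s ^ 2) (-2 * x) 1 y = ‖y - x‖ ^ 2 + s ^ 2 := by
  simp [quad, norm_sq_re_im]; ring

lemma quad_H (x y : ℂ) : quad 1 (-2 * x) (‖x‖ ^ 2) y = ‖1 - cj x * y‖ ^ 2 := by
  simp [quad, norm_sq_re_im]; ring

lemma one_sub_conj_ge {x y : ℂ} (hx : ‖x‖ ≤ 1) (hy : ‖y‖ ≤ 1) :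
    ‖y - x‖ ≤ ‖1 - cj x * y‖ := by
  have h : ‖1 - cj x * y‖ ^ 2 - ‖y - x‖ ^ 2 = (1 - ‖x‖ ^ 2) * (1 - ‖y‖ ^ 2) := by
    simp [norm_sq_re_im]; ring
  have h1 : 0 ≤ 1 - ‖x‖ ^ 2 := by nlinarith [norm_nonneg x]
  have h2 : 0 ≤ 1 - ‖y‖ ^ 2 := by nlinarith [norm_nonneg y]
  exact abs_le_of_sq_le_sq' (by nlinarith [mul_nonneg h1 h2]) (norm_nonneg _) |>.2

lemma one_sub_conj_eq {x y : ℂ} (hy : ‖y‖ = 1) :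
    ‖1 - cj x * y‖ ^ 2 = ‖y - x‖ ^ 2 := by
  have h : ‖1 - cj x * y‖ ^ 2 - ‖y - x‖ ^ 2 = (1 - ‖x‖ ^ 2) * (1 - ‖y‖ ^ 2) := by
    simp [norm_sq_re_im]; ring
  rw [hy] at h; linarith

lemma one_sub_conj_pos {x y : ℂ} (hx : ‖x‖ < 1) (hy : ‖y‖ ≤ 1) :
    0 < ‖1 - cj x * y‖ := by
  rw [norm_pos_iff, sub_ne_zero]
  intro h
  have : ‖cj x * y‖ = 1 := by rw [← h]; simp
  rw [norm_mul, RCLike.norm_conj] at this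
  nlinarith [norm_nonneg x, norm_nonneg y]

lemma C1.lip {F : Type*} [NormedAddCommGroup F] [NormedSpace ℝ F] {v : ℂ → F} (h : C1 v) :
    ∃ L > 0, ∀ x ∈ CB, ∀ y ∈ CB,
      ‖v y - v x‖ ≤ L * ‖y - x‖ := by
  have hc : ContinuousOn (fun y => fderiv ℝ v y) CB := fun x hx =>
    ((h x hx).fderiv_right (m := 0) (by norm_num)).continuousAt.continuousWithinAt
  obtain ⟨C, hC⟩ := (isCompact_closedBall (0:ℂ) 1).exists_bound_of_continuousOn hc
  refine ⟨max C 1, by positivity, fun x hx y hy => ?_⟩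
  refine Convex.norm_image_sub_le_of_norm_fderiv_le (𝕜 := ℝ) (fun z hz => h.diff hz)
    (fun z hz => (hC z hz).trans (le_max_left _ _)) (convex_closedBall _ _) hx hy

lemma contOn_bound {F : Type*} [NormedAddCommGroup F] {v : ℂ → F}
    (h : ContinuousOn v CB) :
    ∃ L > 0, ∀ x ∈ CB, ‖v x‖ ≤ L := by
  obtain ⟨C, hC⟩ := (isCompact_closedBall (0:ℂ) 1).exists_bound_of_continuousOn h
  exact ⟨max C 1, by positivity, fun x hx => (hC x hx).trans (le_max_left _ _)⟩

def Lg (x : ℂ) (s : ℝ) (y : ℂ) : ℝ :=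
  log (‖y - x‖ ^ 2 + s ^ 2) + log (‖1 - cj x * y‖ ^ 2)

def Err (w : ℂ → ℝ) (x : ℂ) (s : ℝ) : ℝ := ∫ θ in 0..2 * π, w (bpt θ) *
  (2 * (1 - (x.re * cos θ + x.im * sin θ)) *
    (1 / (‖bpt θ - x‖ ^ 2 + s ^ 2) - 1 / ‖bpt θ - x‖ ^ 2))

lemma bpt_sub_pos {x : ℂ} (hx : ‖x‖ < 1) (θ : ℝ) : 0 < ‖bpt θ - x‖ := by
  rw [norm_pos_iff, sub_ne_zero]
  intro hh; rw [← hh, norm_bpt] at hx; exact lt_irrefl _ hx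

lemma Lg_cont {x : ℂ} (hx : ‖x‖ < 1) {s : ℝ} (hs : 0 < s) :
    ContinuousOn (Lg x s) CB := by
  unfold Lg
  refine ContinuousOn.add (ContinuousOn.log (by fun_prop) fun y hy => by positivity)
    (ContinuousOn.log (by fun_prop) fun y hy => ?_)
  have := one_sub_conj_pos hx (y := y) (by simpa using hy)
  positivity

theorem rep {w : ℂ → ℝ} (hw : C2 w) {x : ℂ} (hx : ‖x‖ < 1) {s : ℝ} (hs : 0 < s) :
    4 * ∫ y in BB, (s ^ 2 / (‖y - x‖ ^ 2 + s ^ 2) ^ 2) * w y =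
      (∫ y in BB, Lg x s y * lap w y)
      - (∫ θ in 0..2 * π, Lg x s (bpt θ) * nderiv w (bpt θ))
      + 2 * (∫ θ in 0..2 * π, w (bpt θ)) + Err w x s := by
  have p1 : ∀ y, 0 < quad (‖x‖ ^ 2 + s ^ 2) (-2 * x) 1 y := fun y => by rw [quad_s]; positivity
  have p2 : ∀ y ∈ CB, 0 < quad 1 (-2 * x) (‖x‖ ^ 2) y := fun y hy => by
    rw [quad_H]
    have := one_sub_conj_pos hx (y := y) (by simpa using hy)
    positivity
  have c1 : C2 (fun y => log (quad (‖x‖ ^ 2 + s ^ 2) (-2 * x) 1 y)) := fun y _ =>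
    log_quad_contDiffAt (p1 y)
  have c2 : C2 (fun y => log (quad 1 (-2 * x) (‖x‖ ^ 2) y)) := fun y hy =>
    log_quad_contDiffAt (p2 y hy)
  have g1 := green2 c1 hw
  have g2 := green2 c2 hw
  have e1 : ∫ y in BB, w y * lap (fun y => log (quad (‖x‖ ^ 2 + s ^ 2) (-2 * x) 1 y)) y
     = 4 * ∫ y in BB, (s ^ 2 / (‖y - x‖ ^ 2 + s ^ 2) ^ 2) * w y := by
    rw [← integral_const_mul]
    congr 1; ext y
    rw [lap_log_quad (p1 y), quad_s]
    have : 0 < ‖y - x‖ ^ 2 + s ^ 2 := by positivity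
    field_simp
    simp [norm_sq_re_im]; ring_nf
  have e2 : ∫ y in BB, w y * lap (fun y => log (quad 1 (-2 * x) (‖x‖ ^ 2) y)) y = 0 := by
    rw [setIntegral_congr_fun (g := fun _ => (0:ℝ)) measurableSet_ball fun y hy => ?_]
    · simp
    · beta_reduce
      rw [lap_log_quad (p2 y (Metric.ball_subset_closedBall hy))]
      simp [norm_sq_re_im]; right; left; ring
  have i1 : IntegrableOn (fun y => log (quad (‖x‖ ^ 2 + s ^ 2) (-2 * x) 1 y) * lap w y) (Metric.ball 0 1) :=
    intD (c1.C1.cont.mul hw.lap_cont)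
  have i2 : IntegrableOn (fun y => log (quad 1 (-2 * x) (‖x‖ ^ 2) y) * lap w y) (Metric.ball 0 1) :=
    intD (c2.C1.cont.mul hw.lap_cont)
  have e3 : (∫ y in BB, Lg x s y * lap w y) =
      (∫ y in BB, log (quad (‖x‖ ^ 2 + s ^ 2) (-2 * x) 1 y) * lap w y) +
      ∫ y in BB, log (quad 1 (-2 * x) (‖x‖ ^ 2) y) * lap w y := by
    rw [← integral_add i1 i2]
    congr 1; ext y; rw [quad_s, quad_H, Lg]; ring
  have e4 : (∫ θ in 0..2 * π, Lg x s (bpt θ) * nderiv w (bpt θ)) =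
      (∫ θ in 0..2 * π, log (quad (‖x‖ ^ 2 + s ^ 2) (-2 * x) 1 (bpt θ)) * nderiv w (bpt θ)) +
      ∫ θ in 0..2 * π, log (quad 1 (-2 * x) (‖x‖ ^ 2) (bpt θ)) * nderiv w (bpt θ) := by
    have j1 : IntervalIntegrable (fun θ => log (quad (‖x‖ ^ 2 + s ^ 2) (-2 * x) 1 (bpt θ)) * nderiv w (bpt θ))
      volume 0 (2 * π) := (cont_bpt (c1.C1.cont.mul hw.C1.nderiv_cont)).intervalIntegrable _ _
    have j2 : IntervalIntegrable (fun θ => log (quad 1 (-2 * x) (‖x‖ ^ 2) (bpt θ)) * nderiv w (bpt θ))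
      volume 0 (2 * π) := (cont_bpt (c2.C1.cont.mul hw.C1.nderiv_cont)).intervalIntegrable _ _
    rw [← intervalIntegral.integral_add j1 j2]
    congr 1; ext θ; rw [quad_s, quad_H, Lg]; ring
  have e5 : (∫ θ in 0..2 * π, w (bpt θ) * nderiv (fun y => log (quad (‖x‖ ^ 2 + s ^ 2) (-2 * x) 1 y)) (bpt θ)) +
      (∫ θ in 0..2 * π, w (bpt θ) * nderiv (fun y => log (quad 1 (-2 * x) (‖x‖ ^ 2) y)) (bpt θ)) =
      2 * (∫ θ in 0..2 * π, w (bpt θ)) + Err w x s := by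
    have j1 : IntervalIntegrable (fun θ => w (bpt θ) * nderiv (fun y => log (quad (‖x‖ ^ 2 + s ^ 2) (-2 * x) 1 y)) (bpt θ))
      volume 0 (2 * π) := (cont_bpt (hw.C1.cont.mul c1.C1.nderiv_cont)).intervalIntegrable _ _
    have j2 : IntervalIntegrable (fun θ => w (bpt θ) * nderiv (fun y => log (quad 1 (-2 * x) (‖x‖ ^ 2) y)) (bpt θ))
      volume 0 (2 * π) := (cont_bpt (hw.C1.cont.mul c2.C1.nderiv_cont)).intervalIntegrable _ _
    rw [Err, ← intervalIntegral.integral_const_mul,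
      ← intervalIntegral.integral_add j1 j2,
      ← intervalIntegral.integral_add]
    · congr 1; ext θ
      rw [nderiv_log_quad (p1 _), nderiv_log_quad (p2 _ (bpt_mem θ)), quad_s, quad_H,
        one_sub_conj_eq (norm_bpt θ)]
      have hp := bpt_sub_pos hx θ
      have hp2 : 0 < ‖bpt θ - x‖ ^ 2 + s ^ 2 := by positivity
      have hcs := sin_sq_add_cos_sq θ
      have hq : ‖bpt θ - x‖ ^ 2 = 1 - 2 * (x.re * cos θ + x.im * sin θ) + ‖x‖ ^ 2 := by
        simp [norm_sq_re_im]; linear_combination hcs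
      simp only [bpt_re, bpt_im]
      have hcs' : cos θ * cos θ + sin θ * sin θ = 1 := by linear_combination hcs
      have r1 : (-2 * x).re = -2 * x.re := by simp
      have r2 : (-2 * x).im = -2 * x.im := by simp
      rw [hcs', r1, r2]
      set q := ‖bpt θ - x‖ ^ 2 with hqd
      have hqp : 0 < q := by positivity
      have hX : ‖x‖ ^ 2 = q - 1 + 2 * (x.re * cos θ + x.im * sin θ) := by linarith
      rw [hX]
      field_simp
      ring
    · exact ((cont_bpt hw.C1.cont).const_mul 2 |>.intervalIntegrable _ _)
    · apply Continuous.intervalIntegrable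
      have := continuous_bpt
      refine (cont_bpt hw.C1.cont).mul (Continuous.mul (by fun_prop) (Continuous.sub ?_ ?_))
      · exact continuous_const.div (by fun_prop) fun θ => by positivity
      · exact continuous_const.div (by fun_prop) fun θ => by have := bpt_sub_pos hx θ; positivity
  linarith

lemma Err_le {w : ℂ → ℝ} {L : ℝ} (hL : ∀ y ∈ CB, ‖w y‖ ≤ L) {x : ℂ} (hx : ‖x‖ < 1)
    {s : ℝ} (hs : 0 < s) : |Err w x s| ≤ L * (4 * (s ^ 2 / (1 - ‖x‖) ^ 4)) * (2 * π) := by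
  have hd : 0 < 1 - ‖x‖ := by linarith
  have := intervalIntegral.norm_integral_le_of_norm_le_const (a := 0) (b := 2 * π)
    (C := L * (4 * (s ^ 2 / (1 - ‖x‖) ^ 4))) (f := fun θ => w (bpt θ) *
  (2 * (1 - (x.re * cos θ + x.im * sin θ)) *
    (1 / (‖bpt θ - x‖ ^ 2 + s ^ 2) - 1 / ‖bpt θ - x‖ ^ 2))) (fun θ _ => ?_)
  · rw [sub_zero, abs_of_pos (by positivity : (0:ℝ) < 2 * π)] at this
    exact this
  rw [norm_mul]
  have hL0 : 0 ≤ L := (norm_nonneg _).trans (hL _ (bpt_mem 0))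
  refine mul_le_mul (hL _ (bpt_mem θ)) ?_ (norm_nonneg _) hL0
  have hp := bpt_sub_pos hx θ
  have hp2 : 1 - ‖x‖ ≤ ‖bpt θ - x‖ := by
    have := norm_sub_norm_le (bpt θ) x
    rwa [norm_bpt] at this
  rw [norm_eq_abs, abs_mul]
  have h1 : |2 * (1 - (x.re * cos θ + x.im * sin θ))| ≤ 4 := by
    have hn := norm_sq_re_im x
    have hcs := sin_sq_add_cos_sq θ
    have : (x.re * cos θ + x.im * sin θ) ^ 2 ≤ 1 ^ 2 := by
      nlinarith [sq_nonneg (x.re * sin θ - x.im * cos θ), norm_nonneg x]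
    have := abs_le_of_sq_le_sq' this (by norm_num)
    rw [abs_le]; constructor <;> linarith [this.1, this.2]
  have h2 : |1 / (‖bpt θ - x‖ ^ 2 + s ^ 2) - 1 / ‖bpt θ - x‖ ^ 2| ≤ s ^ 2 / (1 - ‖x‖) ^ 4 := by
    have e : 1 / (‖bpt θ - x‖ ^ 2 + s ^ 2) - 1 / ‖bpt θ - x‖ ^ 2 =
        -(s ^ 2 / ((‖bpt θ - x‖ ^ 2 + s ^ 2) * ‖bpt θ - x‖ ^ 2)) := by
      have : 0 < ‖bpt θ - x‖ ^ 2 + s ^ 2 := by positivity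
      field_simp; ring
    rw [e, abs_neg, abs_of_nonneg (by positivity)]
    gcongr
    calc (1 - ‖x‖) ^ 4 = (1 - ‖x‖) ^ 2 * (1 - ‖x‖) ^ 2 := by ring
      _ ≤ (‖bpt θ - x‖ ^ 2 + s ^ 2) * ‖bpt θ - x‖ ^ 2 := by
        gcongr
        calc (1 - ‖x‖) ^ 2 ≤ ‖bpt θ - x‖ ^ 2 := by gcongr
          _ ≤ _ := by linarith [sq_nonneg s]
  exact mul_le_mul h1 h2 (abs_nonneg _) (by norm_num)

lemma Err_tendsto {w : ℂ → ℝ} (hw : ContinuousOn w CB) {x : ℂ} (hx : ‖x‖ < 1) :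
    Tendsto (Err w x) (nhdsWithin 0 (Set.Ioi 0)) (nhds 0) := by
  obtain ⟨L, hL0, hL⟩ := contOn_bound hw
  refine squeeze_zero_norm' (a := fun s => L * (4 * (s ^ 2 / (1 - ‖x‖) ^ 4)) * (2 * π)) ?_ ?_
  · filter_upwards [self_mem_nhdsWithin] with s hs
    exact Err_le hL hx hs
  · have : Continuous (fun s : ℝ => L * (4 * (s ^ 2 / (1 - ‖x‖) ^ 4)) * (2 * π)) := by fun_prop
    have h := this.tendsto 0
    simp only [ne_eq, OfNat.ofNat_ne_zero, not_false_eq_true, zero_pow, zero_div, mul_zero, zero_mul] at h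
    exact h.mono_left nhdsWithin_le_nhds

lemma mass {x : ℂ} (hx : ‖x‖ < 1) :
    Tendsto (fun s : ℝ => ∫ y in BB, s ^ 2 / (‖y - x‖ ^ 2 + s ^ 2) ^ 2)
      (nhdsWithin 0 (Set.Ioi 0)) (nhds π) := by
  have h1 : C2 (fun _ : ℂ => (1:ℝ)) := fun _ _ => contDiffAt_const
  have l0 : ∀ y, lap (fun _ : ℂ => (1:ℝ)) y = 0 := by intro y; simp [lap, pd]
  have n0 : ∀ y, nderiv (fun _ : ℂ => (1:ℝ)) y = 0 := by intro y; simp [nderiv, pd]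
  have hE := (Err_tendsto (w := fun _ => 1) continuousOn_const hx).const_add (4 * π) |>.div_const 4
  rw [show (4 * π + 0) / 4 = π by ring] at hE
  refine hE.congr' ?_
  filter_upwards [self_mem_nhdsWithin] with s hs
  have := rep h1 hx hs
  simp only [l0, n0, mul_zero, mul_one, integral_zero, intervalIntegral.integral_zero, sub_zero, zero_add,
    intervalIntegral.integral_const, smul_eq_mul] at this
  linarith

lemma approx_id {F : Type*} [NormedAddCommGroup F] [NormedSpace ℝ F] [CompleteSpace F]
    {w : ℂ → F} (hc : ContinuousOn w CB)
    {x : ℂ} (hx : ‖x‖ < 1) {L : ℝ} (hL : ∀ y ∈ BB, ‖w y - w x‖ ≤ L * ‖y - x‖) :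
    Tendsto (fun s : ℝ => ∫ y in BB, (s ^ 2 / (‖y - x‖ ^ 2 + s ^ 2) ^ 2) • w y)
      (nhdsWithin 0 (Set.Ioi 0)) (nhds (π • w x)) := by
  obtain ⟨C, hC, hr⟩ := rpow_disk (α := 3/2) (by norm_num) (by norm_num)
  obtain ⟨hi, hb⟩ := hr x
  have hkc : ∀ s > 0, ContinuousOn (fun y : ℂ => s ^ 2 / (‖y - x‖ ^ 2 + s ^ 2) ^ 2)
      CB := by
    intro s hs
    exact continuousOn_const.div (by fun_prop) fun y _ => by positivity
  have h2 : Tendsto (fun s : ℝ => ∫ y in BB,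
      (s ^ 2 / (‖y - x‖ ^ 2 + s ^ 2) ^ 2) • (w y - w x)) (nhdsWithin 0 (Set.Ioi 0)) (nhds 0) := by
    refine squeeze_zero_norm' (a := fun s => s ^ (1/2:ℝ) * (|L| * C)) ?_ ?_
    · filter_upwards [self_mem_nhdsWithin] with s (hs : 0 < s)
      calc _ ≤ ∫ y in BB, s ^ (1/2:ℝ) * (|L| * ‖y - x‖ ^ (-(3/2):ℝ)) := by
            refine norm_integral_le_of_norm_le ((hi.const_mul _).const_mul _) ?_
            have h1 : ∀ᵐ y : ℂ, y ≠ x := by simp [ae_iff]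
            filter_upwards [ae_restrict_mem measurableSet_ball, ae_restrict_of_ae h1] with y hy hyx
            have hr : 0 < ‖y - x‖ := norm_pos_iff.2 (sub_ne_zero.2 hyx)
            rw [norm_smul, norm_eq_abs, abs_of_nonneg (by positivity)]
            set r := ‖y - x‖
            have h3 : ‖w y - w x‖ ≤ |L| * r :=
              (hL y hy).trans (by gcongr; exact le_abs_self L)
            have h4 : s ^ 2 / (r ^ 2 + s ^ 2) ^ 2 * r ≤ s ^ (1/2:ℝ) * r ^ (-(3/2):ℝ) := by
              have e1 : s ^ 2 = s ^ (3/2:ℝ) * s ^ (1/2:ℝ) := by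
                rw [← rpow_add hs]; norm_num
              have e2 : (r * s) ^ (3/2:ℝ) * r ≤ (r ^ 2 + s ^ 2) ^ 2 := by
                have a1 : (r * s) ^ (3/2:ℝ) ≤ (r ^ 2 + s ^ 2) ^ (3/2:ℝ) := by
                  gcongr; nlinarith [sq_nonneg (r - s), mul_pos hr hs]
                have a2 : r ≤ (r ^ 2 + s ^ 2) ^ (1/2:ℝ) := by
                  rw [← sqrt_eq_rpow]; exact le_sqrt_of_sq_le (by nlinarith [sq_nonneg s])
                calc _ ≤ (r ^ 2 + s ^ 2) ^ (3/2:ℝ) * (r ^ 2 + s ^ 2) ^ (1/2:ℝ) := by gcongr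
                  _ = _ := by rw [← rpow_add (by positivity)]; norm_num
              rw [div_mul_eq_mul_div, div_le_iff₀ (by positivity)]
              calc s ^ 2 * r = s ^ (1/2:ℝ) * r ^ (-(3/2):ℝ) * ((r * s) ^ (3/2:ℝ) * r) := by
                    rw [mul_rpow hr.le hs.le, e1, rpow_neg hr.le]
                    have : 0 < r ^ (3/2:ℝ) := by positivity
                    field_simp
                _ ≤ _ := by gcongr
            calc _ ≤ s ^ 2 / (r ^ 2 + s ^ 2) ^ 2 * (|L| * r) := by gcongr
              _ = |L| * (s ^ 2 / (r ^ 2 + s ^ 2) ^ 2 * r) := by ring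
              _ ≤ |L| * (s ^ (1/2:ℝ) * r ^ (-(3/2):ℝ)) := by gcongr
              _ = _ := by ring
        _ ≤ _ := by
            rw [integral_const_mul, integral_const_mul]
            gcongr
    · have : Tendsto (fun s : ℝ => s ^ (1/2:ℝ) * (|L| * C)) (nhds 0) (nhds ((0:ℝ) ^ (1/2:ℝ) * (|L| * C))) :=
        ((continuousAt_rpow_const _ _ (Or.inr (by norm_num))).tendsto).mul_const _
      rw [zero_rpow (by norm_num), zero_mul] at this
      exact this.mono_left nhdsWithin_le_nhds
  have h3 := h2.add ((mass hx).smul_const (w x))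
  rw [zero_add] at h3
  refine h3.congr' ?_
  filter_upwards [self_mem_nhdsWithin] with s (hs : 0 < s)
  rw [← integral_smul_const, ← integral_add]
  · congr 1; ext y; rw [← smul_add, sub_add_cancel]
  · exact intD ((hkc s hs).smul (hc.sub continuousOn_const))
  · exact intD ((hkc s hs).smul continuousOn_const)

lemma Lg_diff {α : ℝ} (hα : 0 < α) (hα1 : α ≤ 1) {x x' y : ℂ} (hx : ‖x‖ < 1) (hx' : ‖x'‖ < 1) (hy : ‖y‖ ≤ 1)
    (h : y ≠ x) (h' : y ≠ x') (s : ℝ) :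
    |Lg x s y - Lg x' s y| ≤ 4 * α⁻¹ * ‖x - x'‖ ^ α * (‖y - x‖ ^ (-α) + ‖y - x'‖ ^ (-α)) := by
  have p : 0 < ‖y - x‖ := norm_pos_iff.2 (sub_ne_zero.2 h)
  have p' : 0 < ‖y - x'‖ := norm_pos_iff.2 (sub_ne_zero.2 h')
  have q := one_sub_conj_pos hx hy
  have q' := one_sub_conj_pos hx' hy
  have r := one_sub_conj_ge hx.le hy
  have r' := one_sub_conj_ge hx'.le hy
  have l1 := log_sq_add (s := s) p p'
  have l2 := log_holder p p' hα hα1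
  have l3 := log_holder q q' hα hα1
  have d1 : |‖y - x‖ - ‖y - x'‖| ≤ ‖x - x'‖ := by
    refine (abs_norm_sub_norm_le _ _).trans_eq ?_
    rw [← norm_neg]; congr 1; ring
  have d2 : |‖1 - cj x * y‖ - ‖1 - cj x' * y‖| ≤ ‖x - x'‖ := by
    refine (abs_norm_sub_norm_le _ _).trans ?_
    have : (1 - cj x * y) - (1 - cj x' * y) = -(cj (x - x') * y) := by
      simp; ring
    rw [this, norm_neg, norm_mul, RCLike.norm_conj]
    nlinarith [norm_nonneg (x - x')]
  have e1 : ‖1 - cj x * y‖ ^ (-α) ≤ ‖y - x‖ ^ (-α) :=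
    rpow_le_rpow_of_nonpos p r (by linarith)
  have e1' : ‖1 - cj x' * y‖ ^ (-α) ≤ ‖y - x'‖ ^ (-α) :=
    rpow_le_rpow_of_nonpos p' r' (by linarith)
  have f1 : |‖y - x‖ - ‖y - x'‖| ^ α ≤ ‖x - x'‖ ^ α := rpow_le_rpow (abs_nonneg _) d1 hα.le
  have f2 : |‖1 - cj x * y‖ - ‖1 - cj x' * y‖| ^ α ≤ ‖x - x'‖ ^ α :=
    rpow_le_rpow (abs_nonneg _) d2 hα.le
  have hs : 0 ≤ ‖y - x‖ ^ (-α) + ‖y - x'‖ ^ (-α) := by positivity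
  have g2 : |log ‖y - x‖ - log ‖y - x'‖| ≤ α⁻¹ * (‖x - x'‖ ^ α * (‖y - x‖ ^ (-α) + ‖y - x'‖ ^ (-α))) :=
    l2.trans (by gcongr)
  have g3 : |log ‖1 - cj x * y‖ - log ‖1 - cj x' * y‖| ≤
      α⁻¹ * (‖x - x'‖ ^ α * (‖y - x‖ ^ (-α) + ‖y - x'‖ ^ (-α))) :=
    l3.trans (by gcongr)
  unfold Lg
  rw [log_pow, log_pow]
  push_cast
  have l4 := abs_le.1 (l1.trans (mul_le_mul_of_nonneg_left g2 (by norm_num)))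
  have g4 := abs_le.1 g3
  rw [abs_le]
  constructor <;> linarith [l4.1, l4.2, g4.1, g4.2]

lemma rpow_circ {α : ℝ} (hα : 0 < α) (hα1 : α < 1) : ∃ C > 0, ∀ x : ℂ, ‖x‖ < 1 →
    ∫ θ in 0..2 * π, ‖bpt θ - x‖ ^ (-α) ≤ C := by
  obtain ⟨C, hC, h⟩ := ker_circ (m := 1) hα.le hα1 (by norm_num; linarith)
  refine ⟨3 * C, by positivity, fun x hx => ?_⟩
  have h1 := h 1 one_pos 1 x (by simp) hx
  simp only [one_rpow, mul_one] at h1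
  have hc : Continuous fun θ => ‖bpt θ - x‖ ^ (-α) := by
    have := continuous_bpt
    exact Continuous.rpow_const (by fun_prop) fun θ => Or.inl (bpt_sub_pos hx θ).ne'
  have : ∫ θ in 0..2 * π, ‖bpt θ - x‖ ^ (-α) ≤
      ∫ θ in 0..2 * π, 3 * (((1 + ‖bpt θ - 1‖) ^ 1)⁻¹ * ‖bpt θ - x‖ ^ (-α)) := by
    refine intervalIntegral.integral_mono_on (by positivity) (hc.intervalIntegrable _ _) ?_ fun θ _ => ?_
    · have := continuous_bpt
      exact (Continuous.mul continuous_const (Continuous.mul (Continuous.inv₀ (by fun_prop)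
        fun θ => by positivity) hc)).intervalIntegrable _ _
    · have h2 : ‖bpt θ - 1‖ ≤ 2 := (norm_sub_le _ _).trans (by simp; norm_num)
      have h3 : (0:ℝ) < 1 + ‖bpt θ - 1‖ := by positivity
      have h4 : 1 ≤ 3 * ((1 + ‖bpt θ - 1‖) ^ 1)⁻¹ := by
        rw [pow_one, ← div_eq_mul_inv, le_div_iff₀ h3]; linarith
      rw [← mul_assoc]
      exact le_mul_of_one_le_left (by positivity) h4
  rw [intervalIntegral.integral_const_mul] at this
  first
  | linarith
  | (push_cast at *; simp only [pow_one] at *; linarith)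

lemma int_rpow {f : ℂ → ℝ} (hf : ContinuousOn f CB) {α : ℝ} (hα : 0 < α) (hα1 : α < 1) (x : ℂ) :
    IntegrableOn (fun y => |f y| * ‖y - x‖ ^ (-α)) (Metric.ball 0 1) := by
  obtain ⟨C, hC, h⟩ := rpow_disk hα.le (by linarith : α < 2)
  obtain ⟨L, hL, hb⟩ := contOn_bound hf
  refine ((h x).1.const_mul L).mono' ?_ ?_
  · exact ((hf.mono Metric.ball_subset_closedBall).abs.aestronglyMeasurable measurableSet_ball).mul
      (Measurable.aestronglyMeasurable (by fun_prop))
  · filter_upwards [ae_restrict_mem measurableSet_ball] with y hy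
    have := hb y (Metric.ball_subset_closedBall hy)
    rw [norm_eq_abs] at this
    rw [norm_of_nonneg (by positivity)]
    gcongr

theorem holder_int {α : ℝ} (hα : 0 < α) (hα1 : α < 1) {w : ℂ → ℝ} (hw : C2 w) {B : ℝ}
    (hB : ∀ x : ℂ, ‖x‖ < 1 → ∫ y in BB, |lap w y| * ‖y - x‖ ^ (-α) ≤ B)
    (hB' : ∀ x : ℂ, ‖x‖ < 1 → ∫ θ in 0..2 * π, |nderiv w (bpt θ)| * ‖bpt θ - x‖ ^ (-α) ≤ B)
    {x x' : ℂ} (hx : ‖x‖ < 1) (hx' : ‖x'‖ < 1) :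
    |w x - w x'| ≤ 4 * α⁻¹ * B * ‖x - x'‖ ^ α := by
  obtain ⟨L, hL, hl⟩ := hw.C1.lip
  have T : ∀ x : ℂ, ‖x‖ < 1 → Tendsto (fun s : ℝ => (4 * ∫ y in BB, (s ^ 2 / (‖y - x‖ ^ 2 + s ^ 2) ^ 2) * w y) - Err w x s)
      (nhdsWithin 0 (Set.Ioi 0)) (nhds (4 * (π * w x) - 0)) := by
    intro x hx
    have := approx_id hw.C1.cont hx (L := L) fun y hy => hl x (by simpa using hx.le) y (Metric.ball_subset_closedBall hy)
    simp only [smul_eq_mul] at this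
    exact (this.const_mul 4).sub (Err_tendsto hw.C1.cont hx)
  have key := ((T x hx).sub (T x' hx')).abs
  set D := 4 * α⁻¹ * ‖x - x'‖ ^ α with hD
  have hD0 : 0 ≤ D := by positivity
  have bd : ∀ᶠ s in nhdsWithin (0:ℝ) (Set.Ioi 0),
     |((4 * ∫ y in BB, (s ^ 2 / (‖y - x‖ ^ 2 + s ^ 2) ^ 2) * w y) - Err w x s) -
      ((4 * ∫ y in BB, (s ^ 2 / (‖y - x'‖ ^ 2 + s ^ 2) ^ 2) * w y) - Err w x' s)| ≤ 4 * D * B := by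
    filter_upwards [self_mem_nhdsWithin] with s hs
    rw [rep hw hx hs, rep hw hx' hs]
    have i1 : IntegrableOn (fun y => Lg x s y * lap w y) (Metric.ball 0 1) := intD ((Lg_cont hx hs).mul hw.lap_cont)
    have i2 : IntegrableOn (fun y => Lg x' s y * lap w y) (Metric.ball 0 1) := intD ((Lg_cont hx' hs).mul hw.lap_cont)
    have j1 : IntervalIntegrable (fun θ => Lg x s (bpt θ) * nderiv w (bpt θ)) volume 0 (2 * π) :=
      (cont_bpt ((Lg_cont hx hs).mul hw.C1.nderiv_cont)).intervalIntegrable _ _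
    have j2 : IntervalIntegrable (fun θ => Lg x' s (bpt θ) * nderiv w (bpt θ)) volume 0 (2 * π) :=
      (cont_bpt ((Lg_cont hx' hs).mul hw.C1.nderiv_cont)).intervalIntegrable _ _
    have k1 : |(∫ y in BB, Lg x s y * lap w y) - ∫ y in BB, Lg x' s y * lap w y| ≤ D * (B + B) := by
      rw [← integral_sub i1 i2, ← norm_eq_abs]
      refine (norm_integral_le_of_norm_le (g := fun y => D * (|lap w y| * ‖y - x‖ ^ (-α) + |lap w y| * ‖y - x'‖ ^ (-α))) ?_ ?_).trans ?_
      · exact ((int_rpow hw.lap_cont hα hα1 x).add (int_rpow hw.lap_cont hα hα1 x')).const_mul D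
      · have hne : ∀ z : ℂ, ∀ᵐ y ∂(volume.restrict BB), y ≠ z := fun z =>
          ae_restrict_of_ae (compl_mem_ae_iff.2 (by simp : volume {z} = 0))
        filter_upwards [ae_restrict_mem measurableSet_ball, hne x, hne x'] with y hy h1 h2
        rw [← sub_mul, norm_mul, norm_eq_abs, norm_eq_abs]
        have := Lg_diff hα hα1.le hx hx' (by simpa using (Metric.ball_subset_closedBall hy)) h1 h2 s
        rw [← hD] at this
        nlinarith [abs_nonneg (lap w y)]
      · rw [integral_const_mul, integral_add (int_rpow hw.lap_cont hα hα1 x) (int_rpow hw.lap_cont hα hα1 x')]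
        exact mul_le_mul_of_nonneg_left (add_le_add (hB x hx) (hB x' hx')) hD0
    have rc : ∀ x : ℂ, ‖x‖ < 1 → Continuous fun θ => |nderiv w (bpt θ)| * ‖bpt θ - x‖ ^ (-α) := fun x hx => by
      have := continuous_bpt
      exact (cont_bpt hw.C1.nderiv_cont.abs).mul
        (Continuous.rpow_const (by fun_prop) fun θ => Or.inl (bpt_sub_pos hx θ).ne')
    have k2 : |(∫ θ in 0..2 * π, Lg x s (bpt θ) * nderiv w (bpt θ)) - ∫ θ in 0..2 * π, Lg x' s (bpt θ) * nderiv w (bpt θ)| ≤ D * (B + B) := by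
      rw [← intervalIntegral.integral_sub j1 j2, ← norm_eq_abs]
      refine (intervalIntegral.norm_integral_le_of_norm_le (g := fun θ => D * (|nderiv w (bpt θ)| * ‖bpt θ - x‖ ^ (-α) + |nderiv w (bpt θ)| * ‖bpt θ - x'‖ ^ (-α))) (by positivity) ?_ ?_).trans ?_
      · refine Eventually.of_forall fun θ _ => ?_
        rw [← sub_mul, norm_mul, norm_eq_abs, norm_eq_abs]
        have := Lg_diff hα hα1.le hx hx' (norm_bpt θ).le (sub_ne_zero.1 (norm_pos_iff.1 (bpt_sub_pos hx θ)))
          (sub_ne_zero.1 (norm_pos_iff.1 (bpt_sub_pos hx' θ))) s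
        rw [← hD] at this
        nlinarith [abs_nonneg (nderiv w (bpt θ))]
      · exact (continuous_const.mul ((rc x hx).add (rc x' hx'))).intervalIntegrable _ _
      · rw [intervalIntegral.integral_const_mul, intervalIntegral.integral_add ((rc x hx).intervalIntegrable _ _) ((rc x' hx').intervalIntegrable _ _)]
        exact mul_le_mul_of_nonneg_left (add_le_add (hB' x hx) (hB' x' hx')) hD0
    rw [abs_le] at *
    constructor <;> linarith [k1.1, k1.2, k2.1, k2.2]
  have fin := le_of_tendsto key bd
  have h3 : |4 * (π * w x) - 0 - (4 * (π * w x') - 0)| = 4 * π * |w x - w x'| := by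
    rw [show 4 * (π * w x) - 0 - (4 * (π * w x') - 0) = (4 * π) * (w x - w x') by ring, abs_mul, abs_of_pos (by positivity : (0:ℝ) < 4 * π)]
  rw [h3] at fin
  have hpi := pi_gt_three
  have hB0 : 4 * D * B ≤ 4 * π * (D * B) := by
    have : 0 ≤ B := le_trans (integral_nonneg fun y => by positivity) (hB 0 (by simp))
    nlinarith [mul_nonneg hD0 this]
  have := le_of_mul_le_mul_left (fin.trans hB0) (by positivity)
  refine this.trans_eq (by rw [hD]; ring)

lemma extend_closed {w : ℂ → ℝ} (hw : ContinuousOn w CB) {α D : ℝ} (hα : 0 < α)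
    (h : ∀ x x' : ℂ, ‖x‖ < 1 → ‖x'‖ < 1 → |w x - w x'| ≤ D * ‖x - x'‖ ^ α)
    {x x' : ℂ} (hx : ‖x‖ ≤ 1) (hx' : ‖x'‖ ≤ 1) : |w x - w x'| ≤ D * ‖x - x'‖ ^ α := by
  have sc : ∀ x : ℂ, ‖x‖ ≤ 1 → Tendsto (fun r : ℝ => (r : ℂ) * x) (nhdsWithin 1 (Set.Iio 1)) (nhdsWithin x (Metric.closedBall 0 1)) := by
    intro x hx
    refine tendsto_nhdsWithin_iff.2 ⟨?_, ?_⟩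
    · have : Continuous (fun r : ℝ => (r : ℂ) * x) := by fun_prop
      have := (this.tendsto 1).mono_left (nhdsWithin_le_nhds (s := Set.Iio 1))
      simpa using this
    · filter_upwards [Ioo_mem_nhdsLT (zero_lt_one' ℝ)] with r hr
      simp [abs_of_pos hr.1]; nlinarith [hr.1, hr.2, norm_nonneg x]
  have t1 := (hw x (by simpa using hx)).tendsto.comp (sc x hx)
  have t2 := (hw x' (by simpa using hx')).tendsto.comp (sc x' hx')
  have t3 := (tendsto_nhdsWithin_iff.1 (sc x hx)).1.sub (tendsto_nhdsWithin_iff.1 (sc x' hx')).1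
  have t4 := (t3.norm.rpow_const (p := α) (Or.inr hα.le)).const_mul D
  refine le_of_tendsto_of_tendsto (t1.sub t2).abs t4 ?_
  filter_upwards [Ioo_mem_nhdsLT (zero_lt_one' ℝ)] with r hr
  have : ∀ x : ℂ, ‖x‖ ≤ 1 → ‖(r:ℂ) * x‖ < 1 := fun x hx => by
    simp [abs_of_pos hr.1]; nlinarith [hr.1, hr.2, norm_nonneg x]
  exact h _ _ (this x hx) (this x' hx')

structure Cfg (Λ δ κ : ℝ) (p : ℂ) (A C : ℝ) (v : ℂ → ℝ) : Prop where
  hv : C2 v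
  hb : ∀ x ∈ CB, |v x| ≤ Λ
  hΛ : 1 ≤ Λ
  hδ : 0 < δ
  hδ1 : δ ≤ 1
  hκ : 0 ≤ κ
  hκ1 : κ ≤ Λ
  hp : ‖p‖ = 1
  hC : C ≤ 0
  hCl : -Λ ≤ C
  hA : A ≤ Λ
  hAC : Λ⁻¹ ≤ A + C
  hF : ∀ x ∈ BB, |lap v x + 8 * A * C * exp (v x)| ≤
    Λ * (δ * ((δ + ‖x + p‖) ^ 1)⁻¹ + κ * δ ^ 2 * ((δ + ‖x + p‖) ^ 4)⁻¹)
  hG : ∀ θ : ℝ, |nderiv v (bpt θ) - (2 * (A - C) * exp (v (bpt θ) / 2) - 2)| ≤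
    Λ * (δ * ((δ + ‖bpt θ + p‖) ^ 1)⁻¹ + κ * δ * ((δ + ‖bpt θ + p‖) ^ 2)⁻¹)
  bal1 : ∫ x in BB, x.re * exp (v x) = 0
  bal2 : ∫ x in BB, x.im * exp (v x) = 0

def FF (A C : ℝ) (v : ℂ → ℝ) (x : ℂ) : ℝ := lap v x + 8 * A * C * exp (v x)
def GG (A C : ℝ) (v : ℂ → ℝ) (x : ℂ) : ℝ := nderiv v x - (2 * (A - C) * exp (v x / 2) - 2)
def ww (A C : ℝ) (v : ℂ → ℝ) (x : ℂ) : ℝ := v x + 2 * log (quad A 0 C x)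

lemma quad0 (A C : ℝ) (x : ℂ) : quad A 0 C x = A + C * ‖x‖ ^ 2 := by
  simp [quad, norm_sq_re_im]

lemma lap_add_const_mul {u w : ℂ → ℝ} (c : ℝ) {x : ℂ} (hu : ContDiffAt ℝ 2 u x) (hw : ContDiffAt ℝ 2 w x) :
    lap (fun y => u y + c * w y) x = lap u x + c * lap w x := by
  have ev : ∀ e : ℂ, (fun y => pd (fun y => u y + c * w y) e y) =ᶠ[nhds x] fun y => pd u e y + c * pd w e y := by
    intro e
    filter_upwards [hu.eventually (by simp), hw.eventually (by simp)] with y hy hy'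
    have d1 : DifferentiableAt ℝ u y := hy.differentiableAt (by norm_num)
    have d2 : DifferentiableAt ℝ w y := hy'.differentiableAt (by norm_num)
    simp only [pd]
    rw [fderiv_fun_add d1 (d2.const_mul c), fderiv_const_mul d2]; simp
  have dd : ∀ {f : ℂ → ℝ}, ContDiffAt ℝ 2 f x → ∀ e, DifferentiableAt ℝ (fun y => pd f e y) x := fun hf e =>
    ((hf.fderiv_right (m := 1) (by norm_num)).clm_apply contDiffAt_const).differentiableAt (by norm_num)
  simp only [lap]
  rw [(ev 1).fderiv_eq, (ev iI).fderiv_eq, fderiv_fun_add (dd hu _) ((dd hw _).const_mul c),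
    fderiv_fun_add (dd hu _) ((dd hw _).const_mul c), fderiv_const_mul (dd hw _), fderiv_const_mul (dd hw _)]
  simp; ring

lemma nderiv_add_const_mul {u w : ℂ → ℝ} (c : ℝ) {x : ℂ} (hu : ContDiffAt ℝ 1 u x) (hw : ContDiffAt ℝ 1 w x) :
    nderiv (fun y => u y + c * w y) x = nderiv u x + c * nderiv w x := by
  have d1 : DifferentiableAt ℝ u x := hu.differentiableAt (by norm_num)
  have d2 : DifferentiableAt ℝ w x := hw.differentiableAt (by norm_num)
  simp only [nderiv, pd]
  rw [fderiv_fun_add d1 (d2.const_mul c), fderiv_const_mul d2]; simp; ring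

lemma exp_diff {a b m : ℝ} (ha : a ≤ m) (hb : b ≤ m) : |exp a - exp b| ≤ exp m * |a - b| := by
  have key : ∀ a b : ℝ, b ≤ m → a ≤ b → |exp a - exp b| ≤ exp m * |a - b| := by
    intro a b hb hab
    have h1 : a - b + 1 ≤ exp (a - b) := add_one_le_exp _
    rw [abs_of_nonpos (sub_nonpos.2 (exp_le_exp.2 hab)), abs_of_nonpos (sub_nonpos.2 hab)]
    have h2 : exp a = exp b * exp (a - b) := by rw [← exp_add]; congr 1; ring
    have h3 : exp b ≤ exp m := exp_le_exp.2 hb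
    have := exp_pos b
    nlinarith
  rcases le_total a b with h | h
  · exact key a b hb h
  · rw [abs_sub_comm, abs_sub_comm a]; exact key b a ha h

namespace Cfg
variable {Λ δ κ : ℝ} {p : ℂ} {A C : ℝ} {v : ℂ → ℝ} (c : Cfg Λ δ κ p A C v)
include c

lemma Λpos : 0 < Λ := by linarith [c.hΛ]
lemma Ll : (0:ℝ) < Λ⁻¹ := inv_pos.2 c.Λpos
lemma AC0 : 0 < A + C := c.Ll.trans_le c.hAC
lemma A0 : 0 < A := by linarith [c.AC0, c.hC]
lemma E_lb {x : ℂ} (hx : ‖x‖ ≤ 1) : Λ⁻¹ ≤ quad A 0 C x := by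
  rw [quad0]
  have : ‖x‖ ^ 2 ≤ 1 := by nlinarith [norm_nonneg x]
  nlinarith [c.hAC, c.hC]
lemma E_pos {x : ℂ} (hx : ‖x‖ ≤ 1) : 0 < quad A 0 C x := c.Ll.trans_le (c.E_lb hx)
lemma E_ub {x : ℂ} : quad A 0 C x ≤ Λ := by
  rw [quad0]
  nlinarith [c.hA, c.hC, sq_nonneg ‖x‖]
lemma logE {x : ℂ} (hx : ‖x‖ ≤ 1) : |log (quad A 0 C x)| ≤ Λ := by
  have h1 := log_le_log (c.E_pos hx) c.E_ub
  have h2 := log_le_log c.Ll (c.E_lb hx)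
  rw [log_inv] at h2
  have := log_le_sub_one_of_pos c.Λpos
  rw [abs_le]; constructor <;> linarith
lemma w_bd {x : ℂ} (hx : ‖x‖ ≤ 1) : |ww A C v x| ≤ 3 * Λ := by
  have h1 := abs_le.1 (c.logE hx)
  have h2 := abs_le.1 (c.hb x (by simpa using hx))
  rw [ww, abs_le]; constructor <;> linarith
lemma logC2 : C2 (fun x => log (quad A 0 C x)) := fun x hx =>
  log_quad_contDiffAt (c.E_pos (by simpa using hx))
lemma wC2 : C2 (ww A C v) := fun x hx => (c.hv x hx).add (contDiffAt_const.mul (c.logC2 x hx))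
lemma expV {x : ℂ} (hx : ‖x‖ ≤ 1) : exp (-(2 * log (quad A 0 C x))) = (quad A 0 C x ^ 2)⁻¹ := by
  rw [exp_neg, mul_comm, exp_mul, exp_log (c.E_pos hx)]; norm_cast
lemma expV2 {x : ℂ} (hx : ‖x‖ ≤ 1) : exp (-(2 * log (quad A 0 C x)) / 2) = (quad A 0 C x)⁻¹ := by
  rw [show -(2 * log (quad A 0 C x)) / 2 = -log (quad A 0 C x) by ring, exp_neg, exp_log (c.E_pos hx)]
lemma lap_w {x : ℂ} (hx : ‖x‖ ≤ 1) : lap (ww A C v) x = FF A C v x -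
    8 * A * C * (exp (v x) - exp (-(2 * log (quad A 0 C x)))) := by
  have hx' : x ∈ CB := by simpa using hx
  unfold ww
  rw [lap_add_const_mul 2 (c.hv x hx') (c.logC2 x hx'), lap_log_quad (c.E_pos hx), c.expV hx, FF]
  simp; ring
lemma nderiv_w {x : ℂ} (hx : ‖x‖ = 1) : nderiv (ww A C v) x = GG A C v x +
    2 * (A - C) * (exp (v x / 2) - exp (-(2 * log (quad A 0 C x)) / 2)) := by
  have hx' : x ∈ CB := by simp [hx]
  unfold ww
  rw [nderiv_add_const_mul 2 (c.hv.C1 x hx') (c.logC2.C1 x hx'), nderiv_log_quad (c.E_pos hx.le), c.expV2 hx.le, GG]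
  have h1 : x.re * x.re + x.im * x.im = 1 := by rw [← norm_sq_re_im, hx]; norm_num
  rw [h1, quad0, hx]
  have := c.AC0
  simp; field_simp; ring
lemma lap_w_bd {x : ℂ} (hx : ‖x‖ ≤ 1) : |lap (ww A C v) x| ≤ |FF A C v x| +
    8 * Λ ^ 2 * exp (2 * Λ) * |ww A C v x| := by
  rw [c.lap_w hx]
  refine (abs_sub _ _).trans (add_le_add le_rfl ?_)
  have h1 := abs_le.1 (c.logE hx)
  have h2 := abs_le.1 (c.hb x (by simpa using hx))
  have h3 := exp_diff (a := v x) (b := -(2 * log (quad A 0 C x))) (m := 2 * Λ) (by linarith [c.Λpos]) (by linarith)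
  rw [show v x - -(2 * log (quad A 0 C x)) = ww A C v x by rw [ww]; ring] at h3
  have h4 : |8 * A * C| ≤ 8 * Λ ^ 2 := by
    rw [abs_mul, abs_mul, abs_of_pos c.A0, abs_of_nonpos c.hC]; norm_num
    nlinarith [c.A0, c.hA, c.hC, c.hCl]
  rw [abs_mul, mul_assoc _ (exp _)]
  gcongr
lemma h_bd : 0 ≤ A - C ∧ A - C ≤ 2 * Λ := ⟨by linarith [c.A0, c.hC], by linarith [c.hA, c.hCl]⟩
lemma nderiv_w_bd {x : ℂ} (hx : ‖x‖ = 1) : |nderiv (ww A C v) x| ≤ |GG A C v x| +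
    4 * Λ * exp (2 * Λ) * |ww A C v x| := by
  rw [c.nderiv_w hx]
  refine (abs_add_le _ _).trans (add_le_add le_rfl ?_)
  have h1 := abs_le.1 (c.logE hx.le)
  have h2 := abs_le.1 (c.hb x (by simp [hx]))
  have h3 := exp_diff (a := v x / 2) (b := -(2 * log (quad A 0 C x)) / 2) (m := 2 * Λ) (by linarith [c.Λpos]) (by linarith [c.Λpos])
  rw [show v x / 2 - -(2 * log (quad A 0 C x)) / 2 = ww A C v x / 2 by rw [ww]; ring, abs_div] at h3
  have h4 : |ww A C v x| / |2| ≤ |ww A C v x| := by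
    rw [abs_two]; linarith [abs_nonneg (ww A C v x)]
  have h5 := h3.trans (mul_le_mul_of_nonneg_left h4 (exp_pos _).le)
  rw [abs_mul, mul_assoc _ (exp _)]
  have : |2 * (A - C)| ≤ 4 * Λ := by
    rw [abs_of_nonneg (by linarith [c.h_bd.1])]; linarith [c.h_bd.2]
  exact mul_le_mul this h5 (abs_nonneg _) (by linarith [c.Λpos])

lemma FF_cont : ContinuousOn (FF A C v) CB :=
  c.hv.lap_cont.add (continuousOn_const.mul (continuous_exp.comp_continuousOn c.hv.C1.cont))
lemma GG_cont : ContinuousOn (GG A C v) CB :=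
  c.hv.C1.nderiv_cont.sub ((continuousOn_const.mul (continuous_exp.comp_continuousOn (c.hv.C1.cont.div_const 2))).sub continuousOn_const)

lemma tpos (x : ℂ) : 0 < δ + ‖x + p‖ := by have := c.hδ; positivity
lemma t_ub {x : ℂ} (hx : ‖x‖ ≤ 1) : δ + ‖x + p‖ ≤ 3 := by
  have := norm_add_le x p
  rw [c.hp] at this; linarith [c.hδ1]
end Cfg

def eta (α δ κ : ℝ) : ℝ := δ ^ (-α) * (δ + κ)

lemma eta_pos {α δ κ : ℝ} (hδ : 0 < δ) (hκ : 0 ≤ κ) : 0 < eta α δ κ := by unfold eta; positivity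

lemma dk_le_eta {α δ κ : ℝ} (hα : 0 < α) (hδ : 0 < δ) (hδ1 : δ ≤ 1) (hκ : 0 ≤ κ) : δ + κ ≤ eta α δ κ := by
  unfold eta
  have : 1 ≤ δ ^ (-α) := one_le_rpow_of_pos_of_le_one_of_nonpos hδ hδ1 (by linarith)
  nlinarith

theorem cfg_src (Λ : ℝ) {α : ℝ} (hα : 0 < α) (hα1 : α < 1) : ∃ K > 0, ∀ {δ κ : ℝ} {p : ℂ} {A C : ℝ} {v : ℂ → ℝ},
    Cfg Λ δ κ p A C v → ∀ x : ℂ, ‖x‖ < 1 →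
    (∫ y in BB, |FF A C v y| * ‖y - x‖ ^ (-α) ≤ K * eta α δ κ) ∧
    ∫ θ in 0..2 * π, |GG A C v (bpt θ)| * ‖bpt θ - x‖ ^ (-α) ≤ K * eta α δ κ := by
  obtain ⟨K1, hK1, h1⟩ := ker_disk (m := 2) hα.le (by linarith) (by norm_num; linarith)
  obtain ⟨K2, hK2, h2⟩ := ker_disk (m := 4) hα.le (by linarith) (by norm_num; linarith)
  obtain ⟨K3, hK3, h3⟩ := ker_circ (m := 1) hα.le (by linarith) (by norm_num; linarith)
  obtain ⟨K4, hK4, h4⟩ := ker_circ (m := 2) hα.le (by linarith) (by norm_num; linarith)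
  refine ⟨|Λ| * (3 * K1 + K2 + K3 + K4) + 1, by positivity, ?_⟩
  intro δ κ p A C v c x hx
  have hΛ := c.Λpos
  have hδ := c.hδ
  have hκ := c.hκ
  rw [abs_of_pos hΛ]
  have np : ‖-p‖ = 1 := by rw [norm_neg, c.hp]
  have P := eta_pos (α := α) hδ hκ
  obtain ⟨i1, b1⟩ := h1 δ hδ (-p) x
  obtain ⟨i2, b2⟩ := h2 δ hδ (-p) x
  have b3 := h3 δ hδ (-p) x np hx
  have b4 := h4 δ hδ (-p) x np hx
  simp only [sub_neg_eq_add] at i1 i2 b1 b2 b3 b4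
  have s1 : δ * δ ^ ((2:ℝ) - (2:ℕ) - α) = δ ^ (-α) * δ := by
    norm_num; ring
  have s2 : κ * δ ^ 2 * δ ^ ((2:ℝ) - (4:ℕ) - α) = δ ^ (-α) * κ := by
    rw [show (2:ℝ) - (4:ℕ) - α = -α + (-2:ℤ) by norm_num; ring, rpow_add_intCast hδ.ne']
    field_simp
  have s3 : δ * δ ^ ((1:ℝ) - (1:ℕ) - α) = δ ^ (-α) * δ := by
    norm_num; ring
  have s4 : κ * δ * δ ^ ((1:ℝ) - (2:ℕ) - α) = δ ^ (-α) * κ := by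
    rw [show (1:ℝ) - (2:ℕ) - α = -α + (-1:ℤ) by norm_num; ring, rpow_add_intCast hδ.ne']
    field_simp
  have e1 : 0 ≤ δ ^ (-α) * δ := by positivity
  have e2 : 0 ≤ δ ^ (-α) * κ := by positivity
  have e3 : eta α δ κ = δ ^ (-α) * δ + δ ^ (-α) * κ := by unfold eta; ring
  constructor
  · have : ∫ y in BB, |FF A C v y| * ‖y - x‖ ^ (-α) ≤
        ∫ y in BB, (Λ * (3 * δ) * (((δ + ‖y + p‖) ^ 2)⁻¹ * ‖y - x‖ ^ (-α)) +
          Λ * (κ * δ ^ 2) * (((δ + ‖y + p‖) ^ 4)⁻¹ * ‖y - x‖ ^ (-α))) := by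
      refine setIntegral_mono_on (int_rpow c.FF_cont hα hα1 x) ((i1.const_mul _).add (i2.const_mul _)) measurableSet_ball fun y hy => ?_
      have hF := c.hF y hy
      have t0 := c.tpos y
      have t1 := c.t_ub (x := y) (by simpa using (Metric.ball_subset_closedBall hy))
      have : ((δ + ‖y + p‖) ^ 1)⁻¹ ≤ 3 * ((δ + ‖y + p‖) ^ 2)⁻¹ := by
        rw [pow_one, ← div_eq_mul_inv, inv_eq_one_div, div_le_div_iff₀ t0 (by positivity)]; nlinarith
      have h5 : |FF A C v y| ≤ Λ * (3 * δ) * ((δ + ‖y + p‖) ^ 2)⁻¹ + Λ * (κ * δ ^ 2) * ((δ + ‖y + p‖) ^ 4)⁻¹ := by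
        refine hF.trans ?_
        have := mul_le_mul_of_nonneg_left this (by positivity : 0 ≤ Λ * δ)
        linarith
      refine (mul_le_mul_of_nonneg_right h5 (by positivity)).trans_eq (by ring)
    rw [integral_add (i1.const_mul _) (i2.const_mul _), integral_const_mul, integral_const_mul] at this
    have u1 := mul_le_mul_of_nonneg_left b1 (by positivity : 0 ≤ Λ * (3 * δ))
    have u2 := mul_le_mul_of_nonneg_left b2 (by positivity : 0 ≤ Λ * (κ * δ ^ 2))
    rw [show Λ * (3 * δ) * (K1 * δ ^ ((2:ℝ) - (2:ℕ) - α)) = Λ * 3 * K1 * (δ * δ ^ ((2:ℝ) - (2:ℕ) - α)) by ring, s1] at u1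
    rw [show Λ * (κ * δ ^ 2) * (K2 * δ ^ ((2:ℝ) - (4:ℕ) - α)) = Λ * K2 * (κ * δ ^ 2 * δ ^ ((2:ℝ) - (4:ℕ) - α)) by ring, s2] at u2
    rw [e3]
    have q1 : 0 ≤ Λ * K1 * (δ ^ (-α) * κ) := by positivity
    have q2 : 0 ≤ Λ * K2 * (δ ^ (-α) * δ) := by positivity
    have q3 : 0 ≤ Λ * (K3 + K4) * (δ ^ (-α) * δ + δ ^ (-α) * κ) := by positivity
    linarith
  · have hcb := continuous_bpt
    have rc : Continuous fun θ => ‖bpt θ - x‖ ^ (-α) :=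
      Continuous.rpow_const (by fun_prop) fun θ => Or.inl (bpt_sub_pos hx θ).ne'
    have cc : ∀ m : ℕ, Continuous fun θ => ((δ + ‖bpt θ + p‖) ^ m)⁻¹ * ‖bpt θ - x‖ ^ (-α) := fun m =>
      (Continuous.inv₀ (by fun_prop) fun θ => (pow_pos (c.tpos _) m).ne').mul rc
    have i1 : IntervalIntegrable (fun θ => Λ * δ * (((δ + ‖bpt θ + p‖) ^ 1)⁻¹ * ‖bpt θ - x‖ ^ (-α))) volume 0 (2 * π) :=
      (continuous_const.mul (cc 1)).intervalIntegrable _ _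
    have i2 : IntervalIntegrable (fun θ => Λ * (κ * δ) * (((δ + ‖bpt θ + p‖) ^ 2)⁻¹ * ‖bpt θ - x‖ ^ (-α))) volume 0 (2 * π) :=
      (continuous_const.mul (cc 2)).intervalIntegrable _ _
    have : ∫ θ in 0..2 * π, |GG A C v (bpt θ)| * ‖bpt θ - x‖ ^ (-α) ≤
        ∫ θ in 0..2 * π, (Λ * δ * (((δ + ‖bpt θ + p‖) ^ 1)⁻¹ * ‖bpt θ - x‖ ^ (-α)) +
          Λ * (κ * δ) * (((δ + ‖bpt θ + p‖) ^ 2)⁻¹ * ‖bpt θ - x‖ ^ (-α))) := by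
      refine intervalIntegral.integral_mono_on (by positivity)
        (((cont_bpt c.GG_cont.abs).mul rc).intervalIntegrable _ _) (i1.add i2) fun θ _ => ?_
      have hG := c.hG θ
      have h5 : |GG A C v (bpt θ)| ≤ Λ * δ * ((δ + ‖bpt θ + p‖) ^ 1)⁻¹ + Λ * (κ * δ) * ((δ + ‖bpt θ + p‖) ^ 2)⁻¹ := by
        refine hG.trans (le_of_eq ?_); ring
      rw [← mul_assoc, ← mul_assoc, ← add_mul]
      gcongr
    rw [intervalIntegral.integral_add i1 i2, intervalIntegral.integral_const_mul, intervalIntegral.integral_const_mul] at this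
    have u1 := mul_le_mul_of_nonneg_left b3 (by positivity : 0 ≤ Λ * δ)
    have u2 := mul_le_mul_of_nonneg_left b4 (by positivity : 0 ≤ Λ * (κ * δ))
    rw [show Λ * δ * (K3 * δ ^ ((1:ℝ) - (1:ℕ) - α)) = Λ * K3 * (δ * δ ^ ((1:ℝ) - (1:ℕ) - α)) by ring, s3] at u1
    rw [show Λ * (κ * δ) * (K4 * δ ^ ((1:ℝ) - (2:ℕ) - α)) = Λ * K4 * (κ * δ * δ ^ ((1:ℝ) - (2:ℕ) - α)) by ring, s4] at u2
    rw [e3]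
    have q1 : 0 ≤ Λ * K3 * (δ ^ (-α) * κ) := by positivity
    have q2 : 0 ≤ Λ * K4 * (δ ^ (-α) * δ) := by positivity
    have q3 : 0 ≤ Λ * (3 * K1 + K2) * (δ ^ (-α) * δ + δ ^ (-α) * κ) := by positivity
    linarith

theorem cfg_src1 (Λ : ℝ) {α : ℝ} (hα : 0 < α) (hα1 : α < 1) : ∃ K > 0, ∀ {δ κ : ℝ} {p : ℂ} {A C : ℝ} {v : ℂ → ℝ},
    Cfg Λ δ κ p A C v →
    (∫ y in BB, |FF A C v y| ≤ K * eta α δ κ) ∧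
    ∫ θ in 0..2 * π, |GG A C v (bpt θ)| ≤ K * eta α δ κ := by
  obtain ⟨K, hK, h⟩ := cfg_src Λ hα hα1
  refine ⟨K, hK, ?_⟩
  intro δ κ p A C v c
  obtain ⟨h1, h2⟩ := h c 0 (by simp)
  refine ⟨le_trans (setIntegral_mono_on_ae (intD c.FF_cont.abs) (int_rpow c.FF_cont hα hα1 0) measurableSet_ball ?_) h1, h2.trans' (le_of_eq ?_)⟩
  · filter_upwards [compl_mem_ae_iff.2 (by simp : volume {(0:ℂ)} = 0)] with y hy0 hy
    have h5 : 0 < ‖y‖ := norm_pos_iff.2 hy0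
    have h6 : 1 ≤ ‖y - 0‖ ^ (-α) := by
      rw [sub_zero]
      exact one_le_rpow_of_pos_of_le_one_of_nonpos h5 (by simpa using (Metric.ball_subset_closedBall hy)) (by linarith)
    exact le_mul_of_one_le_right (abs_nonneg _) h6
  · simp

theorem cfg_holder (Λ : ℝ) {α : ℝ} (hα : 0 < α) (hα1 : α < 1) : ∃ K > 0, ∀ {δ κ : ℝ} {p : ℂ} {A C : ℝ} {v : ℂ → ℝ},
    Cfg Λ δ κ p A C v → ∀ M, (∀ x : ℂ, ‖x‖ ≤ 1 → |ww A C v x| ≤ M) → ∀ x x' : ℂ, ‖x‖ ≤ 1 → ‖x'‖ ≤ 1 →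
    |ww A C v x - ww A C v x'| ≤ K * (M + eta α δ κ) * ‖x - x'‖ ^ α := by
  obtain ⟨K, hK, h⟩ := cfg_src Λ hα hα1
  obtain ⟨K1, hK1, h1⟩ := rpow_disk hα.le (by linarith : α < 2)
  obtain ⟨K2, hK2, h2⟩ := rpow_circ hα hα1
  set Q := 8 * |Λ| ^ 2 * exp (2 * |Λ|) * K1 + 4 * |Λ| * exp (2 * |Λ|) * K2 + K with hQ
  have hQ0 : 0 < Q := by positivity
  refine ⟨4 * α⁻¹ * Q, by positivity, ?_⟩
  intro δ κ p A C v c M hM x x' hx hx'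
  have hM0 : 0 ≤ M := (abs_nonneg _).trans (hM 0 (by simp))
  have P := eta_pos (α := α) c.hδ c.hκ
  have hΛ := c.Λpos
  rw [abs_of_pos hΛ] at hQ
  refine extend_closed c.wC2.C1.cont hα (fun x x' hx hx' => ?_) hx hx'
  have n1 : 0 ≤ 8 * Λ ^ 2 * exp (2 * Λ) * K1 := by positivity
  have n2 : 0 ≤ 4 * Λ * exp (2 * Λ) * K2 := by positivity
  have := holder_int hα hα1 c.wC2 (B := Q * (M + eta α δ κ)) ?_ ?_ hx hx'
  · refine this.trans_eq (by ring)
  · intro z hz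
    have i1 := int_rpow c.FF_cont hα hα1 z
    have i2 := (h1 z).1.const_mul (8 * Λ ^ 2 * exp (2 * Λ) * M)
    have := setIntegral_mono_on (int_rpow c.wC2.lap_cont hα hα1 z) (i1.add i2) measurableSet_ball fun y hy => by
      have hy' : ‖y‖ ≤ 1 := by simpa using (Metric.ball_subset_closedBall hy)
      have h3 := c.lap_w_bd hy'
      have h4 : |lap (ww A C v) y| ≤ |FF A C v y| + 8 * Λ ^ 2 * exp (2 * Λ) * M := h3.trans (by gcongr; exact hM y hy')
      rw [Pi.add_apply, ← add_mul]
      exact mul_le_mul_of_nonneg_right h4 (by positivity)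
    simp only [Pi.add_apply] at this
    rw [integral_add i1 i2, integral_const_mul] at this
    have h6 := (h c z hz).1
    have h7 := mul_le_mul_of_nonneg_left (h1 z).2 (by positivity : 0 ≤ 8 * Λ ^ 2 * exp (2 * Λ) * M)
    have h8 : 0 ≤ (8 * Λ ^ 2 * exp (2 * Λ) * K1) * eta α δ κ := by positivity
    have h9 : 0 ≤ (4 * Λ * exp (2 * Λ) * K2) * (M + eta α δ κ) := by positivity
    have h10 : 0 ≤ K * M := by positivity
    rw [hQ]; linarith
  · intro z hz
    have hcb := continuous_bpt
    have rc : Continuous fun θ => ‖bpt θ - z‖ ^ (-α) :=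
      Continuous.rpow_const (by fun_prop) fun θ => Or.inl (bpt_sub_pos hz θ).ne'
    have i1 : IntervalIntegrable (fun θ => |GG A C v (bpt θ)| * ‖bpt θ - z‖ ^ (-α)) volume 0 (2 * π) :=
      ((cont_bpt c.GG_cont.abs).mul rc).intervalIntegrable _ _
    have i2 : IntervalIntegrable (fun θ => (4 * Λ * exp (2 * Λ) * M) * ‖bpt θ - z‖ ^ (-α)) volume 0 (2 * π) :=
      (continuous_const.mul rc).intervalIntegrable _ _
    have : ∫ θ in 0..2 * π, |nderiv (ww A C v) (bpt θ)| * ‖bpt θ - z‖ ^ (-α) ≤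
       ∫ θ in 0..2 * π, (|GG A C v (bpt θ)| * ‖bpt θ - z‖ ^ (-α) + (4 * Λ * exp (2 * Λ) * M) * ‖bpt θ - z‖ ^ (-α)) :=
      intervalIntegral.integral_mono_on (a := 0) (b := 2 * π) (by positivity)
      (((cont_bpt c.wC2.C1.nderiv_cont.abs).mul rc).intervalIntegrable _ _) (i1.add i2) fun θ _ => by
      have h3 := c.nderiv_w_bd (norm_bpt θ)
      have h4 : |nderiv (ww A C v) (bpt θ)| ≤ |GG A C v (bpt θ)| + 4 * Λ * exp (2 * Λ) * M :=
        h3.trans (by gcongr; exact hM _ (norm_bpt θ).le)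
      rw [← add_mul]
      exact mul_le_mul_of_nonneg_right h4 (by positivity)
    rw [intervalIntegral.integral_add i1 i2, intervalIntegral.integral_const_mul] at this
    have h6 := (h c z hz).2
    have h7 := mul_le_mul_of_nonneg_left (h2 z hz) (by positivity : 0 ≤ 4 * Λ * exp (2 * Λ) * M)
    have h8 : 0 ≤ (4 * Λ * exp (2 * Λ) * K2) * eta α δ κ := by positivity
    have h9 : 0 ≤ (8 * Λ ^ 2 * exp (2 * Λ) * K1) * (M + eta α δ κ) := by positivity
    have h10 : 0 ≤ K * M := by positivity
    rw [hQ]; linarith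

lemma pd_symm {v : ℂ → ℝ} {x : ℂ} (h : ContDiffAt ℝ 2 v x) (d e : ℂ) :
    fderiv ℝ (fun y => pd v d y) x e = fderiv ℝ (fun y => pd v e y) x d := by
  have hs := h.isSymmSndFDerivAt (by simp)
  have hd : DifferentiableAt ℝ (fderiv ℝ v) x := (h.fderiv_right (m := 1) (by norm_num)).differentiableAt (by norm_num)
  have : ∀ a b : ℂ, fderiv ℝ (fun y => pd v a y) x b = fderiv ℝ (fderiv ℝ v) x b a := fun a b => by
    simp only [pd]
    rw [fderiv_clm_apply hd (differentiableAt_const _)]; simp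
  rw [this, this]; exact hs e d

theorem pohozaev {v : ℂ → ℝ} (hv : C2 v) :
    ∫ θ in 0..2 * π, tderiv v (bpt θ) ^ 2 = (∫ θ in 0..2 * π, nderiv v (bpt θ) ^ 2) -
      2 * ∫ x in BB, nderiv v x * lap v x := by
  have hre : C1 (fun y : ℂ => y.re) := fun x _ => contDiff_re.contDiffAt
  have him : C1 (fun y : ℂ => y.im) := fun x _ => contDiff_im.contDiffAt
  have ha := hv.pd 1
  have hb := hv.pd iI
  have hD := div_thm (fun y => 2 * (y.re * pd v 1 y + y.im * pd v iI y) * pd v 1 y - (pd v 1 y * pd v 1 y + pd v iI y * pd v iI y) * y.re)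
    (fun y => 2 * (y.re * pd v 1 y + y.im * pd v iI y) * pd v iI y - (pd v 1 y * pd v 1 y + pd v iI y * pd v iI y) * y.im)
    (fun x hx => ((contDiffAt_const.mul (((hre x hx).mul (ha x hx)).add ((him x hx).mul (hb x hx)))).mul (ha x hx)).sub
      ((((ha x hx).mul (ha x hx)).add ((hb x hx).mul (hb x hx))).mul (hre x hx)))
    (fun x hx => ((contDiffAt_const.mul (((hre x hx).mul (ha x hx)).add ((him x hx).mul (hb x hx)))).mul (hb x hx)).sub
      ((((ha x hx).mul (ha x hx)).add ((hb x hx).mul (hb x hx))).mul (him x hx)))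
  have e1 : ∀ x ∈ BB,
      fderiv ℝ (fun y => 2 * (y.re * pd v 1 y + y.im * pd v iI y) * pd v 1 y - (pd v 1 y * pd v 1 y + pd v iI y * pd v iI y) * y.re) x 1 +
      fderiv ℝ (fun y => 2 * (y.re * pd v 1 y + y.im * pd v iI y) * pd v iI y - (pd v 1 y * pd v 1 y + pd v iI y * pd v iI y) * y.im) x iI
      = 2 * (nderiv v x * lap v x) := by
    intro x hx
    have hx := Metric.ball_subset_closedBall hx
    have a' := (ha.diff hx).hasFDerivAt
    have b' := (hb.diff hx).hasFDerivAt
    have r' := Complex.reCLM.hasFDerivAt (x := x)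
    have i' := Complex.imCLM.hasFDerivAt (x := x)
    have h1 := ((((r'.fun_mul a').fun_add (i'.fun_mul b')).const_mul 2).fun_mul a').fun_sub (((a'.fun_mul a').fun_add (b'.fun_mul b')).fun_mul r')
    have h2 := ((((r'.fun_mul a').fun_add (i'.fun_mul b')).const_mul 2).fun_mul b').fun_sub (((a'.fun_mul a').fun_add (b'.fun_mul b')).fun_mul i')
    simp only [Complex.reCLM_apply, Complex.imCLM_apply] at h1 h2
    rw [h1.fderiv, h2.fderiv]
    have s := pd_symm (hv x hx) 1 iI
    change fderiv ℝ (pd v 1) x iI = fderiv ℝ (pd v iI) x 1 at s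
    simp [nderiv, lap, s]
    rw [show fderiv ℝ (fun y => pd v 1 y) x = fderiv ℝ (pd v 1) x from rfl, show fderiv ℝ (fun y => pd v iI y) x = fderiv ℝ (pd v iI) x from rfl]
    ring
  rw [setIntegral_congr_fun measurableSet_ball e1, integral_const_mul] at hD
  have j1 : IntervalIntegrable (fun θ => nderiv v (bpt θ) ^ 2) volume 0 (2 * π) :=
    (cont_bpt (hv.C1.nderiv_cont.pow 2)).intervalIntegrable _ _
  have j2 : IntervalIntegrable (fun θ => tderiv v (bpt θ) ^ 2) volume 0 (2 * π) :=
    (cont_bpt (hv.C1.tderiv_cont.pow 2)).intervalIntegrable _ _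
  rw [hD, eq_sub_iff_add_eq, ← intervalIntegral.integral_add j2]
  · congr 1; ext θ
    simp only [tderiv, nderiv, bpt_re, bpt_im, smul_eq_mul]
    have := sin_sq_add_cos_sq θ
    linear_combination (pd v 1 (bpt θ) ^ 2 + pd v iI (bpt θ) ^ 2) * (0:ℝ) * this
  · have hcont : Continuous fun θ => cos θ • ((2 * ((bpt θ).re * pd v 1 (bpt θ) + (bpt θ).im * pd v iI (bpt θ)) * pd v 1 (bpt θ) - (pd v 1 (bpt θ) * pd v 1 (bpt θ) + pd v iI (bpt θ) * pd v iI (bpt θ)) * (bpt θ).re)) +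
        sin θ • ((2 * ((bpt θ).re * pd v 1 (bpt θ) + (bpt θ).im * pd v iI (bpt θ)) * pd v iI (bpt θ) - (pd v 1 (bpt θ) * pd v 1 (bpt θ) + pd v iI (bpt θ) * pd v iI (bpt θ)) * (bpt θ).im)) := by
      have c1 := cont_bpt (hv.C1.pd_cont 1)
      have c2 := cont_bpt (hv.C1.pd_cont iI)
      simp only [bpt_re, bpt_im, smul_eq_mul]
      fun_prop
    exact hcont.intervalIntegrable _ _

namespace Cfg
variable {Λ δ κ : ℝ} {p : ℂ} {A C : ℝ} {v : ℂ → ℝ} (c : Cfg Λ δ κ p A C v)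
include c
lemma t1 (x : ℂ) : δ * ((δ + ‖x + p‖) ^ 1)⁻¹ ≤ 1 := by
  rw [pow_one, ← div_eq_mul_inv, div_le_one (c.tpos x)]; linarith [norm_nonneg (x + p)]
lemma F1 {x : ℂ} (hx : x ∈ BB) : |FF A C v x| ≤ Λ + Λ * κ * δ ^ 2 * ((δ + ‖x + p‖) ^ 4)⁻¹ := by
  have := c.hF x hx
  rw [FF]
  nlinarith [c.t1 x, c.Λpos]
lemma G1 (θ : ℝ) : |GG A C v (bpt θ)| ≤ Λ + Λ * κ * δ * ((δ + ‖bpt θ + p‖) ^ 2)⁻¹ := by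
  have := c.hG θ
  rw [GG]
  nlinarith [c.t1 (bpt θ), c.Λpos]
lemma lap1 {x : ℂ} (hx : ‖x‖ ≤ 1) : |lap v x| ≤ |FF A C v x| + 8 * Λ ^ 2 * exp Λ := by
  have h1 : lap v x = FF A C v x - 8 * A * C * exp (v x) := by rw [FF]; ring
  rw [h1]
  refine (abs_sub _ _).trans (add_le_add le_rfl ?_)
  have h4 : |8 * A * C| ≤ 8 * Λ ^ 2 := by
    rw [abs_mul, abs_mul, abs_of_pos c.A0, abs_of_nonpos c.hC]; norm_num
    nlinarith [c.A0, c.hA, c.hC, c.hCl]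
  rw [abs_mul, abs_of_pos (exp_pos _)]
  have := exp_le_exp.2 (abs_le.1 (c.hb x (by simpa using hx))).2
  gcongr
lemma nd1 {x : ℂ} (hx : ‖x‖ ≤ 1) : |nderiv v x| ≤ |GG A C v x| + (4 * Λ * exp Λ + 2) := by
  have h1 : nderiv v x = GG A C v x + (2 * (A - C) * exp (v x / 2) - 2) := by rw [GG]; ring
  rw [h1]
  refine (abs_add_le _ _).trans (add_le_add le_rfl ?_)
  have h2 : exp (v x / 2) ≤ exp Λ :=
    exp_le_exp.2 (by linarith [(abs_le.1 (c.hb x (by simpa using hx))).2, c.Λpos])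
  have h3 := exp_pos (v x / 2)
  have h4 := c.h_bd
  have h5 : 2 * (A - C) * exp (v x / 2) ≤ 4 * Λ * exp Λ :=
    mul_le_mul (by linarith) h2 h3.le (by linarith [c.Λpos])
  have h6 : 0 ≤ 2 * (A - C) * exp (v x / 2) := by have := h4.1; positivity
  rw [abs_le]; constructor <;> linarith
end Cfg

lemma ker_disk0 {m : ℕ} (hm : 2 < m) : ∃ K > (0:ℝ), ∀ δ > (0:ℝ), ∀ q : ℂ,
      IntegrableOn (fun y => ((δ + ‖y + q‖) ^ m)⁻¹) (Metric.ball 0 1) ∧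
      ∫ y in BB, ((δ + ‖y + q‖) ^ m)⁻¹ ≤ K * (δ ^ (m - 2))⁻¹ := by
  obtain ⟨K, hK, h⟩ := ker_disk (m := m) (α := 0) le_rfl (by norm_num) (by simpa using hm)
  refine ⟨K, hK, fun δ hδ q => ?_⟩
  have := h δ hδ (-q) 0
  simp only [neg_zero, rpow_zero, mul_one, sub_neg_eq_add, sub_zero] at this
  refine ⟨this.1, this.2.trans_eq ?_⟩
  congr 1
  rw [show (2:ℝ) - m = -((m - 2 : ℕ) : ℝ) by push_cast [Nat.cast_sub hm.le]; ring, rpow_neg hδ.le, rpow_natCast]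

lemma ker_circ0 {m : ℕ} (hm : 1 < m) : ∃ K > (0:ℝ), ∀ δ > (0:ℝ), ∀ q : ℂ, ‖q‖ = 1 →
      ∫ θ in 0..2 * π, ((δ + ‖bpt θ + q‖) ^ m)⁻¹ ≤ K * (δ ^ (m - 1))⁻¹ := by
  obtain ⟨K, hK, h⟩ := ker_circ (m := m) (α := 0) le_rfl (by norm_num) (by simpa using hm)
  refine ⟨K, hK, fun δ hδ q hq => ?_⟩
  have := h δ hδ (-q) 0 (by simpa using hq) (by simp)
  simp only [neg_zero, rpow_zero, mul_one, sub_neg_eq_add, sub_zero] at this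
  refine this.trans_eq ?_
  congr 1
  rw [show (1:ℝ) - m = -((m - 1 : ℕ) : ℝ) by push_cast [Nat.cast_sub hm.le]; ring, rpow_neg hδ.le, rpow_natCast]

lemma vol_ball : (volume BB).toReal = π := by
  rw [Complex.volume_ball]; simp

lemma int_const (a : ℝ) : ∫ _ in BB, a = π * a := by
  rw [setIntegral_const, smul_eq_mul, Measure.real, vol_ball]

theorem cfg_L1 (Λ : ℝ) : ∃ K > 0, ∀ {δ κ : ℝ} {p : ℂ} {A C : ℝ} {v : ℂ → ℝ},
    Cfg Λ δ κ p A C v → (∫ x in BB, |lap v x| ≤ K) ∧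
    (∫ θ in 0..2 * π, |nderiv v (bpt θ)| ≤ K) := by
  obtain ⟨K1, hK1, h1⟩ := ker_disk0 (m := 4) (by norm_num)
  obtain ⟨K2, hK2, h2⟩ := ker_circ0 (m := 2) (by norm_num)
  refine ⟨π * (|Λ| + 8 * Λ ^ 2 * exp Λ) + |Λ| * |Λ| * K1 + (2 * π) * (|Λ| + (4 * |Λ| * exp Λ + 2)) + |Λ| * |Λ| * K2, by positivity, ?_⟩
  intro δ κ p A C v c
  have hΛ := c.Λpos
  have hδ := c.hδ
  have hκ := c.hκ
  have hκ1 := c.hκ1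
  rw [abs_of_pos hΛ]
  obtain ⟨i1, b1⟩ := h1 δ hδ p
  have b2 := h2 δ hδ p c.hp
  norm_num at b1 b2
  have e1 : Λ * κ * δ ^ 2 * (K1 * (δ ^ 2)⁻¹) ≤ Λ * Λ * K1 := by
    rw [show Λ * κ * δ ^ 2 * (K1 * (δ ^ 2)⁻¹) = Λ * κ * K1 by field_simp]; gcongr
  have e2 : Λ * κ * δ * (K2 * δ⁻¹) ≤ Λ * Λ * K2 := by
    rw [show Λ * κ * δ * (K2 * δ⁻¹) = Λ * κ * K2 by field_simp]; gcongr
  have p1 : 0 ≤ π * (Λ + 8 * Λ ^ 2 * exp Λ) + Λ * Λ * K1 := by positivity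
  have p2 : 0 ≤ (2 * π) * (Λ + (4 * Λ * exp Λ + 2)) + Λ * Λ * K2 := by positivity
  constructor
  · have ic : IntegrableOn (fun _ : ℂ => Λ + 8 * Λ ^ 2 * exp Λ) BB := intD continuousOn_const
    have := setIntegral_mono_on (intD c.hv.lap_cont.abs) (ic.add (i1.const_mul (Λ * κ * δ ^ 2))) measurableSet_ball fun y hy => by
      have h3 := c.lap1 (x := y) (by simpa using (Metric.ball_subset_closedBall hy))
      have h4 := c.F1 hy
      rw [Pi.add_apply]; linarith
    simp only [Pi.add_apply] at this
    rw [integral_add ic (i1.const_mul _), integral_const_mul, int_const] at this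
    have h5 := mul_le_mul_of_nonneg_left b1 (by positivity : 0 ≤ Λ * κ * δ ^ 2)
    linarith
  · have hcb := continuous_bpt
    have i1 : IntervalIntegrable (fun θ => Λ * κ * δ * ((δ + ‖bpt θ + p‖) ^ 2)⁻¹) volume 0 (2 * π) :=
      (Continuous.mul continuous_const (Continuous.inv₀ (by fun_prop) fun θ => (pow_pos (c.tpos _) 2).ne')).intervalIntegrable _ _
    have i0 : IntervalIntegrable (fun _ => Λ + (4 * Λ * exp Λ + 2)) volume 0 (2 * π) := continuous_const.intervalIntegrable _ _
    have : ∫ θ in 0..2 * π, |nderiv v (bpt θ)| ≤ ∫ θ in 0..2 * π, ((Λ + (4 * Λ * exp Λ + 2)) + Λ * κ * δ * ((δ + ‖bpt θ + p‖) ^ 2)⁻¹) :=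
      intervalIntegral.integral_mono_on (by positivity) ((cont_bpt c.hv.C1.nderiv_cont.abs).intervalIntegrable _ _) (i0.add i1) fun θ _ => by
        have h3 := c.nd1 (norm_bpt θ).le
        have h4 := c.G1 θ
        linarith
    rw [intervalIntegral.integral_add i0 i1, intervalIntegral.integral_const_mul, intervalIntegral.integral_const, smul_eq_mul, sub_zero] at this
    have h5 := mul_le_mul_of_nonneg_left b2 (by positivity : 0 ≤ Λ * κ * δ)
    linarith

lemma gradSq_cont {v : ℂ → ℝ} (hv : C1 v) : ContinuousOn (gradSq v) CB :=
  ((hv.pd_cont 1).pow 2).add ((hv.pd_cont iI).pow 2)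

theorem cfg_energy (Λ : ℝ) : ∃ K > 0, ∀ {δ κ : ℝ} {p : ℂ} {A C : ℝ} {v : ℂ → ℝ},
    Cfg Λ δ κ p A C v → (∫ x in BB, gradSq v x ≤ K) := by
  obtain ⟨K, hK, h⟩ := cfg_L1 Λ
  refine ⟨2 * (|Λ| + 1) * K, by positivity, ?_⟩
  intro δ κ p A C v c
  have hΛ := c.Λpos
  obtain ⟨h1, h2⟩ := h c
  have g := green1 c.hv.C1 c.hv
  have i1 : IntegrableOn (fun x => v x * lap v x) BB := intD (c.hv.C1.cont.mul c.hv.lap_cont)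
  have i2 : IntegrableOn (fun x => gradSq v x) BB := intD (gradSq_cont c.hv.C1)
  have e : ∀ x, v x * lap v x + (pd v 1 x * pd v 1 x + pd v iI x * pd v iI x) = v x * lap v x + gradSq v x := fun x => by
    rw [gradSq]; ring
  simp only [e] at g
  rw [integral_add i1 i2] at g
  have b1 : |∫ x in BB, v x * lap v x| ≤ Λ * K := by
    rw [← norm_eq_abs]
    refine (norm_integral_le_of_norm_le (g := fun x => Λ * |lap v x|) ((intD c.hv.lap_cont.abs).const_mul Λ) ?_).trans ?_
    · filter_upwards [ae_restrict_mem measurableSet_ball] with y hy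
      rw [norm_mul, norm_eq_abs, norm_eq_abs]
      gcongr
      exact c.hb y (Metric.ball_subset_closedBall hy)
    · rw [integral_const_mul]; gcongr
  have b2 : |∫ θ in 0..2 * π, v (bpt θ) * nderiv v (bpt θ)| ≤ Λ * K := by
    rw [← norm_eq_abs]
    refine (intervalIntegral.norm_integral_le_of_norm_le (g := fun θ => Λ * |nderiv v (bpt θ)|) (by positivity)
      (Eventually.of_forall fun θ _ => ?_) ((continuous_const.mul (cont_bpt c.hv.C1.nderiv_cont.abs)).intervalIntegrable _ _)).trans ?_
    · rw [norm_mul, norm_eq_abs, norm_eq_abs]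
      gcongr
      exact c.hb _ (bpt_mem θ)
    · rw [intervalIntegral.integral_const_mul]; gcongr
  rw [abs_of_pos hΛ]
  rw [abs_le] at b1 b2
  linarith [b1.1, b2.2]

lemma nderiv_sq_le (v : ℂ → ℝ) {x : ℂ} (hx : ‖x‖ ≤ 1) : nderiv v x ^ 2 ≤ gradSq v x := by
  have h1 : ‖x‖ ^ 2 ≤ 1 := by nlinarith [norm_nonneg x]
  rw [norm_sq_re_im] at h1
  rw [nderiv, gradSq]
  nlinarith [sq_nonneg (x.re * pd v iI x - x.im * pd v 1 x), sq_nonneg (pd v 1 x), sq_nonneg (pd v iI x)]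

set_option maxHeartbeats 1600000 in
theorem cfg_tau (Λ : ℝ) : ∃ K > 0, ∀ {δ κ : ℝ} {p : ℂ} {A C : ℝ} {v : ℂ → ℝ},
    Cfg Λ δ κ p A C v → δ * (∫ θ in 0..2 * π, |tderiv v (bpt θ)|) ≤ K * (δ + κ) := by
  obtain ⟨K, hK, hE⟩ := cfg_energy Λ
  obtain ⟨K1, hK1, h1⟩ := ker_disk0 (m := 8) (by norm_num)
  set c1 := 8 * Λ ^ 2 * exp Λ + |Λ| with hc1
  set c2 := 4 * |Λ| * exp Λ + 2 + |Λ| with hc2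
  have hc1' : 0 ≤ c1 := by positivity
  have hc2' : 0 ≤ c2 := by positivity
  refine ⟨2 * π * c2 ^ 2 + (K + 2 * (π * c1 ^ 2 + Λ ^ 2 * K1)) + 2 * π, by positivity, ?_⟩
  intro δ κ p A C v c
  have hΛ := c.Λpos
  have hδ := c.hδ
  have hκ := c.hκ
  rw [abs_of_pos hΛ] at hc1 hc2
  obtain ⟨i1, b1⟩ := h1 δ hδ p
  norm_num at b1
  set R := 1 + κ / δ with hR
  have hR1 : 1 ≤ R := by rw [hR]; have : 0 ≤ κ / δ := by positivity
                         linarith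
  have hkR : κ / δ ≤ R := by rw [hR]; linarith
  have hkR0 : 0 ≤ κ / δ := by positivity
  have nb : ∀ θ, nderiv v (bpt θ) ^ 2 ≤ c2 ^ 2 * R ^ 2 := by
    intro θ
    have h3 := c.nd1 (norm_bpt θ).le
    have h4 := c.G1 θ
    have h5 : δ * ((δ + ‖bpt θ + p‖) ^ 2)⁻¹ ≤ 1 / δ := by
      rw [← div_eq_mul_inv, div_le_div_iff₀ (pow_pos (c.tpos _) 2) hδ]
      nlinarith [norm_nonneg (bpt θ + p), c.tpos (bpt θ)]
    have h6 : Λ * κ * δ * ((δ + ‖bpt θ + p‖) ^ 2)⁻¹ ≤ Λ * (κ / δ) := by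
      have := mul_le_mul_of_nonneg_left h5 (by positivity : 0 ≤ Λ * κ)
      calc _ = Λ * κ * (δ * ((δ + ‖bpt θ + p‖) ^ 2)⁻¹) := by ring
        _ ≤ _ := this
        _ = _ := by ring
    have h7 : |nderiv v (bpt θ)| ≤ c2 * R := by
      have : 0 ≤ (4 * Λ * exp Λ + 2) * (κ / δ) := by positivity
      have e : c2 * R = (4 * Λ * exp Λ + 2) + (4 * Λ * exp Λ + 2) * (κ / δ) + Λ + Λ * (κ / δ) := by
        rw [hc2, hR]; ring
      linarith
    rw [← mul_pow, ← sq_abs]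
    gcongr
  have b2 : ∫ θ in 0..2 * π, nderiv v (bpt θ) ^ 2 ≤ 2 * π * c2 ^ 2 * R ^ 2 := by
    have : ∫ θ in 0..2 * π, nderiv v (bpt θ) ^ 2 ≤ ∫ _ in 0..2 * π, c2 ^ 2 * R ^ 2 :=
      intervalIntegral.integral_mono_on (a := 0) (b := 2 * π) (by positivity)
      ((cont_bpt (c.hv.C1.nderiv_cont.pow 2)).intervalIntegrable _ _) (continuous_const.intervalIntegrable _ _) (fun θ _ => nb θ)
    rw [intervalIntegral.integral_const, smul_eq_mul, sub_zero] at this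
    refine this.trans_eq (by ring)
  have b3 : -2 * ∫ x in BB, nderiv v x * lap v x ≤ K + 2 * (π * c1 ^ 2 + Λ ^ 2 * κ ^ 2 * δ ^ 4 * (K1 * (δ ^ 6)⁻¹)) := by
    have ic : IntegrableOn (fun _ : ℂ => 2 * c1 ^ 2) BB := intD continuousOn_const
    have i2 : IntegrableOn (fun x => gradSq v x) BB := intD (gradSq_cont c.hv.C1)
    have i3 := i1.const_mul (2 * (Λ ^ 2 * κ ^ 2 * δ ^ 4))
    have := setIntegral_mono_on ((intD (c.hv.C1.nderiv_cont.mul c.hv.lap_cont)).const_mul (-2)) ((i2.add ic).add i3) measurableSet_ball fun y hy => by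
      have hy' : ‖y‖ ≤ 1 := by simpa using (Metric.ball_subset_closedBall hy)
      have h3 := c.lap1 hy'
      have h4 := c.F1 hy
      have h5 := nderiv_sq_le v hy'
      have t0 := c.tpos y
      set X := Λ * κ * δ ^ 2 * ((δ + ‖y + p‖) ^ 4)⁻¹ with hX
      have hX0 : 0 ≤ X := by positivity
      have h6 : |lap v y| ≤ c1 + X := by linarith
      have h7 : (lap v y) ^ 2 ≤ 2 * c1 ^ 2 + 2 * X ^ 2 := by
        rw [← sq_abs]
        have := pow_le_pow_left₀ (abs_nonneg _) h6 2
        linarith [sq_nonneg (c1 - X), (by ring : (c1 - X) ^ 2 = c1 ^ 2 + X ^ 2 - 2 * (c1 * X)), (by ring : (c1 + X) ^ 2 = c1 ^ 2 + X ^ 2 + 2 * (c1 * X))]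
      have h8 : X ^ 2 = Λ ^ 2 * κ ^ 2 * δ ^ 4 * ((δ + ‖y + p‖) ^ 8)⁻¹ := by
        rw [hX]; field_simp
      simp only [Pi.add_apply, Pi.mul_apply]
      rw [mul_assoc 2, ← h8]
      linarith [sq_nonneg (nderiv v y + lap v y), (by ring : (nderiv v y + lap v y) ^ 2 = nderiv v y ^ 2 + lap v y ^ 2 + 2 * (nderiv v y * lap v y))]
    simp only [Pi.add_apply, Pi.mul_apply] at this
    have ea : ∫ x in BB, (gradSq v x + 2 * c1 ^ 2 + 2 * (Λ ^ 2 * κ ^ 2 * δ ^ 4) * ((δ + ‖x + p‖) ^ 8)⁻¹)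
        = (∫ x in BB, gradSq v x) + π * (2 * c1 ^ 2) + 2 * (Λ ^ 2 * κ ^ 2 * δ ^ 4) * ∫ x in BB, ((δ + ‖x + p‖) ^ 8)⁻¹ := by
      have := integral_add (i2.add ic) i3
      simp only [Pi.add_apply] at this
      rw [this, integral_add i2 ic, int_const, integral_const_mul]
    rw [integral_const_mul, ea] at this
    have h5 := mul_le_mul_of_nonneg_left b1 (by positivity : 0 ≤ 2 * (Λ ^ 2 * κ ^ 2 * δ ^ 4))
    linarith [hE c]
  have e4 : Λ ^ 2 * κ ^ 2 * δ ^ 4 * (K1 * (δ ^ 6)⁻¹) = Λ ^ 2 * K1 * (κ / δ) ^ 2 := by field_simp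
  have hR2 : 1 ≤ R ^ 2 := one_le_pow₀ hR1
  have hR3 : (κ / δ) ^ 2 ≤ R ^ 2 := by gcongr
  set K' := 2 * π * c2 ^ 2 + (K + 2 * (π * c1 ^ 2 + Λ ^ 2 * K1)) with hK'
  have hK'0 : 0 ≤ K' := by positivity
  have b5 : ∫ θ in 0..2 * π, tderiv v (bpt θ) ^ 2 ≤ K' * R ^ 2 := by
    rw [pohozaev c.hv]
    rw [e4] at b3
    have q1 : K ≤ K * R ^ 2 := le_mul_of_one_le_right hK.le hR2
    have q2 : π * c1 ^ 2 ≤ π * c1 ^ 2 * R ^ 2 := le_mul_of_one_le_right (by positivity) hR2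
    have q3 : Λ ^ 2 * K1 * (κ / δ) ^ 2 ≤ Λ ^ 2 * K1 * R ^ 2 := by gcongr
    rw [hK']; linarith
  have b6 : ∫ θ in 0..2 * π, |tderiv v (bpt θ)| ≤ (K' + 2 * π) * R := by
    have i5 : IntervalIntegrable (fun θ => R⁻¹ * tderiv v (bpt θ) ^ 2) volume 0 (2 * π) :=
      (continuous_const.mul (cont_bpt (c.hv.C1.tderiv_cont.pow 2))).intervalIntegrable _ _
    have i6 : IntervalIntegrable (fun _ => R) volume 0 (2 * π) := continuous_const.intervalIntegrable _ _
    have : ∫ θ in 0..2 * π, |tderiv v (bpt θ)| ≤ ∫ θ in 0..2 * π, (R⁻¹ * tderiv v (bpt θ) ^ 2 + R) :=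
      intervalIntegral.integral_mono_on (by positivity) ((cont_bpt c.hv.C1.tderiv_cont.abs).intervalIntegrable _ _) (i5.add i6) fun θ _ => by
        have hR0 : 0 < R := by linarith
        rw [← sq_abs (tderiv v (bpt θ)), ← sub_nonneg]
        have : R⁻¹ * |tderiv v (bpt θ)| ^ 2 + R - |tderiv v (bpt θ)| = R⁻¹ * (|tderiv v (bpt θ)| ^ 2 + R ^ 2 - R * |tderiv v (bpt θ)|) := by
          field_simp
        rw [this]
        refine mul_nonneg (inv_nonneg.2 hR0.le) ?_
        have s1 := sq_nonneg (|tderiv v (bpt θ)| - R)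
        have s2 := mul_nonneg hR0.le (abs_nonneg (tderiv v (bpt θ)))
        linarith [(by ring : (|tderiv v (bpt θ)| - R) ^ 2 = |tderiv v (bpt θ)| ^ 2 + R ^ 2 - 2 * (R * |tderiv v (bpt θ)|))]
    rw [intervalIntegral.integral_add i5 i6, intervalIntegral.integral_const_mul, intervalIntegral.integral_const, smul_eq_mul, sub_zero] at this
    have hR0 : 0 < R := by linarith
    have q : R⁻¹ * (∫ θ in 0..2 * π, tderiv v (bpt θ) ^ 2) ≤ R⁻¹ * (K' * R ^ 2) := by gcongr
    have q' : R⁻¹ * (K' * R ^ 2) = K' * R := by field_simp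
    linarith
  have := mul_le_mul_of_nonneg_left b6 hδ.le
  refine this.trans_eq ?_
  rw [hR]; field_simp

def dd (ω : ℂ) (f : ℂ → ℂ) (x : ℂ) : ℂ := (fderiv ℝ f x 1 + ω * fderiv ℝ f x iI) / 2

lemma dd_mul (ω : ℂ) {f g : ℂ → ℂ} {x : ℂ} (hf : DifferentiableAt ℝ f x) (hg : DifferentiableAt ℝ g x) :
    dd ω (fun y => f y * g y) x = dd ω f x * g x + f x * dd ω g x := by
  rw [dd, dd, dd, fderiv_fun_mul hf hg]; simp; ring
lemma dd_add (ω : ℂ) {f g : ℂ → ℂ} {x : ℂ} (hf : DifferentiableAt ℝ f x) (hg : DifferentiableAt ℝ g x) :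
    dd ω (fun y => f y + g y) x = dd ω f x + dd ω g x := by
  rw [dd, dd, dd, fderiv_fun_add hf hg]; simp; ring
lemma dd_sub (ω : ℂ) {f g : ℂ → ℂ} {x : ℂ} (hf : DifferentiableAt ℝ f x) (hg : DifferentiableAt ℝ g x) :
    dd ω (fun y => f y - g y) x = dd ω f x - dd ω g x := by
  rw [dd, dd, dd, fderiv_fun_sub hf hg]; simp; ring
lemma dd_const_mul (ω a : ℂ) {f : ℂ → ℂ} {x : ℂ} (hf : DifferentiableAt ℝ f x) :
    dd ω (fun y => a * f y) x = a * dd ω f x := by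
  rw [dd, dd, fderiv_const_mul hf]; simp; ring
lemma C2.dd {f : ℂ → ℂ} (h : C2 f) (ω : ℂ) : _root_.C1 (dd ω f) := fun x hx => by
  unfold _root_.dd
  exact ((h.fd 1 x hx).add (contDiffAt_const.mul (h.fd iI x hx))).div_const 2
lemma C1.dd_cont {f : ℂ → ℂ} (h : C1 f) (ω : ℂ) : ContinuousOn (_root_.dd ω f) CB := by
  unfold _root_.dd
  exact ((h.fdcont 1).add (continuousOn_const.mul (h.fdcont iI))).div_const 2
lemma dd_symm (ω ω' : ℂ) {f : ℂ → ℂ} {x : ℂ} (h : ContDiffAt ℝ 2 f x) :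
    dd ω (dd ω' f) x = dd ω' (dd ω f) x := by
  have hs := h.isSymmSndFDerivAt (by simp)
  have hd : DifferentiableAt ℝ (fderiv ℝ f) x := (h.fderiv_right (m := 1) (by norm_num)).differentiableAt (by norm_num)
  have h1 : ∀ a b : ℂ, fderiv ℝ (fun y => fderiv ℝ f y a) x b = fderiv ℝ (fderiv ℝ f) x b a := fun a b => by
    rw [fderiv_clm_apply hd (differentiableAt_const _)]; simp
  have hda : ∀ a : ℂ, DifferentiableAt ℝ (fun y => fderiv ℝ f y a) x := fun a => hd.clm_apply (differentiableAt_const _)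
  have key : ∀ ω e : ℂ, fderiv ℝ (dd ω f) x e = (fderiv ℝ (fderiv ℝ f) x e 1 + ω * fderiv ℝ (fderiv ℝ f) x e iI) / 2 := by
    intro ω e
    have : dd ω f = fun y => (1/2 : ℂ) * (fderiv ℝ f y 1 + ω * fderiv ℝ f y iI) := by ext y; rw [dd]; ring
    rw [this, fderiv_const_mul ((hda 1).fun_add ((hda _).const_mul ω)), fderiv_fun_add (hda 1) ((hda _).const_mul ω), fderiv_const_mul (hda _)]
    simp [h1]; ring
  have s := hs 1 iI
  rw [dd, dd, key, key, key, key]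
  rw [s]; ring

lemma int_dd (ω : ℂ) {f : ℂ → ℂ} (hf : C1 f) :
    ∫ x in BB, dd ω f x = (1/2) * ∫ θ in 0..2 * π, ((cos θ : ℂ) + ω * sin θ) * f (bpt θ) := by
  have := div_thm (fun y => (1/2 : ℂ) * f y) (fun y => (ω/2) * f y) (fun x hx => contDiffAt_const.mul (hf x hx)) (fun x hx => contDiffAt_const.mul (hf x hx))
  rw [← intervalIntegral.integral_const_mul]
  convert this using 1
  · refine setIntegral_congr_fun measurableSet_ball fun x hx => ?_
    have d := hf.diff (Metric.ball_subset_closedBall hx)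
    beta_reduce
    rw [dd, fderiv_const_mul d, fderiv_const_mul d]; simp; ring
  · congr 1; ext θ; simp only [Complex.real_smul]; ring

def vz (v : ℂ → ℝ) (x : ℂ) : ℂ := ((pd v 1 x : ℂ) - iI * pd v iI x) / 2

lemma ofRealC1 {g : ℂ → ℝ} (h : C1 g) : C1 (fun x => (g x : ℂ)) := fun x hx =>
  Complex.ofRealCLM.contDiff.contDiffAt.comp x (h x hx)
lemma ofRealC2 {g : ℂ → ℝ} (h : C2 g) : C2 (fun x => (g x : ℂ)) := fun x hx =>
  Complex.ofRealCLM.contDiff.contDiffAt.comp x (h x hx)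
lemma fderiv_ofReal {g : ℂ → ℝ} {x : ℂ} (h : DifferentiableAt ℝ g x) (e : ℂ) :
    fderiv ℝ (fun x => (g x : ℂ)) x e = (fderiv ℝ g x e : ℂ) := by
  have := (Complex.ofRealCLM.hasFDerivAt (x := g x)).comp x h.hasFDerivAt
  have h2 : fderiv ℝ (fun x => (g x : ℂ)) x = _ := this.fderiv
  rw [h2]; simp
lemma vz_C1 {v : ℂ → ℝ} (hv : C2 v) : C1 (vz v) := fun x hx => by
  unfold vz
  exact ((ofRealC1 (hv.pd 1) x hx).sub (contDiffAt_const.mul (ofRealC1 (hv.pd iI) x hx))).div_const 2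

lemma dzb_vz {v : ℂ → ℝ} (hv : C2 v) {x : ℂ} (hx : x ∈ CB) :
    dd iI (vz v) x = (lap v x : ℂ) / 4 := by
  have h1 := (ofRealC1 (hv.pd 1)).diff hx
  have h2 := (ofRealC1 (hv.pd iI)).diff hx
  have e : vz v = fun x => (1/2 : ℂ) * ((pd v 1 x : ℂ) - iI * pd v iI x) := by ext y; rw [vz]; ring
  have f : ∀ d, fderiv ℝ (vz v) x d = (1/2) * ((fderiv ℝ (pd v 1) x d : ℂ) - iI * (fderiv ℝ (pd v iI) x d : ℂ)) := by
    intro d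
    rw [e, fderiv_const_mul (h1.fun_sub (h2.const_mul _)), fderiv_fun_sub h1 (h2.const_mul _), fderiv_const_mul h2]
    simp only [ContinuousLinearMap.smul_apply, ContinuousLinearMap.sub_apply, smul_eq_mul]
    rw [fderiv_ofReal ((hv.pd 1).diff hx), fderiv_ofReal ((hv.pd iI).diff hx)]
  have s := pd_symm (hv x hx) 1 iI
  change fderiv ℝ (pd v 1) x iI = fderiv ℝ (pd v iI) x 1 at s
  rw [dd, f, f, lap, s]
  change _ = ((fderiv ℝ (pd v 1) x 1 + fderiv ℝ (pd v iI) x iI : ℝ) : ℂ) / 4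
  push_cast
  linear_combination (-(1/4) * (fderiv ℝ (pd v iI) x iI : ℂ)) * Complex.I_mul_I

lemma dz_exp {v : ℂ → ℝ} (a : ℝ) (hv : C1 v) {x : ℂ} (hx : x ∈ CB) :
    dd (-iI) (fun y => ((exp (a * v y) : ℝ) : ℂ)) x = a * exp (a * v x) * vz v x := by
  have d := ((hv.diff hx).const_mul a)
  rw [dd, fderiv_ofReal d.exp, fderiv_ofReal d.exp, (d.hasFDerivAt.exp).fderiv, fderiv_const_mul (hv.diff hx), vz]
  simp [pd]; ring

def Qh (v : ℂ → ℝ) (x : ℂ) : ℂ := dd (-iI) (vz v) x - vz v x ^ 2 / 2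

lemma L7_pt {v : ℂ → ℝ} (hv : C2 v) {X : ℂ → ℂ} (hX : C2 X) (A C : ℝ) {x : ℂ} (hx : x ∈ CB) :
    dd (-iI) (fun y => vz v y * dd iI X y - (2 * A * C : ℂ) * ((exp (1 * v y) : ℝ) * X y)) x -
     dd iI (fun y => vz v y * dd (-iI) X y + (1/2 : ℂ) * (vz v y * vz v y * X y)) x =
    Qh v x * dd iI X x - (FF A C v x : ℂ) / 4 * (dd (-iI) X x + vz v x * X x) := by
  have dZ := (vz_C1 hv).diff hx
  have dX := hX.C1.diff hx
  have d1 := (hX.dd iI).diff hx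
  have d2 := (hX.dd (-iI)).diff hx
  have hexp : C1 (fun y => exp (1 * v y)) := fun x hx => (contDiffAt_const.mul (hv.C1 x hx)).exp
  have de := (ofRealC1 hexp).diff hx
  rw [dd_sub _ (dZ.fun_mul d1) ((de.fun_mul dX).const_mul _), dd_add _ (dZ.fun_mul d2) (((dZ.fun_mul dZ).fun_mul dX).const_mul _),
    dd_mul _ dZ d1, dd_mul _ dZ d2, dd_const_mul _ _ (de.fun_mul dX), dd_const_mul _ _ ((dZ.fun_mul dZ).fun_mul dX),
    dd_mul _ de dX, dd_mul _ (dZ.fun_mul dZ) dX, dd_mul _ dZ dZ, dzb_vz hv hx, dz_exp 1 hv.C1 hx, dd_symm _ _ (hX x hx), Qh, FF]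
  push_cast
  rw [one_mul]
  ring

theorem L7 {v : ℂ → ℝ} (hv : C2 v) {X : ℂ → ℂ} (hX : C2 X) (A C : ℝ) {χ χ' : ℝ → ℝ} (hχ : ∀ θ, HasDerivAt χ (χ' θ) θ) (hχc : Continuous χ')
    (hb : ∀ θ, X (bpt θ) = iI * bpt θ * χ θ) (hper : χ (2 * π) = χ 0) :
    (∫ x in BB, Qh v x * dd iI X x).re =
      -(1/4) * (∫ θ in 0..2 * π, (GG A C v (bpt θ) * χ' θ + GG A C v (bpt θ) * tderiv v (bpt θ) * χ θ / 2)) +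
      (1/4) * (∫ x in BB, (FF A C v x : ℂ) * (dd (-iI) X x + vz v x * X x)).re := by
  have hexp : C1 (fun y => exp (1 * v y)) := fun x hx => (contDiffAt_const.mul (hv.C1 x hx)).exp
  have cZ := vz_C1 hv
  have cA : C1 (fun y => vz v y * dd iI X y - (2 * A * C : ℂ) * ((exp (1 * v y) : ℝ) * X y)) := fun x hx =>
    ((cZ x hx).mul (hX.dd _ x hx)).sub (contDiffAt_const.mul ((ofRealC1 hexp x hx).mul (hX.C1 x hx)))
  have cB : C1 (fun y => vz v y * dd (-iI) X y + (1/2 : ℂ) * (vz v y * vz v y * X y)) := fun x hx =>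
    ((cZ x hx).mul (hX.dd _ x hx)).add (contDiffAt_const.mul (((cZ x hx).mul (cZ x hx)).mul (hX.C1 x hx)))
  have iA := int_dd (-iI) cA
  have iB := int_dd iI cB
  have cF : ContinuousOn (fun x => (FF A C v x : ℂ)) CB :=
    Complex.continuous_ofReal.comp_continuousOn (hv.lap_cont.add (continuousOn_const.mul (continuous_exp.comp_continuousOn hv.C1.cont)))
  have cR : ContinuousOn (fun x => (FF A C v x : ℂ) * (dd (-iI) X x + vz v x * X x)) CB :=
    cF.mul ((hX.C1.dd_cont _).add (cZ.cont.mul hX.C1.cont))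
  have cQ : ContinuousOn (fun x => Qh v x * dd iI X x) CB :=
    ((cZ.dd_cont _).sub ((cZ.cont.pow 2).div_const 2)).mul (hX.C1.dd_cont _)
  have key : (∫ x in BB, Qh v x * dd iI X x) - (1/4) * ∫ x in BB, (FF A C v x : ℂ) * (dd (-iI) X x + vz v x * X x)
     = (1/2) * ∫ θ in 0..2 * π, (((cos θ : ℂ) + (-iI) * sin θ) * (vz v (bpt θ) * dd iI X (bpt θ) - (2 * A * C : ℂ) * ((exp (1 * v (bpt θ)) : ℝ) * X (bpt θ))) -
       ((cos θ : ℂ) + iI * sin θ) * (vz v (bpt θ) * dd (-iI) X (bpt θ) + (1/2 : ℂ) * (vz v (bpt θ) * vz v (bpt θ) * X (bpt θ)))) := by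
    rw [intervalIntegral.integral_sub, mul_sub, ← iA, ← iB, ← integral_const_mul, ← integral_sub (intD cQ) ((intD cR).const_mul _),
      ← integral_sub (intD (cA.dd_cont _)) (intD (cB.dd_cont _))]
    · refine setIntegral_congr_fun measurableSet_ball fun x hx => ?_
      beta_reduce
      rw [L7_pt hv hX A C (Metric.ball_subset_closedBall hx)]; ring
    · have := cont_bpt cA.cont
      exact (Continuous.mul (by fun_prop) this).intervalIntegrable _ _
    · have := cont_bpt cB.cont
      exact (Continuous.mul (by fun_prop) this).intervalIntegrable _ _
  have hXθ : ∀ θ, iI * (bpt θ * dd (-iI) X (bpt θ) - cj (bpt θ) * dd iI X (bpt θ)) = -bpt θ * χ θ + iI * bpt θ * χ' θ := by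
    intro θ
    have d1 : HasDerivAt (fun θ => X (bpt θ)) (fderiv ℝ X (bpt θ) (iI * bpt θ)) θ :=
      (hX.C1.diff (bpt_mem θ)).hasFDerivAt.comp_hasDerivAt θ (hasDerivAt_bpt θ)
    have d2 : HasDerivAt (fun θ => X (bpt θ)) (-bpt θ * χ θ + iI * bpt θ * χ' θ) θ := by
      have h2 : HasDerivAt (fun θ => iI * bpt θ * (χ θ : ℂ)) _ θ := ((hasDerivAt_bpt θ).const_mul iI).mul (hχ θ).ofReal_comp
      have : (fun θ => X (bpt θ)) = fun θ => iI * bpt θ * (χ θ : ℂ) := by ext θ; exact hb θ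
      rw [this]
      refine h2.congr_deriv ?_
      linear_combination (bpt θ * (χ θ : ℂ)) * Complex.I_mul_I
    have := d1.unique d2
    rw [← this, clm_apply]
    simp only [dd]
    have e1 : (iI * bpt θ).re = -sin θ := by simp
    have e2 : (iI * bpt θ).im = cos θ := by simp
    rw [e1, e2]
    have e3 := bpt_eq θ
    rw [e3]
    simp only [map_add, map_mul, Complex.conj_ofReal, Complex.conj_I, Complex.real_smul, Complex.ofReal_neg]
    ring_nf
    simp only [Complex.I_sq]
    ring
  have hzz : ∀ θ, bpt θ * vz v (bpt θ) = ((nderiv v (bpt θ) : ℂ) - iI * tderiv v (bpt θ)) / 2 := by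
    intro θ
    have e3 := bpt_eq θ
    rw [vz, nderiv, tderiv, bpt_re, bpt_im]
    push_cast
    generalize (pd v 1 (bpt θ) : ℂ) = a
    generalize (pd v iI (bpt θ) : ℂ) = b
    rw [e3]
    push_cast
    ring_nf
    simp only [Complex.I_sq]
    ring
  have hcos : ∀ θ : ℝ, (cos θ : ℂ) + (-iI) * sin θ = cj (bpt θ) := by
    intro θ; rw [bpt_eq]; simp only [map_add, map_mul, Complex.conj_ofReal, Complex.conj_I]; ring
  have hcos2 : ∀ θ : ℝ, (cos θ : ℂ) + iI * sin θ = bpt θ := by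
    intro θ; rw [bpt_eq]; ring
  have hzb : ∀ θ, cj (bpt θ) * bpt θ = 1 := by
    intro θ; rw [mul_comm, Complex.mul_conj, Complex.normSq_eq_norm_sq, norm_bpt]; simp
  have hint : ∀ θ, (((cos θ : ℂ) + (-iI) * sin θ) * (vz v (bpt θ) * dd iI X (bpt θ) - (2 * A * C : ℂ) * ((exp (1 * v (bpt θ)) : ℝ) * X (bpt θ))) -
       ((cos θ : ℂ) + iI * sin θ) * (vz v (bpt θ) * dd (-iI) X (bpt θ) + (1/2 : ℂ) * (vz v (bpt θ) * vz v (bpt θ) * X (bpt θ)))) =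
      ((-(nderiv v (bpt θ) * χ' θ) / 2 - tderiv v (bpt θ) * χ θ / 2 - nderiv v (bpt θ) * tderiv v (bpt θ) * χ θ / 4 : ℝ) : ℂ) +
      ((-nderiv v (bpt θ) * χ θ / 2 + tderiv v (bpt θ) * χ' θ / 2 - 2 * A * C * exp (v (bpt θ)) * χ θ - (nderiv v (bpt θ)^2 - tderiv v (bpt θ)^2) * χ θ / 8 : ℝ) : ℂ) * iI := by
    intro θ
    rw [hcos, hcos2, hb, one_mul]
    have h1 := hXθ θ
    have h2 := hzz θ
    have h3 := hzb θ
    push_cast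
    generalize cj (bpt θ) = c at *
    generalize dd iI X (bpt θ) = x1 at *
    generalize dd (-iI) X (bpt θ) = x2 at *
    generalize vz v (bpt θ) = Z at *
    have h4 : c * x1 - bpt θ * x2 = iI * (-bpt θ * χ θ + iI * bpt θ * χ' θ) := by
      rw [← h1]; linear_combination (-(bpt θ * x2 - c * x1)) * Complex.I_mul_I
    linear_combination Z * h4 + (-iI * χ θ + iI ^ 2 * χ' θ - iI * χ θ * (bpt θ * Z + ((nderiv v (bpt θ) : ℂ) - iI * tderiv v (bpt θ)) / 2) / 2) * h2 -
      (2 * A * C * Complex.exp (v (bpt θ)) * iI * χ θ : ℂ) * h3 +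
      ((tderiv v (bpt θ) : ℂ) * χ θ / 2 + nderiv v (bpt θ) * χ' θ / 2 - iI * tderiv v (bpt θ) * χ' θ / 2 + nderiv v (bpt θ) * tderiv v (bpt θ) * χ θ / 4 - iI * (tderiv v (bpt θ) : ℂ) ^ 2 * χ θ / 8) * Complex.I_mul_I
  have cχ : Continuous χ := continuous_iff_continuousAt.2 fun θ => (hχ θ).continuousAt
  have cn := cont_bpt hv.C1.nderiv_cont
  have ct := cont_bpt hv.C1.tderiv_cont
  have cv := cont_bpt hv.C1.cont
  have ce : Continuous (fun θ => exp (v (bpt θ))) := continuous_exp.comp cv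
  have ce2 : Continuous (fun θ => exp (v (bpt θ) / 2)) := continuous_exp.comp (cv.div_const 2)
  have keyre := congrArg Complex.re key
  rw [intervalIntegral.integral_congr (g := fun θ => ((-(nderiv v (bpt θ) * χ' θ) / 2 - tderiv v (bpt θ) * χ θ / 2 - nderiv v (bpt θ) * tderiv v (bpt θ) * χ θ / 4 : ℝ) : ℂ) +
      ((-nderiv v (bpt θ) * χ θ / 2 + tderiv v (bpt θ) * χ' θ / 2 - 2 * A * C * exp (v (bpt θ)) * χ θ - (nderiv v (bpt θ)^2 - tderiv v (bpt θ)^2) * χ θ / 8 : ℝ) : ℂ) * iI) (fun θ _ => hint θ),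
      intervalIntegral.integral_add, intervalIntegral.integral_mul_const, intervalIntegral.integral_ofReal, intervalIntegral.integral_ofReal] at keyre
  rotate_left
  · exact (Continuous.intervalIntegrable (Complex.continuous_ofReal.comp (by fun_prop)) _ _)
  · exact (Continuous.intervalIntegrable ((Complex.continuous_ofReal.comp (by fun_prop)).mul continuous_const) _ _)
  have hder : ∀ θ, HasDerivAt (fun θ => χ θ - (A - C) * (exp (v (bpt θ) / 2) * χ θ))
      (χ' θ - (A - C) * (exp (v (bpt θ) / 2) * (tderiv v (bpt θ) / 2) * χ θ + exp (v (bpt θ) / 2) * χ' θ)) θ := by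
    intro θ
    have d1 : HasDerivAt (fun θ => v (bpt θ)) (fderiv ℝ v (bpt θ) (iI * bpt θ)) θ :=
      (hv.C1.diff (bpt_mem θ)).hasFDerivAt.comp_hasDerivAt θ (hasDerivAt_bpt θ)
    have e : fderiv ℝ v (bpt θ) (iI * bpt θ) = tderiv v (bpt θ) := by
      rw [clm_apply, tderiv, pd, pd]; simp
    rw [e] at d1
    exact (hχ θ).sub ((((d1.div_const 2).exp).mul (hχ θ)).const_mul (A - C))
  have hz := intervalIntegral.integral_eq_sub_of_hasDerivAt (a := 0) (b := 2 * π) (fun θ _ => hder θ)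
    (Continuous.intervalIntegrable (by fun_prop) _ _)
  have hbp : bpt (2 * π) = bpt 0 := by simpa using bpt_periodic 0
  rw [hbp, hper, sub_self] at hz
  have hsplit : (∫ θ in 0..2 * π, (-(nderiv v (bpt θ) * χ' θ) / 2 - tderiv v (bpt θ) * χ θ / 2 - nderiv v (bpt θ) * tderiv v (bpt θ) * χ θ / 4)) =
      -(1/2) * (∫ θ in 0..2 * π, (GG A C v (bpt θ) * χ' θ + GG A C v (bpt θ) * tderiv v (bpt θ) * χ θ / 2)) := by
    have az : ∀ a b c : ℝ, c = 0 → a = b + c → a = b := fun a b c h1 h2 => by linarith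
    refine az _ _ _ hz ?_
    rw [← intervalIntegral.integral_const_mul, ← intervalIntegral.integral_add]
    · congr 1; ext θ; rw [GG]; ring
    · refine Continuous.intervalIntegrable ?_ _ _
      unfold GG; fun_prop
    · exact Continuous.intervalIntegrable (by fun_prop) _ _
  rw [hsplit] at keyre
  have q : ∀ z : ℂ, ((1/4 : ℂ) * z).re = (1/4) * z.re := fun z => by simp
  have q2 : ∀ z : ℂ, ((1/2 : ℂ) * z).re = (1/2) * z.re := fun z => by simp
  rw [Complex.sub_re, q, q2, Complex.add_re, Complex.ofReal_re, Complex.re_ofReal_mul, Complex.I_re] at keyre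
  linarith

lemma locInt_inv : LocallyIntegrable (fun w : ℂ => w⁻¹) volume := by
  intro x
  by_cases hx : x = 0
  · subst hx
    obtain ⟨C, hC, h⟩ := rpow_disk (α := 1) (by norm_num) (by norm_num)
    refine ⟨Metric.ball 0 1, Metric.ball_mem_nhds _ one_pos, ?_⟩
    have := (h 0).1
    refine Integrable.mono' this (Measurable.aestronglyMeasurable (by fun_prop)) (Eventually.of_forall fun w => ?_)
    rw [sub_zero, rpow_neg_one, norm_inv]
  · exact Measure.FiniteAtFilter.integrableAtFilter_of_tendsto
      ⟨Set.univ, univ_mem, Measurable.aestronglyMeasurable (by fun_prop)⟩ (Measure.finiteAt_nhds _ x) (continuousAt_inv₀ hx)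

def Tc (f : ℂ → ℂ) (z : ℂ) : ℂ := (π : ℂ)⁻¹ * ∫ w, w⁻¹ * f (z - w)

lemma Tc_eq_conv (f : ℂ → ℂ) : Tc f = fun z => (π : ℂ)⁻¹ * convolution (fun w : ℂ => w⁻¹) f (ContinuousLinearMap.mul ℝ ℂ) volume z := by
  ext z; rw [Tc, convolution_def]; simp

lemma hcs {F : Type*} [Zero F] {f : ℂ → F} {r : ℝ} (hs : ∀ x, r ≤ ‖x‖ → f x = 0) : HasCompactSupport f :=
  HasCompactSupport.intro (isCompact_closedBall (0:ℂ) r) fun x hx => hs x (by simp at hx; exact hx.le)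

lemma Tc_contDiff {f : ℂ → ℂ} {r : ℝ} (hf : ContDiff ℝ 2 f) (hs : ∀ x, r ≤ ‖x‖ → f x = 0) : ContDiff ℝ 2 (Tc f) := by
  rw [Tc_eq_conv]
  exact contDiff_const.mul ((hcs hs).contDiff_convolution_right (n := 2) _ locInt_inv hf)

lemma fderiv_supp {F : Type*} [NormedAddCommGroup F] [NormedSpace ℝ F] {f : ℂ → F} {r : ℝ} (hf : ContDiff ℝ 1 f) (hs : ∀ x, r ≤ ‖x‖ → f x = 0) :
    ∀ x, r < ‖x‖ → fderiv ℝ f x = 0 := by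
  intro x hx
  have : f =ᶠ[nhds x] fun _ => 0 := by
    filter_upwards [(continuous_norm.isOpen_preimage _ isOpen_Ioi).mem_nhds (show x ∈ norm ⁻¹' Set.Ioi r from hx)] with y hy
    exact hs y (le_of_lt hy)
  rw [this.fderiv_eq]; simp

lemma Tc_dd (ω : ℂ) {f : ℂ → ℂ} {r : ℝ} (hf : ContDiff ℝ 2 f) (hs : ∀ x, r ≤ ‖x‖ → f x = 0) (z : ℂ) :
    dd ω (Tc f) z = Tc (dd ω f) z := by
  have hf1 : ContDiff ℝ 1 f := hf.of_le (by norm_num)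
  have h := (hcs hs).hasFDerivAt_convolution_right (ContinuousLinearMap.mul ℝ ℂ) locInt_inv hf1 z
  have cs := (hcs hs).fderiv (𝕜 := ℝ)
  have ci : ConvolutionExists (fun w : ℂ => w⁻¹) (fderiv ℝ f) (ContinuousLinearMap.precompR ℂ (ContinuousLinearMap.mul ℝ ℂ)) volume :=
    cs.convolutionExists_right _ locInt_inv (hf1.continuous_fderiv (by norm_num))
  have cz := ci z
  have happ : ∀ e : ℂ, fderiv ℝ (Tc f) z e = (π : ℂ)⁻¹ * ∫ w, w⁻¹ * fderiv ℝ f (z - w) e := by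
    intro e
    rw [Tc_eq_conv, (h.const_mul _).fderiv, convolution_def]
    simp only [ContinuousLinearMap.smul_apply, smul_eq_mul]
    rw [ContinuousLinearMap.integral_apply cz]; simp
  have hint : ∀ e : ℂ, Integrable (fun w : ℂ => w⁻¹ * fderiv ℝ f (z - w) e) := by
    intro e
    have := ContinuousLinearMap.integrable_comp (ContinuousLinearMap.apply ℝ ℂ e) cz
    simpa using this
  rw [dd, happ, happ, Tc]
  have : (fun w => w⁻¹ * dd ω f (z - w)) = fun w => (1/2 : ℂ) * (w⁻¹ * fderiv ℝ f (z - w) 1 + ω * (w⁻¹ * fderiv ℝ f (z - w) iI)) := by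
    ext w; rw [dd]; ring
  rw [this, integral_const_mul, integral_add (hint 1) ((hint iI).const_mul ω), integral_const_mul]
  ring

lemma Tc_disk {f : ℂ → ℂ} {r : ℝ} (hr : r < 1) (hs : ∀ x, r < ‖x‖ → f x = 0) (z : ℂ) :
    Tc f z = (π : ℂ)⁻¹ * ∫ y in BB, (z - y)⁻¹ * f y := by
  rw [Tc]
  have := integral_sub_left_eq_self (fun w => w⁻¹ * f (z - w)) volume z
  simp only [sub_sub_cancel] at this
  rw [← this, setIntegral_eq_integral_of_forall_compl_eq_zero]
  intro y hy
  rw [hs y (by simp at hy; linarith), mul_zero]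

lemma pompeiu {f : ℂ → ℂ} {r : ℝ} (hr : r < 1) (hf : ContDiff ℝ 2 f) (hs : ∀ x, r ≤ ‖x‖ → f x = 0) {z : ℂ} (hz : ‖z‖ < 1) :
    Tc (dd iI f) z = f z := by
  have hf1 : ContDiff ℝ 1 f := hf.of_le (by norm_num)
  have hC1 : C1 f := fun x _ => hf1.contDiffAt
  have hC2 : C2 f := fun x _ => hf.contDiffAt
  have hsd : ∀ x, r < ‖x‖ → dd iI f x = 0 := by
    intro x hx; rw [dd, fderiv_supp hf1 hs x hx]; simp
  rw [Tc_disk hr hsd]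
  have hL : ∃ L, ∀ y ∈ BB, ‖f y - f z‖ ≤ L * ‖y - z‖ := by
    obtain ⟨L, hL⟩ := hf1.lipschitzWith_of_hasCompactSupport (hcs hs) (by norm_num)
    exact ⟨L, fun y _ => by simpa [dist_eq_norm] using hL.dist_le_mul y z⟩
  obtain ⟨L, hL⟩ := hL
  have lim1 := approx_id hC1.cont hz hL
  set k : ℝ → ℂ → ℂ := fun s y => cj (z - y) * (((‖y - z‖ ^ 2 + s ^ 2)⁻¹ : ℝ) : ℂ) with hk
  have ibp : ∀ s > 0, ∫ y in BB, k s y * dd iI f y = ∫ y in BB, (s ^ 2 / (‖y - z‖ ^ 2 + s ^ 2) ^ 2) • f y := by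
    intro s hs0
    have Dpos : ∀ y : ℂ, 0 < ‖y - z‖ ^ 2 + s ^ 2 := fun y => by positivity
    have kC : ContDiff ℝ 1 (k s) := by
      refine ContDiff.mul ((Complex.conjCLE : ℂ ≃L[ℝ] ℂ).contDiff.comp (contDiff_const.sub contDiff_id)) (Complex.ofRealCLM.contDiff.comp (ContDiff.inv ?_ fun y => (Dpos y).ne'))
      exact ((contDiff_norm_sq ℝ).comp (contDiff_id.sub contDiff_const)).add contDiff_const
    have dconj : ∀ y, HasFDerivAt (fun y : ℂ => cj (y - z)) ((Complex.conjCLE : ℂ ≃L[ℝ] ℂ) : ℂ →L[ℝ] ℂ) y := fun y => by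
      exact ((Complex.conjCLE : ℂ ≃L[ℝ] ℂ) : ℂ →L[ℝ] ℂ).hasFDerivAt.comp y ((hasFDerivAt_id (𝕜 := ℝ) y).sub_const z)
    have did : ∀ y, HasFDerivAt (fun y : ℂ => y - z) (ContinuousLinearMap.id ℝ ℂ) y := fun y => (hasFDerivAt_id (𝕜 := ℝ) y).sub_const z
    have ddc : ∀ y, dd iI (fun y : ℂ => cj (y - z)) y = 1 := fun y => by
      rw [dd, (dconj y).fderiv]; simp
    have ddi : ∀ y, dd iI (fun y : ℂ => y - z) y = 0 := fun y => by
      rw [dd, (did y).fderiv]; simp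
    have ddk : ∀ y, dd iI (k s) y = -((s ^ 2 / (‖y - z‖ ^ 2 + s ^ 2) ^ 2 : ℝ) : ℂ) := by
      intro y
      have hDd : DifferentiableAt ℝ (fun y => (y - z) * cj (y - z) + (s ^ 2 : ℂ)) y := ((did y).differentiableAt.fun_mul (dconj y).differentiableAt).add_const _
      have e1 := dd_mul iI (kC.differentiable (by norm_num) y) hDd
      have e2 : (fun y => k s y * ((y - z) * cj (y - z) + (s ^ 2 : ℂ))) = fun y => (-1 : ℂ) * cj (y - z) := by
        ext y
        have : (y - z) * cj (y - z) + (s ^ 2 : ℂ) = ((‖y - z‖ ^ 2 + s ^ 2 : ℝ) : ℂ) := by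
          rw [Complex.mul_conj, Complex.normSq_eq_norm_sq]; push_cast; ring
        rw [this, hk]; beta_reduce
        rw [mul_assoc, ← Complex.ofReal_mul, inv_mul_cancel₀ (Dpos y).ne', ← neg_sub y z, map_neg]; simp
      rw [e2, dd_const_mul _ _ (dconj y).differentiableAt, ddc, dd_add _ ((did y).differentiableAt.fun_mul (dconj y).differentiableAt) (differentiableAt_const _),
        dd_mul _ (did y).differentiableAt (dconj y).differentiableAt, ddi, ddc] at e1
      have e3 : dd iI (fun _ : ℂ => (s ^ 2 : ℂ)) y = 0 := by rw [dd]; simp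
      have e4 : (y - z) * cj (y - z) + (s ^ 2 : ℂ) = ((‖y - z‖ ^ 2 + s ^ 2 : ℝ) : ℂ) := by
        rw [Complex.mul_conj, Complex.normSq_eq_norm_sq]; push_cast; ring
      have e5 : (y - z) * cj (y - z) = ((‖y - z‖ ^ 2 : ℝ) : ℂ) := by
        rw [Complex.mul_conj, Complex.normSq_eq_norm_sq]
      have e6 : k s y * (y - z) = -((‖y - z‖ ^ 2 * (‖y - z‖ ^ 2 + s ^ 2)⁻¹ : ℝ) : ℂ) := by
        rw [hk]; beta_reduce; rw [← neg_sub y z, map_neg, Complex.ofReal_mul, ← e5]; ring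
      rw [e3, e4] at e1
      have hne : ((‖y - z‖ ^ 2 + s ^ 2 : ℝ) : ℂ) ≠ 0 := by exact_mod_cast (Dpos y).ne'
      have e7 : dd iI (k s) y * ((‖y - z‖ ^ 2 + s ^ 2 : ℝ) : ℂ) = ((-1 + ‖y - z‖ ^ 2 * (‖y - z‖ ^ 2 + s ^ 2)⁻¹ : ℝ) : ℂ) := by
        push_cast at e1 e6 ⊢
        linear_combination -e1 - e6
      rw [← Complex.ofReal_neg]
      apply mul_right_cancel₀ hne
      rw [e7, ← Complex.ofReal_mul]
      congr 1
      have := (Dpos y).ne'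
      field_simp; ring
    have kC1 : C1 (k s) := fun y _ => kC.contDiffAt
    have h0 := int_dd iI (f := fun y => k s y * f y) (fun y hy => (kC1 y hy).mul (hC1 y hy))
    have h1 : ∀ θ : ℝ, f (bpt θ) = 0 := fun θ => hs _ (by rw [norm_bpt]; exact hr.le)
    simp only [h1, mul_zero, intervalIntegral.integral_zero] at h0
    rw [← sub_eq_zero, ← integral_sub]
    · refine Eq.trans ?_ h0
      refine setIntegral_congr_fun measurableSet_ball fun y hy => ?_
      have hy' := Metric.ball_subset_closedBall hy
      beta_reduce
      rw [dd_mul _ (kC1.diff hy') (hC1.diff hy'), ddk, Complex.real_smul]; ring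
    · exact intD (kC1.cont.mul (hC1.dd_cont _))
    · refine intD (ContinuousOn.fun_smul (Continuous.continuousOn ?_) hC1.cont)
      exact continuous_const.div (by fun_prop) fun y => (pow_pos (Dpos y) 2).ne'
  have lim2 : Tendsto (fun s : ℝ => ∫ y in BB, k s y * dd iI f y) (nhdsWithin 0 (Set.Ioi 0))
      (nhds (∫ y in BB, (z - y)⁻¹ * dd iI f y)) := by
    obtain ⟨C, hC, hR⟩ := rpow_disk (α := 1) (by norm_num) (by norm_num)
    have hR := (hR z).1
    obtain ⟨B, hB⟩ := (isCompact_closedBall (0:ℂ) 1).exists_bound_of_continuousOn (hC1.dd_cont iI)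
    have dc : Continuous (dd iI f) := by
      unfold dd
      exact (((hf1.continuous_fderiv (by norm_num)).clm_apply continuous_const).add (continuous_const.mul ((hf1.continuous_fderiv (by norm_num)).clm_apply continuous_const))).div_const 2
    refine tendsto_integral_filter_of_dominated_convergence (fun y => ‖y - z‖ ^ (-(1:ℝ)) * B) ?_ ?_ (hR.mul_const B) ?_
    · refine Eventually.of_forall fun s => AEStronglyMeasurable.mul ?_ dc.aestronglyMeasurable
      refine Measurable.aestronglyMeasurable ?_
      rw [hk]
      exact (Complex.continuous_conj.measurable.comp (by fun_prop)).mul (Complex.measurable_ofReal.comp (by fun_prop))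
    · filter_upwards [self_mem_nhdsWithin] with s hs0
      refine (ae_restrict_iff' measurableSet_ball).2 (Eventually.of_forall fun y hy => ?_)
      rw [norm_mul]
      refine mul_le_mul ?_ (hB y (Metric.ball_subset_closedBall hy)) (norm_nonneg _) (by positivity)
      have hs0' : (0:ℝ) < s := hs0
      rw [hk]; beta_reduce
      rw [norm_mul, RCLike.norm_conj, Complex.norm_real, norm_of_nonneg (by positivity), norm_sub_rev z y, rpow_neg_one, ← div_eq_mul_inv]
      rcases eq_or_lt_of_le (norm_nonneg (y - z)) with h | h
      · rw [← h]; simp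
      · rw [← one_div, div_le_div_iff₀ (by positivity) h]; nlinarith
    · refine Eventually.of_forall fun y => ?_
      refine Tendsto.mul_const _ ?_
      by_cases hy : y = z
      · subst hy; simp [hk]
      · have hn : 0 < ‖y - z‖ := norm_pos_iff.2 (sub_ne_zero.2 hy)
        have e : (z - y)⁻¹ = cj (z - y) * (((‖y - z‖ ^ 2 + 0 ^ 2)⁻¹ : ℝ) : ℂ) := by
          rw [Complex.inv_def, Complex.normSq_eq_norm_sq, norm_sub_rev z y]; simp
        rw [e]
        refine tendsto_nhdsWithin_of_tendsto_nhds (Tendsto.const_mul _ ((Complex.continuous_ofReal.tendsto _).comp (Tendsto.inv₀ ?_ (by positivity))))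
        exact Continuous.tendsto (by fun_prop) _
  have := tendsto_nhds_unique (lim2.congr' (by filter_upwards [self_mem_nhdsWithin] with s hs using ibp s hs)) lim1
  rw [this, Complex.real_smul, ← mul_assoc, inv_mul_cancel₀ (by exact_mod_cast pi_ne_zero), one_mul]

lemma inv_int_bd : ∃ C > (0:ℝ), ∀ z : ℂ, IntegrableOn (fun y => ‖(z - y)⁻¹‖) (Metric.ball 0 1) ∧
    ∫ y in BB, ‖(z - y)⁻¹‖ ≤ C := by
  obtain ⟨C, hC, h⟩ := rpow_disk (α := 1) (by norm_num) (by norm_num)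
  refine ⟨C, hC, fun z => ?_⟩
  have e : (fun y => ‖(z - y)⁻¹‖) = fun y => ‖y - z‖ ^ (-(1:ℝ)) := by
    ext y; rw [norm_inv, rpow_neg_one, norm_sub_rev]
  rw [e]; exact h z

lemma Tc_sup : ∃ C > (0:ℝ), ∀ {f : ℂ → ℂ} {r : ℝ} {B : ℝ}, r < 1 → (∀ x, r < ‖x‖ → f x = 0) → (∀ x, ‖f x‖ ≤ B) → ∀ z, ‖Tc f z‖ ≤ C * B := by
  obtain ⟨C, hC, h⟩ := inv_int_bd
  refine ⟨π⁻¹ * C, by positivity, ?_⟩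
  intro f r B hr hs hB z
  have hB0 : 0 ≤ B := (norm_nonneg _).trans (hB 0)
  rw [Tc_disk hr hs, norm_mul, norm_inv, Complex.norm_real, norm_of_nonneg pi_pos.le, mul_assoc]
  refine mul_le_mul_of_nonneg_left ?_ (by positivity)
  refine (norm_integral_le_of_norm_le ((h z).1.mul_const B) (Eventually.of_forall fun y => ?_)).trans ?_
  · rw [norm_mul]; exact mul_le_mul_of_nonneg_left (hB y) (norm_nonneg _)
  · rw [integral_mul_const]; exact mul_le_mul_of_nonneg_right (h z).2 hB0

lemma Tc_L1 : ∃ C > (0:ℝ), ∀ {f : ℂ → ℂ} {r : ℝ}, r < 1 → (∀ x, r < ‖x‖ → f x = 0) → Continuous f → AEStronglyMeasurable (Tc f) (volume.restrict (Metric.ball 0 1)) →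
    ∫ z in BB, ‖Tc f z‖ ≤ C * ∫ z in BB, ‖f z‖ := by
  obtain ⟨C, hC, h⟩ := inv_int_bd
  refine ⟨π⁻¹ * C, by positivity, ?_⟩
  intro f r hr hs hf hm
  have hi : Integrable f (volume.restrict BB) := (hf.continuousOn.integrableOn_compact (isCompact_closedBall (0:ℂ) 1)).mono_set Metric.ball_subset_closedBall
  rw [integral_norm_eq_lintegral_enorm hm]
  refine ENNReal.toReal_le_of_le_ofReal (by positivity) ?_
  calc ∫⁻ z in BB, ‖Tc f z‖ₑ ≤ ∫⁻ z in BB, ENNReal.ofReal π⁻¹ * ∫⁻ y in BB, ‖(z - y)⁻¹‖ₑ * ‖f y‖ₑ := by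
        refine lintegral_mono fun z => ?_
        rw [Tc_disk hr hs, enorm_mul]
        gcongr
        · rw [enorm_inv (by exact_mod_cast pi_ne_zero), ENNReal.ofReal_inv_of_pos pi_pos, ← ofReal_norm, Complex.norm_real, norm_of_nonneg pi_pos.le]
        · refine (enorm_integral_le_lintegral_enorm _).trans (lintegral_mono fun y => ?_)
          rw [enorm_mul]
    _ = ENNReal.ofReal π⁻¹ * ∫⁻ z in BB, ∫⁻ y in BB, ‖(z - y)⁻¹‖ₑ * ‖f y‖ₑ := by
        rw [lintegral_const_mul' _ _ ENNReal.ofReal_ne_top]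
    _ = ENNReal.ofReal π⁻¹ * ∫⁻ y in BB, ∫⁻ z in BB, ‖(z - y)⁻¹‖ₑ * ‖f y‖ₑ := by
        rw [lintegral_lintegral_swap]
        refine Measurable.aemeasurable ?_
        have := hf.measurable
        unfold Function.uncurry
        exact Measurable.mul (by fun_prop) ((this.comp measurable_snd).enorm)
    _ ≤ ENNReal.ofReal π⁻¹ * ∫⁻ y in BB, ENNReal.ofReal C * ‖f y‖ₑ := by
        gcongr with y
        rw [lintegral_mul_const' _ _ (by simp)]
        gcongr
        have e : ∀ z : ℂ, ‖(z - y)⁻¹‖ₑ = ‖(y - z)⁻¹‖ₑ := fun z => by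
          rw [← ofReal_norm, ← ofReal_norm, norm_inv, norm_inv, norm_sub_rev]
        simp only [e]
        have hq := h y
        rw [← ofReal_integral_norm_eq_lintegral_enorm]
        · exact ENNReal.ofReal_le_ofReal hq.2
        · refine (integrable_norm_iff (Measurable.aestronglyMeasurable (by fun_prop))).1 hq.1
    _ = ENNReal.ofReal (π⁻¹ * C * ∫ z in BB, ‖f z‖) := by
        rw [lintegral_const_mul' _ _ ENNReal.ofReal_ne_top, ← ofReal_integral_norm_eq_lintegral_enorm hi, ← mul_assoc, ← ENNReal.ofReal_mul (by positivity), ← ENNReal.ofReal_mul (by positivity)]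

def Sc (f : ℂ → ℂ) (z : ℂ) : ℂ := (π : ℂ)⁻¹ * ∫ y in BB, cj (f y) * (z * (1 - cj y * z)⁻¹)

lemma Sc_bpt {f : ℂ → ℂ} {r : ℝ} (hr : r < 1) (hs : ∀ x, r < ‖x‖ → f x = 0) (θ : ℝ) : Sc f (bpt θ) = cj (Tc f (bpt θ)) := by
  rw [Tc_disk hr hs, Sc, map_mul, ← integral_conj, map_inv₀, Complex.conj_ofReal]
  congr 1
  refine setIntegral_congr_fun measurableSet_ball fun y hy => ?_
  beta_reduce
  rw [map_mul, map_inv₀, map_sub]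
  have hzb : cj (bpt θ) * bpt θ = 1 := by
    rw [mul_comm, Complex.mul_conj, Complex.normSq_eq_norm_sq, norm_bpt]; simp
  have hb0 : bpt θ ≠ 0 := right_ne_zero_of_mul (hzb.symm ▸ one_ne_zero)
  have : 1 - cj y * bpt θ = bpt θ * (cj (bpt θ) - cj y) := by linear_combination -hzb
  rw [this, mul_inv, ← mul_assoc (bpt θ), mul_inv_cancel₀ hb0, one_mul, mul_comm]

lemma Sc_deriv {f : ℂ → ℂ} {r B : ℝ} (hr0 : 0 < r) (hr : r < 1) (hf : Continuous f) (hs : ∀ x, r ≤ ‖x‖ → f x = 0) (hB : ∀ x, ‖f x‖ ≤ B) {z : ℂ}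
    (hz : ‖z‖ < 2 / (1 + r)) : HasDerivAt (Sc f) ((π : ℂ)⁻¹ * ∫ y in BB, cj (f y) * ((1 - cj y * z) ^ 2)⁻¹) z := by
  have hB0 : 0 ≤ B := (norm_nonneg _).trans (hB 0)
  set m := (1 - r) / (1 + r) with hm
  have hm0 : 0 < m := div_pos (by linarith) (by linarith)
  have lb : ∀ y : ℂ, ‖y‖ < r → ∀ z : ℂ, ‖z‖ < 2 / (1 + r) → m ≤ ‖1 - cj y * z‖ := by
    intro y hy z hz
    have h1 : ‖(1:ℂ)‖ - ‖cj y * z‖ ≤ ‖1 - cj y * z‖ := norm_sub_norm_le _ _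
    rw [norm_one, norm_mul, RCLike.norm_conj] at h1
    have h2 : ‖y‖ * ‖z‖ ≤ r * (2 / (1 + r)) := mul_le_mul hy.le hz.le (norm_nonneg _) hr0.le
    have h3 : 1 - r * (2 / (1 + r)) = m := by rw [hm]; field_simp; ring
    linarith
  have hfm := hf.measurable
  have mc : Measurable fun y => cj (f y) := Complex.continuous_conj.measurable.comp hfm
  have mc2 : Measurable fun y : ℂ => cj y := Complex.continuous_conj.measurable
  have hmeas1 : ∀ z : ℂ, Measurable fun y => cj (f y) * (z * (1 - cj y * z)⁻¹) := fun z => by fun_prop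
  have hmeas2 : ∀ z : ℂ, Measurable fun y => cj (f y) * ((1 - cj y * z) ^ 2)⁻¹ := fun z => by fun_prop
  have hdom : ∀ y z : ℂ, ‖z‖ < 2 / (1 + r) → ‖cj (f y) * ((1 - cj y * z) ^ 2)⁻¹‖ ≤ B * (m ^ 2)⁻¹ := by
    intro y z hz
    by_cases hy : ‖y‖ < r
    · rw [norm_mul, RCLike.norm_conj, norm_inv, norm_pow]
      have := lb y hy z hz
      gcongr
      exact hB y
    · rw [hs y (not_lt.1 hy)]; simp; positivity
  have hfin : IsFiniteMeasure (volume.restrict BB) := ⟨by simpa using measure_ball_lt_top⟩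
  have key := hasDerivAt_integral_of_dominated_loc_of_deriv_le (μ := volume.restrict BB) (𝕜 := ℂ)
    (F := fun z y => cj (f y) * (z * (1 - cj y * z)⁻¹))
    (F' := fun z y => cj (f y) * ((1 - cj y * z) ^ 2)⁻¹) (x₀ := z) (s := Metric.ball 0 (2 / (1 + r)))
    (bound := fun _ => B * (m ^ 2)⁻¹)
    (Metric.isOpen_ball.mem_nhds (by simpa using hz)) (Eventually.of_forall fun z => (hmeas1 z).aestronglyMeasurable) ?_
    (hmeas2 z).aestronglyMeasurable (Eventually.of_forall fun y z hz => hdom y z (by simpa using hz)) (integrable_const _) ?_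
  · exact key.2.const_mul _
  · refine Integrable.mono' (integrable_const (B * (2 / (1 + r) * m⁻¹))) (hmeas1 z).aestronglyMeasurable (Eventually.of_forall fun y => ?_)
    by_cases hy : ‖y‖ < r
    · rw [norm_mul, RCLike.norm_conj, norm_mul, norm_inv]
      have := lb y hy z hz
      gcongr
      exact hB y
    · rw [hs y (not_lt.1 hy)]; simp; positivity
  · refine Eventually.of_forall fun y z hz => ?_
    by_cases hy : ‖y‖ < r
    · have hne : 1 - cj y * z ≠ 0 := norm_pos_iff.1 (hm0.trans_le (lb y hy z (by simpa using hz)))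
      have h1 : HasDerivAt (fun z => 1 - cj y * z) (-(cj y)) z := by
        simpa using ((hasDerivAt_id z).const_mul (cj y)).const_sub 1
      have h2 := ((hasDerivAt_id z).mul (h1.inv hne)).const_mul (cj (f y))
      refine h2.congr_deriv ?_
      congr 1
      simp only [id]
      simp
      field_simp
      ring
    · rw [hs y (not_lt.1 hy)]; simp; exact hasDerivAt_const _ _

lemma dd_holo (ω : ℂ) {f : ℂ → ℂ} {f' z : ℂ} (h : HasDerivAt f f' z) : dd ω f z = f' * (1 + ω * iI) / 2 := by
  have h1 := h.hasFDerivAt.restrictScalars ℝ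
  rw [dd, h1.fderiv]; simp; ring

theorem exists_Y {r : ℝ} (hr0 : 0 < r) (hr : r < 1) : ∃ K > 0, ∀ {β : ℂ → ℂ} {B : ℝ}, ContDiff ℝ 2 β → (∀ x, r ≤ ‖x‖ → β x = 0) → (∀ x, ‖β x‖ ≤ B) →
    ∃ Y S S' : ℂ → ℂ, C2 Y ∧ (∀ z, ‖z‖ < 1 → dd iI Y z = β z) ∧ (∀ θ, Y (bpt θ) = -2 * iI * (S (bpt θ)).im) ∧
      (∀ z, ‖z‖ ≤ 1 → HasDerivAt S (S' z) z ∧ ‖S z‖ ≤ K * B ∧ ‖S' z‖ ≤ K * B ∧ ‖Y z‖ ≤ K * B) ∧ ContinuousOn S' (Metric.closedBall 0 1) ∧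
      ∫ z in BB, ‖dd (-iI) Y z‖ ≤ K * (B + ∫ z in BB, ‖dd (-iI) β z‖) := by
  obtain ⟨K1, hK1, h1⟩ := Tc_sup
  obtain ⟨K2, hK2, h2⟩ := Tc_L1
  have q : 0 < 1 - r := by linarith
  refine ⟨K1 + K2 + (1 - r)⁻¹ + ((1 - r) ^ 2)⁻¹ * (1 + π), by positivity, ?_⟩
  intro β B hβ hs hB
  have hB0 : 0 ≤ B := (norm_nonneg _).trans (hB 0)
  have pp := pi_pos
  have hs' : ∀ x, r < ‖x‖ → β x = 0 := fun x hx => hs x hx.le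
  have hβ1 : ContDiff ℝ 1 β := hβ.of_le (by norm_num)
  have hT := Tc_contDiff hβ hs
  have h1r : (1:ℝ) < 2 / (1 + r) := by rw [lt_div_iff₀ (by linarith)]; linarith
  have hSd : ∀ z, ‖z‖ < 2 / (1 + r) → HasDerivAt (Sc β) (deriv (Sc β) z) z := fun z hz => (Sc_deriv hr0 hr hβ.continuous hs hB hz).differentiableAt.hasDerivAt
  have hSan : ∀ z, ‖z‖ ≤ 1 → AnalyticAt ℂ (Sc β) z := by
    intro z hz
    have : DifferentiableOn ℂ (Sc β) (Metric.ball 0 (2 / (1 + r))) := fun z hz => (hSd z (by simpa using hz)).differentiableAt.differentiableWithinAt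
    exact this.analyticAt (Metric.isOpen_ball.mem_nhds (by simpa using hz.trans_lt h1r))
  have hSC2 : C2 (Sc β) := fun z hz => (hSan z (by simpa using hz)).contDiffAt.restrict_scalars ℝ
  have hS'c : ContinuousOn (deriv (Sc β)) (Metric.closedBall 0 1) := fun z hz => (hSan z (by simpa using hz)).deriv.continuousAt.continuousWithinAt
  have lb : ∀ y z : ℂ, ‖y‖ < r → ‖z‖ ≤ 1 → 1 - r ≤ ‖1 - cj y * z‖ := by
    intro y z hy hz
    have h1 : ‖(1:ℂ)‖ - ‖cj y * z‖ ≤ ‖1 - cj y * z‖ := norm_sub_norm_le _ _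
    rw [norm_one, norm_mul, RCLike.norm_conj] at h1
    nlinarith [norm_nonneg y, norm_nonneg z]
  have bdint : ∀ {g : ℂ → ℂ} {D : ℝ}, (∀ y, ‖g y‖ ≤ D) → ‖(π : ℂ)⁻¹ * ∫ y in BB, g y‖ ≤ D := by
    intro g D hg
    rw [norm_mul, norm_inv, Complex.norm_real, norm_of_nonneg pp.le]
    have := norm_setIntegral_le_of_norm_le_const (μ := volume) (s := BB) (f := g) (C := D) measure_ball_lt_top (fun y _ => hg y)
    rw [Measure.real, vol_ball] at this
    rw [inv_mul_le_iff₀ pp]; linarith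
  have hSb : ∀ z, ‖z‖ ≤ 1 → ‖Sc β z‖ ≤ (1 - r)⁻¹ * B := by
    intro z hz
    refine bdint fun y => ?_
    by_cases hy : ‖y‖ < r
    · rw [norm_mul, RCLike.norm_conj, norm_mul, norm_inv]
      have := lb y z hy hz
      calc ‖β y‖ * (‖z‖ * ‖1 - cj y * z‖⁻¹) ≤ B * (1 * (1 - r)⁻¹) := by
            gcongr
            exact hB y
        _ = _ := by ring
    · rw [hs y (not_lt.1 hy)]; simp; positivity
  have hS'b : ∀ z, ‖z‖ ≤ 1 → ‖deriv (Sc β) z‖ ≤ ((1 - r) ^ 2)⁻¹ * B := by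
    intro z hz
    rw [(Sc_deriv hr0 hr hβ.continuous hs hB (hz.trans_lt h1r)).deriv]
    refine bdint fun y => ?_
    by_cases hy : ‖y‖ < r
    · rw [norm_mul, RCLike.norm_conj, norm_inv, norm_pow]
      have := lb y z hy hz
      calc ‖β y‖ * (‖1 - cj y * z‖ ^ 2)⁻¹ ≤ B * ((1 - r) ^ 2)⁻¹ := by
            gcongr
            exact hB y
        _ = _ := by ring
    · rw [hs y (not_lt.1 hy)]; simp; positivity
  have hTC2 : C2 (Tc β) := fun z _ => hT.contDiffAt
  have hdd : ∀ ω z, ‖z‖ ≤ 1 → dd ω (fun z => Tc β z - Sc β z) z = Tc (dd ω β) z - deriv (Sc β) z * (1 + ω * iI) / 2 := by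
    intro ω z hz
    have hz' : z ∈ CB := by simpa using hz
    rw [dd_sub _ (hTC2.C1.diff hz') (hSC2.C1.diff hz'), Tc_dd ω hβ hs, dd_holo _ (hSd z (hz.trans_lt h1r))]
  refine ⟨fun z => Tc β z - Sc β z, Sc β, deriv (Sc β), fun z hz => (hTC2 z hz).sub (hSC2 z hz), ?_, ?_, ?_, hS'c, ?_⟩
  · intro z hz
    rw [hdd _ z hz.le, pompeiu hr hβ hs hz, Complex.I_mul_I]; ring
  · intro θ
    beta_reduce
    rw [Sc_bpt hr hs']
    generalize Tc β (bpt θ) = T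
    apply Complex.ext
    · simp
    · simp; ring
  · intro z hz
    have e1 := hSb z hz
    have e2 := hS'b z hz
    have e3 := h1 hr hs' hB z
    have f1 : 0 ≤ (1 - r)⁻¹ * B := by positivity
    have f2 : 0 ≤ ((1 - r) ^ 2)⁻¹ * B := by positivity
    have f3 : 0 ≤ ((1 - r) ^ 2)⁻¹ * B * π := by positivity
    have f4 : 0 ≤ K1 * B := by positivity
    have f5 : 0 ≤ K2 * B := by positivity
    have g := norm_sub_le (Tc β z) (Sc β z)
    refine ⟨hSd z (hz.trans_lt h1r), ?_, ?_, ?_⟩ <;> nlinarith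
  · have hsd : ∀ x, r < ‖x‖ → dd (-iI) β x = 0 := by
      intro x hx; rw [dd, fderiv_supp hβ1 hs x hx]; simp
    have dc : Continuous (dd (-iI) β) := by
      unfold dd
      exact (((hβ1.continuous_fderiv (by norm_num)).clm_apply continuous_const).add (continuous_const.mul ((hβ1.continuous_fderiv (by norm_num)).clm_apply continuous_const))).div_const 2
    have hTd : ContinuousOn (Tc (dd (-iI) β)) (Metric.closedBall 0 1) := by
      have : Tc (dd (-iI) β) = dd (-iI) (Tc β) := by ext z; rw [Tc_dd _ hβ hs]
      rw [this]; exact hTC2.C1.dd_cont _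
    have e := h2 hr hsd dc ((hTd.mono Metric.ball_subset_closedBall).aestronglyMeasurable measurableSet_ball)
    have i1 := (intD hTd).norm
    have : ∫ z in BB, ‖dd (-iI) (fun z => Tc β z - Sc β z) z‖ ≤ ∫ z in BB, (‖Tc (dd (-iI) β) z‖ + ((1 - r) ^ 2)⁻¹ * B) := by
      have hfin : IsFiniteMeasure (volume.restrict BB) := ⟨by simpa using measure_ball_lt_top⟩
      refine setIntegral_mono_on ?_ (i1.add (integrable_const _)) measurableSet_ball fun z hz => ?_
      · have : C2 (fun z => Tc β z - Sc β z) := fun z hz => (hTC2 z hz).sub (hSC2 z hz)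
        exact (intD (this.C1.dd_cont _)).norm
      · have hz' : ‖z‖ ≤ 1 := by simp at hz; exact hz.le
        rw [hdd _ z hz']
        refine (norm_sub_le _ _).trans (add_le_add le_rfl ?_)
        have : deriv (Sc β) z * (1 + -iI * iI) / 2 = deriv (Sc β) z := by rw [neg_mul, Complex.I_mul_I]; ring
        rw [this]; exact hS'b z hz'
    have hfin : IsFiniteMeasure (volume.restrict BB) := ⟨by simpa using measure_ball_lt_top⟩
    rw [integral_add i1 (integrable_const _), int_const] at this
    have n0 : 0 ≤ ∫ z in BB, ‖dd (-iI) β z‖ := integral_nonneg fun _ => norm_nonneg _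
    generalize ∫ z in BB, ‖dd (-iI) β z‖ = J at *
    have f1 : 0 ≤ (1 - r)⁻¹ := by positivity
    have f2 : 0 ≤ ((1 - r) ^ 2)⁻¹ := by positivity
    generalize (1 - r)⁻¹ = P at *
    generalize ((1 - r) ^ 2)⁻¹ = R at *
    have g1 : 0 ≤ (K1 + P + R * (1 + π)) * J := by positivity
    have g2 : 0 ≤ (K1 + K2 + P + R) * B := by positivity
    nlinarith

lemma ibp_dd (ω : ℂ) {f g : ℂ → ℂ} (hf : C1 f) (hg : C1 g) (h0 : ∀ θ, g (bpt θ) = 0) :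
    ∫ x in BB, f x * dd ω g x = -∫ x in BB, dd ω f x * g x := by
  have h := int_dd ω (f := fun y => f y * g y) (fun y hy => (hf y hy).mul (hg y hy))
  simp only [h0, mul_zero, intervalIntegral.integral_zero] at h
  rw [eq_neg_iff_add_eq_zero, ← integral_add (intD (hf.cont.fun_mul (hg.dd_cont ω))) (intD ((hf.dd_cont ω).fun_mul hg.cont))]
  refine Eq.trans (setIntegral_congr_fun measurableSet_ball fun y hy => ?_) h
  have hy' := Metric.ball_subset_closedBall hy
  beta_reduce
  rw [dd_mul _ (hf.diff hy') (hg.diff hy')]; ring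

def EE (v : ℂ → ℝ) (x : ℂ) : ℂ := ((exp ((-1/2 : ℝ) * v x) : ℝ) : ℂ)

lemma EE_C2 {v : ℂ → ℝ} (hv : C2 v) : C2 (EE v) := ofRealC2 fun x hx => (contDiffAt_const.mul (hv x hx)).exp

lemma EE_ibp {v : ℂ → ℝ} (hv : C2 v) {Ψ : ℂ → ℂ} {r : ℝ} (hr : r < 1) (hΨ : ContDiff ℝ 2 Ψ) (hs : ∀ x, r ≤ ‖x‖ → Ψ x = 0) :
    ∫ x in BB, EE v x * dd (-iI) (dd (-iI) Ψ) x = -(1/2) * ∫ x in BB, Qh v x * (EE v x * Ψ x) := by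
  have hC2 : C2 Ψ := fun x _ => hΨ.contDiffAt
  have h1 : ∀ θ, Ψ (bpt θ) = 0 := fun θ => hs _ (by rw [norm_bpt]; exact hr.le)
  have h2 : ∀ θ, dd (-iI) Ψ (bpt θ) = 0 := fun θ => by
    rw [dd, fderiv_supp (hΨ.of_le (by norm_num)) hs _ (by rw [norm_bpt]; exact hr)]; simp
  have cEZ : C1 (fun x => EE v x * vz v x) := fun x hx => ((EE_C2 hv).C1 x hx).mul (vz_C1 hv x hx)
  rw [ibp_dd _ (EE_C2 hv).C1 (hC2.dd _) h2]
  have e1 : ∫ x in BB, dd (-iI) (EE v) x * dd (-iI) Ψ x = ∫ x in BB, (-(1/2) : ℂ) * ((EE v x * vz v x) * dd (-iI) Ψ x) := by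
    refine setIntegral_congr_fun measurableSet_ball fun y hy => ?_
    have := dz_exp (-1/2) hv.C1 (Metric.ball_subset_closedBall hy)
    change dd (-iI) (EE v) y = _ at this
    beta_reduce
    rw [this, EE]; push_cast; ring
  rw [e1, integral_const_mul, ibp_dd _ cEZ hC2.C1 h1, ← neg_mul_eq_neg_mul, mul_neg, neg_neg, neg_mul]
  congr 2
  refine setIntegral_congr_fun measurableSet_ball fun y hy => ?_
  have hy' := Metric.ball_subset_closedBall hy
  have := dz_exp (-1/2) hv.C1 hy'
  change dd (-iI) (EE v) y = _ at this
  beta_reduce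
  rw [dd_mul _ ((EE_C2 hv).C1.diff hy') ((vz_C1 hv).diff hy'), this, Qh, EE]; push_cast; ring

lemma vz_norm (v : ℂ → ℝ) (x : ℂ) : ‖vz v x‖ ≤ 1 + gradSq v x := by
  have h : ‖vz v x‖ ^ 2 = gradSq v x / 4 := by
    have : vz v x = ((pd v 1 x / 2 : ℝ) : ℂ) + ((-(pd v iI x) / 2 : ℝ) : ℂ) * iI := by rw [vz]; push_cast; ring
    rw [this, Complex.sq_norm, Complex.normSq_add_mul_I, gradSq]; ring
  nlinarith [sq_nonneg (‖vz v x‖ - 1)]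

lemma vz_L1 (Λ : ℝ) : ∃ K > 0, ∀ {δ κ : ℝ} {p : ℂ} {A C : ℝ} {v : ℂ → ℝ},
    Cfg Λ δ κ p A C v → (∫ x in BB, ‖vz v x‖ ≤ K) := by
  obtain ⟨K, hK, h⟩ := cfg_energy Λ
  refine ⟨π * 1 + K, by positivity, ?_⟩
  intro δ κ p A C v c
  have hfin : IsFiniteMeasure (volume.restrict BB) := ⟨by simpa using measure_ball_lt_top⟩
  have ig := intD (gradSq_cont c.hv.C1)
  have : ∫ x in BB, ‖vz v x‖ ≤ ∫ x in BB, (1 + gradSq v x) :=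
    integral_mono (intD (vz_C1 c.hv).cont).norm ((integrable_const _).add ig) fun x => vz_norm v x
  rw [integral_add (integrable_const _) ig, int_const] at this
  linarith [h c]

lemma EE_bd {Λ δ κ : ℝ} {p : ℂ} {A C : ℝ} {v : ℂ → ℝ} (c : Cfg Λ δ κ p A C v) {x : ℂ} (hx : ‖x‖ ≤ 1) : ‖EE v x‖ ≤ exp Λ := by
  rw [EE, Complex.norm_real, norm_of_nonneg (exp_pos _).le]
  apply exp_le_exp.2
  have := (abs_le.1 (c.hb x (by simpa using hx))).1
  have := c.Λpos
  linarith

def bet (v : ℂ → ℝ) (p : ℂ) (Ψ : ℂ → ℂ) (x : ℂ) : ℂ := EE v x * (Ψ x * (p * ((x + p) ^ 2)⁻¹))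

lemma xp_lb {p x : ℂ} (hp : ‖p‖ = 1) : 1 - ‖x‖ ≤ ‖x + p‖ := by
  have := norm_sub_norm_le p (-x)
  rw [norm_neg, hp, sub_neg_eq_add, add_comm p x] at this
  exact this

theorem bet_props (Λ : ℝ) {Ψ : ℂ → ℂ} {r : ℝ} (hr : r < 1) (hΨ : ContDiff ℝ 2 Ψ) (hs : ∀ x, r ≤ ‖x‖ → Ψ x = 0) :
    ∃ B > 0, ∀ {δ κ : ℝ} {p : ℂ} {A C : ℝ} {v : ℂ → ℝ}, Cfg Λ δ κ p A C v → ContDiff ℝ 2 (bet v p Ψ) ∧ (∀ x, r ≤ ‖x‖ → bet v p Ψ x = 0) ∧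
      (∀ x, ‖bet v p Ψ x‖ ≤ B) ∧ ∫ x in BB, ‖dd (-iI) (bet v p Ψ) x‖ ≤ B := by
  obtain ⟨K, hK, hL1⟩ := vz_L1 Λ
  have hΨ1 : ContDiff ℝ 1 Ψ := hΨ.of_le (by norm_num)
  have hC1 : C1 Ψ := fun x _ => hΨ1.contDiffAt
  obtain ⟨b0, hb0⟩ := (isCompact_closedBall (0:ℂ) 1).exists_bound_of_continuousOn hC1.cont
  obtain ⟨b1, hb1⟩ := (isCompact_closedBall (0:ℂ) 1).exists_bound_of_continuousOn (hC1.dd_cont (-iI))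
  have hb00 : 0 ≤ b0 := (norm_nonneg _).trans (hb0 0 (by simp))
  have hb10 : 0 ≤ b1 := (norm_nonneg _).trans (hb1 0 (by simp))
  have q : 0 < 1 - r := by linarith
  set R := ((1 - r) ^ 2)⁻¹ with hR
  set R3 := ((1 - r) ^ 3)⁻¹ with hR3
  have hR0 : 0 < R := by positivity
  have hR30 : 0 < R3 := by positivity
  set Q := exp Λ with hQ
  have hQ0 : 0 < Q := exp_pos _
  have pp := pi_pos
  refine ⟨Q * (b0 * R) + K * (Q * (b0 * R)) + π * (Q * (b1 * R + 2 * b0 * R3)) + 1, by positivity, ?_⟩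
  intro δ κ p A C v c
  have hp := c.hp
  have hsup : ∀ x, r ≤ ‖x‖ → bet v p Ψ x = 0 := fun x hx => by rw [bet, hs x hx]; simp
  have hne : ∀ x : ℂ, ‖x‖ < 1 → x + p ≠ 0 := fun x hx => norm_pos_iff.1 (by linarith [xp_lb (x := x) hp])
  have hcd : ContDiff ℝ 2 (bet v p Ψ) := by
    rw [contDiff_iff_contDiffAt]
    intro x
    by_cases hx : ‖x‖ < 1
    · have h1 := EE_C2 c.hv x (by simpa using hx.le)
      refine h1.mul (hΨ.contDiffAt.mul (contDiffAt_const.mul (ContDiffAt.inv ?_ (pow_ne_zero 2 (hne x hx)))))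
      exact (contDiffAt_id.add contDiffAt_const).pow 2
    · have : bet v p Ψ =ᶠ[nhds x] fun _ => 0 := by
        filter_upwards [(continuous_norm.isOpen_preimage _ isOpen_Ioi).mem_nhds (show x ∈ norm ⁻¹' Set.Ioi r from (hr.trans_le (not_lt.1 hx)))] with y hy
        exact hsup y (le_of_lt hy)
      exact contDiffAt_const.congr_of_eventuallyEq this
  have hgb : ∀ x, ‖x‖ < 1 → ‖Ψ x * (p * ((x + p) ^ 2)⁻¹)‖ ≤ b0 * R := by
    intro x hx
    by_cases hxr : r ≤ ‖x‖
    · rw [hs x hxr]; simp; positivity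
    · rw [norm_mul, norm_mul, hp, one_mul, norm_inv, norm_pow]
      have := xp_lb (x := x) hp
      have h3 : 1 - r ≤ ‖x + p‖ := by linarith
      rw [hR]
      gcongr
      exact hb0 x (by simpa using hx.le)
  have hdg : ∀ x, ‖x‖ < 1 → ‖dd (-iI) (fun x => Ψ x * (p * ((x + p) ^ 2)⁻¹)) x‖ ≤ b1 * R + 2 * b0 * R3 := by
    intro x hx
    have hd : HasDerivAt (fun x => p * ((x + p) ^ 2)⁻¹) (p * (-(2 * (x + p)) / ((x + p) ^ 2) ^ 2)) x := by
      have := ((((hasDerivAt_id x).add_const p).pow 2).inv (pow_ne_zero 2 (hne x hx))).const_mul p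
      simpa using this
    have hdR : DifferentiableAt ℝ (fun x => p * ((x + p) ^ 2)⁻¹) x := hd.differentiableAt.restrictScalars ℝ
    have hx' : x ∈ CB := by simpa using hx.le
    rw [dd_mul _ (hC1.diff hx') hdR, dd_holo _ hd]
    by_cases hxr : r < ‖x‖
    · rw [hs x hxr.le, dd, fderiv_supp hΨ1 hs x hxr]; simp; positivity
    · have h3 : 1 - r ≤ ‖x + p‖ := by linarith [xp_lb (x := x) hp]
      refine (norm_add_le _ _).trans (add_le_add ?_ ?_)
      · rw [norm_mul, norm_mul, hp, one_mul, norm_inv, norm_pow, hR]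
        gcongr
        exact hb1 x hx'
      · have e : p * (-(2 * (x + p)) / ((x + p) ^ 2) ^ 2) * (1 + -iI * iI) / 2 = -2 * p * ((x + p) ^ 3)⁻¹ := by
          have := hne x hx
          rw [neg_mul, Complex.I_mul_I]; field_simp; norm_num
        rw [e, norm_mul, norm_mul, norm_mul, hp, norm_inv, norm_pow, hR3]
        simp only [norm_neg, Complex.norm_ofNat, mul_one]
        calc ‖Ψ x‖ * (2 * (‖x + p‖ ^ 3)⁻¹) ≤ b0 * (2 * ((1 - r) ^ 3)⁻¹) := by
              gcongr
              exact hb0 x hx'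
          _ = _ := by ring
  refine ⟨hcd, hsup, ?_, ?_⟩
  · intro x
    have : 0 ≤ K * (Q * (b0 * R)) + π * (Q * (b1 * R + 2 * b0 * R3)) + 1 := by positivity
    by_cases hx : ‖x‖ < 1
    · have h1 := EE_bd c hx.le
      have h2 := mul_le_mul h1 (hgb x hx) (norm_nonneg _) hQ0.le
      rw [bet, norm_mul]; linarith
    · rw [hsup x (by linarith)]; simp; positivity
  · have hfin : IsFiniteMeasure (volume.restrict BB) := ⟨by simpa using measure_ball_lt_top⟩
    have iz := (intD (vz_C1 c.hv).cont).norm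
    have hcC1 : C1 (bet v p Ψ) := fun x _ => (hcd.of_le (by norm_num)).contDiffAt
    have : ∫ x in BB, ‖dd (-iI) (bet v p Ψ) x‖ ≤ ∫ x in BB, (‖vz v x‖ * (Q * (b0 * R)) + Q * (b1 * R + 2 * b0 * R3)) := by
      refine setIntegral_mono_on (intD (hcC1.dd_cont _)).norm ((iz.mul_const _).add (integrable_const _)) measurableSet_ball fun x hx => ?_
      have hx' := Metric.ball_subset_closedBall hx
      have hx1 : ‖x‖ < 1 := by simpa using hx
      have dg : DifferentiableAt ℝ (fun x => Ψ x * (p * ((x + p) ^ 2)⁻¹)) x := by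
        have h2 : DifferentiableAt ℂ (fun x => p * ((x + p) ^ 2)⁻¹) x := by
          have := hne x hx1
          fun_prop (disch := simpa using this)
        exact (hC1.diff hx').fun_mul (h2.restrictScalars ℝ)
      have e0 := dz_exp (-1/2) c.hv.C1 hx'
      change dd (-iI) (EE v) x = _ at e0
      have e : dd (-iI) (bet v p Ψ) x = (-(1/2) * (EE v x * vz v x)) * (Ψ x * (p * ((x + p) ^ 2)⁻¹)) + EE v x * dd (-iI) (fun x => Ψ x * (p * ((x + p) ^ 2)⁻¹)) x := by
        have := dd_mul (-iI) ((EE_C2 c.hv).C1.diff hx') dg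
        change dd (-iI) (bet v p Ψ) x = _ at this
        rw [this, e0, EE]; push_cast; ring
      have n1 := EE_bd c hx1.le
      rw [e]
      refine (norm_add_le _ _).trans (add_le_add ?_ ?_)
      · rw [norm_mul, norm_mul, norm_mul]
        have n2 : ‖(-(1/2) : ℂ)‖ ≤ 1 := by norm_num
        calc ‖(-(1/2) : ℂ)‖ * (‖EE v x‖ * ‖vz v x‖) * ‖Ψ x * (p * ((x + p) ^ 2)⁻¹)‖ ≤ 1 * (Q * ‖vz v x‖) * (b0 * R) := by
              gcongr
              exact hgb x hx1
          _ = _ := by ring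
      · rw [norm_mul]; exact mul_le_mul n1 (hdg x hx1) (norm_nonneg _) hQ0.le
    rw [integral_add (iz.mul_const _) (integrable_const _), int_const, integral_mul_const] at this
    have h3 := mul_le_mul_of_nonneg_right (hL1 c) (show 0 ≤ Q * (b0 * R) by positivity)
    have : 0 ≤ Q * (b0 * R) := by positivity
    linarith

namespace Cfg
variable {Λ δ κ : ℝ} {p : ℂ} {A C : ℝ} {v : ℂ → ℝ} (c : Cfg Λ δ κ p A C v)
include c
lemma Gt (θ : ℝ) : |GG A C v (bpt θ)| * ‖bpt θ + p‖ ≤ Λ * (δ + κ) ∧ |GG A C v (bpt θ)| * ‖bpt θ + p‖ ^ 2 ≤ (2 + Λ) * Λ * δ := by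
  have h := c.hG θ
  have ht := c.tpos (bpt θ)
  have hd := c.hδ
  have hL := c.Λpos
  have hk := c.hκ
  set t := ‖bpt θ + p‖ with htd
  have t0 : 0 ≤ t := norm_nonneg _
  have t2 : t ≤ 2 := by have := norm_add_le (bpt θ) p; rw [norm_bpt, c.hp] at this; linarith
  have e1 : ((δ + t) ^ 1)⁻¹ * t ≤ 1 := by rw [pow_one, inv_mul_le_iff₀ ht]; linarith
  have e2 : δ * ((δ + t) ^ 2)⁻¹ * t ≤ 1 := by rw [mul_comm δ, mul_assoc, inv_mul_le_iff₀ (by positivity)]; nlinarith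
  have e3 : ((δ + t) ^ 2)⁻¹ * t ^ 2 ≤ 1 := by rw [inv_mul_le_iff₀ (by positivity)]; nlinarith
  have h' : |GG A C v (bpt θ)| ≤ _ := h
  constructor
  · calc |GG A C v (bpt θ)| * t ≤ _ * t := mul_le_mul_of_nonneg_right h' t0
      _ = Λ * (δ * (((δ + t) ^ 1)⁻¹ * t) + κ * (δ * ((δ + t) ^ 2)⁻¹ * t)) := by ring
      _ ≤ Λ * (δ * 1 + κ * 1) := by gcongr
      _ = _ := by ring
  · calc |GG A C v (bpt θ)| * t ^ 2 ≤ _ * t ^ 2 := mul_le_mul_of_nonneg_right h' (sq_nonneg t)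
      _ = Λ * (δ * ((((δ + t) ^ 1)⁻¹ * t) * t) + κ * δ * (((δ + t) ^ 2)⁻¹ * t ^ 2)) := by ring
      _ ≤ Λ * (δ * (1 * 2) + Λ * δ * 1) := by gcongr; exact c.hκ1
      _ = _ := by ring

lemma Ft {x : ℂ} (hx : x ∈ BB) : |FF A C v x| * ‖x + p‖ ≤ Λ * (δ + κ * δ ^ 2 * ((δ + ‖x + p‖) ^ 3)⁻¹) ∧
    |FF A C v x| * ‖x + p‖ ^ 2 ≤ 2 * Λ * (δ + κ) := by
  have h := c.hF x hx
  have ht := c.tpos x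
  have hd := c.hδ
  have hL := c.Λpos
  have hk := c.hκ
  have hx' : ‖x‖ < 1 := by simpa using hx
  set t := ‖x + p‖ with htd
  have t0 : 0 ≤ t := norm_nonneg _
  have t2 : t ≤ 2 := by have := norm_add_le x p; rw [c.hp] at this; linarith
  have e1 : ((δ + t) ^ 1)⁻¹ * t ≤ 1 := by rw [pow_one, inv_mul_le_iff₀ ht]; linarith
  have e1' : (δ + t)⁻¹ * t ≤ 1 := by simpa using e1
  have e3 : δ ^ 2 * ((δ + t) ^ 4)⁻¹ * t ^ 2 ≤ 1 := by
    rw [mul_comm (δ ^ 2), mul_assoc, inv_mul_le_iff₀ (by positivity)]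
    have : δ * t ≤ (δ + t) ^ 2 := by nlinarith
    calc δ ^ 2 * t ^ 2 = (δ * t) ^ 2 := by ring
      _ ≤ ((δ + t) ^ 2) ^ 2 := by gcongr
      _ = _ := by ring
  have h' : |FF A C v x| ≤ _ := h
  constructor
  · calc |FF A C v x| * t ≤ _ * t := mul_le_mul_of_nonneg_right h' t0
      _ = Λ * (δ * (((δ + t) ^ 1)⁻¹ * t) + κ * δ ^ 2 * ((δ + t) ^ 3)⁻¹ * ((δ + t)⁻¹ * t)) := by
        rw [show (δ + t) ^ 4 = (δ + t) ^ 3 * (δ + t) by ring, mul_inv]; ring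
      _ ≤ Λ * (δ * 1 + κ * δ ^ 2 * ((δ + t) ^ 3)⁻¹ * 1) := by gcongr
      _ = _ := by ring
  · calc |FF A C v x| * t ^ 2 ≤ _ * t ^ 2 := mul_le_mul_of_nonneg_right h' (sq_nonneg t)
      _ = Λ * (δ * ((((δ + t) ^ 1)⁻¹ * t) * t) + κ * (δ ^ 2 * ((δ + t) ^ 4)⁻¹ * t ^ 2)) := by ring
      _ ≤ Λ * (δ * (1 * 2) + κ * 1) := by gcongr
      _ ≤ _ := by nlinarith
end Cfg

lemma tt_bpt {p : ℂ} (hp : ‖p‖ = 1) (θ : ℝ) : (bpt θ + p) ^ 2 * p⁻¹ = bpt θ * ((‖bpt θ + p‖ ^ 2 : ℝ) : ℂ) := by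
  have hp0 : p ≠ 0 := norm_pos_iff.1 (by rw [hp]; norm_num)
  have hb0 : bpt θ ≠ 0 := norm_pos_iff.1 (by simp)
  have c1 : cj p = p⁻¹ := by rw [Complex.inv_def, Complex.normSq_eq_norm_sq, hp]; simp
  have c2 : cj (bpt θ) = (bpt θ)⁻¹ := by rw [Complex.inv_def, Complex.normSq_eq_norm_sq, norm_bpt]; simp
  rw [← Complex.normSq_eq_norm_sq, ← Complex.mul_conj, map_add, c1, c2]
  field_simp; ring

lemma deriv_nsq {p : ℂ} (θ : ℝ) : HasDerivAt (fun θ => ‖bpt θ + p‖ ^ 2)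
    (2 * ((bpt θ + p).re * (iI * bpt θ).re + (bpt θ + p).im * (iI * bpt θ).im)) θ := by
  have h := (hasDerivAt_bpt θ).add_const p
  have h1 : HasDerivAt (fun θ => (bpt θ + p).re) (iI * bpt θ).re θ := Complex.reCLM.hasFDerivAt.comp_hasDerivAt θ h
  have h2 : HasDerivAt (fun θ => (bpt θ + p).im) (iI * bpt θ).im θ := Complex.imCLM.hasFDerivAt.comp_hasDerivAt θ h
  have e : (fun θ => ‖bpt θ + p‖ ^ 2) = fun θ => (bpt θ + p).re * (bpt θ + p).re + (bpt θ + p).im * (bpt θ + p).im := by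
    funext θ; rw [norm_sq_re_im]
  rw [e]
  exact ((h1.mul h1).add (h2.mul h2)).congr_deriv (by ring)

lemma dot_le (z w : ℂ) : |z.re * w.re + z.im * w.im| ≤ ‖z‖ * ‖w‖ := by
  have : z.re * w.re + z.im * w.im = (cj z * w).re := by simp
  rw [this]
  refine (Complex.abs_re_le_norm _).trans_eq ?_
  rw [norm_mul, Complex.norm_conj]

theorem L8 (Λ : ℝ) {Ψ : ℂ → ℂ} {r : ℝ} (hr0 : 0 < r) (hr : r < 1) (hΨ : ContDiff ℝ 2 Ψ) (hs : ∀ x, r ≤ ‖x‖ → Ψ x = 0) :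
    ∃ K > 0, ∀ {δ κ : ℝ} {p : ℂ} {A C : ℝ} {v : ℂ → ℝ}, Cfg Λ δ κ p A C v →
      |(∫ x in BB, EE v x * dd (-iI) (dd (-iI) Ψ) x).re| ≤ K * (δ + κ) := by
  obtain ⟨B, hB, hbet⟩ := bet_props Λ hr hΨ hs
  obtain ⟨K, hK, hY⟩ := exists_Y hr0 hr
  obtain ⟨Kt, hKt, htau⟩ := cfg_tau Λ
  obtain ⟨Kv, hKv, hvz⟩ := vz_L1 Λ
  obtain ⟨Kd, hKd, hker⟩ := ker_disk0 (m := 3) (by norm_num)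
  set M := K * B with hM
  have hM0 : 0 < M := by positivity
  have pp := pi_pos
  refine ⟨|Λ| * (2 * π * (8 * M)) + (2 + |Λ|) * |Λ| * M * Kt + (2 * M * (|Λ| * (π + Kd)) + 2 * |Λ| * (K * (B + B)) + 2 * |Λ| * (Kv * M)) + 1, by positivity, ?_⟩
  intro δ κ p A C v c
  rw [abs_of_pos c.Λpos]
  obtain ⟨hcd, hsup, hsb, hL1⟩ := hbet c
  obtain ⟨Y, S, S', hYC, hYb, hYbd, hYS, hS'c, hYL⟩ := hY hcd hsup hsb
  have hL := c.Λpos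
  have hd := c.hδ
  have hk := c.hκ
  have hp := c.hp
  have hp0 : p ≠ 0 := norm_pos_iff.1 (by rw [hp]; norm_num)
  have htd : ∀ z : ℂ, HasDerivAt (fun z => (z + p) ^ 2 * p⁻¹) (2 * (z + p) * p⁻¹) z := fun z => by
    simpa using (((hasDerivAt_id z).add_const p).pow 2).mul_const p⁻¹
  have htC : ContDiff ℝ 2 (fun z : ℂ => (z + p) ^ 2 * p⁻¹) := by fun_prop
  have hXC : C2 (fun z => (z + p) ^ 2 * p⁻¹ * Y z) := fun x hx => htC.contDiffAt.mul (hYC x hx)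
  set X : ℂ → ℂ := fun z => (z + p) ^ 2 * p⁻¹ * Y z with hXd
  have hddX : ∀ ω, ∀ z, ‖z‖ < 1 → dd ω X z = 2 * (z + p) * p⁻¹ * (1 + ω * iI) / 2 * Y z + (z + p) ^ 2 * p⁻¹ * dd ω Y z := by
    intro ω z hz
    rw [hXd, dd_mul _ ((htd z).differentiableAt.restrictScalars ℝ) (hYC.C1.diff (by simpa using hz.le)), dd_holo _ (htd z)]
  have hSd : ∀ θ, HasDerivAt (fun θ => (S (bpt θ)).im) (S' (bpt θ) * (iI * bpt θ)).im θ := fun θ => by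
    have h1 := ((hYS (bpt θ) (by simp)).1).comp θ (hasDerivAt_bpt θ)
    exact Complex.imCLM.hasFDerivAt.comp_hasDerivAt θ h1
  have hχ : ∀ θ, HasDerivAt (fun θ => -2 * (‖bpt θ + p‖ ^ 2 * (S (bpt θ)).im)) (-2 * (2 * ((bpt θ + p).re * (iI * bpt θ).re + (bpt θ + p).im * (iI * bpt θ).im) * (S (bpt θ)).im + ‖bpt θ + p‖ ^ 2 * (S' (bpt θ) * (iI * bpt θ)).im)) θ :=
    fun θ => ((deriv_nsq θ).mul (hSd θ)).const_mul _
  set χ : ℝ → ℝ := fun θ => -2 * (‖bpt θ + p‖ ^ 2 * (S (bpt θ)).im) with hχd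
  set χ' : ℝ → ℝ := fun θ => (-2 * (2 * ((bpt θ + p).re * (iI * bpt θ).re + (bpt θ + p).im * (iI * bpt θ).im) * (S (bpt θ)).im + ‖bpt θ + p‖ ^ 2 * (S' (bpt θ) * (iI * bpt θ)).im)) with hχ'd
  have hbc := continuous_bpt
  have hSc : Continuous (fun θ => (S (bpt θ)).im) := continuous_iff_continuousAt.2 fun θ => (hSd θ).continuousAt
  have hS'b : Continuous (fun θ => S' (bpt θ)) := hS'c.comp_continuous hbc fun θ => by simp
  have hχc : Continuous χ' :=
    continuous_const.mul (((by fun_prop : Continuous fun θ => 2 * ((bpt θ + p).re * (iI * bpt θ).re + (bpt θ + p).im * (iI * bpt θ).im)).mul hSc).add ((by fun_prop : Continuous fun θ => ‖bpt θ + p‖ ^ 2).mul (Complex.continuous_im.comp (hS'b.mul (continuous_const.mul hbc)))))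
  have hχ0 : Continuous χ := continuous_iff_continuousAt.2 fun θ => (hχ θ).continuousAt
  have hbX : ∀ θ, X (bpt θ) = iI * bpt θ * χ θ := fun θ => by
    rw [hXd, hχd]; beta_reduce; rw [tt_bpt hp, hYbd]; push_cast; ring
  have hper : χ (2 * π) = χ 0 := by
    have := bpt_periodic 0
    rw [zero_add] at this
    rw [hχd]; beta_reduce; rw [this]
  have tb : ∀ θ, ‖bpt θ + p‖ ≤ 2 := fun θ => by have := norm_add_le (bpt θ) p; rw [norm_bpt, hp] at this; linarith
  have bχ : ∀ θ, |χ θ| ≤ 2 * ‖bpt θ + p‖ ^ 2 * M := fun θ => by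
    have h1 := (Complex.abs_im_le_norm (S (bpt θ))).trans (hYS (bpt θ) (by simp)).2.1
    rw [hχd]; beta_reduce
    rw [abs_mul, abs_mul, abs_of_nonneg (sq_nonneg ‖bpt θ + p‖), show |(-2:ℝ)| = 2 by norm_num, mul_assoc]
    gcongr
  have nb : ∀ θ, ‖iI * bpt θ‖ = 1 := fun θ => by simp
  have bχ' : ∀ θ, |χ' θ| ≤ ‖bpt θ + p‖ * (8 * M) := fun θ => by
    have h1 := (Complex.abs_im_le_norm (S (bpt θ))).trans (hYS (bpt θ) (by simp)).2.1
    have h2 := (Complex.abs_im_le_norm (S' (bpt θ) * (iI * bpt θ)))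
    rw [norm_mul, nb, mul_one] at h2
    replace h2 := h2.trans (hYS (bpt θ) (by simp)).2.2.1
    have h3 := dot_le (bpt θ + p) (iI * bpt θ)
    rw [nb, mul_one] at h3
    rw [hχ'd]; beta_reduce
    rw [abs_mul, show |(-2:ℝ)| = 2 by norm_num]
    have h4 : ‖bpt θ + p‖ ^ 2 ≤ 2 * ‖bpt θ + p‖ := by nlinarith [tb θ, norm_nonneg (bpt θ + p)]
    calc _ ≤ 2 * (2 * ‖bpt θ + p‖ * M + 2 * ‖bpt θ + p‖ * M) := by
          gcongr
          refine (abs_add_le _ _).trans (add_le_add ?_ ?_)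
          · rw [abs_mul, abs_mul, abs_two]; gcongr
          · rw [abs_mul, abs_of_nonneg (sq_nonneg ‖bpt θ + p‖)]; gcongr
      _ = _ := by ring
  have key := L7 c.hv hXC A C hχ hχc hbX hper
  have e1 : ∫ x in BB, Qh v x * (EE v x * Ψ x) = ∫ x in BB, Qh v x * dd iI X x := by
    refine setIntegral_congr_fun measurableSet_ball fun z hz => ?_
    have hz' : ‖z‖ < 1 := by simpa using hz
    have hne : z + p ≠ 0 := norm_pos_iff.1 (by linarith [xp_lb (x := z) hp])
    beta_reduce
    rw [hddX _ z hz', hYb z hz', bet, Complex.I_mul_I]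
    field_simp; ring
  rw [EE_ibp c.hv hr hΨ hs, e1]
  have e2 : (-(1/2) * ∫ x in BB, Qh v x * dd iI X x).re = -(1/2) * (∫ x in BB, Qh v x * dd iI X x).re := by
    rw [show (-(1/2) : ℂ) = ((-(1/2) : ℝ) : ℂ) by push_cast; ring, Complex.re_ofReal_mul]
  rw [e2, key]
  have cG : Continuous (fun θ => GG A C v (bpt θ)) := cont_bpt c.GG_cont
  have cT : Continuous (fun θ => tderiv v (bpt θ)) := cont_bpt c.hv.C1.tderiv_cont
  have hIb : |∫ θ in 0..2 * π, (GG A C v (bpt θ) * χ' θ + GG A C v (bpt θ) * tderiv v (bpt θ) * χ θ / 2)| ≤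
      Λ * (2 * π * (8 * M)) * (δ + κ) + (2 + Λ) * Λ * M * Kt * (δ + κ) := by
    have h0 : |∫ θ in 0..2 * π, (GG A C v (bpt θ) * χ' θ + GG A C v (bpt θ) * tderiv v (bpt θ) * χ θ / 2)| ≤
        ∫ θ in 0..2 * π, (Λ * (δ + κ) * (8 * M) + (2 + Λ) * Λ * M * δ * |tderiv v (bpt θ)|) := by
      refine (intervalIntegral.abs_integral_le_integral_abs (by positivity)).trans (intervalIntegral.integral_mono_on (by positivity) (Continuous.intervalIntegrable (by fun_prop) _ _) (Continuous.intervalIntegrable (by fun_prop) _ _) fun θ _ => ?_)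
      obtain ⟨g1, g2⟩ := c.Gt θ
      refine (abs_add_le _ _).trans (add_le_add ?_ ?_)
      · rw [abs_mul]
        calc _ ≤ |GG A C v (bpt θ)| * (‖bpt θ + p‖ * (8 * M)) := by gcongr; exact bχ' θ
          _ = |GG A C v (bpt θ)| * ‖bpt θ + p‖ * (8 * M) := by ring
          _ ≤ _ := by gcongr
      · rw [abs_div, abs_mul, abs_mul, abs_two]
        calc _ ≤ |GG A C v (bpt θ)| * |tderiv v (bpt θ)| * (2 * ‖bpt θ + p‖ ^ 2 * M) / 2 := by gcongr; exact bχ θ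
          _ = |GG A C v (bpt θ)| * ‖bpt θ + p‖ ^ 2 * (M * |tderiv v (bpt θ)|) := by ring
          _ ≤ (2 + Λ) * Λ * δ * (M * |tderiv v (bpt θ)|) := by gcongr
          _ = _ := by ring
    have j1 : IntervalIntegrable (fun θ : ℝ => Λ * (δ + κ) * (8 * M)) volume 0 (2 * π) := continuous_const.intervalIntegrable _ _
    have j2 : IntervalIntegrable (fun θ : ℝ => (2 + Λ) * Λ * M * δ * |tderiv v (bpt θ)|) volume 0 (2 * π) := (continuous_const.mul cT.abs).intervalIntegrable _ _
    rw [intervalIntegral.integral_add j1 j2, intervalIntegral.integral_const, intervalIntegral.integral_const_mul] at h0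
    have h1 := mul_le_mul_of_nonneg_left (htau c) (show 0 ≤ (2 + Λ) * Λ * M by positivity)
    simp only [sub_zero, smul_eq_mul] at h0
    linarith
  have hfin : IsFiniteMeasure (volume.restrict BB) := ⟨by simpa using measure_ball_lt_top⟩
  have iY := (intD (hYC.C1.dd_cont (-iI))).norm
  have iz := (intD (vz_C1 c.hv).cont).norm
  obtain ⟨ik, hk3⟩ := hker δ hd p
  have cX : ContinuousOn (fun x => (FF A C v x : ℂ) * (dd (-iI) X x + vz v x * X x)) (Metric.closedBall 0 1) :=
    (Complex.continuous_ofReal.comp_continuousOn c.FF_cont).fun_mul ((hXC.C1.dd_cont _).fun_add ((vz_C1 c.hv).cont.fun_mul hXC.C1.cont))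
  have hId : |(∫ x in BB, (FF A C v x : ℂ) * (dd (-iI) X x + vz v x * X x)).re| ≤
      (2 * M * (Λ * (π + Kd)) + 2 * Λ * (K * (B + B)) + 2 * Λ * (Kv * M)) * (δ + κ) := by
    have i1 : Integrable (fun x => 2 * M * (Λ * (δ + κ * δ ^ 2 * ((δ + ‖x + p‖) ^ 3)⁻¹))) (volume.restrict BB) :=
      (((integrable_const _).add (ik.const_mul _)).const_mul _).const_mul _
    have i2 : Integrable (fun x => 2 * Λ * (δ + κ) * (‖dd (-iI) Y x‖ + ‖vz v x‖ * M)) (volume.restrict BB) :=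
      (iY.add (iz.mul_const M)).const_mul _
    have h0 : |(∫ x in BB, (FF A C v x : ℂ) * (dd (-iI) X x + vz v x * X x)).re| ≤
        ∫ x in BB, (2 * M * (Λ * (δ + κ * δ ^ 2 * ((δ + ‖x + p‖) ^ 3)⁻¹)) + 2 * Λ * (δ + κ) * (‖dd (-iI) Y x‖ + ‖vz v x‖ * M)) := by
      refine (Complex.abs_re_le_norm _).trans ((norm_integral_le_integral_norm _).trans (setIntegral_mono_on (intD cX).norm (i1.add i2) measurableSet_ball fun z hz => ?_))
      have hz' : ‖z‖ < 1 := by simpa using hz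
      obtain ⟨f1, f2⟩ := c.Ft hz
      have hYz := (hYS z hz'.le).2.2.2
      have npi : ‖p⁻¹‖ = 1 := by rw [norm_inv, hp, inv_one]
      have n1 : ‖dd (-iI) X z + vz v z * X z‖ ≤ ‖z + p‖ * (2 * M) + ‖z + p‖ ^ 2 * (‖dd (-iI) Y z‖ + ‖vz v z‖ * M) := by
        rw [hddX _ z hz']
        have : 2 * (z + p) * p⁻¹ * (1 + -iI * iI) / 2 * Y z + (z + p) ^ 2 * p⁻¹ * dd (-iI) Y z + vz v z * X z =
          2 * (z + p) * p⁻¹ * Y z + (z + p) ^ 2 * p⁻¹ * (dd (-iI) Y z + vz v z * Y z) := by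
          rw [neg_mul, Complex.I_mul_I, hXd]; ring
        rw [this]
        refine (norm_add_le _ _).trans (add_le_add ?_ ?_)
        · rw [norm_mul, norm_mul, norm_mul, npi, Complex.norm_ofNat]
          calc _ ≤ 2 * ‖z + p‖ * 1 * M := by gcongr
            _ = _ := by ring
        · rw [norm_mul, norm_mul, npi, norm_pow, mul_one]
          gcongr
          refine (norm_add_le _ _).trans (add_le_add le_rfl ?_)
          rw [norm_mul]; gcongr
      rw [norm_mul, Complex.norm_real, norm_eq_abs]
      calc _ ≤ |FF A C v z| * (‖z + p‖ * (2 * M) + ‖z + p‖ ^ 2 * (‖dd (-iI) Y z‖ + ‖vz v z‖ * M)) := by gcongr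
        _ = 2 * M * (|FF A C v z| * ‖z + p‖) + (|FF A C v z| * ‖z + p‖ ^ 2) * (‖dd (-iI) Y z‖ + ‖vz v z‖ * M) := by ring
        _ ≤ _ := by gcongr
    rw [integral_add i1 i2, integral_const_mul, integral_const_mul, integral_const_mul, integral_add iY (iz.mul_const M), integral_mul_const,
      integral_add (integrable_const _) (ik.const_mul _), int_const, integral_const_mul] at h0
    have j1 : κ * δ ^ 2 * (∫ y in BB, ((δ + ‖y + p‖) ^ 3)⁻¹) ≤ κ * Kd := by
      calc _ ≤ κ * δ ^ 2 * (Kd * (δ ^ (3 - 2))⁻¹) := by gcongr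
        _ = κ * Kd * δ := by norm_num; field_simp
        _ ≤ κ * Kd * 1 := by gcongr; exact c.hδ1
        _ = _ := mul_one _
    have j2 : ∫ x in BB, ‖dd (-iI) Y x‖ ≤ K * (B + B) := hYL.trans (by gcongr)
    have j3 := mul_le_mul_of_nonneg_right (hvz c) hM0.le
    refine h0.trans ?_
    calc _ ≤ 2 * M * (Λ * (π * (δ + κ) + (δ + κ) * Kd)) + 2 * Λ * (δ + κ) * (K * (B + B) + Kv * M) := by
          have j4 : κ * Kd ≤ (δ + κ) * Kd := by gcongr; linarith
          have j5 : π * δ ≤ π * (δ + κ) := by gcongr; linarith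
          refine add_le_add (mul_le_mul_of_nonneg_left (mul_le_mul_of_nonneg_left (add_le_add j5 (j1.trans j4)) hL.le) (by positivity)) (mul_le_mul_of_nonneg_left (add_le_add j2 j3) (by positivity))
      _ = _ := by ring
  refine (show ∀ a b c d e: ℝ, |a| ≤ c → |b| ≤ d → c + d ≤ e → |-(1/2) * (-(1/4) * a + 1/4 * b)| ≤ e from fun a b c d e ha hb h => ?_) _ _ _ _ _ hIb hId ?_
  · have := abs_le.1 ha
    have := abs_le.1 hb
    rw [abs_le]; constructor <;> linarith
  · have : 0 < δ + κ := by linarith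
    nlinarith

lemma const_ball {f : ℂ → ℝ} {R : ℝ} (hf : ∀ x ∈ Metric.ball (0:ℂ) R, DifferentiableAt ℝ f x)
    (h1 : ∀ x ∈ Metric.ball (0:ℂ) R, fderiv ℝ f x 1 = 0) (h2 : ∀ x ∈ Metric.ball (0:ℂ) R, fderiv ℝ f x iI = 0) :
    ∀ x ∈ Metric.ball (0:ℂ) R, f x = f 0 := by
  intro x hx
  have hR : 0 < R := lt_of_le_of_lt (norm_nonneg x) (by simpa using hx)
  refine Metric.isOpen_ball.is_const_of_fderiv_eq_zero (𝕜 := ℝ) (convex_ball (0:ℂ) R).isPreconnected (fun y hy => (hf y hy).differentiableWithinAt) (fun y hy => ?_) hx (by simpa using hR)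
  ext z
  rw [clm_apply, h1 y hy, h2 y hy]; simp

lemma quad_of_pd {g : ℂ → ℝ} {R : ℝ} (hg : ContDiff ℝ 3 g)
    (h1 : ∀ x ∈ Metric.ball (0:ℂ) R, fderiv ℝ (pd g 1) x 1 = fderiv ℝ (pd g iI) x iI)
    (h2 : ∀ x ∈ Metric.ball (0:ℂ) R, fderiv ℝ (pd g 1) x iI = 0) :
    ∃ A b C, ∀ x ∈ Metric.ball (0:ℂ) R, g x = quad A b C x := by
  have hp : ∀ d, ContDiff ℝ 2 (pd g d) := fun d => (hg.fderiv_right (m := 2) (by norm_num)).clm_apply contDiff_const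
  have hpp : ∀ d e, ContDiff ℝ 1 (pd (pd g d) e) := fun d e => ((hp d).fderiv_right (m := 1) (by norm_num)).clm_apply contDiff_const
  have dif : ∀ {n : WithTop ℕ∞} {f : ℂ → ℝ}, ContDiff ℝ n f → n ≠ 0 → ∀ x, DifferentiableAt ℝ f x := fun h hn x => h.contDiffAt.differentiableAt hn
  have h3 : ∀ x ∈ Metric.ball (0:ℂ) R, fderiv ℝ (pd g iI) x 1 = 0 := fun x hx => by
    rw [← h2 x hx]; exact pd_symm (hg.of_le (by norm_num)).contDiffAt _ _
  have ev : ∀ {f f' : ℂ → ℝ}, (∀ x ∈ Metric.ball (0:ℂ) R, f x = f' x) → ∀ x ∈ Metric.ball (0:ℂ) R, fderiv ℝ f x = fderiv ℝ f' x := fun h x hx =>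
    Filter.EventuallyEq.fderiv_eq (by filter_upwards [Metric.isOpen_ball.mem_nhds hx] with y hy using h y hy)
  have kc := const_ball (f := pd (pd g 1) 1) (R := R) (fun x _ => dif (hpp 1 1) (by norm_num) x)
    (fun x hx => by
      rw [ev (f := pd (pd g 1) 1) (f' := pd (pd g iI) iI) h1 x hx]
      have := pd_symm (hp iI).contDiffAt (x := x) iI 1
      change fderiv ℝ (fun y => pd (pd g iI) iI y) x 1 = 0
      rw [this, ev (f := fun y => pd (pd g iI) 1 y) (f' := fun _ => 0) (fun y hy => h3 y hy) x hx]; simp)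
    (fun x hx => by
      have := pd_symm (hp 1).contDiffAt (x := x) 1 iI
      change fderiv ℝ (fun y => pd (pd g 1) 1 y) x iI = 0
      rw [this, ev (f := fun y => pd (pd g 1) iI y) (f' := fun _ => 0) (fun y hy => h2 y hy) x hx]; simp)
  set k := pd (pd g 1) 1 0 with hk
  have fre : ∀ x : ℂ, HasFDerivAt (fun y : ℂ => k * y.re) (k • Complex.reCLM) x := fun x => Complex.reCLM.hasFDerivAt.const_mul k
  have fim : ∀ x : ℂ, HasFDerivAt (fun y : ℂ => k * y.im) (k • Complex.imCLM) x := fun x => Complex.imCLM.hasFDerivAt.const_mul k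
  have pa := const_ball (f := fun y => pd g 1 y - k * y.re) (R := R) (fun x _ => (dif (hp 1) (by norm_num) x).fun_sub (fre x).differentiableAt)
    (fun x hx => by
      rw [fderiv_fun_sub (dif (hp 1) (by norm_num) x) (fre x).differentiableAt, (fre x).fderiv]
      have := kc x hx
      rw [pd] at this; simp [this])
    (fun x hx => by
      rw [fderiv_fun_sub (dif (hp 1) (by norm_num) x) (fre x).differentiableAt, (fre x).fderiv]
      simp [h2 x hx])
  have pb := const_ball (f := fun y => pd g iI y - k * y.im) (R := R) (fun x _ => (dif (hp iI) (by norm_num) x).fun_sub (fim x).differentiableAt)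
    (fun x hx => by
      rw [fderiv_fun_sub (dif (hp iI) (by norm_num) x) (fim x).differentiableAt, (fim x).fderiv]
      simp [h3 x hx])
    (fun x hx => by
      rw [fderiv_fun_sub (dif (hp iI) (by norm_num) x) (fim x).differentiableAt, (fim x).fderiv]
      have := kc x hx
      rw [pd, h1 x hx] at this; simp [this])
  simp only [Complex.zero_re, Complex.zero_im, mul_zero, sub_zero] at pa pb
  set b : ℂ := ⟨pd g 1 0, pd g iI 0⟩ with hb
  have hq : ∀ x, HasFDerivAt (quad 0 b (k / 2)) _ x := fun x => quad_hasFDerivAt 0 b (k / 2) x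
  have pc := const_ball (f := fun y => g y - quad 0 b (k / 2) y) (R := R) (fun x _ => (dif hg (by norm_num) x).fun_sub (hq x).differentiableAt)
    (fun x hx => by
      rw [fderiv_fun_sub (dif hg (by norm_num) x) (hq x).differentiableAt, (hq x).fderiv]
      have := pa x hx
      rw [pd] at this; simp [hb]; linarith)
    (fun x hx => by
      rw [fderiv_fun_sub (dif hg (by norm_num) x) (hq x).differentiableAt, (hq x).fderiv]
      have := pb x hx
      rw [pd] at this; simp [hb]; linarith)
  refine ⟨g 0, b, k / 2, fun x hx => ?_⟩
  have := pc x hx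
  simp only [quad, Complex.zero_re, Complex.zero_im] at this ⊢
  linarith

lemma conv_pd {e φ : ℂ → ℝ} (he : Continuous e) (hφ : ContDiff ℝ 1 φ) (hc : HasCompactSupport φ) (d x : ℂ) :
    pd (fun x => ∫ y, e y * φ (x - y)) d x = ∫ y, e y * pd φ d (x - y) := by
  have hl : LocallyIntegrable e volume := he.locallyIntegrable
  have eq : (fun x => ∫ y, e y * φ (x - y)) = convolution e φ (ContinuousLinearMap.mul ℝ ℝ) volume := by
    ext z; rw [convolution_def]; simp
  have h := hc.hasFDerivAt_convolution_right (ContinuousLinearMap.mul ℝ ℝ) hl hφ x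
  have cs := hc.fderiv (𝕜 := ℝ)
  have ci : ConvolutionExists e (fderiv ℝ φ) (ContinuousLinearMap.precompR ℂ (ContinuousLinearMap.mul ℝ ℝ)) volume :=
    cs.convolutionExists_right _ hl (hφ.continuous_fderiv (by norm_num))
  rw [pd, eq, h.fderiv, convolution_def, ContinuousLinearMap.integral_apply (ci x)]
  simp [pd]

lemma conv_contDiff {e φ : ℂ → ℝ} (he : Continuous e) (hφ : ContDiff ℝ 3 φ) (hc : HasCompactSupport φ) :
    ContDiff ℝ 3 (fun x => ∫ y, e y * φ (x - y)) := by
  have eq : (fun x => ∫ y, e y * φ (x - y)) = convolution e φ (ContinuousLinearMap.mul ℝ ℝ) volume := by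
    ext z; rw [convolution_def]; simp
  rw [eq]
  exact hc.contDiff_convolution_right (n := 3) _ he.locallyIntegrable hφ

lemma pd_refl {φ : ℂ → ℝ} {n : WithTop ℕ∞} (h : ContDiff ℝ n φ) (hn : n ≠ 0) (x d y : ℂ) : pd (fun y => φ (x - y)) d y = -pd φ d (x - y) := by
  have h1 : HasFDerivAt φ (fderiv ℝ φ (x - y)) (x - y) := (h.contDiffAt.differentiableAt hn).hasFDerivAt
  have h2 : HasFDerivAt (fun y => φ (x - y)) _ y := h1.comp y ((hasFDerivAt_id y).const_sub x)
  rw [pd, h2.fderiv]; simp [pd]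

theorem L10 {e : ℂ → ℝ} (he : Continuous e)
    (h : ∀ (ψ : ℂ → ℝ) (r : ℝ), 0 < r → r < 1 → ContDiff ℝ 2 ψ → (∀ x, r ≤ ‖x‖ → ψ x = 0) →
      ∫ x in BB, e x * (pd (pd ψ 1) 1 x - pd (pd ψ iI) iI x) = 0 ∧
      ∫ x in BB, e x * pd (pd ψ 1) iI x = 0) :
    ∃ A b C, ∀ x ∈ BB, e x = quad A b C x := by
  let Φ : ℕ → ContDiffBump (0:ℂ) := fun n => ⟨1 / (n + 2) / 2, 1 / (n + 2), by positivity, by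
    have : (0:ℝ) < 1 / (n + 2) := by positivity
    linarith⟩
  have hΦ : Tendsto (fun n => (Φ n).rOut) atTop (nhds 0) := by
    have := (tendsto_add_atTop_iff_nat 1).2 (tendsto_one_div_add_atTop_nhds_zero_nat (𝕜 := ℝ))
    refine this.congr fun n => ?_
    change _ = 1 / ((n : ℝ) + 2); push_cast; ring
  set φ : ℕ → ℂ → ℝ := fun n => (Φ n).normed volume with hφd
  set g : ℕ → ℂ → ℝ := fun n x => ∫ y, e y * φ n (x - y) with hgd
  have hlim : ∀ x, Tendsto (fun n => g n x) atTop (nhds (e x)) := by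
    intro x
    refine (ContDiffBump.convolution_tendsto_right_of_continuous (μ := volume) hΦ he x).congr fun n => ?_
    rw [convolution_def, hgd]
    have := integral_sub_left_eq_self (fun w => e w * φ n (x - w)) volume x
    beta_reduce
    rw [← this]
    refine integral_congr_ae (Eventually.of_forall fun t => ?_)
    simp [hφd, mul_comm]
  have hc : ∀ n, HasCompactSupport (φ n) := fun n => (Φ n).hasCompactSupport_normed
  have hcd : ∀ n, ContDiff ℝ 3 (φ n) := fun n => (Φ n).contDiff_normed
  have hz : ∀ n z, (Φ n).rOut ≤ ‖z‖ → φ n z = 0 := fun n z hz => by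
    have := (Φ n).support_normed_eq (μ := volume)
    by_contra hne
    have : z ∈ Function.support (φ n) := hne
    rw [hφd, ContDiffBump.support_normed_eq] at this
    simp at this; linarith
  have hq : ∀ n, ∃ A b C, ∀ x ∈ Metric.ball (0:ℂ) (1 - (Φ n).rOut), g n x = quad A b C x := by
    intro n
    have c1 : ∀ d, ContDiff ℝ 2 (pd (φ n) d) := fun d => ((hcd n).fderiv_right (m := 2) (by norm_num)).clm_apply contDiff_const
    have cc : ∀ d, HasCompactSupport (pd (φ n) d) := fun d => (hc n).fderiv_apply (𝕜 := ℝ) d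
    have ecp : ∀ d, pd (g n) d = fun x => ∫ y, e y * pd (φ n) d (x - y) := fun d => funext fun x => conv_pd he ((hcd n).of_le (by norm_num)) (hc n) d x
    have ecpp : ∀ d d' x, pd (pd (g n) d) d' x = ∫ y, e y * pd (pd (φ n) d) d' (x - y) := fun d d' x => by
      rw [ecp]; exact conv_pd he ((c1 d).of_le (by norm_num)) (cc d) d' x
    have key : ∀ x ∈ Metric.ball (0:ℂ) (1 - (Φ n).rOut), ∃ r, 0 < r ∧ r < 1 ∧ ∀ y, r ≤ ‖y‖ → φ n (x - y) = 0 := by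
      intro x hx
      have hx' : ‖x‖ < 1 - (Φ n).rOut := by simpa using hx
      have r0 := (Φ n).rOut_pos
      refine ⟨‖x‖ + (Φ n).rOut, by positivity, by linarith, fun y hy => hz n _ ?_⟩
      have := norm_sub_norm_le y x
      rw [norm_sub_rev] at this; linarith
    have p2 : ∀ x d d', pd (pd (fun y => φ n (x - y)) d) d' = fun y => pd (pd (φ n) d) d' (x - y) := by
      intro x d d'; ext y
      have : pd (fun y => φ n (x - y)) d = fun y => -pd (φ n) d (x - y) := funext fun y => pd_refl (hcd n) (by norm_num) x d y
      rw [this, pd, fderiv_fun_neg]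
      have := pd_refl (c1 d) (by norm_num) x d' y
      rw [pd] at this; simp [this]
    have fin : ∀ x ∈ Metric.ball (0:ℂ) (1 - (Φ n).rOut), ∀ d d', ∫ y in BB, e y * pd (pd (φ n) d) d' (x - y) = ∫ y, e y * pd (pd (φ n) d) d' (x - y) := by
      intro x hx d d'
      have hx' : ‖x‖ < 1 - (Φ n).rOut := by simpa using hx
      refine setIntegral_eq_integral_of_forall_compl_eq_zero fun y hy => ?_
      have hy' : 1 ≤ ‖y‖ := by simpa using hy
      have h1 : (Φ n).rOut < ‖x - y‖ := by
        have := norm_sub_norm_le y x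
        rw [norm_sub_rev] at this; linarith
      have h2 : ∀ z, (Φ n).rOut < ‖z‖ → pd (φ n) d z = 0 := fun z hzz => by
        rw [pd, fderiv_supp ((hcd n).of_le (by norm_num)) (hz n) z hzz]; simp
      obtain ⟨s, hs1, hs2⟩ := exists_between h1
      have : pd (pd (φ n) d) d' (x - y) = 0 := by
        rw [pd, fderiv_supp (r := s) ((c1 d).of_le (by norm_num)) (fun z hz' => h2 z (by linarith)) _ hs2]; simp
      rw [this, mul_zero]
    have ib : ∀ x d d', IntegrableOn (fun y => e y * pd (pd (φ n) d) d' (x - y)) BB := by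
      intro x d d'
      have : Continuous (pd (pd (φ n) d) d') := ((c1 d).continuous_fderiv (by norm_num)).clm_apply continuous_const
      have h2 : Continuous (fun y => e y * pd (pd (φ n) d) d' (x - y)) := he.mul (this.comp (continuous_const.sub continuous_id))
      exact intD h2.continuousOn
    refine quad_of_pd (conv_contDiff he (hcd n) (hc n)) (fun x hx => ?_) (fun x hx => ?_)
    · obtain ⟨r, r0, r1, hr⟩ := key x hx
      have := (h (fun y => φ n (x - y)) r r0 r1 (((hcd n).of_le (by norm_num)).comp (contDiff_const.sub contDiff_id)) hr).1
      rw [p2, p2] at this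
      change pd (pd (g n) 1) 1 x = pd (pd (g n) iI) iI x
      rw [ecpp, ecpp, ← fin x hx, ← fin x hx, ← sub_eq_zero, ← integral_sub (ib _ _ _) (ib _ _ _)]
      simpa only [mul_sub] using this
    · obtain ⟨r, r0, r1, hr⟩ := key x hx
      have := (h (fun y => φ n (x - y)) r r0 r1 (((hcd n).of_le (by norm_num)).comp (contDiff_const.sub contDiff_id)) hr).2
      rw [p2] at this
      change pd (pd (g n) 1) iI x = 0
      rw [ecpp, ← fin x hx, this]
  choose A b C hq using hq
  have inb : ∀ x : ℂ, ‖x‖ < 1 → ∀ᶠ n in atTop, g n x = quad (A n) (b n) (C n) x := fun x hx => by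
    filter_upwards [hΦ.eventually_lt_const (show 0 < 1 - ‖x‖ by linarith)] with n hn
    exact hq n x (by simp; linarith)
  have l0 := (hlim 0).congr' (inb 0 (by simp))
  have l1 := (hlim (1/2)).congr' (inb (1/2) (by norm_num))
  have l2 := (hlim (-(1/2))).congr' (inb (-(1/2)) (by norm_num))
  have l3 := (hlim (iI/2)).congr' (inb (iI/2) (by norm_num))
  simp only [quad] at l0 l1 l2 l3
  norm_num at l0 l1 l2 l3
  refine ⟨e 0, ⟨e (1/2) - e (-(1/2)), 2 * (e (iI/2) - e 0) - 1/2 * (2 * (e (1/2) + e (-(1/2)) - 2 * e 0))⟩, 2 * (e (1/2) + e (-(1/2)) - 2 * e 0), fun x hx => ?_⟩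
  have hx' : ‖x‖ < 1 := by simpa using hx
  refine tendsto_nhds_unique ((hlim x).congr' (inb x hx')) ?_
  have lC : Tendsto C atTop (nhds (2 * (e (1/2) + e (-(1/2)) - 2 * e 0))) := by
    refine Tendsto.congr (fun n => ?_) (((l1.add l2).sub (l0.const_mul 2)).const_mul 2) 
    ring
  have lb1 : Tendsto (fun n => (b n).re) atTop (nhds (e (1/2) - e (-(1/2)))) := (l1.sub l2).congr fun n => by ring
  have lb2 : Tendsto (fun n => (b n).im) atTop (nhds (2 * (e (iI/2) - e 0) - 1/2 * (2 * (e (1/2) + e (-(1/2)) - 2 * e 0)))) :=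
    (((l3.sub l0).const_mul 2).sub (lC.const_mul (1/2))).congr fun n => by ring
  simp only [quad]
  exact (l0.add ((lb1.mul_const _).add (lb2.mul_const _))).add (lC.mul_const _)

def Ex (v : ℂ → ℝ) (x : ℂ) : ℝ := exp ((-1/2 : ℝ) * v x)

lemma Ex_sq (v : ℂ → ℝ) (x : ℂ) : exp (v x) = (Ex v x ^ 2)⁻¹ := by
  rw [Ex, ← exp_nat_mul, ← exp_neg]; congr 1; push_cast; ring
lemma Ex_inv (v : ℂ → ℝ) (x : ℂ) : exp (v x / 2) = (Ex v x)⁻¹ := by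
  rw [Ex, ← exp_neg]; congr 1; ring
lemma Ex_log (v : ℂ → ℝ) (x : ℂ) : v x = -2 * log (Ex v x) := by rw [Ex, log_exp]; ring

lemma Cfg.Ex_bd {Λ δ κ : ℝ} {p : ℂ} {A C : ℝ} {v : ℂ → ℝ} (c : Cfg Λ δ κ p A C v) {x : ℂ} (hx : ‖x‖ ≤ 1) :
    exp (-Λ) ≤ Ex v x ∧ Ex v x ≤ exp Λ := by
  have := abs_le.1 (c.hb x (by simpa using hx))
  have := c.Λpos
  constructor <;> (apply exp_le_exp.2; linarith)

lemma log_lip {a b m : ℝ} (hm : 0 < m) (ha : m ≤ a) (hb : m ≤ b) : |log a - log b| ≤ |a - b| / m := by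
  have key : ∀ a b : ℝ, m ≤ a → m ≤ b → log a - log b ≤ |a - b| / m := fun a b ha hb => by
    have ha0 := hm.trans_le ha
    have hb0 := hm.trans_le hb
    rw [← log_div ha0.ne' hb0.ne']
    refine (log_le_sub_one_of_pos (by positivity)).trans ?_
    rw [show a / b - 1 = (a - b) / b by field_simp]
    exact (div_le_div_of_nonneg_right (le_abs_self _) hb0.le).trans (by gcongr)
  rw [abs_le]
  have := key b a hb ha
  rw [abs_sub_comm] at this
  exact ⟨by linarith, key a b ha hb⟩

lemma inv_diff {a b m : ℝ} (hm : 0 < m) (ha : m ≤ a) (hb : m ≤ b) : |a⁻¹ - b⁻¹| ≤ |a - b| / m ^ 2 := by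
  have ha0 := hm.trans_le ha
  have hb0 := hm.trans_le hb
  rw [inv_sub_inv ha0.ne' hb0.ne', abs_div, abs_of_pos (mul_pos ha0 hb0), abs_sub_comm]
  gcongr
  nlinarith

set_option maxHeartbeats 800000 in
theorem radial (Λ : ℝ) {α : ℝ} (hα : 0 < α) (hα1 : α < 1) : ∃ K > 0, ∀ {δ κ : ℝ} {p : ℂ} {A C : ℝ} {v : ℂ → ℝ}, Cfg Λ δ κ p A C v →
    ∀ M η a b : ℝ, 0 < M → 0 ≤ η → M * η ≤ exp (-Λ) / 2 → eta α δ κ ≤ η * M →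
    (∀ x : ℂ, ‖x‖ ≤ 1 → |Ex v x - quad (A + M * a) 0 (C + M * b) x| ≤ M * η) →
    |A * b + C * a + M * a * b| ≤ K * η ∧ |b - a| ≤ K * η := by
  obtain ⟨K1, hK1, hsrc⟩ := cfg_src1 Λ hα hα1
  let φb : ContDiffBump (0:ℂ) := ⟨1/4, 1/2, by norm_num, by norm_num⟩
  set φ : ℂ → ℝ := fun x => φb x with hφd
  have φC : ContDiff ℝ 2 φ := φb.contDiff
  have φC2 : C2 φ := fun x _ => φC.contDiffAt
  have φ0 : ∀ x, 0 ≤ φ x := fun x => φb.nonneg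
  have φ1 : ∀ x, φ x ≤ 1 := fun x => φb.le_one
  have φz : ∀ x, 1/2 ≤ ‖x‖ → φ x = 0 := fun x hx => φb.zero_of_le_dist (by rw [dist_zero_right]; exact hx)
  have φn : ∀ θ, nderiv φ (bpt θ) = 0 := fun θ => by
    rw [nderiv, pd, pd, fderiv_supp (φC.of_le (by norm_num)) φz _ (by norm_num)]; simp
  have φI : 0 < ∫ x in BB, φ x := by
    rw [setIntegral_eq_integral_of_forall_compl_eq_zero (fun x hx => φz x (by simp at hx; linarith))]
    exact φb.integral_pos
  set I := ∫ x in BB, φ x with hI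
  obtain ⟨L, hL, hLb⟩ := contOn_bound φC2.lap_cont
  set m := exp (-Λ) / 2 with hm
  have m0 : 0 < m := by positivity
  set T := 2 * exp Λ with hT
  have T0 : 0 < T := by positivity
  have pp := pi_pos
  set k1 := K1 + 8 * Λ ^ 2 * (2 * T / m ^ 4) * π with hk1
  have k10 : 0 < k1 := by positivity
  set KP := (2 / m * L * π + k1) * T ^ 2 / I with hKP
  have KP0 : 0 < KP := by positivity
  refine ⟨KP + (K1 + 4 * |Λ| * (1 / m ^ 2) * (2 * π) + k1 + 8 * KP * π / m ^ 2) * T, by positivity, ?_⟩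
  intro δ κ p A C v c M η a b hM hη hMη heta hE
  rw [abs_of_pos c.Λpos]
  have hΛ := c.Λpos
  have ee : exp (-Λ) = 2 * m := by rw [hm]; ring
  have meT : m ≤ exp Λ := by
    have : exp (-Λ) ≤ exp Λ := exp_le_exp.2 (by linarith)
    linarith
  set A' := A + M * a with hA'
  set C' := C + M * b with hC'
  set P := A * b + C * a + M * a * b with hP
  have eP : A' * C' = A * C + M * P := by rw [hA', hC', hP]; ring
  have Qlb : ∀ x : ℂ, ‖x‖ ≤ 1 → m ≤ quad A' 0 C' x := fun x hx => by
    have := abs_le.1 (hE x hx); have := (c.Ex_bd hx).1; linarith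
  have Qub : ∀ x : ℂ, ‖x‖ ≤ 1 → quad A' 0 C' x ≤ T := fun x hx => by
    have := abs_le.1 (hE x hx); have := (c.Ex_bd hx).2; linarith
  have Elb : ∀ x : ℂ, ‖x‖ ≤ 1 → m ≤ Ex v x := fun x hx => by have := (c.Ex_bd hx).1; linarith
  have Eub : ∀ x : ℂ, ‖x‖ ≤ 1 → Ex v x ≤ T := fun x hx => by have := (c.Ex_bd hx).2; linarith
  have qC2 : C2 (fun x => log (quad A' 0 C' x)) := fun x hx => log_quad_contDiffAt (m0.trans_le (Qlb x (by simpa using hx)))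
  have zC2 : C2 (ww A' C' v) := fun x hx => (c.hv x hx).add (contDiffAt_const.mul (qC2 x hx))
  have inb : ∀ {x : ℂ}, x ∈ BB → ‖x‖ ≤ 1 := fun hx => by simp at hx; exact hx.le
  have zb : ∀ x : ℂ, ‖x‖ ≤ 1 → |ww A' C' v x| ≤ 2 / m * (M * η) := fun x hx => by
    rw [ww, Ex_log v x, show -2 * log (Ex v x) + 2 * log (quad A' 0 C' x) = (-2) * (log (Ex v x) - log (quad A' 0 C' x)) by ring, abs_mul]
    have h1 := (log_lip m0 (Elb x hx) (Qlb x hx)).trans (div_le_div_of_nonneg_right (hE x hx) m0.le)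
    rw [show |(-2:ℝ)| = 2 by norm_num]
    calc _ ≤ 2 * (M * η / m) := by gcongr
      _ = _ := by ring
  have zlap : ∀ x : ℂ, ‖x‖ ≤ 1 → lap (ww A' C' v) x = FF A C v x - 8 * A * C * ((Ex v x ^ 2)⁻¹ - (quad A' 0 C' x ^ 2)⁻¹) + 8 * M * P * (quad A' 0 C' x ^ 2)⁻¹ := fun x hx => by
    have hx' : x ∈ CB := by simpa using hx
    unfold ww
    rw [lap_add_const_mul 2 (c.hv x hx') (qC2 x hx'), lap_log_quad (m0.trans_le (Qlb x hx)), FF, Ex_sq]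
    simp only [Complex.zero_re, Complex.zero_im, mul_zero, add_zero, sub_zero]
    rw [show 4 * C' * A' = 4 * (A' * C') by ring, eP]; ring
  have znd : ∀ θ, nderiv (ww A' C' v) (bpt θ) = GG A C v (bpt θ) + 2 * (A - C) * ((Ex v (bpt θ))⁻¹ - (A' + C')⁻¹) + 2 * M * (b - a) * (A' + C')⁻¹ := fun θ => by
    have hx' : bpt θ ∈ CB := by simp
    have h1 : (bpt θ).re * (bpt θ).re + (bpt θ).im * (bpt θ).im = 1 := by rw [← norm_sq_re_im, norm_bpt]; norm_num
    have hq : quad A' 0 C' (bpt θ) = A' + C' := by rw [quad0, norm_bpt]; ring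
    have hq0 := m0.trans_le (Qlb (bpt θ) (by simp))
    unfold ww
    rw [nderiv_add_const_mul 2 (c.hv.C1 _ hx') (qC2.C1 _ hx'), nderiv_log_quad hq0, GG, Ex_inv, h1, hq]
    rw [hq] at hq0
    have : 2 * M * (b - a) = 2 * (A - C) - 2 * (A' + C') + 4 * C' := by rw [hA', hC']; ring
    rw [this]
    simp; field_simp; ring
  have dsq : ∀ x : ℂ, ‖x‖ ≤ 1 → |(Ex v x ^ 2)⁻¹ - (quad A' 0 C' x ^ 2)⁻¹| ≤ 2 * T / m ^ 4 * (M * η) := fun x hx => by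
    have e1 := Elb x hx
    have e2 := Qlb x hx
    refine (inv_diff (m := m ^ 2) (by positivity) (by gcongr) (by gcongr)).trans ?_
    rw [show Ex v x ^ 2 - quad A' 0 C' x ^ 2 = (Ex v x + quad A' 0 C' x) * (Ex v x - quad A' 0 C' x) by ring, abs_mul, abs_of_pos (by linarith)]
    calc _ ≤ (T + T) * (M * η) / (m ^ 2) ^ 2 := by
          gcongr
          · exact Eub x hx
          · exact Qub x hx
          · exact hE x hx
      _ = _ := by ring
  have hAC : |8 * A * C| ≤ 8 * Λ ^ 2 := by
    rw [abs_mul, abs_mul, abs_of_pos c.A0, abs_of_nonpos c.hC]; norm_num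
    nlinarith [c.hA, c.hCl, c.hC, c.A0]
  have exC : ContinuousOn (Ex v) CB := continuous_exp.comp_continuousOn (continuousOn_const.mul c.hv.C1.cont)
  have quC : ContinuousOn (fun x => (quad A' 0 C' x ^ 2)⁻¹) CB :=
    ((quad_contDiff (n := 0) A' 0 C').continuous.continuousOn.pow 2).inv₀ fun x hx => (pow_pos (m0.trans_le (Qlb x (by simpa using hx))) 2).ne'
  set R : ℂ → ℝ := fun x => lap (ww A' C' v) x - 8 * M * P * (quad A' 0 C' x ^ 2)⁻¹ with hR
  have RC : ContinuousOn R CB := zC2.lap_cont.sub (continuousOn_const.mul quC)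
  have hfin : IsFiniteMeasure (volume.restrict BB) := ⟨by simpa using measure_ball_lt_top⟩
  obtain ⟨hF1, hG1⟩ := hsrc c
  have Rb : ∫ x in BB, |R x| ≤ k1 * (M * η) := by
    have iF := (intD c.FF_cont).abs
    have : ∫ x in BB, |R x| ≤ ∫ x in BB, (|FF A C v x| + 8 * Λ ^ 2 * (2 * T / m ^ 4 * (M * η))) := by
      refine setIntegral_mono_on (intD RC).abs (iF.add (integrable_const _)) measurableSet_ball fun x hx => ?_
      rw [hR]; beta_reduce
      rw [zlap x (inb hx), add_sub_cancel_right]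
      refine (abs_sub _ _).trans (add_le_add le_rfl ?_)
      rw [abs_mul]
      exact mul_le_mul hAC (dsq x (inb hx)) (abs_nonneg _) (by positivity)
    rw [integral_add iF (integrable_const _), int_const] at this
    have h2 := mul_le_mul_of_nonneg_left heta hK1.le
    rw [hk1]; nlinarith
  have ntest : ∀ ψ : ℂ → ℝ, Continuous ψ → (∀ x, |ψ x| ≤ 1) → |∫ x in BB, ψ x * R x| ≤ k1 * (M * η) := fun ψ hψ h1 => by
    refine (abs_integral_le_integral_abs).trans (le_trans (setIntegral_mono_on (intD (hψ.continuousOn.mul RC)).abs (intD RC).abs measurableSet_ball fun x _ => ?_) Rb)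
    rw [abs_mul]
    exact mul_le_of_le_one_left (abs_nonneg _) (h1 x)
  have spl : ∀ ψ : ℂ → ℝ, Continuous ψ → ∫ x in BB, ψ x * lap (ww A' C' v) x = (∫ x in BB, ψ x * R x) + 8 * M * P * ∫ x in BB, ψ x * (quad A' 0 C' x ^ 2)⁻¹ := fun ψ hψ => by
    rw [← integral_const_mul, ← integral_add (intD (hψ.continuousOn.fun_mul RC)) ((intD (hψ.continuousOn.fun_mul quC)).const_mul _)]
    congr 1; ext x; rw [hR]; ring
  have hP' : |P| ≤ KP * η := by
    have g := green2 φC2 zC2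
    have z1 : ∀ θ, φ (bpt θ) = 0 := fun θ => φz _ (by norm_num)
    simp only [z1, φn, zero_mul, mul_zero, intervalIntegral.integral_zero, sub_self] at g
    have hzl : |∫ x in BB, ww A' C' v x * lap φ x| ≤ 2 / m * (M * η) * L * π := by
      refine (abs_integral_le_integral_abs).trans (le_trans (setIntegral_mono_on (intD (zC2.C1.cont.mul φC2.lap_cont)).abs (integrable_const (2 / m * (M * η) * L)) measurableSet_ball fun x hx => ?_) ?_)
      · rw [abs_mul]
        exact mul_le_mul (zb x (inb hx)) (hLb x (Metric.ball_subset_closedBall hx)) (abs_nonneg _) (by positivity)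
      · rw [int_const]; linarith
    have hr := ntest φ φC.continuous fun x => by rw [abs_of_nonneg (φ0 x)]; exact φ1 x
    have low : I / T ^ 2 ≤ ∫ x in BB, φ x * (quad A' 0 C' x ^ 2)⁻¹ := by
      rw [hI, div_eq_mul_inv, ← integral_mul_const]
      refine setIntegral_mono_on ((intD φC.continuous.continuousOn).mul_const _) (intD (φC.continuous.continuousOn.fun_mul quC)) measurableSet_ball fun x hx => ?_
      have h1 := m0.trans_le (Qlb x (inb hx))
      have h2 := Qub x (inb hx)
      have := φ0 x
      gcongr
    have e := spl φ φC.continuous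
    set J := ∫ x in BB, φ x * (quad A' 0 C' x ^ 2)⁻¹ with hJ
    have J0 : 0 < J := lt_of_lt_of_le (by positivity) low
    have h3 : |8 * M * P * J| ≤ (2 / m * L * π + k1) * (M * η) := by
      have : 8 * M * P * J = (∫ x in BB, ww A' C' v x * lap φ x) - ∫ x in BB, φ x * R x := by linarith
      rw [this]
      refine (abs_sub _ _).trans ?_
      linarith
    rw [abs_mul, abs_mul, abs_mul, abs_of_pos hM, abs_of_pos J0, show |(8:ℝ)| = 8 by norm_num] at h3
    have h4 : |P| * (I / T ^ 2) * M ≤ (2 / m * L * π + k1) * η * M := by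
      have : |P| * (I / T ^ 2) ≤ |P| * J := by gcongr
      have : |P| * (I / T ^ 2) * M ≤ |P| * J * M := by gcongr
      have : 0 ≤ |P| * J * M := by positivity
      linarith
    have h5 := le_of_mul_le_mul_right h4 hM
    rw [hKP]
    rw [← le_div_iff₀ (by positivity)] at h5
    refine h5.trans_eq ?_
    field_simp
  refine ⟨hP'.trans ?_, ?_⟩
  · gcongr
    have : 0 ≤ (K1 + 4 * Λ * (1 / m ^ 2) * (2 * π) + k1 + 8 * KP * π / m ^ 2) * T := by positivity
    linarith
  · have C2one : C2 (fun _ : ℂ => (1:ℝ)) := fun x _ => contDiffAt_const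
    have g := green2 C2one zC2
    have l1 : ∀ x, lap (fun _ : ℂ => (1:ℝ)) x = 0 := fun x => by simp [lap, pd]
    have n1 : ∀ x, nderiv (fun _ : ℂ => (1:ℝ)) x = 0 := fun x => by simp [nderiv, pd]
    simp only [l1, n1, mul_zero, intervalIntegral.integral_zero, integral_zero, sub_zero] at g
    rw [spl (fun _ => 1) continuous_const] at g
    have hr := ntest (fun _ => 1) continuous_const fun x => by norm_num
    have hup : |8 * M * P * ∫ x in BB, 1 * (quad A' 0 C' x ^ 2)⁻¹| ≤ 8 * KP * π / m ^ 2 * (M * η) := by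
      have h1 : |∫ x in BB, 1 * (quad A' 0 C' x ^ 2)⁻¹| ≤ π * (m ^ 2)⁻¹ := by
        rw [← int_const]
        refine (abs_integral_le_integral_abs).trans (setIntegral_mono_on (intD (continuousOn_const.mul quC)).abs (integrable_const _) measurableSet_ball fun x hx => ?_)
        have := Qlb x (inb hx)
        rw [one_mul, abs_of_nonneg (by positivity)]
        gcongr
      rw [abs_mul, abs_mul, abs_mul, abs_of_pos hM, show |(8:ℝ)| = 8 by norm_num]
      calc _ ≤ 8 * M * (KP * η) * (π * (m ^ 2)⁻¹) := by gcongr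
        _ = _ := by ring
    have hq1 : quad A' 0 C' 1 = A' + C' := by rw [quad0]; simp
    have s1 := Qlb 1 (by simp)
    have s2 := Qub 1 (by simp)
    rw [hq1] at s1 s2
    have cG : Continuous (fun θ => GG A C v (bpt θ)) := cont_bpt c.GG_cont
    have cE : Continuous (fun θ => (Ex v (bpt θ))⁻¹) := (cont_bpt exC).inv₀ fun θ => (exp_pos _).ne'
    have en : ∫ θ in 0..2 * π, 1 * nderiv (ww A' C' v) (bpt θ) = (∫ θ in 0..2 * π, (GG A C v (bpt θ) + 2 * (A - C) * ((Ex v (bpt θ))⁻¹ - (A' + C')⁻¹))) + (2 * π) * (2 * M * (b - a) * (A' + C')⁻¹) := by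
      simp only [znd, one_mul]
      have i1 : IntervalIntegrable (fun θ => GG A C v (bpt θ) + 2 * (A - C) * ((Ex v (bpt θ))⁻¹ - (A' + C')⁻¹)) volume 0 (2 * π) :=
        (cG.add (continuous_const.mul (cE.sub continuous_const))).intervalIntegrable _ _
      have i2 : IntervalIntegrable (fun _ : ℝ => 2 * M * (b - a) * (A' + C')⁻¹) volume 0 (2 * π) := continuous_const.intervalIntegrable _ _
      rw [intervalIntegral.integral_add i1 i2, intervalIntegral.integral_const]; simp
    have hbd : |∫ θ in 0..2 * π, (GG A C v (bpt θ) + 2 * (A - C) * ((Ex v (bpt θ))⁻¹ - (A' + C')⁻¹))| ≤ (K1 + 4 * Λ * (1 / m ^ 2) * (2 * π)) * (M * η) := by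
      have i2 : IntervalIntegrable (fun _ : ℝ => 4 * Λ * (M * η / m ^ 2)) volume 0 (2 * π) := continuous_const.intervalIntegrable _ _
      have h1 : |∫ θ in 0..2 * π, (GG A C v (bpt θ) + 2 * (A - C) * ((Ex v (bpt θ))⁻¹ - (A' + C')⁻¹))| ≤ ∫ θ in 0..2 * π, (|GG A C v (bpt θ)| + 4 * Λ * (M * η / m ^ 2)) := by
        refine (intervalIntegral.abs_integral_le_integral_abs (by positivity)).trans (intervalIntegral.integral_mono_on (by positivity) ((cG.add (continuous_const.mul (cE.sub continuous_const))).abs.intervalIntegrable _ _) ((cG.abs.add continuous_const).intervalIntegrable _ _) fun θ _ => ?_)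
        refine (abs_add_le _ _).trans (add_le_add le_rfl ?_)
        have hq : quad A' 0 C' (bpt θ) = A' + C' := by rw [quad0, norm_bpt]; ring
        have := hE (bpt θ) (by simp)
        rw [hq] at this
        have h2 := (inv_diff m0 (Elb (bpt θ) (by simp)) s1).trans (div_le_div_of_nonneg_right this (by positivity))
        rw [abs_mul, abs_of_nonneg (by linarith [c.h_bd.1])]
        have := c.h_bd.2
        exact mul_le_mul (by linarith) h2 (abs_nonneg _) (by positivity)
      rw [intervalIntegral.integral_add (cG.abs.intervalIntegrable _ _) i2, intervalIntegral.integral_const] at h1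
      have h2 := mul_le_mul_of_nonneg_left heta hK1.le
      simp only [sub_zero, smul_eq_mul] at h1
      refine h1.trans ?_
      have e3 : 2 * π * (4 * Λ * (M * η / m ^ 2)) = 4 * Λ * (1 / m ^ 2) * (2 * π) * (M * η) := by ring
      rw [e3]; linarith
    rw [en] at g
    have hS : 0 < A' + C' := m0.trans_le s1
    have fin : |(2 * π) * (2 * M * (b - a) * (A' + C')⁻¹)| ≤ (K1 + 4 * Λ * (1 / m ^ 2) * (2 * π) + k1 + 8 * KP * π / m ^ 2) * (M * η) := by
      have a1 := abs_le.1 hbd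
      have a2 := abs_le.1 hup
      have a3 := abs_le.1 hr
      rw [abs_le]; constructor <;> linarith
    rw [abs_mul, abs_mul, abs_mul, abs_mul, abs_mul, abs_inv, abs_of_pos hS, abs_of_pos hM, abs_two, abs_of_pos pp] at fin
    have f2 : |b - a| * T⁻¹ * M ≤ (K1 + 4 * Λ * (1 / m ^ 2) * (2 * π) + k1 + 8 * KP * π / m ^ 2) * η * M := by
      have q1 : |b - a| * T⁻¹ * M ≤ |b - a| * (A' + C')⁻¹ * M := by gcongr
      have q2 : 0 ≤ |b - a| * (A' + C')⁻¹ * M := by positivity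
      have q3 : |b - a| * (A' + C')⁻¹ * M * 1 ≤ |b - a| * (A' + C')⁻¹ * M * (4 * π) := by gcongr; linarith [pi_gt_three]
      linarith
    have f3 := le_of_mul_le_mul_right f2 hM
    rw [← div_eq_mul_inv, div_le_iff₀ T0] at f3
    have : 0 ≤ KP * η := by positivity
    linarith

lemma dz_ofReal {ψ : ℂ → ℝ} (h : Differentiable ℝ ψ) : dd (-iI) (fun x => (ψ x : ℂ)) = vz ψ := by
  ext x; rw [dd, fderiv_ofReal (h x), fderiv_ofReal (h x), vz]; simp only [pd]; ring

lemma dz_vz {v : ℂ → ℝ} (hv : C2 v) {x : ℂ} (hx : x ∈ CB) :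
    dd (-iI) (vz v) x = ((pd (pd v 1) 1 x - pd (pd v iI) iI x : ℝ) - 2 * iI * pd (pd v 1) iI x) / 4 := by
  have h1 := (ofRealC1 (hv.pd 1)).diff hx
  have h2 := (ofRealC1 (hv.pd iI)).diff hx
  have e : vz v = fun x => (1/2 : ℂ) * ((pd v 1 x : ℂ) - iI * pd v iI x) := by ext y; rw [vz]; ring
  have f : ∀ d, fderiv ℝ (vz v) x d = (1/2) * ((pd (pd v 1) d x : ℂ) - iI * (pd (pd v iI) d x : ℂ)) := by
    intro d
    rw [e, fderiv_const_mul (h1.fun_sub (h2.const_mul _)), fderiv_fun_sub h1 (h2.const_mul _), fderiv_const_mul h2]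
    simp only [ContinuousLinearMap.smul_apply, ContinuousLinearMap.sub_apply, smul_eq_mul]
    rw [fderiv_ofReal ((hv.pd 1).diff hx), fderiv_ofReal ((hv.pd iI).diff hx)]; rfl
  have s := pd_symm (hv x hx) 1 iI
  change pd (pd v 1) iI x = pd (pd v iI) 1 x at s
  rw [dd, f, f, s]
  push_cast
  linear_combination ((1/4) * (pd (pd v iI) iI x : ℂ)) * Complex.I_mul_I

theorem tests (Λ : ℝ) {ψ : ℂ → ℝ} {r : ℝ} (hr0 : 0 < r) (hr : r < 1) (hψ : ContDiff ℝ 2 ψ) (hs : ∀ x, r ≤ ‖x‖ → ψ x = 0) :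
    ∃ K > 0, ∀ {δ κ : ℝ} {p : ℂ} {A C : ℝ} {v : ℂ → ℝ}, Cfg Λ δ κ p A C v →
      |∫ x in BB, (Ex v x - quad A 0 C x) * (pd (pd ψ 1) 1 x - pd (pd ψ iI) iI x)| ≤ K * (δ + κ) ∧
      |∫ x in BB, (Ex v x - quad A 0 C x) * pd (pd ψ 1) iI x| ≤ K * (δ + κ) := by
  have ψ2 : C2 ψ := fun x _ => hψ.contDiffAt
  have ψd : Differentiable ℝ ψ := hψ.differentiable (by norm_num)
  have Ψ2 : ContDiff ℝ 2 (fun x => (ψ x : ℂ)) := Complex.ofRealCLM.contDiff.comp hψ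
  have hsΨ : ∀ x, r ≤ ‖x‖ → (ψ x : ℂ) = 0 := fun x hx => by rw [hs x hx]; simp
  obtain ⟨K1, hK1, h1⟩ := L8 Λ hr0 hr Ψ2 hsΨ
  obtain ⟨K2, hK2, h2⟩ := L8 Λ hr0 hr (contDiff_const.mul Ψ2 : ContDiff ℝ 2 (fun x => iI * (ψ x : ℂ))) fun x hx => by rw [hsΨ x hx, mul_zero]
  refine ⟨4 * K1 + 2 * K2, by positivity, fun {δ κ p A C v} c => ?_⟩
  set P : ℂ → ℝ := fun x => pd (pd ψ 1) 1 x - pd (pd ψ iI) iI x with hP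
  set R : ℂ → ℝ := fun x => pd (pd ψ 1) iI x with hR
  have PC : ContinuousOn P CB := ((ψ2.pd 1).pd_cont 1).sub ((ψ2.pd _).pd_cont _)
  have RC : ContinuousOn R CB := (ψ2.pd 1).pd_cont _
  have exC : ContinuousOn (Ex v) CB := continuous_exp.comp_continuousOn (continuousOn_const.mul c.hv.C1.cont)
  have q2 : ContDiff ℝ 2 (quad A 0 C) := quad_contDiff A 0 C
  have qC : ContinuousOn (quad A 0 C) CB := q2.continuous.continuousOn
  have W : ∀ x ∈ BB, dd (-iI) (vz ψ) x = ((P x : ℝ) - 2 * iI * (R x : ℝ)) / 4 := fun x hx => dz_vz ψ2 (Metric.ball_subset_closedBall hx)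
  have gen : ∀ f : ℂ → ℝ, ContinuousOn f CB → ∫ x in BB, (f x : ℂ) * dd (-iI) (vz ψ) x = ((∫ x in BB, f x * P x : ℝ) - 2 * iI * (∫ x in BB, f x * R x : ℝ)) / 4 := fun f hf => by
    have i1 : IntegrableOn (fun x => ((f x * P x : ℝ) : ℂ)) BB := (intD (hf.fun_mul PC)).ofReal
    have i2 : IntegrableOn (fun x => 2 * iI * ((f x * R x : ℝ) : ℂ)) BB := ((intD (hf.fun_mul RC)).ofReal).const_mul _
    rw [← integral_complex_ofReal, ← integral_complex_ofReal, ← integral_const_mul, ← integral_sub i1 i2, ← integral_div]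
    refine setIntegral_congr_fun measurableSet_ball fun x hx => ?_
    beta_reduce
    rw [W x hx]; push_cast; ring
  have hq : ∫ x in BB, (quad A 0 C x : ℂ) * dd (-iI) (vz ψ) x = 0 := by
    have C2q : C2 (quad A 0 C) := fun x _ => q2.contDiffAt
    have b1 : ∀ θ, vz ψ (bpt θ) = 0 := fun θ => by
      rw [vz, pd, pd, fderiv_supp (hψ.of_le (by norm_num)) hs _ (by rw [norm_bpt]; exact hr)]; simp
    have b2 : ∀ θ, (ψ (bpt θ) : ℂ) = 0 := fun θ => hsΨ _ (by rw [norm_bpt]; exact hr.le)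
    rw [ibp_dd _ (ofRealC2 C2q).C1 (vz_C1 ψ2) b1, dz_ofReal (q2.differentiable (by norm_num)), ← dz_ofReal ψd, ibp_dd _ (vz_C1 C2q) (ofRealC1 ψ2.C1) b2, neg_neg]
    rw [setIntegral_congr_fun (g := fun _ => (0:ℂ)) measurableSet_ball, integral_zero]
    intro x hx
    beta_reduce
    have e1 : pd (quad A 0 C) 1 = quad 0 (2 * C : ℝ) 0 := by ext y; rw [pd_quad]; simp [quad]
    have e2 : pd (quad A 0 C) iI = quad 0 ((2 * C : ℝ) * iI) 0 := by ext y; rw [pd_quad]; simp [quad]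
    rw [dz_vz C2q (Metric.ball_subset_closedBall hx), e1, e2, pd_quad, pd_quad, pd_quad]; simp
  have sub : ∀ T : ℂ → ℝ, ContinuousOn T CB → ∫ x in BB, (Ex v x - quad A 0 C x) * T x = (∫ x in BB, Ex v x * T x) - ∫ x in BB, quad A 0 C x * T x := fun T hT => by
    rw [← integral_sub (intD (exC.fun_mul hT)) (intD (qC.fun_mul hT))]; simp only [sub_mul]
  have hE := gen _ exC
  rw [gen _ qC] at hq
  have z1 := congrArg Complex.re hq
  have z2 := congrArg Complex.im hq
  simp at z1 z2
  have g1 := h1 c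
  have g2 := h2 c
  rw [dz_ofReal ψd] at g1
  have e3 : ∫ x in BB, EE v x * dd (-iI) (dd (-iI) fun x => iI * (ψ x : ℂ)) x = iI * ∫ x in BB, EE v x * dd (-iI) (vz ψ) x := by
    rw [← integral_const_mul]
    refine setIntegral_congr_fun measurableSet_ball fun x hx => ?_
    beta_reduce
    have : dd (-iI) (fun x => iI * (ψ x : ℂ)) = fun x => iI * vz ψ x := by
      rw [← dz_ofReal ψd]; ext y
      exact dd_const_mul _ _ (Ψ2.differentiable (by norm_num) y)
    rw [this, dd_const_mul _ _ ((vz_C1 ψ2).diff (Metric.ball_subset_closedBall hx))]; ring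
  change ∫ x in BB, EE v x * _ = _ at hE
  rw [hE] at g1 e3
  rw [e3] at g2
  simp at g1 g2
  have dk : 0 < δ + κ := by linarith [c.hδ, c.hκ]
  have u1 : 0 < K1 * (δ + κ) := by positivity
  have u2 : 0 < K2 * (δ + κ) := by positivity
  rw [sub P PC, sub R RC]
  rw [abs_le] at g1 g2 ⊢
  rw [abs_le]
  refine ⟨⟨?_, ?_⟩, ?_, ?_⟩ <;> linarith

lemma neg_disk (f : ℂ → ℝ) : ∫ x in BB, f (-x) = ∫ x in BB, f x := by
  have := (Measure.measurePreserving_neg (volume : Measure ℂ)).setIntegral_preimage_emb (Homeomorph.neg ℂ).measurableEmbedding f (Metric.ball 0 1)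
  rw [← this]; congr 2; simp

lemma bal_b (Λ : ℝ) : ∃ K > 0, ∀ {δ κ : ℝ} {p : ℂ} {A C : ℝ} {v : ℂ → ℝ}, Cfg Λ δ κ p A C v → ∀ (M η a c : ℝ) (b : ℂ),
    0 < M → 0 ≤ η → M * η ≤ exp (-Λ) / 2 →
    (∀ x : ℂ, ‖x‖ ≤ 1 → |Ex v x - quad (A + M * a) (M * b) (C + M * c) x| ≤ M * η) →
    ∫ x in BB, (b.re * x.re + b.im * x.im) ^ 2 ≤ K * ‖b‖ * η := by
  set m := exp (-Λ) / 2 with hm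
  have m0 : 0 < m := by positivity
  set T := 2 * exp Λ with hT
  have T0 : 0 < T := by positivity
  have pp := pi_pos
  refine ⟨(2 * T / m ^ 4) * π * T ^ 4 / m, by positivity, fun {δ κ p A C v} cf M η a c b hM hη hMη hE => ?_⟩
  have ee : exp (-Λ) = 2 * m := by rw [hm]; ring
  have hΛ := cf.Λpos
  have meT : m ≤ exp Λ := by
    have : exp (-Λ) ≤ exp Λ := exp_le_exp.2 (by linarith)
    linarith
  set Q := quad (A + M * a) (M * b) (C + M * c) with hQ
  set d : ℂ → ℝ := fun x => b.re * x.re + b.im * x.im with hd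
  have Qlb : ∀ x : ℂ, ‖x‖ ≤ 1 → m ≤ Q x := fun x hx => by
    have := abs_le.1 (hE x hx); have := (cf.Ex_bd hx).1; linarith
  have Qub : ∀ x : ℂ, ‖x‖ ≤ 1 → Q x ≤ T := fun x hx => by
    have := abs_le.1 (hE x hx); have := (cf.Ex_bd hx).2; linarith
  have inb : ∀ {x : ℂ}, x ∈ BB → ‖x‖ ≤ 1 := fun hx => by simp at hx; exact hx.le
  have Qn : ∀ x, Q (-x) = Q x - 2 * M * d x := fun x => by simp [hQ, quad, hd]; ring
  have dC : Continuous d := by fun_prop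
  have QC : ContinuousOn (fun x => (Q x ^ 2)⁻¹) CB :=
    ((quad_contDiff (n := 0) _ _ _).continuous.continuousOn.pow 2).inv₀ fun x hx => (pow_pos (m0.trans_le (Qlb x (by simpa using hx))) 2).ne'
  have vC : ContinuousOn (fun x => exp (v x)) CB := continuous_exp.comp_continuousOn cf.hv.C1.cont
  have negm : Set.MapsTo (fun x : ℂ => -x) CB CB := fun x hx => by simpa using hx
  have QnC : ContinuousOn (fun x => (Q (-x) ^ 2)⁻¹) CB := QC.comp continuousOn_neg negm
  have hfin : IsFiniteMeasure (volume.restrict BB) := ⟨by simpa using measure_ball_lt_top⟩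
  have zero : ∫ x in BB, d x * exp (v x) = 0 := by
    have i1 : IntegrableOn (fun x : ℂ => b.re * (x.re * exp (v x))) BB := (intD (Complex.continuous_re.continuousOn.fun_mul vC)).const_mul _
    have i2 : IntegrableOn (fun x : ℂ => b.im * (x.im * exp (v x))) BB := (intD (Complex.continuous_im.continuousOn.fun_mul vC)).const_mul _
    have : ∫ x in BB, d x * exp (v x) = ∫ x in BB, (b.re * (x.re * exp (v x)) + b.im * (x.im * exp (v x))) := by
      congr 1; ext x; simp only [hd]; ring
    rw [this, integral_add i1 i2, integral_const_mul, integral_const_mul, cf.bal1, cf.bal2]; simp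
  have up : |∫ x in BB, d x * (Q x ^ 2)⁻¹| ≤ π * (‖b‖ * (2 * T / m ^ 4 * (M * η))) := by
    have e : ∫ x in BB, d x * (Q x ^ 2)⁻¹ = ∫ x in BB, d x * ((Q x ^ 2)⁻¹ - exp (v x)) := by
      rw [← sub_zero (∫ x in BB, d x * (Q x ^ 2)⁻¹), ← zero, ← integral_sub (intD (dC.continuousOn.fun_mul QC)) (intD (dC.continuousOn.fun_mul vC))]
      simp only [mul_sub]
    rw [e, ← int_const]
    refine (abs_integral_le_integral_abs).trans (setIntegral_mono_on (intD (dC.continuousOn.fun_mul (QC.fun_sub vC))).abs (integrable_const _) measurableSet_ball fun x hx => ?_)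
    have hx1 := inb hx
    rw [abs_mul, Ex_sq]
    have e1 := (cf.Ex_bd hx1).1
    have e1' : m ≤ Ex v x := by linarith
    have e2 := Qlb x hx1
    refine mul_le_mul ((dot_le b x).trans (mul_le_of_le_one_right (norm_nonneg _) hx1)) ?_ (abs_nonneg _) (norm_nonneg _)
    refine (inv_diff (m := m ^ 2) (by positivity) (by gcongr) (by gcongr)).trans ?_
    rw [show Q x ^ 2 - Ex v x ^ 2 = (Q x + Ex v x) * (Q x - Ex v x) by ring, abs_mul, abs_of_pos (by linarith), abs_sub_comm (Q x)]
    calc _ ≤ (T + T) * (M * η) / (m ^ 2) ^ 2 := by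
          gcongr
          · exact Qub x hx1
          · linarith [(cf.Ex_bd hx1).2]
          · exact hE x hx1
      _ = _ := by ring
  have pair : 2 * ∫ x in BB, d x * (Q x ^ 2)⁻¹ = ∫ x in BB, d x * ((Q x ^ 2)⁻¹ - (Q (-x) ^ 2)⁻¹) := by
    have h1 := neg_disk fun x => d x * (Q x ^ 2)⁻¹
    have dn : ∀ x, d (-x) = -d x := fun x => by simp [hd]; ring
    simp only [dn, neg_mul, integral_neg] at h1
    simp only [mul_sub]
    rw [integral_sub (intD (dC.continuousOn.fun_mul QC)) (intD (dC.continuousOn.fun_mul QnC))]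
    linarith
  have low : (4 * M * m / T ^ 4) * ∫ x in BB, d x ^ 2 ≤ -∫ x in BB, d x * ((Q x ^ 2)⁻¹ - (Q (-x) ^ 2)⁻¹) := by
    rw [← integral_const_mul, ← integral_neg]
    refine setIntegral_mono_on ((intD (dC.pow 2).continuousOn).const_mul _) (intD (dC.continuousOn.fun_mul (QC.fun_sub QnC))).neg measurableSet_ball fun x hx => ?_
    have h1 := Qlb x (inb hx)
    have h2 := Qlb (-x) (by rw [norm_neg]; exact inb hx)
    have h3 := Qub x (inb hx)
    have h4 := Qub (-x) (by rw [norm_neg]; exact inb hx)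
    have n := Qn x
    set q := Q x
    set q' := Q (-x)
    have q0 : 0 < q := m0.trans_le h1
    have q0' : 0 < q' := m0.trans_le h2
    have : -(d x * ((q ^ 2)⁻¹ - (q' ^ 2)⁻¹)) = 2 * M * d x ^ 2 * (q + q') / (q ^ 2 * q' ^ 2) := by
      have : q - q' = 2 * M * d x := by linarith
      rw [show 2 * M * d x ^ 2 * (q + q') = d x * (2 * M * d x) * (q + q') by ring, ← this]
      field_simp; ring
    rw [this]
    calc _ = 2 * M * d x ^ 2 * (m + m) / (T ^ 2 * T ^ 2) := by ring
      _ ≤ _ := by gcongr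
  have a1 := (abs_le.1 up).1
  have fin : (m / T ^ 4) * (∫ x in BB, d x ^ 2) * (4 * M) ≤ (π * (‖b‖ * (2 * T / m ^ 4 * η))) * (4 * M) := by
    have : 0 ≤ (π * (‖b‖ * (2 * T / m ^ 4 * η))) * M := by positivity
    have e1 : (m / T ^ 4) * (∫ x in BB, d x ^ 2) * (4 * M) = (4 * M * m / T ^ 4) * ∫ x in BB, d x ^ 2 := by ring
    rw [e1]; nlinarith
  have fin := le_of_mul_le_mul_right fin (by positivity)
  rw [div_mul_eq_mul_div, div_le_iff₀ (by positivity), mul_comm m, ← le_div_iff₀ m0] at fin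
  refine fin.trans_eq (by ring)

lemma ulim (U : Ultrafilter ℕ) {s : ℕ → ℝ} {B : ℝ} (h : ∀ n, |s n| ≤ B) : ∃ l, Tendsto s U (nhds l) := by
  obtain ⟨l, _, hl⟩ := (isCompact_Icc (a := -B) (b := B)).ultrafilter_le_nhds' (U.map s) (by
    rw [Ultrafilter.mem_map]; exact Filter.univ_mem' fun n => abs_le.1 (h n))
  exact ⟨l, hl⟩

lemma UL (U : Ultrafilter ℕ) {e : ℕ → ℂ → ℝ} {B L α : ℝ} (hα : 0 < α) (hB : ∀ n x, ‖x‖ ≤ 1 → |e n x| ≤ B)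
    (hL : ∀ n x x', ‖x‖ ≤ 1 → ‖x'‖ ≤ 1 → |e n x - e n x'| ≤ L * ‖x - x'‖ ^ α) :
    ∃ E : ℂ → ℝ, Continuous E ∧ ∃ η : ℕ → ℝ, Tendsto η U (nhds 0) ∧ ∀ n x, ‖x‖ ≤ 1 → |e n x - E x| ≤ η n := by
  let ρ : ℂ → ℂ := fun x => ((max 1 ‖x‖)⁻¹ : ℝ) * x
  have ρ1 : ∀ x, ‖ρ x‖ ≤ 1 := fun x => by
    have : 0 < max 1 ‖x‖ := by positivity
    rw [norm_mul, Complex.norm_real, norm_of_nonneg (by positivity), inv_mul_le_iff₀ this, mul_one]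
    exact le_max_right _ _
  have ρe : ∀ x, ‖x‖ ≤ 1 → ρ x = x := fun x hx => by simp only [ρ]; rw [max_eq_left hx]; simp
  have ρC : Continuous ρ := by
    refine (Complex.continuous_ofReal.comp ((continuous_const.max continuous_norm).inv₀ fun x => ?_)).mul continuous_id
    have : 0 < max 1 ‖x‖ := by positivity
    exact this.ne'
  choose E hE using fun x => ulim U (s := fun n => e n (ρ x)) fun n => hB n _ (ρ1 x)
  have EL : ∀ x y, |E x - E y| ≤ L * ‖ρ x - ρ y‖ ^ α := fun x y =>
    le_of_tendsto ((hE x).sub (hE y)).abs (Eventually.of_forall fun n => hL n _ _ (ρ1 x) (ρ1 y))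
  have pw : ∀ {l : Filter ℂ} {x : ℂ}, l ≤ nhds x → Tendsto (fun y => L * ‖ρ y - ρ x‖ ^ α) l (nhds 0) := fun {l x} hl => by
    have h1 : Tendsto (fun y => ‖ρ y - ρ x‖) (nhds x) (nhds 0) := by
      have := ((ρC.sub continuous_const).norm (f := fun y => ρ y - ρ x)).tendsto x
      simpa using this
    have := (h1.rpow_const (p := α) (Or.inr hα.le)).const_mul L
    rw [zero_rpow hα.ne', mul_zero] at this
    exact this.mono_left hl
  have EC : Continuous E := continuous_iff_continuousAt.2 fun x => by
    rw [ContinuousAt, tendsto_iff_dist_tendsto_zero]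
    exact squeeze_zero (fun _ => dist_nonneg) (fun y => EL y x) (pw le_rfl)
  have eC : ∀ n, ContinuousOn (e n) CB := fun n x hx => by
    have hx : ‖x‖ ≤ 1 := by simpa using hx
    rw [ContinuousWithinAt, tendsto_iff_dist_tendsto_zero]
    refine squeeze_zero' (Eventually.of_forall fun _ => dist_nonneg) ?_ (pw nhdsWithin_le_nhds)
    filter_upwards [self_mem_nhdsWithin] with y hy
    have hy : ‖y‖ ≤ 1 := by simpa using hy
    rw [ρe x hx, ρe y hy]; exact hL n y x hy hx
  have mx : ∀ n, ∃ x ∈ CB, IsMaxOn (fun x => |e n x - E x|) CB x := fun n =>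
    (isCompact_closedBall _ _).exists_isMaxOn ⟨0, by simp⟩ ((eC n).sub EC.continuousOn).abs
  choose y hy hmax using mx
  refine ⟨E, EC, fun n => |e n (y n) - E (y n)|, ?_, fun n x hx => hmax n (show x ∈ CB by simpa using hx)⟩
  obtain ⟨z, hz, hl⟩ := (isCompact_closedBall (0:ℂ) 1).ultrafilter_le_nhds' (U.map y) (by
    rw [Ultrafilter.mem_map]; exact Filter.univ_mem' hy)
  have hz : ‖z‖ ≤ 1 := by simpa using hz
  have t1 : Tendsto (fun n => L * ‖ρ (y n) - ρ z‖ ^ α) U (nhds 0) := (pw le_rfl).comp (show Tendsto y U (nhds z) from hl)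
  have t2 : Tendsto (fun n => |e n z - E z|) U (nhds 0) := by
    have := ((hE z).sub_const (E z)).abs
    rw [sub_self, abs_zero, ρe z hz] at this; exact this
  refine squeeze_zero (fun _ => abs_nonneg _) (fun n => ?_) (by simpa using (t1.add t2).add t1)
  have hyn : ‖y n‖ ≤ 1 := by simpa using hy n
  have a1 := hL n (y n) z hyn hz
  have a2 := EL z (y n)
  rw [← ρe _ hyn, ← ρe z hz, ρe _ hyn, ρe z hz] at a1
  rw [norm_sub_rev] at a2
  rw [← ρe _ hyn, ← ρe z hz] at a1
  simp only [ρe _ hyn, ρe z hz] at a1 a2 ⊢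
  calc |e n (y n) - E (y n)| = |(e n (y n) - e n z) + (e n z - E z) + (E z - E (y n))| := by congr 1; ring
    _ ≤ _ := (abs_add_three _ _ _).trans (by linarith)

lemma Cfg.Ex_eq {Λ δ κ : ℝ} {p : ℂ} {A C : ℝ} {v : ℂ → ℝ} (c : Cfg Λ δ κ p A C v) {x : ℂ} (hx : ‖x‖ ≤ 1) :
    Ex v x - quad A 0 C x = quad A 0 C x * (exp (-ww A C v x / 2) - exp 0) := by
  rw [ww, show -(v x + 2 * log (quad A 0 C x)) / 2 = (-1/2) * v x + -log (quad A 0 C x) by ring, exp_add, exp_neg (log _), exp_log (c.E_pos hx), Ex, exp_zero]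
  have := (c.E_pos hx).ne'
  field_simp

lemma e_hold (Λ : ℝ) {α : ℝ} (hα : 0 < α) (hα1 : α < 1) : ∃ B L : ℝ, ∀ {δ κ : ℝ} {p : ℂ} {A C : ℝ} {v : ℂ → ℝ}, Cfg Λ δ κ p A C v →
    ∀ M, 0 < M → eta α δ κ ≤ M → (∀ x : ℂ, ‖x‖ ≤ 1 → |ww A C v x| ≤ M) →
    (∀ x : ℂ, ‖x‖ ≤ 1 → |(Ex v x - quad A 0 C x) / M| ≤ B) ∧
    ∀ x x' : ℂ, ‖x‖ ≤ 1 → ‖x'‖ ≤ 1 → |(Ex v x - quad A 0 C x) / M - (Ex v x' - quad A 0 C x') / M| ≤ L * ‖x - x'‖ ^ α := by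
  obtain ⟨K, hK, hh⟩ := cfg_holder Λ hα hα1
  set X := exp (3 * Λ / 2) with hX
  have X0 : 0 < X := exp_pos _
  refine ⟨Λ * (X * (1 / 2)), Λ * (X * K) + 4 * Λ * (X * (1 / 2)), fun {δ κ p A C v} c M hM he hw => ?_⟩
  have hΛ := c.Λpos
  set g : ℂ → ℝ := fun x => exp (-ww A C v x / 2) - exp 0 with hg
  have wl : ∀ x : ℂ, ‖x‖ ≤ 1 → -ww A C v x / 2 ≤ 3 * Λ / 2 := fun x hx => by linarith [(abs_le.1 (c.w_bd hx)).1]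
  have gb : ∀ x : ℂ, ‖x‖ ≤ 1 → |g x| ≤ X * (1 / 2) * M := fun x hx => by
    have h1 := exp_diff (wl x hx) (by linarith : (0:ℝ) ≤ 3 * Λ / 2)
    rw [sub_zero, abs_div, abs_neg, abs_two] at h1
    have h2 := mul_le_mul_of_nonneg_left (hw x hx) X0.le
    refine h1.trans ?_
    linarith
  have gh : ∀ x x' : ℂ, ‖x‖ ≤ 1 → ‖x'‖ ≤ 1 → |g x - g x'| ≤ X * K * M * ‖x - x'‖ ^ α := fun x x' hx hx' => by
    have h1 := exp_diff (wl x hx) (wl x' hx')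
    have h2 := hh c M hw x x' hx hx'
    have h3 : |-ww A C v x / 2 - -ww A C v x' / 2| = |ww A C v x - ww A C v x'| / 2 := by
      rw [← abs_neg, show -(-ww A C v x / 2 - -ww A C v x' / 2) = (ww A C v x - ww A C v x') / 2 by ring, abs_div, abs_two]
    rw [h3] at h1
    have h4 : K * (M + eta α δ κ) * ‖x - x'‖ ^ α ≤ K * (M + M) * ‖x - x'‖ ^ α := by gcongr
    simp only [hg, sub_sub_sub_cancel_right]
    refine h1.trans ?_
    calc _ ≤ X * ((K * (M + M) * ‖x - x'‖ ^ α) / 2) := by gcongr; exact h2.trans h4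
      _ = _ := by ring
  refine ⟨fun x hx => ?_, fun x x' hx hx' => ?_⟩
  · rw [c.Ex_eq hx, abs_div, abs_of_pos hM, div_le_iff₀ hM, abs_mul, abs_of_pos (c.E_pos hx)]
    calc _ ≤ Λ * (X * (1 / 2) * M) := mul_le_mul c.E_ub (gb x hx) (abs_nonneg _) hΛ.le
      _ = _ := by ring
  · rw [← sub_div, abs_div, abs_of_pos hM, div_le_iff₀ hM, c.Ex_eq hx, c.Ex_eq hx']
    change |quad A 0 C x * g x - quad A 0 C x' * g x'| ≤ _
    have q : |quad A 0 C x - quad A 0 C x'| ≤ 4 * Λ * ‖x - x'‖ ^ α := by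
      rw [quad0, quad0, show A + C * ‖x‖ ^ 2 - (A + C * ‖x'‖ ^ 2) = C * (‖x‖ + ‖x'‖) * (‖x‖ - ‖x'‖) by ring, abs_mul, abs_mul, abs_of_nonpos c.hC, abs_of_nonneg (by positivity : 0 ≤ ‖x‖ + ‖x'‖)]
      have h1 := abs_norm_sub_norm_le x x'
      have t2 : ‖x - x'‖ ≤ 2 := (norm_sub_le _ _).trans (by linarith)
      have h2 : ‖x - x'‖ ≤ 2 * ‖x - x'‖ ^ α := by
        rcases (norm_nonneg (x - x')).eq_or_lt with h0 | h0
        · rw [← h0, zero_rpow hα.ne']; simp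
        calc ‖x - x'‖ = ‖x - x'‖ ^ (1 - α) * ‖x - x'‖ ^ α := by rw [← rpow_add h0]; simp
          _ ≤ (2:ℝ) ^ (1:ℝ) * ‖x - x'‖ ^ α := by
            gcongr
            exact (rpow_le_rpow h0.le t2 (by linarith)).trans (rpow_le_rpow_of_exponent_le (by norm_num) (by linarith))
          _ = _ := by rw [rpow_one]
      calc _ ≤ Λ * 2 * (2 * ‖x - x'‖ ^ α) := by
            refine mul_le_mul (mul_le_mul (by linarith [c.hCl]) (by linarith) (by positivity) hΛ.le) (h1.trans h2) (abs_nonneg _) (by positivity)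
        _ = _ := by ring
    rw [show quad A 0 C x * g x - quad A 0 C x' * g x' = quad A 0 C x * (g x - g x') + (quad A 0 C x - quad A 0 C x') * g x' by ring]
    refine (abs_add_le _ _).trans ?_
    rw [abs_mul, abs_mul, abs_of_pos (c.E_pos hx)]
    calc _ ≤ Λ * (X * K * M * ‖x - x'‖ ^ α) + 4 * Λ * ‖x - x'‖ ^ α * (X * (1 / 2) * M) :=
          add_le_add (mul_le_mul c.E_ub (gh x x' hx hx') (abs_nonneg _) hΛ.le) (mul_le_mul q (gb x' hx') (abs_nonneg _) (by positivity))
      _ = _ := by ring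

theorem core_sup (Λ : ℝ) {α : ℝ} (hα : 0 < α) (hα1 : α < 1) : ∃ K > 0, ∀ {δ κ : ℝ} {p : ℂ} {A C : ℝ} {v : ℂ → ℝ},
    Cfg Λ δ κ p A C v → ∀ x : ℂ, ‖x‖ ≤ 1 → |ww A C v x| ≤ K * eta α δ κ := by
  by_contra! hc
  obtain ⟨B, L, hBL⟩ := e_hold Λ hα hα1
  obtain ⟨Kr, hKr, hrad⟩ := radial Λ hα hα1
  obtain ⟨Kb, hKb, hbal⟩ := bal_b Λ
  have seq := fun n : ℕ => hc (n + 1) (by positivity)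
  choose δ κ p A C v c x hx hlt using seq
  have hΛ := (c 0).Λpos
  have mx : ∀ n, ∃ y ∈ CB, IsMaxOn (fun x => |ww (A n) (C n) (v n) x|) CB y := fun n =>
    (isCompact_closedBall _ _).exists_isMaxOn ⟨0, by simp⟩ ((c n).wC2.C1.cont.abs)
  choose y hy hmax using mx
  have hy1 : ∀ n, ‖y n‖ ≤ 1 := fun n => by simpa using hy n
  set M : ℕ → ℝ := fun n => |ww (A n) (C n) (v n) (y n)| with hM
  have hw : ∀ n (x : ℂ), ‖x‖ ≤ 1 → |ww (A n) (C n) (v n) x| ≤ M n := fun n x hx => hmax n (show x ∈ CB by simpa using hx)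
  have e0 : ∀ n, 0 < eta α (δ n) (κ n) := fun n => eta_pos (c n).hδ (c n).hκ
  have etaM : ∀ n, eta α (δ n) (κ n) ≤ 1 / ((n:ℝ) + 1) * M n := fun n => by
    rw [div_mul_eq_mul_div, one_mul, le_div_iff₀ (by positivity), mul_comm]
    exact (hlt n).le.trans (hw n _ (hx n))
  have n1 : ∀ n : ℕ, 1 / ((n:ℝ) + 1) ≤ 1 := fun n => by rw [div_le_one (by positivity)]; linarith [n.cast_nonneg (α := ℝ)]
  have M0 : ∀ n, 0 < M n := fun n => by
    by_contra! h
    have := etaM n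
    have : 1 / ((n:ℝ) + 1) * M n ≤ 0 := mul_nonpos_of_nonneg_of_nonpos (by positivity) h
    linarith [e0 n]
  have etaM1 : ∀ n, eta α (δ n) (κ n) ≤ M n := fun n => (etaM n).trans (mul_le_of_le_one_left (M0 n).le (n1 n))
  have M3 : ∀ n, M n ≤ 3 * Λ := fun n => (c n).w_bd (hy1 n)
  let U : Ultrafilter ℕ := hyperfilter ℕ
  have hU : (U : Filter ℕ) ≤ atTop := Nat.hyperfilter_le_atTop
  obtain ⟨E, EC, η0, hη0, hE⟩ := UL U hα (fun n => (hBL (c n) _ (M0 n) (etaM1 n) (hw n)).1) fun n => (hBL (c n) _ (M0 n) (etaM1 n) (hw n)).2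
  set η : ℕ → ℝ := fun n => η0 n + 1 / ((n:ℝ) + 1) with hη
  have ηt : Tendsto η U (nhds 0) := by
    have := hη0.add (tendsto_one_div_add_atTop_nhds_zero_nat (𝕜 := ℝ) |>.mono_left hU)
    rwa [add_zero] at this
  have η00 : ∀ n, 0 ≤ η0 n := fun n => (abs_nonneg _).trans (hE n 0 (by simp))
  have ηn : ∀ n, 0 ≤ η n := fun n => add_nonneg (η00 n) (by positivity)
  have hE' : ∀ n x, ‖x‖ ≤ 1 → |Ex (v n) x - (quad (A n) 0 (C n) x + M n * E x)| ≤ M n * η n := fun n x hx => by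
    have h1 := hE n x hx
    have : Ex (v n) x - (quad (A n) 0 (C n) x + M n * E x) = M n * ((Ex (v n) x - quad (A n) 0 (C n) x) / M n - E x) := by
      have := (M0 n).ne'
      field_simp; ring
    rw [this, abs_mul, abs_of_pos (M0 n)]
    refine mul_le_mul_of_nonneg_left (h1.trans ?_) (M0 n).le
    have : 0 ≤ 1 / ((n:ℝ) + 1) := by positivity
    simp only [hη]; linarith
  have lim0 : ∀ {a k : ℝ}, (∀ᶠ n in (U : Filter ℕ), a ≤ k * η n) → a ≤ 0 := fun {a k} h => by
    have := ge_of_tendsto (ηt.const_mul k) h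
    rwa [mul_zero] at this
  have hfin : IsFiniteMeasure (volume.restrict BB) := ⟨by simpa using measure_ball_lt_top⟩
  have inb : ∀ {x : ℂ}, x ∈ BB → ‖x‖ ≤ 1 := fun hx => by simp at hx; exact hx.le
  have tst : ∀ (T : ℂ → ℝ) (K : ℝ), 0 < K → ContinuousOn T CB → (∀ n, |∫ x in BB, (Ex (v n) x - quad (A n) 0 (C n) x) * T x| ≤ K * (δ n + κ n)) → ∫ x in BB, E x * T x = 0 := by
    intro T K hK hT h
    obtain ⟨S, hS, hSb⟩ := contOn_bound hT
    have iE := intD (EC.continuousOn.fun_mul hT)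
    refine abs_nonpos_iff.1 (lim0 (k := K + π * S) (Eventually.of_forall fun n => ?_))
    have exC : ContinuousOn (Ex (v n)) CB := continuous_exp.comp_continuousOn (continuousOn_const.mul (c n).hv.C1.cont)
    have qC : ContinuousOn (quad (A n) 0 (C n)) CB := (quad_contDiff (n := 0) _ _ _).continuous.continuousOn
    have i1 := intD ((exC.fun_sub qC).fun_mul hT)
    have h2 : |∫ x in BB, ((Ex (v n) x - quad (A n) 0 (C n) x) * T x - M n * (E x * T x))| ≤ π * (M n * η n * S) := by
      rw [← int_const]
      refine (abs_integral_le_integral_abs).trans (setIntegral_mono_on (i1.sub (iE.const_mul _)).abs (integrable_const _) measurableSet_ball fun x hx => ?_)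
      rw [show (Ex (v n) x - quad (A n) 0 (C n) x) * T x - M n * (E x * T x) = (Ex (v n) x - (quad (A n) 0 (C n) x + M n * E x)) * T x by ring, abs_mul]
      exact mul_le_mul (hE' n x (inb hx)) (hSb x (Metric.ball_subset_closedBall hx)) (abs_nonneg _) (mul_nonneg (M0 n).le (ηn n))
    rw [integral_sub i1 (iE.const_mul _), integral_const_mul] at h2
    have h3 : M n * |∫ x in BB, E x * T x| ≤ M n * ((K + π * S) * η n) := by
      rw [← abs_of_pos (M0 n), ← abs_mul, abs_of_pos (M0 n)]
      have d1 := dk_le_eta hα (c n).hδ (c n).hδ1 (c n).hκ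
      have d2 : K * (δ n + κ n) ≤ K * (η n * M n) := by
        refine mul_le_mul_of_nonneg_left (d1.trans ((etaM n).trans ?_)) hK.le
        refine mul_le_mul_of_nonneg_right ?_ (M0 n).le
        simp only [hη]; linarith [η00 n]
      have d3 := abs_le.1 h2
      have d4 := abs_le.1 (h n)
      rw [abs_le]; constructor <;> linarith
    exact le_of_mul_le_mul_left h3 (M0 n)
  obtain ⟨a, b, cc, hq⟩ := L10 EC fun ψ r hr0 hr hψ hs => by
    obtain ⟨K, hK, h⟩ := tests Λ hr0 hr hψ hs
    have ψ2 : C2 ψ := fun x _ => hψ.contDiffAt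
    exact ⟨tst _ K hK (((ψ2.pd 1).pd_cont 1).sub ((ψ2.pd _).pd_cont _)) fun n => (h (c n)).1, tst _ K hK ((ψ2.pd 1).pd_cont _) fun n => (h (c n)).2⟩
  have hq1 : ∀ x : ℂ, ‖x‖ ≤ 1 → E x = quad a b cc x := fun x hx => by
    have := Set.EqOn.closure (f := E) (g := quad a b cc) hq EC (quad_contDiff (n := 0) _ _ _).continuous
    rw [closure_ball _ one_ne_zero] at this
    exact this (by simpa using hx)
  have m0 : 0 < exp (-Λ) / 2 := by positivity
  have ev : ∀ᶠ n in (U : Filter ℕ), M n * η n ≤ exp (-Λ) / 2 := by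
    have := (ηt.const_mul (3 * Λ)).eventually_le_const (u := exp (-Λ) / 2) (by rwa [mul_zero])
    filter_upwards [this] with n hn
    exact (mul_le_mul_of_nonneg_right (M3 n) (ηn n)).trans hn
  have hQ : ∀ n x, ‖x‖ ≤ 1 → |Ex (v n) x - quad (A n + M n * a) (M n * b) (C n + M n * cc) x| ≤ M n * η n := fun n x hx => by
    have := hE' n x hx
    rw [hq1 x hx] at this
    convert this using 3
    simp [quad]; ring
  have b0 : b = 0 := by
    have cd : Continuous fun x : ℂ => (b.re * x.re + b.im * x.im) ^ 2 := by fun_prop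
    have h1 : ∫ x in BB, (b.re * x.re + b.im * x.im) ^ 2 ≤ 0 := lim0 (k := Kb * ‖b‖) (by
      filter_upwards [ev] with n hn
      exact hbal (c n) (M n) (η n) a cc b (M0 n) (ηn n) hn (hQ n))
    have h2 := (setIntegral_eq_zero_iff_of_nonneg_ae (Eventually.of_forall fun x => sq_nonneg _) (intD cd.continuousOn)).1 (le_antisymm h1 (integral_nonneg fun x => sq_nonneg _))
    have h3 := Measure.eqOn_open_of_ae_eq h2 Metric.isOpen_ball cd.continuousOn continuousOn_const
    have z1 := h3 (show (1/2:ℂ) ∈ BB by simp; norm_num)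
    have z2 := h3 (show (1/2:ℂ) * iI ∈ BB by simp; norm_num)
    simp at z1 z2
    exact Complex.ext z1 z2
  rw [b0] at hQ
  simp only [mul_zero] at hQ
  have rr : ∀ᶠ n in (U : Filter ℕ), |A n * cc + C n * a + M n * a * cc| ≤ Kr * η n ∧ |cc - a| ≤ Kr * η n := by
    filter_upwards [ev] with n hn
    refine hrad (c n) (M n) (η n) a cc (M0 n) (ηn n) hn ((etaM n).trans ?_) (hQ n)
    refine mul_le_mul_of_nonneg_right ?_ (M0 n).le
    simp only [hη]; linarith [η00 n]
  have ca : cc = a := by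
    have := lim0 (rr.mono fun n h => h.2)
    exact sub_eq_zero.1 (abs_nonpos_iff.1 this)
  have a0 : a = 0 := by
    by_contra ha
    have ha' : 0 < |a| := abs_pos.2 ha
    have : |a| * (Λ⁻¹ / 2) ≤ 0 := lim0 (k := Kr) (by
      filter_upwards [rr, ev] with n h1 h2
      have h3 := h1.1
      rw [ca, show A n * a + C n * a + M n * a * a = a * (A n + C n + M n * a) by ring, abs_mul] at h3
      refine le_trans (mul_le_mul_of_nonneg_left (le_trans ?_ (le_abs_self _)) ha'.le) h3
      have h4 := (abs_le.1 (hQ n 1 (by simp))).2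
      have h5 := ((c n).Ex_bd (x := 1) (by simp)).1
      rw [quad0, ca, norm_one] at h4
      have h6 := (c n).hAC
      linarith)
    have : 0 < |a| * (Λ⁻¹ / 2) := mul_pos ha' (by have := (c 0).Ll; linarith)
    linarith
  rw [ca, a0] at hQ
  simp only [mul_zero, add_zero] at hQ
  set m := min (exp (-Λ)) Λ⁻¹ with hm
  have mm : 0 < m := lt_min (exp_pos _) (c 0).Ll
  have : (1:ℝ) ≤ 0 := lim0 (k := 2 / m) (Eventually.of_forall fun n => by
    have h1 := log_lip mm ((min_le_left _ _).trans ((c n).Ex_bd (hy1 n)).1) ((min_le_right _ _).trans ((c n).E_lb (hy1 n)))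
    have h2 := h1.trans (div_le_div_of_nonneg_right (hQ n _ (hy1 n)) mm.le)
    have h3 : M n = 2 * |log (Ex (v n) (y n)) - log (quad (A n) 0 (C n) (y n))| := by
      simp only [hM]
      rw [ww, Ex_log (v n) (y n), show ∀ s t : ℝ, -2 * s + 2 * t = (-2) * (s - t) by intros; ring, abs_mul]; norm_num
    have h4 : M n * 1 ≤ M n * (2 / m * η n) := by
      calc M n * 1 = M n := mul_one _
        _ = _ := h3
        _ ≤ 2 * (M n * η n / m) := by gcongr
        _ = _ := by ring
    exact le_of_mul_le_mul_left h4 (M0 n))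
  linarith

lemma lap_comp {u : ℂ → ℝ} {f f1 : ℂ → ℂ} {f2 x : ℂ} (hu : ContDiff ℝ 2 u) (hf : ∀ᶠ y in nhds x, HasDerivAt f (f1 y) y)
    (hf1 : HasDerivAt f1 f2 x) : lap (fun y => u (f y)) x = ‖f1 x‖ ^ 2 * lap u (f x) := by
  have hd : Differentiable ℝ (fderiv ℝ u) := (hu.fderiv_right (m := 1) (by norm_num)).differentiable (by norm_num)
  set D2 := fderiv ℝ (fderiv ℝ u) (f x) with hD2
  have fr : HasFDerivAt f _ x := hf.self_of_nhds.hasFDerivAt.restrictScalars ℝ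
  have f1r : HasFDerivAt f1 _ x := hf1.hasFDerivAt.restrictScalars ℝ
  have key : ∀ e : ℂ, fderiv ℝ (fun y => pd (fun y => u (f y)) e y) x e = D2 (f1 x * e) (f1 x * e) + fderiv ℝ u (f x) (f2 * (e * e)) := fun e => by
    have ev : (fun y => pd (fun y => u (f y)) e y) =ᶠ[nhds x] fun y => fderiv ℝ u (f y) (f1 y * e) := by
      filter_upwards [hf] with y hy
      have h1 : HasFDerivAt f _ y := hy.hasFDerivAt.restrictScalars ℝ
      have h2 := (hu.differentiable (by norm_num) (f y)).hasFDerivAt.comp y h1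
      rw [pd, show (fun y => u (f y)) = u ∘ f from rfl, h2.fderiv]; simp [mul_comm]
    have h3 := ((hd (f x)).hasFDerivAt.comp x fr).clm_apply (f1r.mul_const e)
    rw [ev.fderiv_eq]
    have h4 : fderiv ℝ (fun y => fderiv ℝ u (f y) (f1 y * e)) x = _ := h3.fderiv
    rw [h4]; simp [hD2, mul_comm, mul_left_comm, mul_assoc, add_comm]
  have pdd : ∀ d e : ℂ, fderiv ℝ (fun y => pd u d y) (f x) e = D2 e d := fun d e => by
    have := ((hd (f x)).hasFDerivAt.clm_apply (hasFDerivAt_const d (f x))).fderiv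
    have h4 : fderiv ℝ (fun y => pd u d y) (f x) = _ := this
    rw [h4]; simp [hD2]
  rw [lap, key, key, lap, pdd, pdd, Complex.I_mul_I]
  have sy := pd_symm (hu.contDiffAt (x := f x)) 1 iI
  rw [pdd, pdd] at sy
  have e1 : f1 x * 1 = (f1 x).re • (1:ℂ) + (f1 x).im • iI := by simp [Complex.re_add_im]
  have e2 : f1 x * iI = (f1 x).re • iI + (-(f1 x).im) • (1:ℂ) := by apply Complex.ext <;> simp
  rw [e1, e2, norm_sq_re_im]
  simp only [map_add, map_smul, ContinuousLinearMap.add_apply, ContinuousLinearMap.smul_apply, smul_eq_mul, mul_neg, mul_one, map_neg]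
  linear_combination (0:ℝ) * sy

section
variable {a : ℂ} (ha : ‖a‖ < 1)
include ha

def qm (a x : ℂ) : ℝ := quad 1 (2 * a) (‖a‖ ^ 2) x
omit ha in
lemma qm_eq (x : ℂ) : qm a x = ‖1 + cj a * x‖ ^ 2 := by
  simp [qm, quad, norm_sq_re_im]; ring
omit ha in
lemma den_neg (x : ℂ) : 1 - cj (-a) * x = 1 + cj a * x := by simp
lemma den_pos {x : ℂ} (hx : ‖x‖ ≤ 1) : 0 < ‖1 + cj a * x‖ := by
  rw [← den_neg]; exact one_sub_conj_pos (by rwa [norm_neg]) hx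
lemma qm_pos {x : ℂ} (hx : ‖x‖ ≤ 1) : 0 < qm a x := by
  rw [qm_eq]; have := den_pos ha hx; positivity
lemma a1 : 0 < 1 - ‖a‖ ^ 2 := by nlinarith [norm_nonneg a]
lemma den_ne {x : ℂ} (hx : ‖x‖ ≤ 1) : 1 + cj a * x ≠ 0 := norm_pos_iff.1 (den_pos ha hx)
omit ha in
lemma aconj : cj a * a = ((‖a‖ ^ 2 : ℝ) : ℂ) := by
  rw [← Complex.normSq_eq_norm_sq, Complex.normSq_eq_conj_mul_self]

lemma moeb_le {x : ℂ} (hx : ‖x‖ ≤ 1) : ‖moeb a x‖ ≤ 1 := by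
  rw [moeb, norm_div, div_le_one (den_pos ha hx)]
  have := one_sub_conj_ge (x := -a) (by rw [norm_neg]; exact ha.le) hx
  rwa [den_neg, sub_neg_eq_add, add_comm] at this
lemma moeb_lt {x : ℂ} (hx : ‖x‖ < 1) : ‖moeb a x‖ < 1 := by
  rw [moeb, norm_div, div_lt_one (den_pos ha hx.le), ← sq_lt_sq₀ (norm_nonneg _) (norm_nonneg _)]
  have : ‖1 + cj a * x‖ ^ 2 - ‖a + x‖ ^ 2 = (1 - ‖a‖ ^ 2) * (1 - ‖x‖ ^ 2) := by simp [norm_sq_re_im]; ring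
  have := mul_pos (a1 ha) (a1 hx)
  linarith
lemma moeb_circ {x : ℂ} (hx : ‖x‖ = 1) : ‖moeb a x‖ = 1 := by
  rw [moeb, norm_div, div_eq_one_iff_eq (den_pos ha hx.le).ne', ← sq_eq_sq₀ (norm_nonneg _) (norm_nonneg _)]
  have : ‖1 + cj a * x‖ ^ 2 - ‖a + x‖ ^ 2 = (1 - ‖a‖ ^ 2) * (1 - ‖x‖ ^ 2) := by simp [norm_sq_re_im]; ring
  rw [hx] at this; linarith

def m1 (a x : ℂ) : ℂ := (1 - ‖a‖ ^ 2 : ℝ) * ((1 + cj a * x) ^ 2)⁻¹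
omit ha in
lemma den_deriv (x : ℂ) : HasDerivAt (fun x => 1 + cj a * x) (cj a) x := by
  simpa using ((hasDerivAt_id x).const_mul (cj a)).const_add 1
omit ha in
lemma moeb_deriv {x : ℂ} (hx : 1 + cj a * x ≠ 0) : HasDerivAt (moeb a) (m1 a x) x := by
  refine (((hasDerivAt_id x).const_add a).div (den_deriv x) hx).congr_deriv ?_
  rw [m1]
  simp only [id]
  push_cast
  have := aconj (a := a)
  push_cast at this
  rw [← this, div_eq_mul_inv]; ring
lemma m1_norm (x : ℂ) : ‖m1 a x‖ = (1 - ‖a‖ ^ 2) / qm a x := by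
  rw [m1, norm_mul, Complex.norm_real, norm_of_nonneg (a1 ha).le, norm_inv, norm_pow, qm_eq]; rfl
lemma moeb_C2 {x : ℂ} (hx : ‖x‖ ≤ 1) : ContDiffAt ℝ 2 (moeb a) x := by
  unfold moeb
  simp only [div_eq_mul_inv]
  exact (contDiffAt_const.add contDiffAt_id).mul ((contDiffAt_const.add (contDiffAt_const.mul contDiffAt_id)).inv (den_ne ha hx))

lemma moeb_lap {u : ℂ → ℝ} (hu : ContDiff ℝ 2 u) {x : ℂ} (hx : ‖x‖ ≤ 1) : lap (fun y => u (moeb a y)) x = ((1 - ‖a‖ ^ 2) / qm a x) ^ 2 * lap u (moeb a x) := by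
  rw [← m1_norm ha]
  have h0 := den_ne ha hx
  refine lap_comp hu ?_ ((((den_deriv x).fun_pow 2).fun_inv (pow_ne_zero 2 h0)).const_mul _)
  have : ContinuousAt (fun y => 1 + cj a * y) x := by fun_prop
  filter_upwards [this.eventually_ne h0] with y hy
  exact moeb_deriv hy

lemma moeb_nd {u : ℂ → ℝ} (hu : ContDiff ℝ 2 u) {x : ℂ} (hx : ‖x‖ = 1) : nderiv (fun y => u (moeb a y)) x = ((1 - ‖a‖ ^ 2) / qm a x) * nderiv u (moeb a x) := by
  have nd : ∀ (w : ℂ → ℝ) y, nderiv w y = fderiv ℝ w y y := fun w y => by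
    have : fderiv ℝ w y y = fderiv ℝ w y (y.re • (1:ℂ) + y.im • iI) := by congr 1; simp [Complex.re_add_im]
    rw [this, map_add, map_smul, map_smul]; rfl
  have h0 := den_ne ha hx.le
  have h1 : HasFDerivAt (moeb a) _ x := (moeb_deriv h0).hasFDerivAt.restrictScalars ℝ
  have h2 : fderiv ℝ (fun y => u (moeb a y)) x = _ := ((hu.differentiable (by norm_num) _).hasFDerivAt.comp x h1).fderiv
  rw [nd, nd, h2]
  have e : m1 a x * x = ((1 - ‖a‖ ^ 2) / qm a x : ℝ) • moeb a x := by
    have h3 : ((qm a x : ℝ) : ℂ) = (1 + cj a * x) * cj (1 + cj a * x) := by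
      rw [qm_eq, Complex.mul_conj, Complex.normSq_eq_norm_sq]
    have h4 : a + x = x * cj (1 + cj a * x) := by
      have : x * cj x = 1 := by rw [Complex.mul_conj, Complex.normSq_eq_norm_sq, hx]; simp
      simp; linear_combination -a * this
    have h5 : cj (1 + cj a * x) ≠ 0 := by simpa using (map_ne_zero cj).2 h0
    rw [Complex.real_smul, Complex.ofReal_div, h3, moeb, h4, m1]
    field_simp
  simp only [ContinuousLinearMap.comp_apply, ContinuousLinearMap.coe_restrictScalars']
  rw [show (ContinuousLinearMap.toSpanSingleton ℂ (m1 a x)) x = ((1 - ‖a‖ ^ 2) / qm a x : ℝ) • moeb a x by rw [← e]; simp [mul_comm], map_smul, smul_eq_mul]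

def vv (a : ℂ) (u : ℂ → ℝ) (x : ℂ) : ℝ := (u (moeb a x) + 2 * log (1 - ‖a‖ ^ 2)) + (-2) * log (qm a x)

lemma vv_eq (u : ℂ → ℝ) {x : ℂ} (hx : ‖x‖ ≤ 1) : recen a u x = vv a u x := by
  rw [recen, vv, ← qm_eq, log_div (a1 ha).ne' (qm_pos ha hx).ne']; ring
lemma vv_exp (u : ℂ → ℝ) {x : ℂ} (hx : ‖x‖ ≤ 1) (c : ℝ) (hc : c = 1 ∨ c = 2) : exp (vv a u x / c) = exp (u (moeb a x) / c) * ((1 - ‖a‖ ^ 2) / qm a x) ^ (2 / c) := by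
  have h0 := div_pos (a1 ha) (qm_pos ha hx)
  rw [← vv_eq ha u hx, recen, ← qm_eq, add_div, exp_add, rpow_def_of_pos h0]
  congr 2; rcases hc with rfl | rfl <;> ring

lemma vv_C2 {u : ℂ → ℝ} (hu : ContDiff ℝ 2 u) : C2 (vv a u) := fun x hx => by
  have hx : ‖x‖ ≤ 1 := by simpa using hx
  exact ((hu.contDiffAt.comp x (moeb_C2 ha hx)).add contDiffAt_const).add (contDiffAt_const.mul (log_quad_contDiffAt (qm_pos ha hx)))

lemma vv_lap {u : ℂ → ℝ} (hu : ContDiff ℝ 2 u) {x : ℂ} (hx : ‖x‖ ≤ 1) : lap (vv a u) x = ((1 - ‖a‖ ^ 2) / qm a x) ^ 2 * lap u (moeb a x) := by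
  unfold vv
  have hl : ContDiffAt ℝ 2 (fun y => log (qm a y)) x := log_quad_contDiffAt (qm_pos ha hx)
  have hg : ContDiffAt ℝ 2 (fun y => u (moeb a y) + 2 * log (1 - ‖a‖ ^ 2)) x := (hu.contDiffAt.comp x (moeb_C2 ha hx)).add contDiffAt_const
  rw [lap_add_const_mul (-2) hg hl]
  have h1 := moeb_lap ha (hu.add contDiff_const : ContDiff ℝ 2 (fun y => u y + 2 * log (1 - ‖a‖ ^ 2))) hx
  have h2 : lap (fun y => log (qm a y)) x = 0 := by
    have := lap_log_quad (qm_pos ha hx)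
    refine this.trans ?_
    simp [norm_sq_re_im]; ring_nf; simp
  rw [h1, h2]
  have h3 : ∀ e, (fun y => pd (fun y => u y + 2 * log (1 - ‖a‖ ^ 2)) e y) = fun y => pd u e y := fun e => by
    ext y; rw [pd, fderiv_add_const]; rfl
  rw [lap, h3, h3, lap]; ring

lemma vv_nd {u : ℂ → ℝ} (hu : ContDiff ℝ 2 u) {x : ℂ} (hx : ‖x‖ = 1) : nderiv (vv a u) x = ((1 - ‖a‖ ^ 2) / qm a x) * nderiv u (moeb a x) - 2 + 2 * ((1 - ‖a‖ ^ 2) / qm a x) := by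
  unfold vv
  have q0 := qm_pos ha hx.le
  have hl : ContDiffAt ℝ 1 (fun y => log (qm a y)) x := log_quad_contDiffAt q0
  have hg : ContDiffAt ℝ 1 (fun y => u (moeb a y) + 2 * log (1 - ‖a‖ ^ 2)) x := ((hu.contDiffAt.comp x (moeb_C2 ha hx.le)).add contDiffAt_const).of_le (by norm_num)
  rw [nderiv_add_const_mul (-2) hg hl]
  have h1 := moeb_nd ha (hu.add contDiff_const : ContDiff ℝ 2 (fun y => u y + 2 * log (1 - ‖a‖ ^ 2))) hx
  have h2 : nderiv (fun y => log (qm a y)) x = _ := nderiv_log_quad q0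
  have h3 : ∀ e y, pd (fun y => u y + 2 * log (1 - ‖a‖ ^ 2)) e y = pd u e y := fun e y => by
    rw [pd, fderiv_add_const]; rfl
  rw [h1, h2]
  have e1 : x.re * x.re + x.im * x.im = 1 := by rw [← norm_sq_re_im, hx]; norm_num
  have e2 : quad 1 (2 * a) (‖a‖ ^ 2) x = 1 + (2 * a.re * x.re + 2 * a.im * x.im) + ‖a‖ ^ 2 := by rw [quad, e1]; simp
  simp only [nderiv, h3, e1]
  change 0 < quad 1 (2 * a) (‖a‖ ^ 2) x at q0
  simp only [qm]
  set D := quad 1 (2 * a) (‖a‖ ^ 2) x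
  rw [show (2 * a).re * x.re + (2 * a).im * x.im + 2 * ‖a‖ ^ 2 * 1 = D - 1 + ‖a‖ ^ 2 by rw [e2]; simp; ring]
  field_simp
  ring
end

lemma geo {a : ℂ} (ha : ‖a‖ < 1) (ha0 : a ≠ 0) {x : ℂ} (hx : ‖x‖ ≤ 1) :
    (1 - ‖a‖) + ‖x + a / ‖a‖‖ ≤ 3 * ‖1 + cj a * x‖ ∧
    ‖moeb a x - a / ‖a‖‖ * ((1 - ‖a‖) + ‖x + a / ‖a‖‖) ≤ 6 * (1 - ‖a‖) ∧
    (1 - ‖a‖ ^ 2) / qm a x ≤ 18 * (1 - ‖a‖) * (((1 - ‖a‖) + ‖x + a / ‖a‖‖) ^ 2)⁻¹ := by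
  have r0 : 0 < ‖a‖ := norm_pos_iff.2 ha0
  have r0' : (‖a‖ : ℂ) ≠ 0 := by exact_mod_cast r0.ne'
  set p : ℂ := a / ‖a‖ with hp
  have np : ‖p‖ = 1 := by rw [hp, norm_div, Complex.norm_real, norm_norm, div_self r0.ne']
  have ap : a = ‖a‖ * p := by rw [hp]; field_simp
  have ca : cj a = ‖a‖ * cj p := by conv_lhs => rw [ap, map_mul, Complex.conj_ofReal]
  have pp : cj p * p = 1 := by rw [aconj, np]; simp
  have d0 := den_pos ha hx
  set d := ‖1 + cj a * x‖ with hd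
  have n1 : ‖cj a * x‖ ≤ ‖a‖ := by rw [norm_mul, RCLike.norm_conj]; nlinarith
  have h1 : 1 - ‖a‖ ≤ d := by
    have := norm_sub_norm_le (1:ℂ) (-(cj a * x))
    rw [norm_neg, norm_one, sub_neg_eq_add, ← hd] at this
    linarith
  have h2 : ‖x + p‖ ≤ d + (1 - ‖a‖) := by
    have e : ‖x + p‖ = ‖(1 + cj a * x) + ((1 - ‖a‖ : ℝ) : ℂ) * (cj p * x)‖ := by
      rw [show ‖x + p‖ = ‖cj p * (x + p)‖ by rw [norm_mul, RCLike.norm_conj, np, one_mul], ca]; congr 1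
      push_cast; linear_combination pp
    rw [e]
    refine (norm_add_le _ _).trans (add_le_add hd.ge ?_)
    rw [norm_mul, norm_mul, RCLike.norm_conj, np, Complex.norm_real, norm_of_nonneg (by linarith)]
    nlinarith
  have h3 : (1 - ‖a‖) + ‖x + p‖ ≤ 3 * d := by linarith
  have t0 : 0 < (1 - ‖a‖) + ‖x + p‖ := by have := norm_nonneg (x + p); linarith
  refine ⟨h3, ?_, ?_⟩
  · have e : ‖moeb a x - p‖ = (1 - ‖a‖) * ‖x - p‖ / d := by
      have : moeb a x - p = ((1 - ‖a‖ : ℝ) : ℂ) * (x - p) / (1 + cj a * x) := by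
        rw [moeb, div_sub' (den_ne ha hx)]; congr 1
        push_cast; rw [ca]; linear_combination ap - ‖a‖ * x * pp
      rw [this, norm_div, norm_mul, Complex.norm_real, norm_of_nonneg (by linarith)]
    have n2 : ‖x - p‖ ≤ 2 := (norm_sub_le _ _).trans (by linarith)
    have n3 : (1 - ‖a‖) * ‖x - p‖ ≤ (1 - ‖a‖) * 2 := mul_le_mul_of_nonneg_left n2 (by linarith)
    have n4 : 0 ≤ (1 - ‖a‖) * ‖x - p‖ := mul_nonneg (by linarith) (norm_nonneg _)
    rw [e, div_mul_eq_mul_div, div_le_iff₀ d0]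
    calc _ ≤ ((1 - ‖a‖) * 2) * (3 * d) := mul_le_mul n3 h3 t0.le (by linarith)
      _ = _ := by ring
  · rw [qm_eq, ← hd, ← div_eq_mul_inv, div_le_div_iff₀ (by positivity) (by positivity)]
    have : ((1 - ‖a‖) + ‖x + p‖) ^ 2 ≤ (3 * d) ^ 2 := pow_le_pow_left₀ t0.le h3 2
    calc _ ≤ (2 * (1 - ‖a‖)) * (3 * d) ^ 2 := mul_le_mul (by nlinarith) this (by positivity) (by linarith)
      _ = _ := by ring

lemma mk_cfg {K h u : ℂ → ℝ} {ε L M Λ : ℝ} {a : ℂ} (ha : ‖a‖ < 1) (ha0 : a ≠ 0) (hu : IsPerturbedSolution K h ε u)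
    (hε : |ε| ≤ 1 / 2) (hL : 0 ≤ L) (hK : ∀ x y, ‖x‖ ≤ 1 → ‖y‖ ≤ 1 → |K x - K y| ≤ L * ‖x - y‖)
    (hh : ∀ x y, ‖x‖ = 1 → ‖y‖ = 1 → |h x - h y| ≤ L * ‖x - y‖)
    (hM : ∀ x, ‖x‖ ≤ 1 → |recen a u x| ≤ M)
    (b1 : ∫ x in unitDisk, x.re * exp (recen a u x) = 0) (b2 : ∫ x in unitDisk, x.im * exp (recen a u x) = 0)
    (h324 : 324 ≤ Λ) (hMΛ : M ≤ Λ) (hLΛ : 24 * L * exp M ≤ Λ)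
    (hφ : 0 < phiHat K h ε a) (hφΛ : phiHat K h ε a ≤ Λ) (hk : kHat K ε a < 0) (hkΛ : -Λ ≤ kHat K ε a / (2 * phiHat K h ε a))
    (hs : Λ⁻¹ ≤ sqrt (heps h ε (a / (‖a‖ : ℂ)) ^ 2 + Keps K ε (a / (‖a‖ : ℂ)))) :
    Cfg Λ (1 - ‖a‖) |ε / (1 + ε)| (a / ‖a‖) (phiHat K h ε a / 2) (kHat K ε a / (2 * phiHat K h ε a)) (vv a u) := by
  have Λ0 : 0 < Λ := by linarith
  obtain ⟨e1, e2⟩ := abs_le.1 hε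
  have E0 : (0:ℝ) < 1 + ε := by linarith
  have r0 : 0 < ‖a‖ := norm_pos_iff.2 ha0
  have np : ‖a / (‖a‖ : ℂ)‖ = 1 := by rw [norm_div, Complex.norm_real, norm_norm, div_self r0.ne']
  set S := sqrt (heps h ε (a / (‖a‖ : ℂ)) ^ 2 + Keps K ε (a / (‖a‖ : ℂ))) with hS
  have S0 : 0 < S := lt_of_lt_of_le (by positivity) hs
  have S2 : S ^ 2 = heps h ε (a / (‖a‖ : ℂ)) ^ 2 + kHat K ε a := by
    rw [hS, sq_sqrt (sqrt_pos.1 S0).le]; rfl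
  have φe : phiHat K h ε a = heps h ε (a / (‖a‖ : ℂ)) + S := rfl
  have ke : kHat K ε a = Keps K ε (a / (‖a‖ : ℂ)) := rfl
  set H := heps h ε (a / (‖a‖ : ℂ)) with hH
  set φ := phiHat K h ε a
  set k := kHat K ε a
  set δ := 1 - ‖a‖ with hδ
  have δ0 : 0 < δ := by linarith
  have hAC : φ / 2 + k / (2 * φ) = S := by field_simp; rw [φe]; linear_combination -S2 
  have hAC' : φ / 2 - k / (2 * φ) = H := by field_simp; rw [φe]; linear_combination S2
  have hAC2 : 8 * (φ / 2) * (k / (2 * φ)) = 2 * k := by field_simp; ring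
  have exM : ∀ x, ‖x‖ ≤ 1 → exp (vv a u x) ≤ exp M := fun x hx => exp_le_exp.2 (by rw [← vv_eq ha u hx]; exact (le_abs_self _).trans (hM x hx))
  have M0 : 0 ≤ M := (abs_nonneg _).trans (hM 0 (by simp))
  have exM2 : ∀ x, ‖x‖ ≤ 1 → exp (vv a u x / 2) ≤ exp M := fun x hx => exp_le_exp.2 (by
    have := (le_abs_self _).trans (hM x hx); rw [vv_eq ha u hx] at this; linarith)
  have fb : ∀ x, ‖x‖ ≤ 1 → L * ‖moeb a x - a / ‖a‖‖ / (1 + ε) ≤ 12 * L * (δ * ((δ + ‖x + a / ‖a‖‖) ^ 1)⁻¹) := fun x hx => by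
    have t0 : 0 < δ + ‖x + a / ‖a‖‖ := by positivity
    have h1 := (geo ha ha0 hx).2.1
    rw [← le_div_iff₀ t0] at h1
    have h2 := mul_le_mul_of_nonneg_left h1 hL
    rw [div_le_iff₀ E0, pow_one, ← div_eq_mul_inv]
    refine h2.trans ?_
    have : 0 ≤ L * (δ / (δ + ‖x + a / ‖a‖‖)) := by positivity
    rw [show L * (6 * (1 - ‖a‖) / ((1 - ‖a‖) + ‖x + a / ‖a‖‖)) = 6 * (L * (δ / (δ + ‖x + a / ‖a‖‖))) by rw [hδ]; ring]
    nlinarith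
  have bc : ∀ g : ℂ → ℝ, ∫ x in BB, g x * exp (vv a u x) = ∫ x in unitDisk, g x * exp (recen a u x) := fun g => by
    refine setIntegral_congr_fun measurableSet_ball fun x hx => ?_
    simp only [vv_eq ha u (mem_ball_zero_iff.1 hx).le]
  refine ⟨vv_C2 ha hu.1, fun x hx => ?_, by linarith, δ0, by linarith, abs_nonneg _, ?_, np, ?_, hkΛ, by linarith, hAC ▸ hs, fun x hx => ?_, fun θ => ?_, ?_, ?_⟩
  · have hx : ‖x‖ ≤ 1 := by simpa using hx
    rw [← vv_eq ha u hx]; exact (hM x hx).trans hMΛ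
  · rw [abs_div, abs_of_pos E0, div_le_iff₀ E0]; nlinarith
  · exact div_nonpos_of_nonpos_of_nonneg hk.le (by positivity)
  · have hx : ‖x‖ < 1 := by simpa using hx
    have hx' := hx.le
    have t0 : 0 < δ + ‖x + a / ‖a‖‖ := by positivity
    have m := moeb_lt ha hx
    have eq := hu.2.1 (moeb a x) (by simpa [unitDisk] using m)
    have ve := vv_exp ha u hx' 1 (Or.inl rfl)
    rw [div_one, div_one, div_one, rpow_two] at ve
    have sb := (geo ha ha0 hx').2.2
    have s0 : 0 < (1 - ‖a‖ ^ 2) / qm a x := div_pos (a1 ha) (qm_pos ha hx')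
    have ex := exM x hx'
    have fbx := fb x hx'
    have Kd := hK _ _ np.le m.le
    rw [vv_lap ha hu.1 hx', hAC2]
    set s := (1 - ‖a‖ ^ 2) / qm a x
    have e3 : s ^ 2 * lap u (moeb a x) + 2 * k * exp (vv a u x) = -(ε / (1 + ε)) * s ^ 2 + 2 * (k - Keps K ε (moeb a x)) * exp (vv a u x) := by
      have : lap u (moeb a x) = -(ε / (1 + ε)) - 2 * Keps K ε (moeb a x) * exp (u (moeb a x)) := by
        rw [← eq, Ktil]; field_simp; ring
      rw [this, ve]; ring
    have e4 : |k - Keps K ε (moeb a x)| ≤ 12 * L * (δ * ((δ + ‖x + a / ‖a‖‖) ^ 1)⁻¹) := by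
      refine le_trans ?_ fbx
      rw [ke, Keps, Keps, ← sub_div, abs_div, abs_of_pos E0, show K (a / ‖a‖) - ε / 2 - (K (moeb a x) - ε / 2) = K (a / ‖a‖) - K (moeb a x) by ring, norm_sub_rev]
      exact div_le_div_of_nonneg_right Kd E0.le
    have e5 : s ^ 2 ≤ 324 * (δ ^ 2 * ((δ + ‖x + a / ‖a‖‖) ^ 4)⁻¹) := by
      refine (pow_le_pow_left₀ s0.le sb 2).trans (le_of_eq ?_)
      rw [hδ]; field_simp; ring
    rw [e3]
    refine (abs_add_le _ _).trans ?_
    rw [abs_mul, abs_neg, abs_mul, abs_mul, abs_of_pos (exp_pos _), abs_two, abs_of_nonneg (sq_nonneg s)]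
    have p1 : |ε / (1 + ε)| * s ^ 2 ≤ Λ * (|ε / (1 + ε)| * δ ^ 2 * ((δ + ‖x + a / ‖a‖‖) ^ 4)⁻¹) := by
      refine (mul_le_mul_of_nonneg_left e5 (abs_nonneg _)).trans ?_
      have : 0 ≤ |ε / (1 + ε)| * δ ^ 2 * ((δ + ‖x + a / ‖a‖‖) ^ 4)⁻¹ := by positivity
      refine le_trans (le_of_eq ?_) (mul_le_mul_of_nonneg_right h324 this)
      ring
    have p2 : 2 * |k - Keps K ε (moeb a x)| * exp (vv a u x) ≤ Λ * (δ * ((δ + ‖x + a / ‖a‖‖) ^ 1)⁻¹) := by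
      have g0 : 0 ≤ δ * ((δ + ‖x + a / ‖a‖‖) ^ 1)⁻¹ := by positivity
      calc _ ≤ 2 * (12 * L * (δ * ((δ + ‖x + a / ‖a‖‖) ^ 1)⁻¹)) * exp M := by gcongr
        _ = (24 * L * exp M) * (δ * ((δ + ‖x + a / ‖a‖‖) ^ 1)⁻¹) := by ring
        _ ≤ _ := mul_le_mul_of_nonneg_right hLΛ g0
    rw [mul_add]; linarith
  · have hx : ‖bpt θ‖ = 1 := norm_bpt θ
    set x := bpt θ
    have hx' := hx.le
    have t0 : 0 < δ + ‖x + a / ‖a‖‖ := by positivity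
    have m := moeb_circ ha hx
    have eq := hu.2.2 (moeb a x) (by simpa [unitCircle] using m)
    have ve := vv_exp ha u hx' 2 (Or.inr rfl)
    rw [div_self two_ne_zero, rpow_one] at ve
    have sb := (geo ha ha0 hx').2.2
    have s0 : 0 < (1 - ‖a‖ ^ 2) / qm a x := div_pos (a1 ha) (qm_pos ha hx')
    have ex := exM2 x hx'
    have fbx := fb x hx'
    have hd := hh _ _ m np
    rw [vv_nd ha hu.1 hx, mul_assoc, hAC']
    set s := (1 - ‖a‖ ^ 2) / qm a x
    have e3 : s * nderiv u (moeb a x) - 2 + 2 * s - (2 * (H * exp (vv a u x / 2)) - 2) = (2 * (ε / (1 + ε))) * s + 2 * (heps h ε (moeb a x) - H) * exp (vv a u x / 2) := by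
      have : nderiv u (moeb a x) = -2 + 2 * (ε / (1 + ε)) + 2 * heps h ε (moeb a x) * exp (u (moeb a x) / 2) := by
        rw [← eq, htil]; field_simp; ring
      rw [this, ve]; ring
    have e4 : |heps h ε (moeb a x) - H| ≤ 12 * L * (δ * ((δ + ‖x + a / ‖a‖‖) ^ 1)⁻¹) := by
      refine le_trans ?_ fbx
      rw [hH, heps, heps, ← sub_div, abs_div, abs_of_pos E0]
      exact div_le_div_of_nonneg_right hd E0.le
    rw [e3]
    refine (abs_add_le _ _).trans ?_
    rw [abs_mul, abs_mul, abs_mul, abs_mul, abs_of_pos (exp_pos _), abs_two, abs_of_pos s0]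
    have p1 : 2 * |ε / (1 + ε)| * s ≤ Λ * (|ε / (1 + ε)| * δ * ((δ + ‖x + a / ‖a‖‖) ^ 2)⁻¹) := by
      refine (mul_le_mul_of_nonneg_left sb (by positivity)).trans ?_
      have : 0 ≤ |ε / (1 + ε)| * δ * ((δ + ‖x + a / ‖a‖‖) ^ 2)⁻¹ := by positivity
      refine le_trans (le_of_eq ?_) (mul_le_mul_of_nonneg_right (show (36:ℝ) ≤ Λ by linarith) this)
      rw [hδ]; ring
    have p2 : 2 * |heps h ε (moeb a x) - H| * exp (vv a u x / 2) ≤ Λ * (δ * ((δ + ‖x + a / ‖a‖‖) ^ 1)⁻¹) := by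
      have g0 : 0 ≤ δ * ((δ + ‖x + a / ‖a‖‖) ^ 1)⁻¹ := by positivity
      calc _ ≤ 2 * (12 * L * (δ * ((δ + ‖x + a / ‖a‖‖) ^ 1)⁻¹)) * exp M := by gcongr
        _ = (24 * L * exp M) * (δ * ((δ + ‖x + a / ‖a‖‖) ^ 1)⁻¹) := by ring
        _ ≤ _ := mul_le_mul_of_nonneg_right hLΛ g0
    rw [mul_add]; linarith
  · rw [bc]; exact b1
  · rw [bc]; exact b2

lemma psi_eq {K h u : ℂ → ℝ} {ε : ℝ} {a : ℂ} (ha : ‖a‖ < 1) (hφ : 0 < phiHat K h ε a) {x : ℂ} (hx : ‖x‖ ≤ 1)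
    (hd : 0 < bubDen K h ε a (moeb a x)) :
    u (moeb a x) - bub K h ε a (moeb a x) = ww (phiHat K h ε a / 2) (kHat K ε a / (2 * phiHat K h ε a)) (vv a u) x := by
  have r0 := a1 ha
  have q0 := qm_pos ha hx
  have dn := den_ne ha hx
  have ac := aconj (a := a)
  have n1 : ‖1 - cj a * moeb a x‖ ^ 2 = (1 - ‖a‖ ^ 2) ^ 2 / qm a x := by
    have : 1 - cj a * moeb a x = ((1 - ‖a‖ ^ 2 : ℝ) : ℂ) / (1 + cj a * x) := by
      rw [moeb, ← mul_div_assoc, eq_div_iff dn, sub_mul, div_mul_cancel₀ _ dn]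
      push_cast at ac ⊢; linear_combination -ac
    rw [this, norm_div, Complex.norm_real, norm_of_nonneg r0.le, div_pow, qm_eq]
  have n2 : ‖moeb a x - a‖ ^ 2 = ‖x‖ ^ 2 * (1 - ‖a‖ ^ 2) ^ 2 / qm a x := by
    have : moeb a x - a = x * ((1 - ‖a‖ ^ 2 : ℝ) : ℂ) / (1 + cj a * x) := by
      rw [moeb, eq_div_iff dn, sub_mul, div_mul_cancel₀ _ dn]
      push_cast at ac ⊢; linear_combination -x * ac
    rw [this, norm_div, norm_mul, Complex.norm_real, norm_of_nonneg r0.le, div_pow, qm_eq, mul_pow]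
  set φ := phiHat K h ε a
  set k := kHat K ε a
  have Q : bubDen K h ε a (moeb a x) = 2 * φ * (1 - ‖a‖ ^ 2) * ((1 - ‖a‖ ^ 2) * quad (φ / 2) 0 (k / (2 * φ)) x / qm a x) := by
    change φ ^ 2 * ‖1 - cj a * moeb a x‖ ^ 2 + k * ‖moeb a x - a‖ ^ 2 = _
    rw [n1, n2, norm_sq_re_im x, quad]; simp; field_simp
  have c0 : 0 < 2 * φ * (1 - ‖a‖ ^ 2) := by positivity
  have q1 : 0 < quad (φ / 2) 0 (k / (2 * φ)) x := by
    rw [Q] at hd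
    have h2 := (mul_pos_iff_of_pos_left c0).1 hd
    rw [div_eq_mul_inv] at h2
    exact (mul_pos_iff_of_pos_left r0).1 ((mul_pos_iff_of_pos_right (inv_pos.2 q0)).1 h2)
  have : bub K h ε a (moeb a x) = 2 * log (qm a x) - 2 * log (1 - ‖a‖ ^ 2) - 2 * log (quad (φ / 2) 0 (k / (2 * φ)) x) := by
    change 2 * log (2 * φ * (1 - ‖a‖ ^ 2) / _) = _
    rw [Q, div_mul_eq_div_div, div_self c0.ne', one_div, log_inv, log_div (by positivity) q0.ne', log_mul r0.ne' q1.ne']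
    ring
  rw [this, ww, vv]; ring

lemma moeb_inv {a : ℂ} (ha : ‖a‖ < 1) {y : ℂ} (hy : ‖y‖ ≤ 1) : moeb a (moeb (-a) y) = y := by
  have h1 := den_ne (a := -a) (by rwa [norm_neg]) hy
  have ac := aconj (a := a)
  have h2 : (1 - (‖a‖ : ℂ) ^ 2) ≠ 0 := by exact_mod_cast (a1 ha).ne'
  push_cast at ac
  have e1 : a + moeb (-a) y = y * (1 - (‖a‖ : ℂ) ^ 2) / (1 + cj (-a) * y) := by
    rw [moeb, eq_div_iff h1, add_mul, div_mul_cancel₀ _ h1]; simp; linear_combination -y * ac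
  have e2 : 1 + cj a * moeb (-a) y = (1 - (‖a‖ : ℂ) ^ 2) / (1 + cj (-a) * y) := by
    rw [moeb, ← mul_div_assoc, eq_div_iff h1, add_mul, div_mul_cancel₀ _ h1]; simp; linear_combination -ac
  rw [moeb, e1, e2, div_div_div_cancel_right₀ h1, mul_div_cancel_right₀ _ h2]

lemma moeb_lip {a : ℂ} (ha : ‖a‖ < 1) {y z : ℂ} (hy : ‖y‖ ≤ 1) (hz : ‖z‖ ≤ 1) : ‖moeb a y - moeb a z‖ ≤ 2 / (1 - ‖a‖) * ‖y - z‖ := by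
  have h1 := den_ne ha hy
  have h2 := den_ne ha hz
  have lb : ∀ x : ℂ, ‖x‖ ≤ 1 → 1 - ‖a‖ ≤ ‖1 + cj a * x‖ := fun x hx => by
    have := norm_sub_norm_le (1:ℂ) (-(cj a * x))
    rw [norm_neg, norm_one, sub_neg_eq_add, norm_mul, RCLike.norm_conj] at this
    nlinarith [norm_nonneg a]
  have e : moeb a y - moeb a z = ((1 - ‖a‖ ^ 2 : ℝ) : ℂ) * (y - z) / ((1 + cj a * y) * (1 + cj a * z)) := by
    have ac := aconj (a := a)
    rw [moeb, moeb, div_sub_div _ _ h1 h2]; congr 1; push_cast at ac ⊢; linear_combination (z - y) * ac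
  have d0 : 0 < 1 - ‖a‖ := by linarith
  rw [e, norm_div, norm_mul, norm_mul, Complex.norm_real, norm_of_nonneg (a1 ha).le, div_le_iff₀ (mul_pos (den_pos ha hy) (den_pos ha hz))]
  have := mul_le_mul (lb y hy) (lb z hz) d0.le (norm_nonneg _)
  calc _ = 2 / (1 - ‖a‖) * ‖y - z‖ * ((1 - ‖a‖) * ((1 + ‖a‖) / 2 * (1 - ‖a‖))) := by field_simp; ring
    _ ≤ 2 / (1 - ‖a‖) * ‖y - z‖ * ((1 - ‖a‖) * (1 - ‖a‖)) := by
      gcongr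
      nlinarith
    _ ≤ _ := by gcongr

lemma h_lip {h : ℂ → ℝ} (hh : ContDiff ℝ 2 (fun θ => h (bpt θ))) : ∃ L > 0, ∀ x y, ‖x‖ = 1 → ‖y‖ = 1 → |h x - h y| ≤ L * ‖x - y‖ := by
  obtain ⟨B, hB⟩ := isCompact_Icc.exists_bound_of_continuousOn (s := Set.Icc (-(2 * π)) (2 * π)) (hh.continuous_deriv (by norm_num)).continuousOn
  have hB' : ∀ s ∈ Set.Icc (-(2 * π)) (2 * π), ∀ t ∈ Set.Icc (-(2 * π)) (2 * π), ‖h (bpt t) - h (bpt s)‖ ≤ B * ‖t - s‖ := fun s hs t ht =>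
    (convex_Icc _ _).norm_image_sub_le_of_norm_deriv_le (f := fun θ => h (bpt θ)) (fun x _ => hh.differentiable (by norm_num) x) hB hs ht
  have B0 : 0 ≤ B := (norm_nonneg _).trans (hB 0 ⟨by linarith [pi_pos], by linarith [pi_pos]⟩)
  have ba : ∀ z : ℂ, ‖z‖ = 1 → bpt z.arg = z := fun z hz => by
    have := Complex.norm_mul_exp_arg_mul_I z; rw [hz] at this; simpa [bpt] using this
  refine ⟨B * (π / 2) + 1, by positivity, fun x y hx hy => ?_⟩
  have y0 : y ≠ 0 := norm_ne_zero_iff.1 (by rw [hy]; norm_num)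
  have h1 := ba y hy
  have h2 := ba (x / y) (by rw [norm_div, hx, hy, div_one])
  have hxe : bpt (y.arg + (x / y).arg) = x := by
    have : bpt (y.arg + (x / y).arg) = bpt y.arg * bpt (x / y).arg := by rw [bpt, bpt, bpt, ← Complex.exp_add]; push_cast; ring_nf
    rw [this, h1, h2]; field_simp
  have a1 := abs_le.1 (Complex.abs_arg_le_pi y)
  have a2 := abs_le.1 (Complex.abs_arg_le_pi (x / y))
  have k1 := hB' y.arg ⟨by linarith, by linarith⟩ (y.arg + (x / y).arg) ⟨by linarith, by linarith⟩
  have k2 := bpt_sub_lower (θ := y.arg + (x / y).arg) (φ := y.arg) (by rw [add_sub_cancel_left]; exact Complex.abs_arg_le_pi _)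
  rw [h1, hxe] at k1 k2
  rw [norm_eq_abs, norm_eq_abs] at k1
  set τ := |y.arg + (x / y).arg - y.arg|
  have k3 : τ ≤ π / 2 * ‖x - y‖ := by
    have := mul_le_mul_of_nonneg_left k2 (show 0 ≤ π / 2 by positivity)
    rw [← mul_assoc, show π / 2 * (2 / π) = 1 by field_simp, one_mul] at this
    exact this
  have := mul_le_mul_of_nonneg_left k3 B0
  nlinarith [norm_nonneg (x - y)]

lemma bub_lip {K h u : ℂ → ℝ} {ε : ℝ} {a : ℂ} (ha : ‖a‖ < 1) (hu : ContDiff ℝ 2 u)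
    (hd : ∀ x ∈ closedUnitDisk, 0 < bubDen K h ε a x) : C1 (fun x => u x - bub K h ε a x) := by
  set φ := phiHat K h ε a with hφ
  set k := kHat K ε a with hk
  have e : ∀ x, bubDen K h ε a x = quad (φ ^ 2 + k * ‖a‖ ^ 2) ((-2 * (φ ^ 2 + k) : ℝ) * a) (φ ^ 2 * ‖a‖ ^ 2 + k) x := fun x => by
    rw [bubDen, quad, ← hφ, ← hk]; simp only [norm_sq_re_im]
    generalize hc : -2 * (φ ^ 2 + k) = c
    simp; subst hc; ring
  intro x hx
  refine (hu.contDiffAt.of_le (by norm_num)).sub ?_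
  rcases eq_or_ne φ 0 with h0 | h0
  · have : bub K h ε a = fun _ => 0 := by ext y; rw [bub, ← hφ, h0]; simp
    rw [this]; exact contDiffAt_const
  · have hx' := hd x hx
    have c : ContDiffAt ℝ 1 (fun x => bubDen K h ε a x) x := by
      rw [funext e]; exact (quad_contDiff _ _ _).contDiffAt
    change ContDiffAt ℝ 1 (fun x => 2 * log (2 * φ * (1 - ‖a‖ ^ 2) / bubDen K h ε a x)) x
    exact contDiffAt_const.mul ((contDiffAt_const.div c hx'.ne').log (div_ne_zero (mul_ne_zero (mul_ne_zero two_ne_zero h0) (a1 ha).ne') hx'.ne'))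

lemma evt {K h : ℂ → ℝ} (hK : ContDiff ℝ 2 K) (hKneg : ∀ x ∈ closedUnitDisk, K x < 0)
    {L : ℝ} (hL : ∀ x y, ‖x‖ = 1 → ‖y‖ = 1 → |h x - h y| ≤ L * ‖x - y‖)
    {εs : ℕ → ℝ} (hε : Tendsto εs atTop (nhds 0)) {aa : ℕ → ℂ} (ha : ∀ n, ‖aa n‖ < 1) (ha0 : ∀ n, aa n ≠ 0)
    {p : ℂ} (hp : ‖p‖ = 1) (hap : Tendsto aa atTop (nhds p)) (hpK : 0 < h p ^ 2 + K p)
    (hden : ∀ n, ∀ x ∈ closedUnitDisk, 0 < bubDen K h (εs n) (aa n) x) :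
    ∃ Λ1 > 0, ∀ᶠ n in atTop, |εs n| ≤ 1 / 2 ∧ 0 < phiHat K h (εs n) (aa n) ∧ phiHat K h (εs n) (aa n) ≤ Λ1 ∧ kHat K (εs n) (aa n) < 0 ∧
      -Λ1 ≤ kHat K (εs n) (aa n) / (2 * phiHat K h (εs n) (aa n)) ∧
      Λ1⁻¹ ≤ sqrt (heps h (εs n) (aa n / (‖aa n‖ : ℂ)) ^ 2 + Keps K (εs n) (aa n / (‖aa n‖ : ℂ))) := by
  have np : ∀ n, ‖aa n / (‖aa n‖ : ℂ)‖ = 1 := fun n => by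
    rw [norm_div, Complex.norm_real, norm_norm, div_self (norm_pos_iff.2 (ha0 n)).ne']
  have tp : Tendsto (fun n => aa n / (‖aa n‖ : ℂ)) atTop (nhds p) := by
    have h1 : Tendsto (fun n => ((‖aa n‖ : ℝ) : ℂ)) atTop (nhds ((‖p‖ : ℝ) : ℂ)) := (Complex.continuous_ofReal.tendsto _).comp hap.norm
    have := hap.div h1 (by rw [hp]; simp)
    rwa [hp, Complex.ofReal_one, div_one] at this
  have th : Tendsto (fun n => h (aa n / (‖aa n‖ : ℂ))) atTop (nhds (h p)) := by
    rw [tendsto_iff_norm_sub_tendsto_zero]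
    refine squeeze_zero (fun _ => norm_nonneg _) (fun n => hL _ _ (np n) hp) ?_
    have := (tendsto_iff_norm_sub_tendsto_zero.1 tp).const_mul L
    rwa [mul_zero] at this
  have te : Tendsto (fun n => 1 + εs n) atTop (nhds 1) := by simpa using hε.const_add 1
  have tH : Tendsto (fun n => heps h (εs n) (aa n / (‖aa n‖ : ℂ))) atTop (nhds (h p)) := by
    have := th.div te one_ne_zero
    rwa [div_one] at this
  have tk : Tendsto (fun n => kHat K (εs n) (aa n)) atTop (nhds (K p)) := by
    have := (((hK.continuous.tendsto p).comp tp).sub (hε.div_const 2)).div te one_ne_zero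
    rw [zero_div, sub_zero, div_one] at this
    exact this
  have tS : Tendsto (fun n => sqrt (heps h (εs n) (aa n / (‖aa n‖ : ℂ)) ^ 2 + Keps K (εs n) (aa n / (‖aa n‖ : ℂ)))) atTop (nhds (sqrt (h p ^ 2 + K p))) :=
    ((tH.pow 2).add tk).sqrt
  have tφ : Tendsto (fun n => phiHat K h (εs n) (aa n)) atTop (nhds (h p + sqrt (h p ^ 2 + K p))) := tH.add tS
  have S0 := sqrt_pos.2 hpK
  have S2 := sq_sqrt hpK.le
  have K0 : K p < 0 := hKneg p (by simp [closedUnitDisk, hp])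
  have φpos : ∀ᶠ n in atTop, 0 < phiHat K h (εs n) (aa n) := by
    filter_upwards [tS.eventually_const_lt S0] with n hn
    have s2 := sq_sqrt (sqrt_pos.1 hn).le
    have d := hden n _ (show aa n / (‖aa n‖ : ℂ) ∈ closedUnitDisk by simp only [closedUnitDisk, mem_closedBall_zero_iff, np n, le_refl])
    have r0 := norm_pos_iff.2 (ha0 n)
    have r0' : (‖aa n‖ : ℂ) ≠ 0 := by exact_mod_cast r0.ne'
    have e1 : ‖1 - cj (aa n) * (aa n / (‖aa n‖ : ℂ))‖ = 1 - ‖aa n‖ := by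
      rw [← mul_div_assoc, aconj, show (1:ℂ) - ((‖aa n‖ ^ 2 : ℝ) : ℂ) / (‖aa n‖ : ℂ) = ((1 - ‖aa n‖ : ℝ) : ℂ) by push_cast; field_simp, Complex.norm_real, norm_of_nonneg (by linarith [ha n])]
    have e2 : ‖aa n / (‖aa n‖ : ℂ) - aa n‖ = 1 - ‖aa n‖ := by
      rw [show aa n / (‖aa n‖ : ℂ) - aa n = ((1 - ‖aa n‖ : ℝ) : ℂ) * (aa n / (‖aa n‖ : ℂ)) by push_cast; field_simp, norm_mul, np, mul_one, Complex.norm_real, norm_of_nonneg (by linarith [ha n])]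
    rw [bubDen, e1, e2, ← add_mul] at d
    have d1 : 0 < 1 - ‖aa n‖ := by linarith [ha n]
    have d2 := (mul_pos_iff_of_pos_right (pow_pos d1 2)).1 d
    have d3 : phiHat K h (εs n) (aa n) ^ 2 + kHat K (εs n) (aa n) = 2 * sqrt (heps h (εs n) (aa n / (‖aa n‖ : ℂ)) ^ 2 + Keps K (εs n) (aa n / (‖aa n‖ : ℂ))) * phiHat K h (εs n) (aa n) := by
      rw [phiHat, kHat]; linear_combination -s2
    rw [d3] at d2
    exact (mul_pos_iff_of_pos_left (by positivity)).1 d2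
  set S := sqrt (h p ^ 2 + K p)
  have φ0 : 0 < h p + S := by
    refine lt_of_le_of_ne (ge_of_tendsto tφ (φpos.mono fun n hn => hn.le)) fun h0 => ?_
    have : (h p + S) * (S - h p) = K p := by linear_combination S2
    rw [← h0, zero_mul] at this; linarith
  have tq : Tendsto (fun n => kHat K (εs n) (aa n) / (2 * phiHat K h (εs n) (aa n))) atTop (nhds (K p / (2 * (h p + S)))) :=
    tk.div (tφ.const_mul 2) (by positivity)
  refine ⟨(h p + S + 1) + (|K p / (2 * (h p + S))| + 1) + 2 / S, by positivity, ?_⟩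
  filter_upwards [φpos, tφ.eventually_lt_const (lt_add_one _), tk.eventually_lt_const K0, tq.eventually_const_lt (sub_one_lt _), tS.eventually_const_lt (half_lt_self S0),
    hε.abs.eventually_lt_const (show |(0:ℝ)| < 1 / 2 by norm_num)] with n h1 h2 h3 h4 h5 h6
  have : 0 < 2 / S := by positivity
  have k1 := neg_abs_le (K p / (2 * (h p + S)))
  have k2 := abs_nonneg (K p / (2 * (h p + S)))
  refine ⟨h6.le, h1, by linarith, h3, by linarith, le_trans ?_ h5.le⟩
  rw [show S / 2 = (2 / S)⁻¹ by rw [inv_div]]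
  exact inv_anti₀ this (by linarith)

lemma fin_n {ψ : ℂ → ℝ} (hψ : C1 ψ) {α R : ℝ} (h0 : 0 < α) (h1 : α < 1) (hR : 0 < R) : ∃ D > 0, ∀ x ∈ closedUnitDisk, ∀ y ∈ closedUnitDisk, ∀ z ∈ closedUnitDisk, y ≠ z →
    |ψ x| + |ψ y - ψ z| / ‖y - z‖ ^ α ≤ D * R := by
  obtain ⟨L, L0, hL⟩ := hψ.lip
  refine ⟨(|ψ 0| + L + 2 * L) / R, by positivity, fun x hx y hy z hz hyz => ?_⟩
  rw [div_mul_cancel₀ _ hR.ne']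
  have n0 : 0 < ‖y - z‖ := norm_pos_iff.2 (sub_ne_zero.2 hyz)
  have hx' : ‖x‖ ≤ 1 := by simpa [closedUnitDisk] using hx
  have hy' : ‖y‖ ≤ 1 := by simpa [closedUnitDisk] using hy
  have hz' : ‖z‖ ≤ 1 := by simpa [closedUnitDisk] using hz
  have b1 := hL 0 (by simp) x hx
  rw [sub_zero, norm_eq_abs] at b1
  have b2 := hL z hz y hy
  rw [norm_eq_abs] at b2
  have b3 : |ψ x| ≤ |ψ x - ψ 0| + |ψ 0| := by have := abs_add_le (ψ x - ψ 0) (ψ 0); rwa [sub_add_cancel] at this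
  have b4 : |ψ y - ψ z| / ‖y - z‖ ^ α ≤ 2 * L := by
    rw [div_le_iff₀ (by positivity)]
    have e : ‖y - z‖ ≤ 2 * ‖y - z‖ ^ α := by
      rcases le_or_gt ‖y - z‖ 1 with h | h
      · have := rpow_le_rpow_of_exponent_ge n0 h h1.le
        rw [rpow_one] at this
        have := norm_nonneg (y - z); linarith
      · have := one_le_rpow h.le h0.le
        have := norm_sub_le y z; linarith
    nlinarith
  nlinarith

/-- Proposition 4.3: Hölder estimate on the error term ψ_n = u_n − u_{a_n}
in the blow-up decomposition. -/
theorem error_term_holder_estimate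
    (K h : ℂ → ℝ)
    (hK : ContDiff ℝ 2 K)
    (hKneg : ∀ x ∈ closedUnitDisk, K x < 0)
    (hh : ContDiff ℝ 2 (fun θ => h (bpt θ)))
    (εs : ℕ → ℝ) (hεs0 : Tendsto εs atTop (nhds 0)) (hεs1 : ∀ n, -1 < εs n)
    (us : ℕ → ℂ → ℝ) (hus : ∀ n, IsPerturbedSolution K h (εs n) (us n))
    (aa : ℕ → ℂ) (haa : ∀ n, aa n ∈ unitDisk) (haa0 : ∀ n, aa n ≠ 0)
    (p : ℂ) (hp : p ∈ unitCircle) (hap : Tendsto aa atTop (nhds p))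
    (hpK : 0 < h p ^ 2 + K p)
    (hden : ∀ n, ∀ x ∈ closedUnitDisk, 0 < bubDen K h (εs n) (aa n) x)
    (hψ : ∃ C : ℝ, ∀ n, ∀ x ∈ closedUnitDisk, |us n x - bub K h (εs n) (aa n) x| ≤ C)
    (hv : ∃ C : ℝ, ∀ n, ∀ x ∈ closedUnitDisk, |recen (aa n) (us n) x| ≤ C)
    (hb1 : ∀ n, ∫ x in unitDisk, x.re * Real.exp (recen (aa n) (us n) x) = 0)
    (hb2 : ∀ n, ∫ x in unitDisk, x.im * Real.exp (recen (aa n) (us n) x) = 0) :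
    ∀ α ∈ Set.Ioo (0:ℝ) (1/2), ∃ C > (0:ℝ), ∀ n,
      ∀ x ∈ closedUnitDisk, ∀ y ∈ closedUnitDisk, ∀ z ∈ closedUnitDisk, y ≠ z →
        |us n x - bub K h (εs n) (aa n) x| +
          |(us n y - bub K h (εs n) (aa n) y) - (us n z - bub K h (εs n) (aa n) z)|
            / ‖y - z‖ ^ α
        ≤ C * (1 - ‖aa n‖) ^ (-(2 * α)) * ((1 - ‖aa n‖) + |εs n|) := by
  rintro α ⟨α0, α2⟩
  have α1 : α < 1 := by linarith
  have ha : ∀ n, ‖aa n‖ < 1 := fun n => by simpa [unitDisk] using haa n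
  have hp' : ‖p‖ = 1 := by simpa [unitCircle] using hp
  obtain ⟨L1, L10, hL1⟩ := C1.lip (v := K) fun x _ => hK.contDiffAt.of_le (by norm_num)
  obtain ⟨L2, L20, hL2⟩ := h_lip hh
  obtain ⟨M, hM⟩ := hv
  have hM0 : 0 ≤ M := (abs_nonneg _).trans (hM 0 0 (by simp [closedUnitDisk]))
  obtain ⟨Λ1, Λ10, hev⟩ := evt hK hKneg hL2 hεs0 ha haa0 hp' hap hpK hden
  obtain ⟨N, hN⟩ := eventually_atTop.1 hev
  have E0 : 0 ≤ 24 * (L1 + L2) * exp M := by positivity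
  obtain ⟨Λ, hΛ⟩ : ∃ Λ, Λ = 324 + M + 24 * (L1 + L2) * exp M + Λ1 := ⟨_, rfl⟩
  obtain ⟨K1, K10, hK1⟩ := core_sup Λ α0 α1
  obtain ⟨K2, K20, hK2⟩ := cfg_holder Λ α0 α1
  have δ0 : ∀ n, 0 < 1 - ‖aa n‖ := fun n => by linarith [ha n]
  have R0 : ∀ n, 0 < (1 - ‖aa n‖) ^ (-(2 * α)) * ((1 - ‖aa n‖) + |εs n|) := fun n => by have := δ0 n; positivity
  choose D D0 hD using fun n => fin_n (bub_lip (ha n) (hus n).1 (hden n)) α0 α1 (R0 n)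
  have S0 : ∀ m, 0 ≤ ∑ n ∈ Finset.range m, D n := fun m => Finset.sum_nonneg fun n _ => (D0 n).le
  refine ⟨2 * (K1 + K2 * (K1 + 1) * 2) + ∑ n ∈ Finset.range N, D n, by have := S0 N; positivity, fun n x hx y hy z hz hyz => ?_⟩
  rw [mul_assoc]
  rcases lt_or_ge n N with hn | hn
  · refine (hD n x hx y hy z hz hyz).trans (mul_le_mul_of_nonneg_right ?_ (R0 n).le)
    have := Finset.single_le_sum (f := D) (fun n _ => (D0 n).le) (Finset.mem_range.2 hn)
    have : 0 ≤ 2 * (K1 + K2 * (K1 + 1) * 2) := by positivity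
    linarith
  obtain ⟨e1, e2, e3, e4, e5, e6⟩ := hN n hn
  have cfg : Cfg Λ _ _ _ _ _ _ := mk_cfg (L := L1 + L2) (ha n) (haa0 n) (hus n) e1 (by positivity)
    (fun x y hx hy => (hL1 y (by simpa using hy) x (by simpa using hx)).trans (by gcongr; linarith))
    (fun x y hx hy => (hL2 x y hx hy).trans (by gcongr; linarith))
    (fun x hx => hM n x (by simpa [closedUnitDisk] using hx)) (hb1 n) (hb2 n) (by linarith) (by linarith) (by linarith)
    e2 (by linarith) e4 (by linarith) (le_trans (inv_anti₀ Λ10 (by linarith)) e6)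
  have cs := hK1 cfg
  have ch := hK2 cfg _ cs
  have na : ‖-aa n‖ < 1 := by rw [norm_neg]; exact ha n
  have pe : ∀ y, ‖y‖ ≤ 1 → us n y - bub K h (εs n) (aa n) y = ww (phiHat K h (εs n) (aa n) / 2) (kHat K (εs n) (aa n) / (2 * phiHat K h (εs n) (aa n))) (vv (aa n) (us n)) (moeb (-aa n) y) := fun y hy => by
    have := psi_eq (u := us n) (ha n) e2 (moeb_le na hy) (hden n _ (by rw [moeb_inv (ha n) hy]; simpa [closedUnitDisk] using hy))
    rwa [moeb_inv (ha n) hy] at this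
  have hx' : ‖x‖ ≤ 1 := by simpa [closedUnitDisk] using hx
  have hy' : ‖y‖ ≤ 1 := by simpa [closedUnitDisk] using hy
  have hz' : ‖z‖ ≤ 1 := by simpa [closedUnitDisk] using hz
  rw [pe x hx', pe y hy', pe z hz']
  have c1 := cs _ (moeb_le na hx')
  have c2 := ch _ _ (moeb_le na hy') (moeb_le na hz')
  have ml := moeb_lip na hy' hz'
  rw [norm_neg] at ml
  obtain ⟨l1, l2⟩ := abs_le.1 e1
  set δ := 1 - ‖aa n‖
  have d0 : 0 < δ := δ0 n
  have d1 : δ ≤ 1 := cfg.hδ1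
  have n0 : 0 < ‖y - z‖ := norm_pos_iff.2 (sub_ne_zero.2 hyz)
  set κ := |εs n / (1 + εs n)| with hκ
  have k1 : κ ≤ 2 * |εs n| := by
    rw [hκ, abs_div, abs_of_pos (show 0 < 1 + εs n by linarith), div_le_iff₀ (by linarith)]
    have := mul_nonneg (abs_nonneg (εs n)) (show 0 ≤ 1 + 2 * εs n by linarith)
    linarith
  have k0 : 0 ≤ κ := abs_nonneg _
  have m1 : ‖moeb (-aa n) y - moeb (-aa n) z‖ ^ α ≤ 2 * δ ^ (-α) * ‖y - z‖ ^ α := by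
    refine (rpow_le_rpow (norm_nonneg _) ml α0.le).trans ?_
    rw [mul_rpow (by positivity) (norm_nonneg _), div_rpow (by norm_num) d0.le, rpow_neg d0.le, ← div_eq_mul_inv]
    have : (2:ℝ) ^ α ≤ 2 := by
      have := rpow_le_rpow_of_exponent_le (show (1:ℝ) ≤ 2 by norm_num) α1.le
      rwa [rpow_one] at this
    gcongr
  have P0 : 0 < δ ^ (-α) := by positivity
  have P1 : 1 ≤ δ ^ (-α) := one_le_rpow_of_pos_of_le_one_of_nonpos d0 d1 (by linarith)
  have P2 : δ ^ (-(2 * α)) = δ ^ (-α) * δ ^ (-α) := by rw [← rpow_add d0]; congr 1; ring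
  have s0 : 0 ≤ δ + κ := by positivity
  have e0 : 0 ≤ eta α δ κ := (eta_pos d0 k0).le
  have f1 : eta α δ κ ≤ δ ^ (-(2 * α)) * (δ + κ) := by
    rw [eta, P2]; gcongr; exact le_mul_of_one_le_left P0.le P1
  have f2 : δ ^ (-α) * eta α δ κ = δ ^ (-(2 * α)) * (δ + κ) := by rw [eta, P2]; ring
  have f3 : δ ^ (-(2 * α)) * (δ + κ) ≤ 2 * (δ ^ (-(2 * α)) * (δ + |εs n|)) := by
    have : 0 < δ ^ (-(2 * α)) := by positivity
    refine (mul_le_mul_of_nonneg_left (show δ + κ ≤ 2 * (δ + |εs n|) by linarith) this.le).trans (le_of_eq (by ring))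
  have c3 := (div_le_iff₀ (by positivity : 0 < ‖y - z‖ ^ α)).2 (c2.trans ((mul_le_mul_of_nonneg_left m1 (by positivity)).trans_eq
    (show _ = (K2 * (K1 + 1) * 2) * (δ ^ (-α) * eta α δ κ) * ‖y - z‖ ^ α by ring)))
  rw [f2] at c3
  have c4 := c1.trans (mul_le_mul_of_nonneg_left f1 K10.le)
  calc _ ≤ (K1 + K2 * (K1 + 1) * 2) * (δ ^ (-(2 * α)) * (δ + κ)) := by rw [add_mul]; exact add_le_add c4 c3
    _ ≤ (K1 + K2 * (K1 + 1) * 2) * (2 * (δ ^ (-(2 * α)) * (δ + |εs n|))) := mul_le_mul_of_nonneg_left f3 (by positivity)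
    _ = (2 * (K1 + K2 * (K1 + 1) * 2)) * (δ ^ (-(2 * α)) * (δ + |εs n|)) := by ring
    _ ≤ _ := mul_le_mul_of_nonneg_right (by linarith [S0 N]) (R0 n).le

end
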